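/- Let g be a root-reductive Lie algebra with splitting maximal toral subalgebra h and Dynkin Borel subalgebra b ⊇ h, and let λ ∈ h*. The following are equivalent: (a) the Verma module M(λ) is of finite length; (b) M(λ) has a simple submodule; (c) there exists an antidominant weight ξ ∈ h* such that ξ is strongly linked to λ; (d) λ is almost antidominant. -/

import Mathlib

noncomputable section
namespace Paper

variable (K : Type) [Field K] [IsAlgClosed K] [CharZero K]
variable (g : Type) [LieRing g] [LieAlgebra K g]

def adWeightSpace (h : LieSubalgebra K g) (α : Module.Dual K h) : Submodule K g where
  carrier := {x | ∀ H : h, ⁅(H : g), x⁆ = α H • x}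
  add_mem' := by intro a b ha hb H; rw [lie_add, ha H, hb H, smul_add]
  zero_mem' := by intro H; rw [lie_zero, smul_zero]
  smul_mem' := by intro c x hx H; rw [lie_smul, hx H, smul_comm]

def IsRootOf (h : LieSubalgebra K g) (α : Module.Dual K h) : Prop :=
  α ≠ 0 ∧ adWeightSpace K g h α ≠ ⊥

def IsToralIn (s t : LieSubalgebra K g) : Prop :=
  t ≤ s ∧ IsLieAbelian t ∧
    s.toSubmodule ≤ ⨆ α : Module.Dual K t, s.toSubmodule ⊓ adWeightSpace K g t α

def IsMaxToralIn (s t : LieSubalgebra K g) : Prop :=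
  IsToralIn K g s t ∧ ∀ t' : LieSubalgebra K g, IsToralIn K g s t' → t ≤ t' → t' = t

/-- A root-reductive Lie algebra `g` together with a splitting maximal toral subalgebra `h`
and a splitting Borel subalgebra `b ⊇ h` determined by a set `pos` of positive roots. -/
structure Setup where
  /-- the exhausting chain of finite-dimensional reductive subalgebras -/
  F : ℕ → LieSubalgebra K g
  F_mono : Monotone F
  F_exhaust : ∀ x : g, ∃ n, x ∈ F n
  F_findim : ∀ n, FiniteDimensional K (F n)
  /-- each `F n` is reductive: every abelian ideal is central -/
  F_reductive : ∀ n, ∀ I : LieIdeal K (F n), IsLieAbelian I → I ≤ LieAlgebra.center K (F n)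
  /-- the nested chain of Cartan subalgebras witnessing the root inclusions -/
  C : ℕ → LieSubalgebra K g
  C_mono : Monotone C
  C_le : ∀ n, C n ≤ F n
  C_cartan : ∀ n, (LieSubalgebra.comap (F n).incl (C n)).IsCartanSubalgebra
  /-- each inclusion `F n ↪ F (n+1)` is a root inclusion with respect to `C (n+1)`:
  every root space of `F n` relative to `C n` is a root space of `F (n+1)` -/
  C_rootIncl : ∀ n, ∀ α : Module.Dual K (C n), α ≠ 0 →
    (F n).toSubmodule ⊓ adWeightSpace K g (C n) α ≠ ⊥ →
    ∃ β : Module.Dual K (C (n + 1)),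
      (F n).toSubmodule ⊓ adWeightSpace K g (C n) α
        = (F (n + 1)).toSubmodule ⊓ adWeightSpace K g (C (n + 1)) β
  /-- the splitting maximal toral subalgebra -/
  h : LieSubalgebra K g
  h_maxToral : ∀ n, IsMaxToralIn K g (F n) (h ⊓ F n)
  /-- `g` is the direct sum of its `h`-weight spaces -/
  h_indep : iSupIndep fun α : Module.Dual K h => adWeightSpace K g h α
  h_span : (⨆ α : Module.Dual K h, adWeightSpace K g h α) = ⊤
  /-- the set `Δ⁺` of positive roots -/
  pos : Set (Module.Dual K h)
  pos_root : ∀ α ∈ pos, IsRootOf K g h α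
  pos_add : ∀ α ∈ pos, ∀ β ∈ pos, IsRootOf K g h (α + β) → α + β ∈ pos
  pos_polar : ∀ α : Module.Dual K h, IsRootOf K g h α → (α ∈ pos ↔ ¬(-α ∈ pos))
  neg_add : ∀ α β : Module.Dual K h, IsRootOf K g h α → IsRootOf K g h β →
    α ∉ pos → β ∉ pos → IsRootOf K g h (α + β) → α + β ∉ pos
  /-- the splitting Borel subalgebra -/
  b : LieSubalgebra K g
  b_eq : b.toSubmodule = h.toSubmodule ⊔ ⨆ α ∈ pos, adWeightSpace K g h α


variable {K g}

namespace Setup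

variable (S : Setup K g)

/-- `h ∩ g_n`. -/
def hn (n : ℕ) : LieSubalgebra K g := S.h ⊓ S.F n

/-- restriction of a functional on `h` to `h ∩ g_n`. -/
def resDual (n : ℕ) (lam : Module.Dual K S.h) : Module.Dual K (S.hn n) :=
  lam.comp (LieSubalgebra.inclusion (inf_le_left : S.hn n ≤ S.h)).toLinearMap

/-- the `α`-root space of `g_n` relative to `h ∩ g_n`. -/
def rootSpaceN (n : ℕ) (α : Module.Dual K (S.hn n)) : Submodule K g :=
  (S.F n).toSubmodule ⊓ adWeightSpace K g (S.hn n) α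

/-- the set of `b`-positive roots of `g_n`. -/
def posRootsN (n : ℕ) : Set (Module.Dual K (S.hn n)) :=
  {α | α ≠ 0 ∧ S.rootSpaceN n α ≠ ⊥ ∧ S.rootSpaceN n α ≤ S.b.toSubmodule}

/-- `ρ_n`, the half sum of the positive roots of `g_n` with respect to `b ∩ g_n`. -/
def rhoN (n : ℕ) : Module.Dual K (S.hn n) :=
  (2 : K)⁻¹ • ∑ᶠ α ∈ S.posRootsN n, α

/-- `α` is a simple `b`-positive root: it is positive and cannot be written as a sum of
two or more positive roots. -/
def IsSimpleRoot (α : Module.Dual K S.h) : Prop :=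
  α ∈ S.pos ∧ ¬∃ s : Multiset (Module.Dual K S.h),
    2 ≤ Multiset.card s ∧ (∀ β ∈ s, β ∈ S.pos) ∧ s.sum = α

/-- `b` is a Dynkin Borel subalgebra: it is generated, as a Lie subalgebra, by `h` together
with the simple root spaces. -/
def IsDynkin : Prop :=
  S.b = LieSubalgebra.lieSpan K g
    ((S.h : Set g) ∪ ⋃ α ∈ {α | S.IsSimpleRoot α}, (adWeightSpace K g S.h α : Set g))

/-- the partial order `≼` on `h^*`: `lam ≼ mu` iff `mu - lam` is a `ℤ≥0`-linear combination
of positive roots. -/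
def wle (lam mu : Module.Dual K S.h) : Prop :=
  ∃ s : Multiset (Module.Dual K S.h), (∀ β ∈ s, β ∈ S.pos) ∧ mu - lam = s.sum

/-- `g` is locally semisimple: each `g_n` is a semisimple Lie algebra. -/
def IsLocallySemisimple : Prop := ∀ n, LieAlgebra.IsSemisimple K (S.F n)

end Setup


/-- the universal enveloping algebra of `g`. -/
abbrev Env (K g : Type) [Field K] [LieRing g] [LieAlgebra K g] : Type :=
  UniversalEnvelopingAlgebra K g

namespace Setup

variable {K : Type} [Field K] [IsAlgClosed K] [CharZero K]
variable {g : Type} [LieRing g] [LieAlgebra K g]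
variable (S : Setup K g)

/-- the nilpotent radical `n⁺ = ⨁_{α ∈ Δ⁺} g^α` of `b`, as a subspace of `g`. -/
def nplus : Submodule K g := ⨆ α ∈ S.pos, adWeightSpace K g S.h α

/-- the left ideal of `U(g)` generated by `n⁺` and the elements `H - lam(H)`, `H ∈ h`. -/
def vermaIdeal (lam : Module.Dual K S.h) : Submodule (Env K g) (Env K g) :=
  Submodule.span (Env K g)
    ((UniversalEnvelopingAlgebra.ι K '' (S.nplus : Set g)) ∪
      Set.range fun H : S.h =>
        UniversalEnvelopingAlgebra.ι K (H : g) - algebraMap K (Env K g) (lam H))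

/-- the Verma module `M(lam) = U(g)/I`. -/
abbrev Verma (lam : Module.Dual K S.h) : Type := Env K g ⧸ S.vermaIdeal lam

/-- the maximal proper submodule of the Verma module `M(lam)`,
i.e. the sum of all proper submodules. -/
def maxSub (lam : Module.Dual K S.h) : Submodule (Env K g) (S.Verma lam) :=
  sSup {N : Submodule (Env K g) (S.Verma lam) | N ≠ ⊤}

/-- the simple module `L(lam)`, the unique simple quotient of `M(lam)`. -/
abbrev SimpleL (lam : Module.Dual K S.h) : Type := S.Verma lam ⧸ S.maxSub lam

/-- `H` is the coroot `h_α` of the root `α`:  `α(H) = 2` and `H ∈ [g^α, g^{-α}]`. -/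
def IsCoroot (α : Module.Dual K S.h) (H : S.h) : Prop :=
  α H = 2 ∧ ∃ x ∈ adWeightSpace K g S.h α, ∃ y ∈ adWeightSpace K g S.h (-α),
    (H : g) = ⁅x, y⁆

/-- the dot-reflection `s_α · mu = mu - (mu + ρ)(h_α) α` associated to a root `α`
with coroot `Hα`, relative to the half sum `ρ` of positive roots. -/
def dotReflect (ρ α : Module.Dual K S.h) (Hα : S.h) (mu : Module.Dual K S.h) :
    Module.Dual K S.h :=
  mu - ((mu + ρ) Hα) • α

/-- `ρ` is the global half sum of positive roots: its restriction to each `h ∩ g_n`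
is the half sum `ρ_n` of positive roots of `g_n`. -/
def IsGlobalRho (ρ : Module.Dual K S.h) : Prop := ∀ n : ℕ, S.resDual n ρ = S.rhoN n

/-- `lam` is strongly linked to `mu` (relative to `ρ`). -/
inductive StronglyLinked (ρ : Module.Dual K S.h) :
    Module.Dual K S.h → Module.Dual K S.h → Prop
  | refl (mu : Module.Dual K S.h) : StronglyLinked ρ mu mu
  | step {lam mu : Module.Dual K S.h} (α : Module.Dual K S.h) (Hα : S.h) :
      α ∈ S.pos → S.IsCoroot α Hα →
      S.wle (S.dotReflect ρ α Hα mu) mu →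
      StronglyLinked ρ lam (S.dotReflect ρ α Hα mu) →
      StronglyLinked ρ lam mu

/-- `lam` is antidominant: `(lam + ρ)(h_α)` is not a positive integer
for any positive root `α`. -/
def IsAntidominant (ρ lam : Module.Dual K S.h) : Prop :=
  ∀ α ∈ S.pos, ∀ Hα : S.h, S.IsCoroot α Hα → ¬∃ k : ℕ, 0 < k ∧ (lam + ρ) Hα = (k : K)

/-- `lam` is almost antidominant: `(lam + ρ)(h_α)` is a positive integer
for only finitely many positive roots `α`. -/
def IsAlmostAntidominant (ρ lam : Module.Dual K S.h) : Prop :=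
  {α | α ∈ S.pos ∧ ∃ Hα : S.h, S.IsCoroot α Hα ∧
    ∃ k : ℕ, 0 < k ∧ (lam + ρ) Hα = (k : K)}.Finite

end Setup

namespace Setup

variable {K : Type} [Field K] [IsAlgClosed K] [CharZero K]
variable {g : Type} [LieRing g] [LieAlgebra K g]
variable (S : Setup K g)

/-- the reflection `s_α : mu ↦ mu - mu(h_α) α`, as a linear map on `h^*`. -/
def reflectionMap (α : Module.Dual K S.h) (Hα : S.h) :
    Module.Dual K S.h →ₗ[K] Module.Dual K S.h where
  toFun mu := mu - mu Hα • α
  map_add' mu ν := by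
    simp only [LinearMap.add_apply, add_smul]
    abel
  map_smul' c mu := by
    simp only [LinearMap.smul_apply, RingHom.id_apply, smul_sub, smul_smul, smul_eq_mul]

/-- the reflection `s_α` associated to a root `α` with coroot `Hα`,
as a linear automorphism of `h^*`. -/
def reflection (α : Module.Dual K S.h) (Hα : S.h) (h2 : α Hα = 2) :
    Module.Dual K S.h ≃ₗ[K] Module.Dual K S.h :=
  LinearEquiv.ofInvolutive (S.reflectionMap α Hα) (by
    intro mu
    show S.reflectionMap α Hα (mu - mu Hα • α) = mu
    show (mu - mu Hα • α) - ((mu - mu Hα • α) Hα) • α = mu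
    rw [LinearMap.sub_apply, LinearMap.smul_apply, h2, smul_eq_mul]
    module)

/-- the Weyl group of `g`, realized as the group of linear automorphisms of `h^*`
generated by the reflections in the roots. -/
def weylGroup : Subgroup (Module.Dual K S.h ≃ₗ[K] Module.Dual K S.h) :=
  Subgroup.closure
    {w | ∃ (α : Module.Dual K S.h) (Hα : S.h) (hc : S.IsCoroot α Hα),
      IsRootOf K g S.h α ∧ w = S.reflection α Hα hc.1}

/-- the dot action `w · mu = w(mu + ρ) - ρ`. -/
def dotAct (ρ : Module.Dual K S.h) (w : Module.Dual K S.h ≃ₗ[K] Module.Dual K S.h)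
    (mu : Module.Dual K S.h) : Module.Dual K S.h :=
  w (mu + ρ) - ρ

/-- the root lattice `Λ`, the `ℤ`-span of the roots in `h^*`. -/
def rootLattice : Submodule ℤ (Module.Dual K S.h) :=
  Submodule.span ℤ {α : Module.Dual K S.h | IsRootOf K g S.h α}

end Setup

open Submodule (span subset_span span_le span_mono span_induction smul_mem mem_iSup_of_mem
  exists_mem_ne_zero_of_ne_bot)
open Finsupp (single single_eq_of_ne single_eq_same support_single_subset smul_single toMultiset
  linearCombination finset_sum_apply)
open Finset (sum_congr mul_sum sum_eq_zero mem_filter sum_comm sum_smul smul_sum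
  sum_sub_distrib mem_univ)
open List (cons_append append_assoc nil_append length_append length_cons)
open Nat (cast_smul_eq_nsmul)
open Set (range)
open Module (End Basis Dual)
open LieSubmodule.Quotient (mk' surjective_mk')

namespace PBW

section

variable {k L ι : Type*} [Field k] [LieRing L] [LieAlgebra k L] [LinearOrder ι]

/-- The number of inversions of a word. -/
def invs : List ι → ℕ
  | [] => 0
  | x :: l => l.countP (· < x) + invs l

theorem invs_swap_lt (a c : List ι) {x y : ι} (h : y < x) :
    invs (a ++ y :: x :: c) < invs (a ++ x :: y :: c) := by
  induction a with
  | nil =>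
    simp only [nil_append, invs, List.countP_cons, h, decide_true, if_true,
      not_lt_of_gt h, decide_false]
    simp only [Bool.false_eq_true, if_false]
    omega
  | cons z a ih =>
    simp only [cons_append, invs]
    have : (a ++ y :: x :: c).Perm (a ++ x :: y :: c) :=
      (List.Perm.swap _ _ _).append_left a
    rw [this.countP_eq]
    omega

/-- The commutative monomial attached to a word. -/
def mono (k : Type*) [Field k] (l : List ι) : MvPolynomial ι k := (l.map MvPolynomial.X).prod

theorem mono_perm {l l' : List ι} (h : l.Perm l') : mono k l = mono k l' :=
  (h.map _).prod_eq

/-- A word with a marked descent. -/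
def IsDescent (w : List ι) (p : List ι × ι × ι × List ι) : Prop :=
  w = p.1 ++ p.2.1 :: p.2.2.1 :: p.2.2.2 ∧ p.2.2.1 < p.2.1

set_option linter.unusedVariables false in
open Classical in
/-- The normal form of a word, obtained by rewriting descents. -/
def nf (b : Basis ι k L) (w : List ι) : MvPolynomial ι k :=
  if h : ∃ p, IsDescent w p then
    nf b (h.choose.1 ++ h.choose.2.2.1 :: h.choose.2.1 :: h.choose.2.2.2) +
      (b.repr ⁅b h.choose.2.1, b h.choose.2.2.1⁆).sum fun i c =>
        c • nf b (h.choose.1 ++ i :: h.choose.2.2.2)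
  else mono k w
termination_by (w.length, invs w)
decreasing_by
  · have h1 := h.choose_spec
    generalize h.choose = p at h1
    obtain ⟨a, x, y, c⟩ := p
    obtain ⟨rfl, h2⟩ := h1
    have := invs_swap_lt a c h2
    simp only [length_append, length_cons]
    exact Prod.Lex.right _ this
  · have h1 := h.choose_spec
    generalize h.choose = p at h1
    obtain ⟨a, x, y, c⟩ := p
    obtain ⟨rfl, h2⟩ := h1
    apply Prod.Lex.left
    simp only [length_append, length_cons]
    omega

variable (b : Basis ι k L)

/-- Normal forms of words with one letter replaced by a Lie algebra element. -/
def nfL (a c : List ι) : L →ₗ[k] MvPolynomial ι k :=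
  b.constr k fun i => nf b (a ++ i :: c)

@[simp] theorem nfL_basis (a c : List ι) (i : ι) : nfL b a c (b i) = nf b (a ++ i :: c) :=
  b.constr_basis _ _ _

theorem nf_of_not_descent {w : List ι} (h : ¬ ∃ p, IsDescent w p) : nf b w = mono k w := by
  rw [nf, dif_neg h]

theorem exists_descent_rule {w : List ι} (h : ∃ p, IsDescent w p) :
    ∃ a x y c, w = a ++ x :: y :: c ∧ y < x ∧
      nf b w = nf b (a ++ y :: x :: c) + nfL b a c ⁅b x, b y⁆ := by
  refine ⟨_, _, _, _, h.choose_spec.1, h.choose_spec.2, ?_⟩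
  rw [nf, dif_pos h]
  rw [nfL, Basis.constr_apply]

/-- The rewriting rule for every pair of adjacent letters of words of length `n`. -/
theorem rule_of_descent_rule (n : ℕ) (h : ∀ a x y c, (a ++ x :: y :: c).length = n → y < x →
      nf b (a ++ x :: y :: c) = nf b (a ++ y :: x :: c) + nfL b a c ⁅b x, b y⁆) (a : List ι)
    (x y : ι) (c : List ι) (hl : (a ++ x :: y :: c).length = n) :
    nf b (a ++ x :: y :: c) = nf b (a ++ y :: x :: c) + nfL b a c ⁅b x, b y⁆ := by
  rcases lt_trichotomy x y with hxy | rfl | hxy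
  · rw [h a y x c (by simpa using hl) hxy, ← lie_skew (b x) (b y), map_neg]
    abel
  · simp
  · exact h a x y c hl hxy

theorem nfL_comm_right (n : ℕ) (h : ∀ a x y c, (a ++ x :: y :: c).length = n →
      nf b (a ++ x :: y :: c) = nf b (a ++ y :: x :: c) + nfL b a c ⁅b x, b y⁆) (a : List ι) (x : ι)
    (c : List ι) (hl : a.length + c.length + 2 = n) (u : L) :
    nfL b a (x :: c) u = nfL b (a ++ [x]) c u + nfL b a c ⁅u, b x⁆ := by
  induction b.mem_span u using span_induction with
  | zero => simp
  | add u v _ _ hu hv => rw [map_add, hu, hv, add_lie, map_add, map_add]; abel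
  | smul r u _ hu => rw [map_smul, hu, smul_lie, map_smul, map_smul, smul_add]
  | mem _ hi =>
    obtain ⟨i, rfl⟩ := hi
    simp only [nfL_basis, append_assoc, cons_append, nil_append]
    exact h a i x c (by simp; omega)

/-- Normal forms of words with two letters replaced by Lie algebra elements. -/
def nfL₂ (a d c : List ι) : L →ₗ[k] L →ₗ[k] MvPolynomial ι k :=
  b.constr k fun i => nfL b (a ++ i :: d) c

theorem nfL₂_basis_left (a d c : List ι) (i : ι) : nfL₂ b a d c (b i) = nfL b (a ++ i :: d) c :=
  b.constr_basis _ _ _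

theorem nfL₂_basis_right (a d c : List ι) (u : L) (j : ι) :
    nfL₂ b a d c u (b j) = nfL b a (d ++ j :: c) u := by
  have : (nfL₂ b a d c).flip (b j) = nfL b a (d ++ j :: c) :=
    b.ext fun i => by simp [nfL₂_basis_left]
  rw [← this, LinearMap.flip_apply]

theorem confluence (n m : ℕ) (ih : ∀ a x y c, y < x → ((a ++ x :: y :: c).length < n ∨
        (a ++ x :: y :: c).length = n ∧ invs (a ++ x :: y :: c) < m) →
      nf b (a ++ x :: y :: c) = nf b (a ++ y :: x :: c) + nfL b a c ⁅b x, b y⁆) (a : List ι)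
    (x y : ι) (c a' : List ι) (x' y' : ι) (c' : List ι) (hn : (a ++ x :: y :: c).length = n)
    (hm : invs (a ++ x :: y :: c) = m) (he : a ++ x :: y :: c = a' ++ x' :: y' :: c') (hxy : y < x)
    (hxy' : y' < x') (hle : a.length ≤ a'.length) :
    nf b (a ++ y :: x :: c) + nfL b a c ⁅b x, b y⁆ =
      nf b (a' ++ y' :: x' :: c') + nfL b a' c' ⁅b x', b y'⁆ := by
  have hm' : invs (a' ++ x' :: y' :: c') = m := by rw [← he, hm]
  have hlen : (a' ++ x' :: y' :: c').length = n := by rw [← he, hn]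
  have s1 := invs_swap_lt a c hxy
  have s2 := invs_swap_lt a' c' hxy'
  have full : ∀ a x y c, (a ++ x :: y :: c).length < n →
      nf b (a ++ x :: y :: c) = nf b (a ++ y :: x :: c) + nfL b a c ⁅b x, b y⁆ := by
    intro a x y c h
    exact rule_of_descent_rule b _ (fun a x y c h' hd => ih a x y c hd (Or.inl (h' ▸ h))) a x y c rfl
  have move : ∀ a x c u, a.length + c.length + 2 < n →
      nfL b a (x :: c) u = nfL b (a ++ [x]) c u + nfL b a c ⁅u, b x⁆ := by
    intro a x c u h
    exact nfL_comm_right b _ (fun a x y c h' => full a x y c (h' ▸ h)) a x c rfl u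
  obtain ⟨d, rfl⟩ : ∃ d, a' = a ++ d := by
    have h1 : a <+: a ++ x :: y :: c := List.prefix_append _ _
    have h2 : a' <+: a ++ x :: y :: c := he ▸ List.prefix_append _ _
    obtain ⟨d, hd⟩ := List.prefix_of_prefix_length_le h1 h2 hle
    exact ⟨d, hd.symm⟩
  rw [append_assoc] at he
  have he := List.append_cancel_left he
  match d, he with
  | [], he =>
    simp only [nil_append, List.cons.injEq] at he
    obtain ⟨rfl, rfl, rfl⟩ := he
    simp
  | [z], he =>
    simp only [cons_append, nil_append, List.cons.injEq] at he
    obtain ⟨rfl, rfl, rfl⟩ := he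
    simp only [append_assoc, cons_append, nil_append, length_append,
      length_cons] at *
    have t1 := invs_swap_lt (a ++ [y]) c' (hxy'.trans hxy)
    have t2 := invs_swap_lt a (y :: c') (hxy'.trans hxy)
    simp only [append_assoc, cons_append, nil_append] at t1 t2
    have e1 := ih (a ++ [y]) x y' c' (hxy'.trans hxy)
      (Or.inr (by simp only [append_assoc, cons_append, nil_append,
        length_append, length_cons, List.length_nil]; omega))
    have e2 := ih a y y' (x :: c') hxy'
      (Or.inr (by simp only [length_append, length_cons]; omega))
    have e3 := ih a x y' (y :: c') (hxy'.trans hxy)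
      (Or.inr (by simp only [length_append, length_cons]; omega))
    have e4 := ih (a ++ [y']) x y c' hxy
      (Or.inr (by simp only [append_assoc, cons_append, nil_append,
        length_append, length_cons, List.length_nil]; omega))
    simp only [append_assoc, cons_append, nil_append] at e1 e2 e3 e4
    rw [e1, e2, e3, e4, move a y' c' _ (by omega), move a x c' _ (by omega),
      move a y c' _ (by omega)]
    have jac : ⁅⁅b x, b y⁆, b y'⁆ + ⁅⁅b y, b y'⁆, b x⁆ - ⁅⁅b x, b y'⁆, b y⁆ = 0 := by
      rw [← lie_skew ⁅b x, b y⁆ (b y'), ← lie_skew ⁅b y, b y'⁆ (b x), ← lie_skew ⁅b x, b y'⁆ (b y),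
        ← lie_skew (b x) (b y'), lie_neg, neg_neg, ← neg_eq_zero, ← lie_jacobi (b x) (b y) (b y')]
      abel
    have := congrArg (nfL b a c') jac
    rw [map_sub, map_add, map_zero] at this
    linear_combination this
  | z :: z' :: d, he =>
    simp only [cons_append, List.cons.injEq] at he
    obtain ⟨rfl, rfl, rfl⟩ := he
    simp only [append_assoc, cons_append, nil_append, length_append,
      length_cons] at *
    have e1 := ih (a ++ y :: x :: d) x' y' c' hxy'
      (Or.inr (by simp only [append_assoc, cons_append,
        length_append, length_cons]; omega))
    have e2 := ih a x y (d ++ y' :: x' :: c') hxy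
      (Or.inr (by simp only [length_append, length_cons]; omega))
    have c1 : nfL b a (d ++ x' :: y' :: c') =
        nfL b a (d ++ y' :: x' :: c') + (nfL₂ b a d c').flip ⁅b x', b y'⁆ := by
      refine b.ext fun i => ?_
      have := full (a ++ i :: d) x' y' c' (by
        simp only [append_assoc, cons_append, length_append, length_cons]
        omega)
      simpa [nfL₂_basis_left] using this
    have c2 : nfL b (a ++ x :: y :: d) c' =
        nfL b (a ++ y :: x :: d) c' + nfL₂ b a d c' ⁅b x, b y⁆ := by
      refine b.ext fun i => ?_
      have := full a x y (d ++ i :: c') (by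
        simp only [length_append, length_cons]
        omega)
      simpa [nfL₂_basis_right] using this
    simp only [append_assoc, cons_append] at e1 e2
    rw [e1, e2, c1, c2]
    simp only [LinearMap.add_apply, LinearMap.flip_apply]
    abel

theorem nf_descent (p : ℕ ×ₗ ℕ) : ∀ a x y c, y < x →
    toLex ((a ++ x :: y :: c).length, invs (a ++ x :: y :: c)) = p →
    nf b (a ++ x :: y :: c) = nf b (a ++ y :: x :: c) + nfL b a c ⁅b x, b y⁆ := by
  induction p using WellFoundedLT.induction with
  | ind p ih =>
    intro a x y c hxy hp
    obtain ⟨a', x', y', c', he, hxy', hr⟩ :=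
      exists_descent_rule b (w := a ++ x :: y :: c) ⟨(a, x, y, c), rfl, hxy⟩
    have ih' : ∀ a₁ x₁ y₁ c₁, y₁ < x₁ → ((a₁ ++ x₁ :: y₁ :: c₁).length < (a ++ x :: y :: c).length ∨
        (a₁ ++ x₁ :: y₁ :: c₁).length = (a ++ x :: y :: c).length ∧
          invs (a₁ ++ x₁ :: y₁ :: c₁) < invs (a ++ x :: y :: c)) →
        nf b (a₁ ++ x₁ :: y₁ :: c₁) = nf b (a₁ ++ y₁ :: x₁ :: c₁) + nfL b a₁ c₁ ⁅b x₁, b y₁⁆ := by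
      intro a₁ x₁ y₁ c₁ h₁ h
      refine ih _ ?_ a₁ x₁ y₁ c₁ h₁ rfl
      rw [← hp, Prod.Lex.toLex_lt_toLex]
      exact h
    rw [hr]
    rcases le_total a.length a'.length with h | h
    · exact (confluence b _ _ ih' a x y c a' x' y' c' rfl rfl he hxy hxy' h).symm
    · exact confluence b _ _ ih' a' x' y' c' a x y c (by rw [he]) (by rw [he]) he.symm hxy' hxy h

theorem nf_rule (a : List ι) (x y : ι) (c : List ι) :
    nf b (a ++ x :: y :: c) = nf b (a ++ y :: x :: c) + nfL b a c ⁅b x, b y⁆ :=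
  rule_of_descent_rule b _ (fun a x y c _ h => nf_descent b _ a x y c h rfl) a x y c rfl

theorem exists_descent_of_not_sorted {w : List ι} (h : ¬ w.Pairwise (· ≤ ·)) :
    ∃ a x y c, w = a ++ x :: y :: c ∧ y < x := by
  rw [← List.isChain_iff_pairwise] at h
  induction w with
  | nil => simp at h
  | cons z w ih =>
    cases w with
    | nil => simp at h
    | cons z' w =>
      rw [List.isChain_cons_cons, not_and_or] at h
      rcases h with h | h
      · exact ⟨[], z, z', w, rfl, not_le.1 h⟩
      · obtain ⟨a, x, y, c, e, hd⟩ := ih h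
        exact ⟨z :: a, x, y, c, by rw [e]; rfl, hd⟩

theorem nf_sorted {w : List ι} (h : w.Pairwise (· ≤ ·)) : nf b w = mono k w := by
  apply nf_of_not_descent
  rintro ⟨p, rfl, hp⟩
  rw [List.pairwise_append] at h
  have := (List.pairwise_cons.1 h.2.1).1 p.2.2.1 (by simp)
  exact absurd hp (not_lt.2 this)

/-- Induction along the rewriting of words. -/
theorem word_induction {P : List ι → Prop} (sorted : ∀ w, w.Pairwise (· ≤ ·) → P w)
    (descent : ∀ a x y c, y < x → P (a ++ y :: x :: c) → (∀ w, w.length < (a ++ x :: y :: c).length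
      → P w) → P (a ++ x :: y :: c)) (w : List ι) : P w := by
  suffices H : ∀ (p : ℕ ×ₗ ℕ) (w : List ι), toLex (w.length, invs w) = p → P w from H _ w rfl
  intro p
  induction p using WellFoundedLT.induction with
  | ind p ih =>
    intro w hw
    by_cases hs : w.Pairwise (· ≤ ·)
    · exact sorted w hs
    · obtain ⟨a, x, y, c, rfl, hd⟩ := exists_descent_of_not_sorted hs
      refine descent a x y c hd (ih _ ?_ _ rfl) fun w' hw' => ih _ ?_ _ rfl
      · rw [← hw, Prod.Lex.toLex_lt_toLex]
        exact Or.inr ⟨by simp, invs_swap_lt a c hd⟩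
      · rw [← hw, Prod.Lex.toLex_lt_toLex]
        exact Or.inl hw'

end

section Enveloping

variable {k L ι : Type*} [Field k] [LieRing L] [LieAlgebra k L] [LinearOrder ι]

open MvPolynomial UniversalEnvelopingAlgebra

attribute [local instance] LieRing.ofAssociativeRing

/-- The nondecreasing word attached to an exponent vector. -/
def word (m : ι →₀ ℕ) : List ι := (toMultiset m).sort (· ≤ ·)

theorem word_sorted (m : ι →₀ ℕ) : (word m).Pairwise (· ≤ ·) :=
  Multiset.pairwise_sort _ _

theorem length_word (m : ι →₀ ℕ) : (word m).length = m.degree := by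
  rw [word, Multiset.length_sort, Finsupp.card_toMultiset]
  rfl

theorem mem_word {m : ι →₀ ℕ} {i : ι} : i ∈ word m ↔ i ∈ m.support := by
  rw [word, Multiset.mem_sort, Finsupp.mem_toMultiset]

/-- The exponent vector of a word. -/
def expo (w : List ι) : ι →₀ ℕ := Multiset.toFinsupp (w : Multiset ι)

theorem expo_word (m : ι →₀ ℕ) : expo (word m) = m := by
  rw [expo, word, Multiset.sort_eq, Finsupp.toMultiset_toFinsupp]

theorem word_expo {w : List ι} (h : w.Pairwise (· ≤ ·)) : word (expo w) = w := by
  rw [expo, word, Multiset.toFinsupp_toMultiset, Multiset.coe_sort]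
  exact List.mergeSort_eq_self _ (by simpa using h)

theorem degree_expo (w : List ι) : (expo w).degree = w.length := by
  have : Multiset.card (toMultiset (expo w)) = w.length := by
    rw [expo, Multiset.toFinsupp_toMultiset, Multiset.coe_card]
  rw [← this, Finsupp.card_toMultiset]
  rfl

theorem expo_append (w w' : List ι) : expo (w ++ w') = expo w + expo w' := by
  rw [expo, ← Multiset.coe_add, map_add]; rfl

theorem mono_eq_monomial (w : List ι) : mono k w = monomial (expo w) (1 : k) := by
  induction w with
  | nil => simp [mono, expo]
  | cons x w ih =>
    have : expo (x :: w) = single x 1 + expo w := by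
      rw [expo, ← Multiset.cons_coe, ← Multiset.singleton_add, map_add, Multiset.toFinsupp_singleton]
      rfl
    rw [mono, List.map_cons, List.prod_cons, ← mono, ih, this, X, monomial_mul, one_mul]

theorem mono_append (w w' : List ι) : mono k (w ++ w') = mono k w * mono k w' := by
  simp [mono]

local notation "ug" => UniversalEnvelopingAlgebra.ι k
local notation "𝓤" => UniversalEnvelopingAlgebra k L

variable (b : Basis ι k L)

/-- The action of `L` on the normal forms by left multiplication. -/
def act : L →ₗ[k] MvPolynomial ι k →ₗ[k] MvPolynomial ι k :=
  ((basisMonomials ι k).constr k fun m => nfL b [] (word m)).flip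

theorem act_sorted {w : List ι} (h : w.Pairwise (· ≤ ·)) (u : L) :
    act b u (mono k w) = nfL b [] w u := by
  have := (basisMonomials ι k).constr_basis k (fun m => nfL b [] (word m)) (expo w)
  rw [coe_basisMonomials] at this
  rw [mono_eq_monomial, act, LinearMap.flip_apply, this, word_expo h]

theorem act_nf (i : ι) (w : List ι) : act b (b i) (nf b w) = nf b (i :: w) := by
  induction w using word_induction with
  | sorted w h => rw [nf_sorted b h, act_sorted b h, nfL_basis, nil_append]
  | descent a x y c hd ih1 ih2 =>
    have e : (act b (b i)) ∘ₗ (nfL b a c) = nfL b (i :: a) c := by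
      refine b.ext fun j => ?_
      rw [LinearMap.comp_apply, nfL_basis, ih2 _ (by simp), nfL_basis, cons_append]
    have e' := LinearMap.congr_fun e ⁅b x, b y⁆
    rw [LinearMap.comp_apply] at e'
    rw [nf_rule, map_add, ih1, e', ← cons_append, ← cons_append, ← nf_rule]

theorem act_lie (u v : L) : act b ⁅u, v⁆ = act b u * act b v - act b v * act b u := by
  have : ∀ i j, act b ⁅b i, b j⁆ = act b (b i) * act b (b j) - act b (b j) * act b (b i) := by
    refine fun i j => (basisMonomials ι k).ext fun m => ?_
    simp only [LinearMap.sub_apply, End.mul_apply, coe_basisMonomials]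
    rw [← expo_word m, ← mono_eq_monomial]
    have hs := word_sorted m
    rw [act_sorted b hs, act_sorted b hs, act_sorted b hs, nfL_basis, nfL_basis, act_nf, act_nf,
      nil_append, nil_append]
    have := nf_rule b [] i j (word m)
    simp only [nil_append] at this
    rw [this]
    abel
  induction b.mem_span u using span_induction with
  | zero => simp
  | add u u' _ _ hu hu' => simp only [add_lie, map_add, hu, hu', add_mul, mul_add]; abel
  | smul r u _ hu =>
    simp only [smul_lie, map_smul, hu, smul_mul_assoc, mul_smul_comm, smul_sub]
  | mem _ hi =>
    obtain ⟨i, rfl⟩ := hi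
    induction b.mem_span v using span_induction with
    | zero => simp
    | add u u' _ _ hu hu' => simp only [lie_add, map_add, hu, hu', add_mul, mul_add]; abel
    | smul r u _ hu =>
      simp only [lie_smul, map_smul, hu, smul_mul_assoc, mul_smul_comm, smul_sub]
    | mem _ hj =>
      obtain ⟨j, rfl⟩ := hj
      exact this i j

/-- The action of `L` on normal forms as a Lie algebra representation. -/
def actHom : L →ₗ⁅k⁆ End k (MvPolynomial ι k) :=
  { act b with map_lie' := fun {u v} => act_lie b u v }

/-- The value of a word in the universal enveloping algebra. -/
def wd (w : List ι) : 𝓤 :=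
  (w.map fun i => ug (b i)).prod

theorem wd_append (w w' : List ι) : wd b (w ++ w') = wd b w * wd b w' := by simp [wd]

theorem wd_cons (i : ι) (w : List ι) : wd b (i :: w) = ug (b i) * wd b w := by simp [wd]

@[simp] theorem wd_nil : wd b [] = 1 := rfl

/-- The normal form map on the universal enveloping algebra. -/
def nform : 𝓤 →ₗ[k] MvPolynomial ι k :=
  (LinearMap.applyₗ (1 : MvPolynomial ι k)).comp (lift k (actHom b)).toLinearMap

theorem nform_wd (w : List ι) : nform b (wd b w) = nf b w := by
  have h0 : ∀ u, nform b u = lift k (actHom b) u 1 := fun u => rfl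
  induction w with
  | nil =>
    rw [h0, wd_nil, map_one (lift k (actHom b)), nf_sorted b List.Pairwise.nil]
    rfl
  | cons i w ih =>
    rw [h0] at ih
    rw [h0, wd_cons, map_mul, End.mul_apply, ih, lift_ι_apply, ← act_nf]
    rfl

theorem wd_rule (a : List ι) (x y : ι) (c : List ι) :
    wd b (a ++ x :: y :: c) = wd b (a ++ y :: x :: c) +
      wd b a * ug ⁅b x, b y⁆ * wd b c := by
  simp only [wd_append, wd_cons, LieHom.map_lie, LieRing.of_associative_ring_bracket]
  noncomm_ring

/-- Words in a set of letters closed under brackets are combinations of nondecreasing words in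
the same letters. -/
theorem wd_mem_span (T : Set ι) (hT : ∀ x ∈ T, ∀ y ∈ T, ⁅b x, b y⁆ ∈ span k (b '' T)) (w : List ι)
    (hw : ∀ x ∈ w, x ∈ T) :
    wd b w ∈ span k
      (wd b '' {w' | w'.Pairwise (· ≤ ·) ∧ (∀ x ∈ w', x ∈ T) ∧ w'.length ≤ w.length}) := by
  induction w using word_induction with
  | sorted w h => exact subset_span ⟨w, ⟨h, hw, le_rfl⟩, rfl⟩
  | descent a x y c hd ih1 ih2 =>
    simp only [List.mem_append, List.mem_cons] at hw
    rw [wd_rule]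
    refine add_mem ?_ ?_
    · have := ih1 (by
        intro z hz
        simp only [List.mem_append, List.mem_cons] at hz
        exact hw z (by tauto))
      simpa using this
    · have key : ∀ u ∈ span k (b '' T),
          wd b a * ug u * wd b c ∈ span k
          (wd b '' {w' | w'.Pairwise (· ≤ ·) ∧ (∀ x ∈ w', x ∈ T) ∧
            w'.length ≤ (a ++ x :: y :: c).length}) := by
        intro u hu
        induction hu using span_induction with
        | zero => simp
        | add u v _ _ hu hv => rw [map_add, mul_add, add_mul]; exact add_mem hu hv
        | smul r u _ hu =>
          rw [map_smul, mul_smul_comm, smul_mul_assoc]; exact smul_mem _ _ hu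
        | mem _ hi =>
          obtain ⟨i, hi, rfl⟩ := hi
          rw [mul_assoc, ← wd_cons, ← wd_append]
          refine span_mono (Set.image_mono ?_) (ih2 (a ++ i :: c) (by simp) ?_)
          · rintro w' ⟨h1, h2, h3⟩
            refine ⟨h1, h2, h3.trans (by simp)⟩
          · intro z hz
            simp only [List.mem_append, List.mem_cons] at hz
            rcases hz with hz | rfl | hz
            · exact hw z (by tauto)
            · exact hi
            · exact hw z (by tauto)
      exact key _ (hT x (hw x (by tauto)) y (hw y (by tauto)))

theorem span_wd : span k (range (wd b)) = ⊤ := by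
  have h1 : span k (range (wd b)) =
      Subalgebra.toSubmodule (Algebra.adjoin k
        (range (ug : L → 𝓤))) := by
    apply le_antisymm
    · rw [span_le]
      rintro _ ⟨w, rfl⟩
      refine Subalgebra.list_prod_mem _ ?_
      intro x hx
      simp only [List.mem_map] at hx
      obtain ⟨i, -, rfl⟩ := hx
      exact Algebra.subset_adjoin ⟨_, rfl⟩
    · rw [Algebra.adjoin_eq_span, span_le]
      intro u hu
      induction hu using Submonoid.closure_induction_left with
      | one => exact subset_span ⟨[], rfl⟩
      | mul_left x hx y hy' hy =>
        clear hy'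
        obtain ⟨x, rfl⟩ := hx
        induction hy using span_induction with
        | zero => simp
        | add u v _ _ hu hv => rw [mul_add]; exact add_mem hu hv
        | smul r u _ hu => rw [mul_smul_comm]; exact smul_mem _ _ hu
        | mem _ hi =>
          obtain ⟨w, rfl⟩ := hi
          induction b.mem_span x using span_induction with
          | zero => simp
          | add u v _ _ hu hv => rw [map_add, add_mul]; exact add_mem hu hv
          | smul r u _ hu => rw [map_smul, smul_mul_assoc]; exact smul_mem _ _ hu
          | mem _ hi =>
            obtain ⟨i, rfl⟩ := hi
            exact subset_span ⟨i :: w, wd_cons b i w⟩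
  have h2 : Algebra.adjoin k
      (range (ug : L → 𝓤)) = ⊤ := by
    set A := Algebra.adjoin k
      (range (ug : L → 𝓤))
    let f : L →ₗ⁅k⁆ A :=
      { toFun := fun x => ⟨ug x, Algebra.subset_adjoin ⟨x, rfl⟩⟩
        map_add' := fun x y => Subtype.ext (by simp)
        map_smul' := fun r x => Subtype.ext (by simp)
        map_lie' := fun {x y} => Subtype.ext (by
          simp [LieRing.of_associative_ring_bracket]) }
    have hid : A.val.comp (lift k f) = AlgHom.id k _ := by
      apply UniversalEnvelopingAlgebra.hom_ext
      ext x
      simp [f]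
    rw [eq_top_iff]
    intro u _
    have : u = A.val (lift k f u) := (AlgHom.congr_fun hid u).symm
    rw [this]
    exact (lift k f u).2
  rw [h1, h2]
  rfl

theorem span_sorted : span k (range fun m : ι →₀ ℕ => wd b (word m)) = ⊤ := by
  rw [eq_top_iff, ← span_wd b, span_le]
  rintro _ ⟨w, rfl⟩
  have := wd_mem_span b Set.univ (fun x _ y _ => by
    rw [Set.image_univ, b.span_eq]; trivial) w (fun _ _ => trivial)
  refine span_mono ?_ this
  rintro _ ⟨w', ⟨h, -, -⟩, rfl⟩
  exact ⟨expo w', by simp only [word_expo h]⟩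

/-- The Poincaré–Birkhoff–Witt isomorphism of vector spaces. -/
def equiv : 𝓤 ≃ₗ[k] MvPolynomial ι k :=
  let ψ : MvPolynomial ι k →ₗ[k] 𝓤 :=
    (basisMonomials ι k).constr k fun m => wd b (word m)
  have h1 : (nform b) ∘ₗ ψ = LinearMap.id := by
    refine (basisMonomials ι k).ext fun m => ?_
    rw [LinearMap.comp_apply, Basis.constr_basis, nform_wd, nf_sorted b (word_sorted m),
      mono_eq_monomial, expo_word, coe_basisMonomials]
    rfl
  have h2 : Function.Surjective ψ := by
    rw [← LinearMap.range_eq_top, eq_top_iff, ← span_sorted b, span_le]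
    rintro _ ⟨m, rfl⟩
    exact ⟨basisMonomials ι k m, (basisMonomials ι k).constr_basis k _ m⟩
  LinearEquiv.ofLinear (nform b) ψ h1 (by
    refine LinearMap.ext fun u => ?_
    obtain ⟨p, rfl⟩ := h2 u
    rw [LinearMap.comp_apply]
    exact congrArg ψ (LinearMap.congr_fun h1 p))

theorem equiv_wd (w : List ι) : equiv b (wd b w) = nf b w := nform_wd b w

theorem equiv_word (m : ι →₀ ℕ) : equiv b (wd b (word m)) = monomial m 1 := by
  rw [equiv_wd, nf_sorted b (word_sorted m), mono_eq_monomial, expo_word]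

/-- The Poincaré–Birkhoff–Witt basis. -/
def basis : Basis (ι →₀ ℕ) k (𝓤) :=
  (basisMonomials ι k).map (equiv b).symm

@[simp] theorem basis_apply (m : ι →₀ ℕ) : basis b m = wd b (word m) := by
  rw [basis, Basis.map_apply, LinearEquiv.symm_apply_eq, equiv_word, coe_basisMonomials]

/-- Polynomials all of whose monomials have degree less than `n`. -/
def low (k ι : Type*) [Field k] (n : ℕ) : Submodule k (MvPolynomial ι k) :=
  ⨅ j ∈ Set.Ici n, LinearMap.ker (homogeneousComponent j)

theorem mem_low {n : ℕ} {p : MvPolynomial ι k} :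
    p ∈ low k ι n ↔ ∀ j, n ≤ j → homogeneousComponent j p = 0 := by
  simp [low]

theorem low_mono {n m : ℕ} (h : n ≤ m) : low k ι n ≤ low k ι m := fun _ hp =>
  mem_low.2 fun j hj => mem_low.1 hp j (h.trans hj)

theorem mono_isHomogeneous (w : List ι) : (mono k w).IsHomogeneous w.length := by
  rw [mono_eq_monomial]
  exact isHomogeneous_monomial _ (degree_expo w)

theorem homogeneousComponent_mono (w : List ι) (n : ℕ) :
    homogeneousComponent n (mono k w) = if w.length = n then mono k w else 0 := by
  rw [homogeneousComponent_of_mem (mono_isHomogeneous w)]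
  simp only [eq_comm]

theorem nf_sub_mono_mem (w : List ι) : nf b w - mono k w ∈ low k ι w.length := by
  induction w using word_induction with
  | sorted w h => rw [nf_sorted b h, sub_self]; exact zero_mem _
  | descent a x y c hd ih1 ih2 =>
    have hp : mono k (a ++ x :: y :: c) = mono k (a ++ y :: x :: c) :=
      mono_perm ((List.Perm.swap _ _ _).append_left a)
    have hL : ∀ u, nfL b a c u ∈ low k ι (a ++ x :: y :: c).length := by
      intro u
      induction b.mem_span u using span_induction with
      | zero => simp
      | add u v _ _ hu hv => rw [map_add]; exact add_mem hu hv
      | smul r u _ hu => rw [map_smul]; exact smul_mem _ _ hu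
      | mem _ hi =>
        obtain ⟨i, rfl⟩ := hi
        rw [nfL_basis, ← sub_add_cancel (nf b (a ++ i :: c)) (mono k (a ++ i :: c))]
        refine add_mem (low_mono (by simp) (ih2 _ (by simp))) (mem_low.2 fun j hj => ?_)
        rw [homogeneousComponent_mono, if_neg]
        simp at hj ⊢
        omega
    rw [nf_rule, hp, add_sub_right_comm]
    refine add_mem ?_ (hL _)
    simpa using ih1

theorem homogeneousComponent_nf {w : List ι} {n : ℕ} (h : w.length ≤ n) :
    homogeneousComponent n (nf b w) = homogeneousComponent n (mono k w) := by
  rw [← sub_eq_zero, ← map_sub]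
  exact mem_low.1 (nf_sub_mono_mem b w) n h

/-- The symbol of a product is the product of the symbols. -/
theorem symbol_mul {m n : ℕ} {u v : 𝓤} (hu : u ∈ span k (wd b '' {w | w.length ≤ m}))
    (hv : v ∈ span k (wd b '' {w | w.length ≤ n})) :
    homogeneousComponent (m + n) (equiv b (u * v)) =
      homogeneousComponent m (equiv b u) * homogeneousComponent n (equiv b v) := by
  induction hu using span_induction with
  | zero => simp
  | add u u' _ _ hu hu' => simp only [add_mul, map_add, hu, hu']
  | smul r u _ hu => simp only [smul_mul_assoc, map_smul, hu]
  | mem _ h =>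
    obtain ⟨w, hw, rfl⟩ := h
    induction hv using span_induction with
    | zero => simp
    | add u u' _ _ hu hu' => simp only [mul_add, map_add, hu, hu']
    | smul r u _ hu => simp only [mul_smul_comm, map_smul, hu]
    | mem _ h =>
      obtain ⟨w', hw', rfl⟩ := h
      simp only [Set.mem_setOf_eq] at hw hw'
      rw [← wd_append, equiv_wd, equiv_wd, equiv_wd, homogeneousComponent_nf b hw,
        homogeneousComponent_nf b hw', homogeneousComponent_nf b (by simp; omega),
        homogeneousComponent_mono, homogeneousComponent_mono, homogeneousComponent_mono,
        length_append, mono_append]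
      split_ifs <;> first | omega | simp

theorem exists_symbol {u : 𝓤} (hu : u ≠ 0) :
    ∃ n, u ∈ span k (wd b '' {w | w.length ≤ n}) ∧
      homogeneousComponent n (equiv b u) ≠ 0 := by
  refine ⟨(equiv b u).totalDegree, ?_, ?_⟩
  · have e := (basis b).linearCombination_repr u
    rw [Finsupp.linearCombination_apply, Finsupp.sum] at e
    have hN : ∀ m ∈ (equiv b u).support, m.degree ≤ (equiv b u).totalDegree :=
      fun m hm => le_totalDegree hm
    generalize (equiv b u).totalDegree = N at hN
    rw [← e]
    refine sum_mem fun m hm => smul_mem (R := k) _ _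
      (subset_span ?_)
    refine ⟨word m, ?_, (basis_apply b m).symm⟩
    have : m ∈ (equiv b u).support := by
      rw [mem_support_iff]
      exact Finsupp.mem_support_iff.1 hm
    rw [Set.mem_setOf_eq, length_word]
    exact hN m this
  · have h0 : equiv b u ≠ 0 := by simpa using hu
    obtain ⟨m, hm, hd⟩ := Finset.exists_mem_eq_sup (equiv b u).support (by simpa using h0)
      (fun s => s.sum fun _ e => e)
    intro hz
    have := congrArg (coeff m) hz
    rw [coeff_homogeneousComponent, if_pos, coeff_zero] at this
    · exact (mem_support_iff.1 hm) this
    · rw [totalDegree, hd]; rfl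

theorem noZeroDivisors (b : Basis ι k L) : NoZeroDivisors (𝓤) := by
  refine ⟨fun {u v} huv => ?_⟩
  by_contra! h
  obtain ⟨m, hm, hm'⟩ := exists_symbol b h.1
  obtain ⟨n, hn, hn'⟩ := exists_symbol b h.2
  have := symbol_mul b hm hn
  rw [huv, map_zero, map_zero] at this
  exact mul_ne_zero hm' hn' this.symm

end Enveloping

end PBW

namespace Red

open LieAlgebra LieModule Module LieAlgebra.IsKilling

section Radical

variable {k L : Type*} [Field k] [LieRing L] [LieAlgebra k L]

/-- The elements of `A` which bracket `r` into `Z`. -/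
def trans (r A Z : LieIdeal k L) : LieIdeal k L where
  carrier := {a | a ∈ A ∧ ∀ x ∈ r, ⁅x, a⁆ ∈ Z}
  add_mem' := by
    rintro a b ⟨ha, ha'⟩ ⟨hb, hb'⟩
    exact ⟨add_mem ha hb, fun x hx => by rw [lie_add]; exact add_mem (ha' x hx) (hb' x hx)⟩
  zero_mem' := ⟨zero_mem _, fun x _ => by rw [lie_zero]; exact zero_mem _⟩
  smul_mem' := by
    rintro c a ⟨ha, ha'⟩
    exact ⟨A.toSubmodule.smul_mem c ha, fun x hx => by
      rw [lie_smul]; exact Z.toSubmodule.smul_mem c (ha' x hx)⟩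
  lie_mem := by
    rintro y a ⟨ha, ha'⟩
    refine ⟨A.lie_mem ha, fun x hx => ?_⟩
    rw [leibniz_lie]
    refine add_mem (ha' _ ?_) (Z.lie_mem (ha' x hx))
    rw [← lie_skew]
    exact neg_mem (r.lie_mem hx)

lemma mem_center_iff {a : L} : a ∈ center k L ↔ ∀ x : L, ⁅x, a⁆ = 0 :=
  mem_maxTrivSubmodule k L L a

lemma lie_center {a : L} (ha : a ∈ center k L) (x : L) : ⁅x, a⁆ = 0 := mem_center_iff.1 ha x

lemma center_lie {a : L} (ha : a ∈ center k L) (x : L) : ⁅a, x⁆ = 0 := by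
  rw [← lie_skew, lie_center ha, neg_zero]

variable [FiniteDimensional k L]

lemma exists_minimal {Z A : LieIdeal k L} (h : Z < A) :
    ∃ A₁, Z < A₁ ∧ A₁ ≤ A ∧ ∀ B, Z < B → B ≤ A₁ → B = A₁ := by
  obtain ⟨A₁, ⟨h1, h2⟩, h3⟩ := WellFounded.has_min
    (LieSubmodule.wellFoundedLT_of_isArtinian k L L).wf
    {B | Z < B ∧ B ≤ A} ⟨A, h, le_rfl⟩
  exact ⟨A₁, h1, h2, fun B hB hBA => by
    by_contra hne
    exact h3 B ⟨hB, hBA.trans h2⟩ (lt_of_le_of_ne hBA hne)⟩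

variable [IsAlgClosed k] [CharZero k]

lemma exists_scalar {Z A₁ r : LieIdeal k L} [IsSolvable r] (h : Z < A₁)
    (hmin : ∀ B, Z < B → B ≤ A₁ → B = A₁) :
    ∃ χ : Dual k r, ∀ x : r, ∀ a ∈ A₁, ⁅(x : L), a⁆ - χ x • a ∈ Z := by
  let N : LieSubmodule k L A₁ := LieSubmodule.comap (LieSubmodule.incl A₁) Z
  obtain ⟨a, ha, haZ⟩ := SetLike.exists_of_lt h
  have hmk : ∀ y : A₁, (LieSubmodule.Quotient.mk y : A₁ ⧸ N) = 0 ↔ (y : L) ∈ Z := by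
    intro y
    exact (LieSubmodule.Quotient.mk_eq_zero' (N := N)).trans Iff.rfl
  have : Nontrivial (A₁ ⧸ N) := ⟨⟨LieSubmodule.Quotient.mk ⟨a, ha⟩, 0, fun h0 => haZ ((hmk _).1 h0)⟩⟩
  obtain ⟨χ, hχ⟩ : ∃ χ : Dual k r, Nontrivial (weightSpace (A₁ ⧸ N) χ) :=
    exists_nontrivial_weightSpace_of_isSolvable k r (A₁ ⧸ N)
  let W : LieSubmodule k L (A₁ ⧸ N) := weightSpaceOfIsLieTower k (A₁ ⧸ N) χ
  have hW : ∀ m : A₁ ⧸ N, m ∈ W ↔ ∀ x : r, ⁅(x : L), m⁆ = χ x • m := by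
    intro m
    exact mem_weightSpace (M := A₁ ⧸ N) χ m
  refine ⟨χ, ?_⟩
  let B : LieIdeal k L :=
    { carrier := {a | a ∈ A₁ ∧ ∀ x : r, ⁅(x : L), a⁆ - χ x • a ∈ Z}
      add_mem' := by
        rintro a b ⟨ha, ha'⟩ ⟨hb, hb'⟩
        refine ⟨add_mem ha hb, fun x => ?_⟩
        have := add_mem (ha' x) (hb' x)
        rw [lie_add, smul_add]
        convert this using 1
        abel
      zero_mem' := ⟨zero_mem _, fun x => by simp⟩
      smul_mem' := by
        rintro c a ⟨ha, ha'⟩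
        refine ⟨A₁.toSubmodule.smul_mem c ha, fun x => ?_⟩
        have := Z.toSubmodule.smul_mem c (ha' x)
        rw [lie_smul, smul_comm, ← smul_sub]
        exact this
      lie_mem := by
        rintro y a ⟨ha, ha'⟩
        refine ⟨A₁.lie_mem ha, fun x => ?_⟩
        have h1 : (LieSubmodule.Quotient.mk (⟨a, ha⟩ : A₁) : A₁ ⧸ N) ∈ W := by
          rw [hW]
          intro x
          exact sub_eq_zero.1 ((hmk (⁅(x : L), (⟨a, ha⟩ : A₁)⁆ - χ x • (⟨a, ha⟩ : A₁))).2 (ha' x))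
        have h2 := (hW _).1 (W.lie_mem (x := y) h1) x
        exact (hmk (⁅(x : L), ⁅y, (⟨a, ha⟩ : A₁)⁆⁆ - χ x • ⁅y, (⟨a, ha⟩ : A₁)⁆)).1
          (sub_eq_zero.2 h2) }
  have hB : B = A₁ := by
    refine hmin B ?_ fun _ h => h.1
    rw [SetLike.lt_iff_le_and_exists]
    refine ⟨fun z hz => ⟨h.le hz, fun x => sub_mem (Z.lie_mem hz) (Z.toSubmodule.smul_mem _ hz)⟩, ?_⟩
    obtain ⟨⟨m, hm⟩, hne⟩ := exists_ne (0 : weightSpace (A₁ ⧸ N) χ)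
    obtain ⟨y, rfl⟩ := surjective_mk' N m
    refine ⟨y, ⟨y.2, fun x => ?_⟩, fun hz => hne (Subtype.ext ((hmk y).2 hz))⟩
    exact (hmk (⁅(x : L), y⁆ - χ x • y)).1 (sub_eq_zero.2 ((hW _).1 hm x))
  intro x a ha
  rw [← hB] at ha
  exact ha.2 x

variable (k L) in
/-- Every abelian ideal is central. -/
def AbelianCentral : Prop :=
  ∀ I : LieIdeal k L, IsLieAbelian I → I ≤ center k L

lemma abelian_le_center (hred : AbelianCentral k L) {I : LieIdeal k L}
    (h : ∀ x ∈ I, ∀ y ∈ I, ⁅x, y⁆ = 0) : I ≤ center k L :=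
  hred I ⟨fun x y => Subtype.ext (h x x.2 y y.2)⟩

lemma minimal_le_trans (hred : AbelianCentral k L) {A₁ : LieIdeal k L} (hr : A₁ ≤ radical k L)
    (h : center k L < A₁) (hmin : ∀ B, center k L < B → B ≤ A₁ → B = A₁)
    (hc : ∀ x ∈ A₁, ∀ y ∈ A₁, ⁅x, y⁆ ∈ center k L) : A₁ ≤ trans (radical k L) A₁ (center k L) := by
  obtain ⟨χ, hχ⟩ := exists_scalar (r := radical k L) h hmin
  have hne : ∃ a ∈ A₁, ∃ b ∈ A₁, ⁅a, b⁆ ≠ 0 := by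
    by_contra! hcon
    exact absurd (abelian_le_center hred hcon) (not_le_of_gt h)
  obtain ⟨a, ha, b, hb, hab⟩ := hne
  have hzero : ∀ x : radical k L, χ x = 0 := by
    intro x
    have h1 : ⁅(x : L), ⁅a, b⁆⁆ = 0 := lie_center (hc a ha b hb) _
    rw [leibniz_lie] at h1
    have h2 : ⁅⁅(x : L), a⁆, b⁆ = χ x • ⁅a, b⁆ := by
      have := center_lie (hχ x a ha) b
      rw [sub_lie, smul_lie] at this
      exact sub_eq_zero.1 this
    have h3 : ⁅a, ⁅(x : L), b⁆⁆ = χ x • ⁅a, b⁆ := by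
      have := lie_center (hχ x b hb) a
      rw [lie_sub, lie_smul] at this
      exact sub_eq_zero.1 this
    rw [h2, h3, ← two_smul k, smul_smul] at h1
    rcases smul_eq_zero.1 h1 with h | h
    · exact (mul_eq_zero.1 h).resolve_left two_ne_zero
    · exact absurd h hab
  intro y hy
  refine ⟨hy, fun x hx => ?_⟩
  simpa [hzero] using hχ ⟨x, hx⟩ y hy

lemma centralizer_trans_le (hred : AbelianCentral k L) {A : LieIdeal k L} (hr : A ≤ radical k L)
    (hZ : center k L ≤ A) (hc : ∀ x ∈ A, ∀ y ∈ A, ⁅x, y⁆ ∈ center k L) :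
    trans (trans (radical k L) A (center k L)) A ⊥ ≤ center k L := by
  set A₂ := trans (radical k L) A (center k L)
  set C := trans A₂ A ⊥
  by_contra hcon
  have hZC : center k L ≤ C := fun z hz => ⟨hZ hz, fun x _ => by
    rw [lie_center hz]; exact zero_mem _⟩
  have hlt : center k L < C := lt_of_le_not_ge hZC hcon
  obtain ⟨A₁, h1, h2, h3⟩ := exists_minimal hlt
  have hCA : C ≤ A := fun _ h => h.1
  have hA₁ := minimal_le_trans hred (h2.trans (hCA.trans hr)) h1 h3
    fun x hx y hy => hc x (hCA (h2 hx)) y (hCA (h2 hy))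
  refine absurd (abelian_le_center hred (I := A₁) fun x hx y hy => ?_) (not_le_of_gt h1)
  have hx2 : x ∈ A₂ := ⟨hCA (h2 hx), (hA₁ hx).2⟩
  simpa using (h2 hy).2 x hx2

lemma lie_mem_center_of_class_two (hred : AbelianCentral k L) {A : LieIdeal k L}
    (hr : A ≤ radical k L) (hZ : center k L ≤ A) (hc : ∀ x ∈ A, ∀ y ∈ A, ⁅x, y⁆ ∈ center k L)
    {x a : L} (hx : x ∈ radical k L) (ha : a ∈ A) : ⁅x, a⁆ ∈ center k L := by
  refine centralizer_trans_le hred hr hZ hc ⟨A.lie_mem ha, fun b hb => ?_⟩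
  have h1 : ⁅b, x⁆ ∈ center k L := by
    rw [← lie_skew]; exact neg_mem (hb.2 x hx)
  rw [leibniz_lie, center_lie h1, lie_center (hc b hb.1 a ha), add_zero]
  exact zero_mem _

/-- In a Lie algebra all of whose abelian ideals are central, the radical is nilpotent of
class at most two. -/
theorem lie_radical_mem_center (hred : AbelianCentral k L) {x y : L} (hx : x ∈ radical k L)
    (hy : y ∈ radical k L) : ⁅x, y⁆ ∈ center k L := by
  obtain ⟨A, ⟨hr, hZ, hc⟩, hmax⟩ := WellFounded.has_min
    (LieSubmodule.wellFoundedGT_of_noetherian k L L).wf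
    {A | A ≤ radical k L ∧ center k L ≤ A ∧ ∀ x ∈ A, ∀ y ∈ A, ⁅x, y⁆ ∈ center k L}
    ⟨center k L, center_le_radical k L, le_rfl, fun x _ y hy => by
      rw [lie_center hy]; exact zero_mem _⟩
  have hmax' : ∀ B : LieIdeal k L, B ≤ radical k L → A ≤ B →
      (∀ x ∈ B, ∀ y ∈ B, ⁅x, y⁆ ∈ center k L) → B ≤ A := by
    intro B h1 h2 h3
    by_contra h4
    exact hmax B ⟨h1, hZ.trans h2, h3⟩ (lt_of_le_not_ge h2 h4)
  set D := trans A (radical k L) ⊥ with hD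
  have hDA : ∀ d ∈ D, ∀ a ∈ A, ⁅a, d⁆ = 0 := fun d hd a ha => by simpa using hd.2 a ha
  have hinter : ∀ z, z ∈ D → z ∈ A → z ∈ center k L := by
    intro z hz hz'
    exact abelian_le_center hred (I := D ⊓ A) (fun x hx y hy => by
      have h := hDA y hy.1 x hx.2
      exact h) ⟨hz, hz'⟩
  have hDZ : D ≤ center k L := by
    by_contra hcon
    have hsol : IsSolvable (radical k L) := inferInstance
    have hDs : IsSolvable D := le_solvable_ideal_solvable (fun _ h => h.1) hsol
    obtain ⟨n, hn⟩ := IsSolvable.solvable k D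
    rw [LieIdeal.derivedSeries_eq_bot_iff] at hn
    have hex : ∃ m, derivedSeriesOfIdeal k L m D ≤ center k L := ⟨n, by rw [hn]; exact bot_le⟩
    classical
    obtain ⟨m, hm, hm'⟩ := (⟨Nat.find hex, Nat.find_spec hex, fun j hj => Nat.find_min hex hj⟩ :
      ∃ m, derivedSeriesOfIdeal k L m D ≤ center k L ∧
        ∀ j < m, ¬ derivedSeriesOfIdeal k L j D ≤ center k L)
    rcases m with _ | m
    · exact hcon hm
    · have hE := hm' m (Nat.lt_succ_self m)
      set E := derivedSeriesOfIdeal k L m D with hEdef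
      have hED : E ≤ D := derivedSeriesOfIdeal_le_self D m
      have hEE : ∀ x ∈ E, ∀ y ∈ E, ⁅x, y⁆ ∈ center k L := by
        intro x hx y hy
        apply hm
        rw [derivedSeriesOfIdeal_succ]
        exact LieSubmodule.lie_mem_lie hx hy
      have := hmax' (A ⊔ E) (sup_le hr fun x hx => (hED hx).1) le_sup_left ?_
      · exact hE fun x hx => hinter x (hED hx) (this (LieSubmodule.mem_sup _ _ _ |>.2
          ⟨0, zero_mem _, x, hx, zero_add _⟩))
      · intro x hx y hy
        obtain ⟨a, ha, d, hd, rfl⟩ := (LieSubmodule.mem_sup _ _ _).1 hx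
        obtain ⟨a', ha', d', hd', rfl⟩ := (LieSubmodule.mem_sup _ _ _).1 hy
        rw [lie_add, add_lie, add_lie, hDA d' (hED hd') a ha, ← lie_skew d a',
          hDA d (hED hd) a' ha', neg_zero, add_zero, zero_add]
        exact add_mem (hc a ha a' ha') (hEE d hd d' hd')
  apply hDZ
  refine ⟨(radical k L).lie_mem hy, fun a ha => ?_⟩
  have h1 : ⁅a, x⁆ ∈ center k L := by
    rw [← lie_skew]; exact neg_mem (lie_mem_center_of_class_two hred hr hZ hc hx ha)
  have h2 : ⁅a, y⁆ ∈ center k L := by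
    rw [← lie_skew]; exact neg_mem (lie_mem_center_of_class_two hred hr hZ hc hy ha)
  rw [leibniz_lie, center_lie h1, lie_center h2, add_zero]
  exact zero_mem _

end Radical

section Semisimple

variable {k s : Type*} [Field k] [IsAlgClosed k] [CharZero k] [LieRing s] [LieAlgebra k s]
  [FiniteDimensional k s] [IsKilling k s] (H : LieSubalgebra k s) [H.IsCartanSubalgebra]

/-- The principal `sl₂`-triple of a semisimple Lie algebra. -/
lemma exists_principal : ∃ (h₀ : H) (x y : s), ⁅x, y⁆ = (h₀ : s) ∧ ⁅(h₀ : s), x⁆ = (2 : k) • x ∧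
    ⁅(h₀ : s), y⁆ = -((2 : k) • y) ∧
    (∀ α : Weight k H s, α.IsNonZero → ∃ n : ℤ, n ≠ 0 ∧ α h₀ = 2 * n) ∧
    x ∈ span k {z | ∃ α : Weight k H s, α.IsNonZero ∧ z ∈ rootSpace H α ∧ α h₀ = 2} := by
  classical
  obtain ⟨b⟩ := RootPairing.nonempty_base (rootSystem H)
  let P := rootSystem H
  obtain ⟨h₀, hh₀⟩ : ∃ h₀ : H, ∀ i : b.support, (i : H.root).1 h₀ = 2 := by
    let φ : Dual k (Dual k H) := b.toWeightBasis.constr k (fun _ => (2 : k))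
    refine ⟨(Module.evalEquiv k H).symm φ, fun i => ?_⟩
    have h1 : φ (P.root i) = 2 := by
      have := b.toWeightBasis.constr_basis k (fun _ => (2 : k)) i
      rwa [b.toWeightBasis_apply] at this
    rw [← h1]
    exact Module.apply_evalEquiv_symm_apply k H (P.root i) φ
  have hnz : ∀ i : b.support, (i : H.root).1.IsNonZero := fun i =>
    LieSubalgebra.isNonZero_coe_root _
  choose h e f ht he hf using fun i : b.support => exists_isSl2Triple_of_weight_isNonZero (hnz i)
  have hh : ∀ i, h i = coroot (i : H.root).1 := fun i => (ht i).h_eq_coroot (hnz i) (he i) (hf i)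
  have hef : ∀ i j : b.support, i ≠ j → ⁅e i, f j⁆ = 0 := by
    intro i j hij
    by_contra hne
    have hmem := lie_mem_genWeightSpace_of_mem_genWeightSpace (he i) (hf j)
    let χ : Weight k H s := ⟨_, fun hbot => hne (by rw [hbot] at hmem; simpa using hmem)⟩
    have hχ : χ.toLinear = P.root i - P.root j := by
      ext z
      simp [χ, P, sub_eq_add_neg]
    have hχ0 : χ.IsNonZero := by
      intro h0
      apply hij
      have : χ.toLinear = 0 := Weight.coe_toLinear_eq_zero_iff.2 h0
      rw [hχ, sub_eq_zero] at this
      exact Subtype.ext (P.root.injective this)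
    refine b.sub_notMem_range_root (i := i) (j := j) i.2 j.2 ⟨⟨χ, by simpa using hχ0⟩, ?_⟩
    rw [← hχ]
    rfl
  let c := b.toCoweightBasis.repr h₀
  have hc : ∑ i, c i • (coroot (i : H.root).1 : H) = h₀ := by
    have := b.toCoweightBasis.sum_repr h₀
    simpa using this
  refine ⟨h₀, ∑ i, e i, ∑ i, c i • f i, ?_, ?_, ?_, ?_, ?_⟩
  · have h1 : ∀ i, ⁅e i, ∑ j, c j • f j⁆ = c i • h i := by
      intro i
      rw [lie_sum, Finset.sum_eq_single i]
      · rw [lie_smul, (ht i).lie_e_f]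
      · intro j _ hj
        rw [lie_smul, hef i j hj.symm, smul_zero]
      · simp
    rw [sum_lie, sum_congr rfl fun i _ => h1 i]
    conv_rhs => rw [← hc]
    simp [hh]
  · rw [lie_sum, smul_sum]
    refine sum_congr rfl fun i _ => ?_
    have := lie_eq_smul_of_mem_rootSpace (he i) h₀
    rw [hh₀ i] at this
    exact this
  · rw [lie_sum, smul_sum, ← Finset.sum_neg_distrib]
    refine sum_congr rfl fun i _ => ?_
    have := lie_eq_smul_of_mem_rootSpace (hf i) h₀
    rw [Pi.neg_apply, hh₀ i] at this
    rw [lie_smul, smul_comm (2 : k), ← smul_neg]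
    congr 1
    rw [← neg_smul]
    exact this
  · intro α hα
    obtain ⟨n, hn, hn'⟩ := b.exists_root_eq_sum_nat_or_neg ⟨α, by simpa using hα⟩
    have hsum : (∑ j ∈ b.support, n j • P.root j) h₀ = 2 * ((∑ j ∈ b.support, n j : ℕ) : k) := by
      rw [LinearMap.sum_apply, Nat.cast_sum, mul_sum]
      refine sum_congr rfl fun j hj => ?_
      have : P.root j h₀ = 2 := hh₀ ⟨j, hj⟩
      rw [LinearMap.smul_apply, this, nsmul_eq_mul, mul_comm]
    have h0 : (∑ j ∈ b.support, n j) ≠ 0 := by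
      intro h0
      have h1 : ∑ j ∈ b.support, n j • P.root j = 0 := by
        refine sum_eq_zero fun j hj => ?_
        rw [Finset.sum_eq_zero_iff.1 h0 j hj, zero_smul]
      have h2 : P.root ⟨α, by simpa using hα⟩ = 0 := by
        rcases hn' with h | h
        · exact h.trans h1
        · exact h.trans (by rw [h1, neg_zero])
      exact P.ne_zero _ h2
    have hαr : α h₀ = P.root ⟨α, by simpa using hα⟩ h₀ := rfl
    rcases hn' with h | h
    · refine ⟨(∑ j ∈ b.support, n j : ℕ), by exact_mod_cast h0, ?_⟩
      rw [hαr]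
      refine (LinearMap.congr_fun h h₀).trans (hsum.trans ?_)
      push_cast
      rfl
    · refine ⟨-(∑ j ∈ b.support, n j : ℕ), neg_ne_zero.2 (Int.natCast_ne_zero.2 h0), ?_⟩
      rw [hαr]
      refine (LinearMap.congr_fun h h₀).trans ?_
      rw [LinearMap.neg_apply]
      refine (congrArg Neg.neg hsum).trans ?_
      push_cast
      ring
  · exact sum_mem fun i _ => subset_span ⟨_, hnz i, he i, hh₀ i⟩

section Weights

variable {W : Type*} [AddCommGroup W] [Module k W] [LieRingModule s W] [LieModule k s W]

/-- The genuine weight space of a module over a semisimple Lie algebra. -/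
def wvec (W : Type*) [AddCommGroup W] [Module k W] [LieRingModule s W] [LieModule k s W]
    (χ : Dual k H) : Submodule k W where
  carrier := {w | ∀ z : H, ⁅(z : s), w⁆ = χ z • w}
  add_mem' := by intro a b ha hb z; rw [lie_add, ha z, hb z, smul_add]
  zero_mem' := by intro z; simp
  smul_mem' := by intro c a ha z; rw [lie_smul, ha z, smul_comm]

lemma lie_mem_wvec {χ : Dual k H} {w : W} (hw : w ∈ wvec H W χ) {α : Weight k H s} {x : s}
    (hx : x ∈ rootSpace H α) : ⁅x, w⁆ ∈ wvec H W (χ + α.toLinear) := by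
  intro z
  have h1 : ⁅(z : s), x⁆ = α z • x := lie_eq_smul_of_mem_rootSpace hx z
  rw [leibniz_lie, h1, hw z, smul_lie, lie_smul, ← add_smul, LinearMap.add_apply, add_comm]
  rfl

lemma forall_of_rootSpace {D : Submodule k s} (h : ∀ α : Weight k H s, ∀ x ∈ rootSpace H α, x ∈ D)
    (x : s) : x ∈ D := by
  have h1 : (⨆ χ : Weight k H s, (rootSpace H χ).toSubmodule) ≤ D := iSup_le fun α => h α
  apply h1
  rw [← LieSubmodule.iSup_toSubmodule, iSup_genWeightSpace_eq_top' k H s]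
  trivial

/-- The additive group generated by the roots. -/
def rootLat : AddSubgroup (Dual k H) :=
  AddSubgroup.closure (range (Weight.toLinear k H s))

lemma toLinear_mem_rootLat (α : Weight k H s) : α.toLinear ∈ rootLat H :=
  AddSubgroup.subset_closure ⟨α, rfl⟩

/-- The sum of the genuine weight spaces for weights in a coset of the root lattice. -/
def cosetPart (W : Type*) [AddCommGroup W] [Module k W] [LieRingModule s W] [LieModule k s W]
    (χ₀ : Dual k H) : LieSubmodule k s W where
  toSubmodule := span k {w | ∃ χ, χ - χ₀ ∈ rootLat H ∧ w ∈ wvec H W χ}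
  lie_mem := by
    intro x w hw
    let D : Submodule k s :=
      { carrier := {x | ⁅x, w⁆ ∈ span k {w | ∃ χ, χ - χ₀ ∈ rootLat H ∧ w ∈ wvec H W χ}}
        add_mem' := by intro a b ha hb; simpa only [Set.mem_setOf_eq, add_lie] using add_mem ha hb
        zero_mem' := by simp
        smul_mem' := by
          intro c a ha
          simpa only [Set.mem_setOf_eq, smul_lie] using smul_mem _ c ha }
    refine forall_of_rootSpace H (D := D) (fun α x hx => ?_) x
    show ⁅x, w⁆ ∈ span k {w | ∃ χ, χ - χ₀ ∈ rootLat H ∧ w ∈ wvec H W χ}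
    induction hw using span_induction with
    | mem w hw =>
      obtain ⟨χ, hχ, hw⟩ := hw
      refine subset_span ⟨_, ?_, lie_mem_wvec H hw hx⟩
      rw [add_sub_right_comm]
      exact add_mem hχ (toLinear_mem_rootLat H α)
    | zero => simp
    | add a b _ _ ha hb => rw [lie_add]; exact add_mem ha hb
    | smul c a _ ha => rw [lie_smul]; exact smul_mem _ c ha

variable [FiniteDimensional k W] [LieModule.IsIrreducible k s W]

lemma eq_top_of_irreducible (N : LieSubmodule k s W) {w : W} (hw : w ∈ N) (h0 : w ≠ 0) : N = ⊤ := by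
  have : Nontrivial N := ⟨⟨⟨w, hw⟩, 0, fun h => h0 (congrArg Subtype.val h)⟩⟩
  exact N.eq_top_of_isIrreducible k s W

lemma form_eq_zero_of_weights (ω : W →ₗ[k] W →ₗ[k] k) (hskew : ∀ v w, ω v w = -ω w v)
    (hinv : ∀ x : s, ∀ v w, ω ⁅x, v⁆ w = -ω v ⁅x, w⁆) (htop : cosetPart H W 0 = ⊤) : ω = 0 := by
  obtain ⟨h₀, x, y, hxy, hx, hy, hroot, hxs⟩ := exists_principal H
  have hint : ∀ χ ∈ rootLat H, ∃ n : ℤ, χ h₀ = 2 * n := by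
    intro χ hχ
    induction hχ using AddSubgroup.closure_induction with
    | mem χ hχ =>
      obtain ⟨α, rfl⟩ := hχ
      by_cases hα : α.IsNonZero
      · obtain ⟨n, -, hn⟩ := hroot α hα
        exact ⟨n, hn⟩
      · refine ⟨0, ?_⟩
        rw [Weight.IsNonZero, not_not] at hα
        have : α h₀ = 0 := by rw [hα.eq]; rfl
        simpa using this
    | zero => exact ⟨0, by simp⟩
    | add a b _ _ ha hb =>
      obtain ⟨m, hm⟩ := ha
      obtain ⟨n, hn⟩ := hb
      exact ⟨m + n, by rw [LinearMap.add_apply, hm, hn]; push_cast; ring⟩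
    | neg a _ ha =>
      obtain ⟨m, hm⟩ := ha
      exact ⟨-m, by rw [LinearMap.neg_apply, hm]; push_cast; ring⟩
  let T : Set ℤ := {j | ∃ w : W, w ≠ 0 ∧ ∃ χ ∈ rootLat H, w ∈ wvec H W χ ∧ χ h₀ = 2 * j}
  have hspan : span k {w : W | ∃ χ ∈ rootLat H, w ∈ wvec H W χ} = ⊤ := by
    have := congrArg LieSubmodule.toSubmodule htop
    simpa [cosetPart] using this
  have := LieModule.nontrivial_of_isIrreducible k s W
  have hTne : T.Nonempty := by
    by_contra hT
    have h1 : span k {w : W | ∃ χ ∈ rootLat H, w ∈ wvec H W χ} ≤ ⊥ := by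
      refine span_le.2 ?_
      rintro w ⟨χ, hχ, hw⟩
      by_contra h0
      obtain ⟨n, hn⟩ := hint χ hχ
      exact hT ⟨n, w, h0, χ, hχ, hw, hn⟩
    rw [hspan, top_le_iff] at h1
    exact bot_ne_top h1.symm.symm
  have hTfin : T.Finite := by
    have h1 : (range fun j : T => (2 * ((j : ℤ) : k))).Finite := by
      refine (End.finite_hasEigenvalue (toEnd k s W (h₀ : s))).subset ?_
      rintro _ ⟨⟨j, w, h0, χ, -, hw, hn⟩, rfl⟩
      refine End.hasEigenvalue_of_hasEigenvector (x := w) ⟨?_, h0⟩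
      rw [End.mem_eigenspace_iff, toEnd_apply_apply]
      exact (hw h₀).trans (congrArg (· • w) hn)
    have hinj : Function.Injective fun j : T => (2 * ((j : ℤ) : k)) := by
      intro a b hab
      have := mul_left_cancel₀ (two_ne_zero (α := k)) hab
      exact Subtype.ext (Int.cast_injective this)
    have := h1.to_subtype
    exact Set.finite_coe_iff.1 (Finite.of_injective (Set.rangeFactorization fun j : T =>
      (2 * ((j : ℤ) : k))) fun a b hab => hinj (congrArg Subtype.val hab))
  obtain ⟨N, hNT, hNmax⟩ := hTfin.exists_maximal hTne
  obtain ⟨v, hv0, χ, hχ, hv, hχN⟩ := hNT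
  have hmax : ∀ j ∈ T, j ≤ N := fun j hj => by
    by_contra hlt
    exact hlt (hNmax hj (le_of_not_ge hlt))
  have hraise : ∀ α : Weight k H s, ∀ z ∈ rootSpace H α, ∀ n : ℤ, 0 < n → α h₀ = 2 * n →
      ⁅z, v⁆ = 0 := by
    intro α z hz n hn hα
    by_contra hne
    have := hmax (N + n) ⟨⁅z, v⁆, hne, χ + α.toLinear, add_mem hχ (toLinear_mem_rootLat H α),
      lie_mem_wvec H hv hz, by
        rw [LinearMap.add_apply, hχN]
        have : Weight.toLinear k H s α h₀ = 2 * n := hα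
        rw [this]; push_cast; ring⟩
    omega
  have hxv : ⁅x, v⁆ = 0 := by
    have h1 : ∀ z ∈ span k {z | ∃ α : Weight k H s, α.IsNonZero ∧ z ∈ rootSpace H α ∧
        α h₀ = 2}, ⁅z, v⁆ = 0 := by
      intro z hz
      induction hz using span_induction with
      | mem z hz =>
        obtain ⟨α, -, hz, h2⟩ := hz
        exact hraise α z hz 1 one_pos (by simpa using h2)
      | zero => simp
      | add a b _ _ ha hb => rw [add_lie, ha, hb, add_zero]
      | smul c a _ ha => rw [smul_lie, ha, smul_zero]
    exact h1 x hxs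
  have hhv : ⁅(h₀ : s), v⁆ = (2 * (N : k)) • v := by rw [hv h₀, hχN]
  -- the lowest weight vector
  obtain ⟨p, hp2, hp0⟩ : ∃ p : ℕ, 2 * (N : k) = 2 * (p : k) ∧ ((toEnd k s W y) ^ (2 * p)) v ≠ 0 := by
    by_cases hN : N = 0
    · exact ⟨0, by simp [hN], by simpa using hv0⟩
    · have ht : IsSl2Triple (h₀ : s) x y := by
        refine ⟨fun h => ?_, hxy, by rw [hx, two_smul, two_smul], by rw [hy, two_smul, two_smul]⟩
        rw [h, zero_lie, eq_comm, smul_eq_zero] at hhv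
        rcases hhv with h | h
        · exact hN (by simpa using h)
        · exact hv0 h
      have hprim : ht.HasPrimitiveVectorWith v (2 * (N : k)) := ⟨hv0, hhv, hxv⟩
      obtain ⟨n, hn⟩ := hprim.exists_nat
      have h2 : 2 * N = n := by exact_mod_cast hn
      refine ⟨N.toNat, ?_, hprim.pow_toEnd_f_ne_zero_of_eq_nat hn (by omega)⟩
      have : ((N.toNat : ℤ) : k) = (N : k) := congrArg _ (by omega)
      rw [← this, Int.cast_natCast]
  set u := ((toEnd k s W y) ^ (2 * p)) v with hu
  have hhu : ⁅(h₀ : s), u⁆ = -(2 * (N : k)) • u := by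
    have h1 : ∀ n : ℕ, ⁅(h₀ : s), ((toEnd k s W y) ^ n) v⁆ =
        (2 * (N : k) - 2 * n) • ((toEnd k s W y) ^ n) v := by
      intro n
      induction n with
      | zero => simpa using hhv
      | succ n ih =>
        rw [pow_succ', End.mul_apply, toEnd_apply_apply, leibniz_lie, ih, hy, lie_smul,
          neg_lie, smul_lie]
        push_cast
        module
    rw [hu, h1, hp2]
    push_cast
    congr 1
    ring
  have huv : ω u v = 0 := by
    have h1 : ∀ n : ℕ, ∀ a b, ω (((toEnd k s W y) ^ n) a) b =
        (-1) ^ n * ω a (((toEnd k s W y) ^ n) b) := by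
      intro n
      induction n with
      | zero => simp
      | succ n ih =>
        intro a b
        rw [pow_succ', End.mul_apply, toEnd_apply_apply, hinv, ih, pow_succ,
          ← pow_succ' (toEnd k s W y), pow_succ (toEnd k s W y), End.mul_apply,
          toEnd_apply_apply]
        ring
    have h2 := h1 (2 * p) v v
    have h4 : (-1 : k) ^ (2 * p) = 1 := by rw [pow_mul, neg_one_sq, one_pow]
    rw [h4, one_mul, ← hu, hskew v u] at h2
    have h3 : (2 : k) * ω u v = 0 := by linear_combination h2
    exact (mul_eq_zero.1 h3).resolve_left two_ne_zero
  -- the subspace generated from `v` by lowering operators is everything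
  let Low : Submodule k W := span k ({v} ∪ {w | ∃ m : ℤ, m < N ∧
    ⁅(h₀ : s), w⁆ = (2 * (m : k)) • w})
  let neg : Set s := {z | ∃ n : ℤ, n < 0 ∧ ⁅(h₀ : s), z⁆ = (2 * (n : k)) • z}
  let D : Submodule k W := sInf {E | v ∈ E ∧ ∀ z ∈ neg, ∀ w ∈ E, ⁅z, w⁆ ∈ E}
  have hDv : v ∈ D := Submodule.mem_sInf.2 fun E hE => hE.1
  have hDneg : ∀ z ∈ neg, ∀ w ∈ D, ⁅z, w⁆ ∈ D := fun z hz w hw =>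
    Submodule.mem_sInf.2 fun E hE => hE.2 z hz w (Submodule.mem_sInf.1 hw E hE)
  have hDstable : ∀ w ∈ D, w ∈ D ∧ ∀ z : s, ⁅z, w⁆ ∈ D := by
    let D' : Submodule k W :=
      { carrier := {w | w ∈ D ∧ ∀ z : s, ⁅z, w⁆ ∈ D}
        add_mem' := by
          rintro a b ⟨ha, ha'⟩ ⟨hb, hb'⟩
          exact ⟨add_mem ha hb, fun z => by rw [lie_add]; exact add_mem (ha' z) (hb' z)⟩
        zero_mem' := ⟨zero_mem _, fun z => by simp⟩
        smul_mem' := by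
          rintro c a ⟨ha, ha'⟩
          exact ⟨D.smul_mem c ha, fun z => by rw [lie_smul]; exact D.smul_mem c (ha' z)⟩ }
    have : D ≤ D' := by
      refine sInf_le ⟨⟨hDv, fun z => ?_⟩, ?_⟩
      · let Dv : Submodule k s :=
          { carrier := {z | ⁅z, v⁆ ∈ D}
            add_mem' := by intro a b ha hb; simpa only [Set.mem_setOf_eq, add_lie] using add_mem ha hb
            zero_mem' := by simp
            smul_mem' := by
              intro c a ha
              simpa only [Set.mem_setOf_eq, smul_lie] using smul_mem _ c ha }
        refine forall_of_rootSpace H (D := Dv) ?_ z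
        intro α z hz
        show ⁅z, v⁆ ∈ D
        by_cases hα : α.IsNonZero
        · obtain ⟨n, hn0, hn⟩ := hroot α hα
          rcases lt_or_gt_of_ne hn0 with h | h
          · refine hDneg z ⟨n, h, ?_⟩ v hDv
            rw [← hn]
            exact lie_eq_smul_of_mem_rootSpace hz h₀
          · rw [hraise α z hz n h hn]
            exact zero_mem _
        · rw [Weight.IsNonZero, not_not] at hα
          rw [hα.eq, LieAlgebra.rootSpace_zero_eq] at hz
          have := hv ⟨z, hz⟩
          rw [show ⁅z, v⁆ = χ ⟨z, hz⟩ • v from this]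
          exact D.smul_mem _ hDv
      · rintro z hz w ⟨hw, hw'⟩
        refine ⟨hDneg z hz w hw, fun t => ?_⟩
        rw [leibniz_lie]
        exact add_mem (hw' _) (hDneg z hz _ (hw' t))
    exact this
  have hDtop : D = ⊤ := by
    let DL : LieSubmodule k s W := { D with lie_mem := fun {z w} hw => (hDstable w hw).2 z }
    have := eq_top_of_irreducible DL (w := v) hDv hv0
    exact congrArg LieSubmodule.toSubmodule this
  have hDLow : D ≤ Low := by
    refine sInf_le ⟨subset_span (Or.inl rfl), ?_⟩
    rintro z ⟨n, hn, hz⟩ w hw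
    have hkey : ∀ w : W, ∀ m : ℤ, m ≤ N → ⁅(h₀ : s), w⁆ = (2 * (m : k)) • w → ⁅z, w⁆ ∈ Low := by
      intro w m hm hw
      refine subset_span (Or.inr ⟨n + m, by omega, ?_⟩)
      rw [leibniz_lie, hz, hw, smul_lie, lie_smul]
      push_cast
      module
    induction hw using span_induction with
    | mem w hw =>
      rcases hw with rfl | ⟨m, hm, hw⟩
      · exact hkey _ N le_rfl hhv
      · exact hkey w m hm.le hw
    | zero => simp
    | add a b _ _ ha hb => rw [lie_add]; exact add_mem ha hb
    | smul c a _ ha => rw [lie_smul]; exact smul_mem _ c ha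
  have hperp : ∀ w, ω u w = 0 := by
    intro w
    have hw : w ∈ Low := hDLow (hDtop ▸ Submodule.mem_top)
    induction hw using span_induction with
    | mem w hw =>
      rcases hw with rfl | ⟨m, hm, hw⟩
      · exact huv
      · have h1 := hinv h₀ u w
        rw [hhu, hw, map_smul, map_smul, LinearMap.smul_apply, smul_eq_mul, smul_eq_mul] at h1
        have h2 : (2 * ((m : k) - N)) * ω u w = 0 := by linear_combination h1
        refine (mul_eq_zero.1 h2).resolve_left (mul_ne_zero two_ne_zero (sub_ne_zero.2 ?_))
        exact fun h => hm.ne (Int.cast_injective h)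
    | zero => simp
    | add a b _ _ ha hb => rw [map_add, ha, hb, add_zero]
    | smul c a _ ha => rw [map_smul, ha, smul_zero]
  let Rad : LieSubmodule k s W :=
    { LinearMap.ker ω with
      lie_mem := by
        intro z w hw
        have hw' : ω w = 0 := hw
        refine LinearMap.ext fun t => ?_
        rw [hinv, hw']
        simp }
  have hRad := eq_top_of_irreducible Rad (w := u) (LinearMap.ext hperp) hp0
  refine LinearMap.ext fun w => ?_
  have : w ∈ Rad := hRad ▸ LieSubmodule.mem_top w
  exact this

lemma exists_cosetPart_eq_top : ∃ χ₀, cosetPart H W χ₀ = ⊤ := by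
  have := LieModule.nontrivial_of_isIrreducible k s W
  obtain ⟨χ, hχ⟩ : ∃ χ : Dual k H, Nontrivial (weightSpace W χ) :=
    exists_nontrivial_weightSpace_of_isSolvable k H W
  obtain ⟨⟨w, hw⟩, hne⟩ := exists_ne (0 : weightSpace W χ)
  refine ⟨χ, eq_top_of_irreducible _ (w := w) (subset_span ⟨χ, by simp, ?_⟩)
    fun h => hne (Subtype.ext h)⟩
  intro z
  exact (mem_weightSpace (M := W) χ w).1 hw z

/-- An irreducible module with a nonzero invariant alternating form has no weights in the root
lattice. -/
theorem exists_coset_of_form (ω : W →ₗ[k] W →ₗ[k] k) (hskew : ∀ v w, ω v w = -ω w v)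
    (hinv : ∀ x : s, ∀ v w, ω ⁅x, v⁆ w = -ω v ⁅x, w⁆) (h0 : ω ≠ 0) :
    span k {w : W | ∃ χ ∉ rootLat H, w ∈ wvec H W χ} = ⊤ := by
  obtain ⟨χ₀, h⟩ := exists_cosetPart_eq_top (W := W) H
  have hχ₀ : χ₀ ∉ rootLat H := by
    intro hmem
    refine h0 (form_eq_zero_of_weights H ω hskew hinv ?_)
    rw [← h]
    ext w
    have : ∀ χ, χ - 0 ∈ rootLat H ↔ χ - χ₀ ∈ rootLat H := fun χ => by
      rw [sub_zero]
      exact ⟨fun h => sub_mem h hmem, fun h => by simpa using add_mem h hmem⟩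
    simp only [cosetPart, this]
  have h1 := congrArg LieSubmodule.toSubmodule h
  rw [eq_top_iff, ← LieSubmodule.top_toSubmodule (R := k) (L := s), ← h1]
  refine span_mono ?_
  rintro w ⟨χ, hχ, hw⟩
  exact ⟨χ, fun hmem => hχ₀ (by simpa using sub_mem hmem hχ), hw⟩

end Weights

end Semisimple

section Transfer

variable {k L s : Type*} [Field k] [IsAlgClosed k] [CharZero k] [LieRing L] [LieAlgebra k L]
  [FiniteDimensional k L] [LieRing s] [LieAlgebra k s] [FiniteDimensional k s]

lemma derivedSeriesOfIdeal_comap_le (π : L →ₗ⁅k⁆ s) (I : LieIdeal k s) (n : ℕ) :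
    derivedSeriesOfIdeal k L n (I.comap π) ≤ (derivedSeriesOfIdeal k s n I).comap π := by
  induction n with
  | zero => exact le_rfl
  | succ n ih =>
    rw [derivedSeriesOfIdeal_succ, derivedSeriesOfIdeal_succ]
    exact (LieSubmodule.mono_lie ih ih).trans (LieIdeal.comap_bracket_le π)

instance hasTrivialRadical_quotient : HasTrivialRadical k (L ⧸ radical k L) := by
  refine ⟨eq_bot_iff.2 fun z hz => ?_⟩
  let π : L →ₗ⁅k⁆ (L ⧸ radical k L) :=
    { (mk' (radical k L) : L →ₗ[k] (L ⧸ radical k L)) with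
      map_lie' := rfl }
  set J := (radical k (L ⧸ radical k L)).comap π with hJ
  have hπ : ∀ x, π x = LieSubmodule.Quotient.mk x := fun _ => rfl
  obtain ⟨n, hn⟩ := IsSolvable.solvable k (radical k (L ⧸ radical k L))
  rw [LieIdeal.derivedSeries_eq_bot_iff] at hn
  have h1 : derivedSeriesOfIdeal k L n J ≤ radical k L := by
    intro x hx
    have := derivedSeriesOfIdeal_comap_le π _ n hx
    rw [hn] at this
    exact LieSubmodule.Quotient.mk_eq_zero'.1 this
  obtain ⟨m, hm⟩ := IsSolvable.solvable k (radical k L)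
  rw [LieIdeal.derivedSeries_eq_bot_iff] at hm
  have h2 : derivedSeriesOfIdeal k L (m + n) J = ⊥ := by
    rw [derivedSeriesOfIdeal_add, eq_bot_iff, ← hm]
    exact derivedSeriesOfIdeal_mono h1 m
  rw [← LieIdeal.derivedSeries_eq_bot_iff] at h2
  have h3 : J ≤ radical k L := (LieIdeal.solvable_iff_le_radical k L J).1 (IsSolvable.mk h2)
  obtain ⟨x, rfl⟩ := surjective_mk' _ z
  have : x ∈ J := hz
  exact LieSubmodule.Quotient.mk_eq_zero'.2 (h3 this)

variable (π : L →ₗ⁅k⁆ s) (H : LieSubalgebra k L) [H.IsCartanSubalgebra]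

/-- The image of a subalgebra. -/
abbrev img : LieSubalgebra k s := (π.comp H.incl).range

/-- The projection onto the image of a subalgebra. -/
abbrev toImg : H →ₗ⁅k⁆ img π H := (π.comp H.incl).rangeRestrict

instance img_nilpotent : LieRing.IsNilpotent (img π H) :=
  LieHom.isNilpotent_range (π.comp H.incl)

lemma map_pow_toEnd (y : H) (c : k) (n : ℕ) (x : L) :
    π (((toEnd k H L y - c • (1 : End k L)) ^ n) x) =
      ((toEnd k (img π H) s (toImg π H y) - c • (1 : End k s)) ^ n) (π x) := by
  induction n generalizing x with
  | zero => rfl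
  | succ n ih =>
    rw [pow_succ, pow_succ, End.mul_apply, End.mul_apply, ih]
    congr 1
    simp only [LinearMap.sub_apply, toEnd_apply_apply, LinearMap.smul_apply, End.one_apply,
      map_sub, map_smul]
    congr 1
    exact π.map_lie y x

lemma map_mem_rootSpace (χ : img π H → k) {x : L} (hx : x ∈ rootSpace H (fun y => χ (toImg π H y))) :
    π x ∈ rootSpace (img π H) χ := by
  rw [mem_genWeightSpace] at hx ⊢
  intro z
  obtain ⟨y, rfl⟩ := LieHom.surjective_rangeRestrict (π.comp H.incl) z
  obtain ⟨n, hn⟩ := hx y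
  refine ⟨n, ?_⟩
  have := map_pow_toEnd π H y (χ (toImg π H y)) n x
  refine Eq.trans this.symm ?_
  exact (congrArg π hn).trans π.map_zero

lemma exists_factor {μ : H → k} {x : L} (hx : x ∈ rootSpace H μ) (h0 : π x ≠ 0) :
    ∃ χ : img π H → k, μ = fun y => χ (toImg π H y) := by
  have key : ∀ y y' : H, toImg π H y = toImg π H y' → μ y = μ y' := by
    intro y y' h
    by_contra hne
    rw [mem_genWeightSpace] at hx
    have h1 : ∀ y : H, π x ∈ (toEnd k (img π H) s (toImg π H y)).maxGenEigenspace (μ y) := by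
      intro y
      obtain ⟨n, hn⟩ := hx y
      rw [End.mem_maxGenEigenspace]
      refine ⟨n, ?_⟩
      have := map_pow_toEnd π H y (μ y) n x
      rw [← this]
      exact (congrArg π hn).trans π.map_zero
    have h2 := h1 y'
    rw [← h] at h2
    have := (End.disjoint_genEigenspace (toEnd k (img π H) s (toImg π H y)) hne ⊤ ⊤)
    exact h0 ((Submodule.disjoint_def.1 this) _ (h1 y) h2)
  refine ⟨fun z => μ (Function.surjInv (LieHom.surjective_rangeRestrict (π.comp H.incl)) z), ?_⟩
  funext y
  exact key _ _ (Function.surjInv_eq _ _).symm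

variable (hπ : Function.Surjective π)

lemma exists_lift_rootSpace (hπ : Function.Surjective π) (χ : img π H → k) {z : s}
    (hz : z ∈ rootSpace (img π H) χ) : ∃ x ∈ rootSpace H (fun y => χ (toImg π H y)), π x = z := by
  let A : (img π H → k) → Submodule k s := fun χ =>
    (rootSpace H (fun y => χ (toImg π H y))).toSubmodule.map (π : L →ₗ[k] s)
  let B : (img π H → k) → Submodule k s := fun χ => (rootSpace (img π H) χ).toSubmodule
  have hAB : ∀ χ, A χ ≤ B χ := by
    rintro χ _ ⟨x, hx, rfl⟩
    exact map_mem_rootSpace π H χ hx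
  have hB : iSupIndep B := by
    have := iSupIndep_genWeightSpace k (img π H) s
    exact LieSubmodule.iSupIndep_toSubmodule.2 this
  have hA : ⨆ χ, A χ = ⊤ := by
    rw [eq_top_iff]
    rintro z -
    obtain ⟨x, rfl⟩ := hπ z
    have h1 : (⨆ α : Weight k H L, (rootSpace H α).toSubmodule) ≤
        (⨆ χ, A χ).comap (π : L →ₗ[k] s) := by
      refine iSup_le fun α x hx => ?_
      by_cases h0 : π x = 0
      · show π x ∈ ⨆ χ, A χ
        rw [h0]; exact zero_mem _
      · obtain ⟨χ, hχ⟩ := exists_factor π H hx h0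
        refine mem_iSup_of_mem χ ⟨x, ?_, rfl⟩
        show x ∈ rootSpace H _
        rw [← hχ]; exact hx
    apply h1
    rw [← LieSubmodule.iSup_toSubmodule, iSup_genWeightSpace_eq_top' k H L]
    trivial
  have hle : B χ ≤ A χ := by
    have h1 : B χ ≤ A χ ⊔ ⨆ (ν) (_ : ν ≠ χ), B ν := by
      refine le_top.trans (hA ▸ iSup_le fun ν => ?_)
      by_cases h : ν = χ
      · exact h ▸ le_sup_left
      · exact (hAB ν).trans ((le_iSup₂ (f := fun ν (_ : ν ≠ χ) => B ν) ν h).trans le_sup_right)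
    have h2 := (hB χ).eq_bot
    calc B χ ≤ (A χ ⊔ ⨆ (ν) (_ : ν ≠ χ), B ν) ⊓ B χ := le_inf h1 le_rfl
      _ = A χ ⊔ (⨆ (ν) (_ : ν ≠ χ), B ν) ⊓ B χ := (sup_inf_assoc_of_le _ (hAB χ))
      _ = A χ := by rw [inf_comm, h2, sup_bot_eq]
  obtain ⟨x, hx, h⟩ := hle hz
  exact ⟨x, hx, h⟩

lemma img_isCartan (hπ : Function.Surjective π) : (img π H).IsCartanSubalgebra := by
  rw [← zeroRootSubalgebra_eq_iff_is_cartan]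
  refine le_antisymm (fun z hz => ?_) (le_zeroRootSubalgebra k s (img π H))
  obtain ⟨x, hx, rfl⟩ := exists_lift_rootSpace π H hπ 0 (z := z) hz
  have hx' : x ∈ rootSpace H (0 : H → k) := hx
  rw [rootSpace_zero_eq] at hx'
  exact ⟨⟨x, hx'⟩, rfl⟩

/-- Weight vectors modulo the kernel of a surjection onto a semisimple Lie algebra, for an
irreducible module on which the kernel acts trivially and which carries an invariant form. -/
lemma span_wvec_eq_top_of_form [IsKilling k s] (hπ : Function.Surjective π) (H' : LieSubalgebra k s)
    [H'.IsCartanSubalgebra] {W : Type*} [AddCommGroup W] [Module k W] [LieRingModule L W]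
    [LieModule k L W] [FiniteDimensional k W] (hirr : LieModule.IsIrreducible k L W)
    (htriv : ∀ x : L, π x = 0 → ∀ w : W, ⁅x, w⁆ = 0) (ω : W →ₗ[k] W →ₗ[k] k)
    (hskew : ∀ v w, ω v w = -ω w v) (hinv : ∀ x : L, ∀ v w, ω ⁅x, v⁆ w = -ω v ⁅x, w⁆) (h0 : ω ≠ 0) :
    span k {w : W | ∃ χ ∉ rootLat H', ∀ (x : L) (hx : π x ∈ H'), ⁅x, w⁆ = χ ⟨π x, hx⟩ • w}
      = ⊤ := by
  obtain ⟨σ, hσ⟩ := LinearMap.exists_rightInverse_of_surjective (π : L →ₗ[k] s)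
    (LinearMap.range_eq_top.2 hπ)
  have hσ' : ∀ z, π (σ z) = z := fun z => LinearMap.congr_fun hσ z
  have hact : ∀ x y : L, π x = π y → ∀ w : W, ⁅x, w⁆ = ⁅y, w⁆ := by
    intro x y h w
    rw [← sub_eq_zero, ← sub_lie]
    exact htriv _ (by rw [map_sub, h, sub_self]) w
  letI : LieRingModule s W :=
    { bracket := fun z w => ⁅σ z, w⁆
      add_lie := fun a b w => by
        show ⁅σ (a + b), w⁆ = _
        rw [map_add, add_lie]
      lie_add := fun a v w => lie_add _ _ _
      leibniz_lie := fun a b w => by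
        show ⁅σ a, ⁅σ b, w⁆⁆ = ⁅σ ⁅a, b⁆, w⁆ + ⁅σ b, ⁅σ a, w⁆⁆
        rw [leibniz_lie, hact (σ ⁅a, b⁆) ⁅σ a, σ b⁆ (by rw [π.map_lie, hσ', hσ', hσ'])] }
  have hbr : ∀ (z : s) (w : W), ⁅z, w⁆ = ⁅σ z, w⁆ := fun _ _ => rfl
  haveI : LieModule k s W :=
    { smul_lie := fun c z w => by rw [hbr, hbr, map_smul, smul_lie]
      lie_smul := fun c z w => by rw [hbr, hbr, lie_smul] }
  haveI : Nontrivial W := LieModule.nontrivial_of_isIrreducible k L W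
  haveI : LieModule.IsIrreducible k s W := by
    refine LieModule.IsIrreducible.mk fun N hN => ?_
    let N' : LieSubmodule k L W :=
      { N.toSubmodule with
        lie_mem := fun {x w} hw => by
          have h1 : ⁅π x, w⁆ ∈ N := N.lie_mem hw
          rw [hbr, hact (σ (π x)) x (hσ' _)] at h1
          exact h1 }
    have hN' : N' ≠ ⊥ := by
      intro h
      apply hN
      rw [LieSubmodule.eq_bot_iff] at h ⊢
      exact h
    have h2 : N' = ⊤ := (IsSimpleOrder.eq_bot_or_eq_top N').resolve_left hN'
    rw [eq_top_iff]
    intro w _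
    have : w ∈ N' := h2 ▸ LieSubmodule.mem_top w
    exact this
  have key := exists_coset_of_form H' ω hskew (fun x v w => hinv (σ x) v w) h0
  rw [← key]
  congr 1
  ext w
  refine exists_congr fun χ => and_congr_right fun _ => ⟨fun h z => ?_, fun h x hx => ?_⟩
  · have := h (σ (z : s)) (by rw [hσ']; exact z.2)
    rw [hbr, this]
    congr 2
    exact Subtype.ext (hσ' _)
  · have := h ⟨π x, hx⟩
    rw [hbr, hact _ x (hσ' _)] at this
    exact this

end Transfer

section Structure

variable {k L : Type*} [Field k] [IsAlgClosed k] [CharZero k] [LieRing L] [LieAlgebra k L]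
  [FiniteDimensional k L]

/-- The projection to the quotient by the radical. -/
def radQuot (k L : Type*) [Field k] [IsAlgClosed k] [CharZero k] [LieRing L] [LieAlgebra k L]
    [FiniteDimensional k L] : L →ₗ⁅k⁆ (L ⧸ radical k L) :=
  { (mk' (radical k L) : L →ₗ[k] (L ⧸ radical k L)) with
    map_lie' := rfl }

lemma radQuot_surjective : Function.Surjective (radQuot k L) :=
  surjective_mk' _

lemma radQuot_eq_zero {x : L} : radQuot k L x = 0 ↔ x ∈ radical k L :=
  LieSubmodule.Quotient.mk_eq_zero'

variable (H : LieSubalgebra k L) [H.IsCartanSubalgebra]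

instance : (img (radQuot k L) H).IsCartanSubalgebra := img_isCartan _ H radQuot_surjective

/-- Elements of the radical which are, modulo the center, weight vectors whose weight is not in
the root lattice. -/
def offLattice : Set L := {a | a ∈ radical k L ∧ ∃ χ ∉ rootLat (img (radQuot k L) H),
  ∀ y : H, ⁅(y : L), a⁆ - χ (toImg (radQuot k L) H y) • a ∈ center k L}

lemma minimal_le_span_offLattice (hred : AbelianCentral k L) {A : LieIdeal k L}
    (hr : A ≤ radical k L) (hlt : center k L < A) (hmin : ∀ B, center k L < B → B ≤ A → B = A) :
    A.toSubmodule ≤ span k (offLattice H ∪ (center k L : Set L)) := by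
  obtain ⟨a, ha, b, hb, hab⟩ : ∃ a ∈ A, ∃ b ∈ A, ⁅a, b⁆ ≠ 0 := by
    by_contra! hcon
    exact not_le_of_gt hlt (abelian_le_center hred hcon)
  have hc : ∀ x ∈ radical k L, ∀ y ∈ radical k L, ⁅x, y⁆ ∈ center k L := fun x hx y hy =>
    lie_radical_mem_center hred hx hy
  let N : LieSubmodule k L A := LieSubmodule.comap (LieSubmodule.incl A) (center k L)
  have hN : ∀ x : A, (LieSubmodule.Quotient.mk x : A ⧸ N) = 0 ↔ (x : L) ∈ center k L :=
    fun x => LieSubmodule.Quotient.mk_eq_zero' (N := N)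
  have hsurj := surjective_mk' N
  obtain ⟨φ, hφ⟩ : ∃ φ : Dual k L, φ ⁅a, b⁆ ≠ 0 := by
    by_contra! h
    exact hab ((Module.forall_dual_apply_eq_zero_iff k _).1 h)
  obtain ⟨σ, hσ⟩ := LinearMap.exists_rightInverse_of_surjective
    (mk' N : A →ₗ[k] (A ⧸ N)) (LinearMap.range_eq_top.2 hsurj)
  have hσ' : ∀ x : A, ((σ (mk' N x) : A) : L) - x ∈ center k L := by
    intro x
    have h1 := LinearMap.congr_fun hσ (mk' N x)
    have h2 : mk' N (σ (mk' N x) - x) = 0 := by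
      rw [map_sub, sub_eq_zero]; exact h1
    exact (hN _).1 h2
  let ω : (A ⧸ N) →ₗ[k] (A ⧸ N) →ₗ[k] k := LinearMap.mk₂ k
    (fun v w => φ ⁅((σ v : A) : L), ((σ w : A) : L)⁆)
    (fun v v' w => by
      rw [map_add]
      show φ ⁅((σ v : A) : L) + ((σ v' : A) : L), _⁆ = _
      rw [add_lie, map_add])
    (fun c v w => by
      rw [map_smul]
      show φ ⁅c • ((σ v : A) : L), _⁆ = _
      rw [smul_lie, map_smul])
    (fun v w w' => by
      rw [map_add]
      show φ ⁅_, ((σ w : A) : L) + ((σ w' : A) : L)⁆ = _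
      rw [lie_add, map_add])
    (fun c v w => by
      rw [map_smul]
      show φ ⁅_, c • ((σ w : A) : L)⁆ = _
      rw [lie_smul, map_smul])
  have hω : ∀ x y : A, ω (mk' N x) (mk' N y) =
      φ ⁅(x : L), (y : L)⁆ := by
    intro x y
    show φ ⁅((σ (mk' N x) : A) : L),
      ((σ (mk' N y) : A) : L)⁆ = _
    congr 1
    have e1 := center_lie (hσ' x) ((σ (mk' N y) : A) : L)
    have e2 := lie_center (hσ' y) (x : L)
    rw [sub_lie, sub_eq_zero] at e1
    rw [lie_sub, sub_eq_zero] at e2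
    rw [e1, e2]
  have hbr : ∀ (x : L) (y : A), ⁅x, mk' N y⁆ =
      mk' N ⁅x, y⁆ := fun x y => rfl
  haveI : Nontrivial (A ⧸ N) := by
    refine ⟨⟨mk' N ⟨a, ha⟩, 0, fun h => hab ?_⟩⟩
    exact center_lie ((hN _).1 h) b
  have hirr : LieModule.IsIrreducible k L (A ⧸ N) := by
    refine LieModule.IsIrreducible.mk fun N' hN' => ?_
    let B : LieIdeal k L := (N'.comap (mk' N)).map (LieSubmodule.incl A)
    have hB : ∀ x : A, (x : L) ∈ B ↔ mk' N x ∈ N' := by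
      intro x
      constructor
      · intro hx
        obtain ⟨y, hy, hyx⟩ := LieSubmodule.mem_map _ |>.1 hx
        have : y = x := Subtype.ext hyx
        rw [← this]; exact hy
      · intro hx
        exact LieSubmodule.mem_map _ |>.2 ⟨x, hx, rfl⟩
    have hBA : B ≤ A := by
      intro x hx
      obtain ⟨y, -, hyx⟩ := LieSubmodule.mem_map _ |>.1 hx
      rw [← hyx]; exact y.2
    have hZB : center k L ≤ B := fun z hz => by
      refine (hB ⟨z, hlt.le hz⟩).2 ?_
      have : mk' N ⟨z, hlt.le hz⟩ = 0 := (hN _).2 hz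
      rw [this]; exact zero_mem _
    have hZB' : center k L < B := by
      refine lt_of_le_of_ne hZB fun h => hN' ?_
      rw [LieSubmodule.eq_bot_iff]
      intro v hv
      obtain ⟨x, hxv⟩ := hsurj v
      rw [← hxv] at hv ⊢
      have := (hB x).2 hv
      rw [← h] at this
      exact (hN x).2 this
    have hBA' := hmin B hZB' hBA
    rw [eq_top_iff]
    intro v hv
    obtain ⟨x, hxv⟩ := hsurj v
    rw [← hxv]
    exact (hB x).1 (hBA'.ge x.2)
  have key := span_wvec_eq_top_of_form (radQuot k L) radQuot_surjective (img (radQuot k L) H)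
    (W := A ⧸ N) hirr
    (fun x hx w => by
      obtain ⟨y, rfl⟩ := hsurj w
      rw [hbr]
      exact (hN _).2 (hc x (radQuot_eq_zero.1 hx) y (hr y.2)))
    ω
    (fun v w => by
      obtain ⟨x, rfl⟩ := hsurj v
      obtain ⟨y, rfl⟩ := hsurj w
      rw [hω, hω, ← lie_skew, map_neg])
    (fun t v w => by
      obtain ⟨x, rfl⟩ := hsurj v
      obtain ⟨y, rfl⟩ := hsurj w
      rw [hbr, hbr, hω, hω, eq_neg_iff_add_eq_zero, ← map_add]
      have := lie_center (hc x (hr x.2) y (hr y.2)) t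
      rw [leibniz_lie] at this
      exact (congrArg φ this).trans (map_zero φ))
    (fun h => hφ (by
      have := hω ⟨a, ha⟩ ⟨b, hb⟩
      rw [h] at this
      exact this.symm))
  intro x hx
  set Q := span k (offLattice H ∪ (center k L : Set L)) with hQ
  have h1 : (⊤ : Submodule k (A ⧸ N)) ≤
      (Q.comap A.toSubmodule.subtype).map (mk' N : A →ₗ[k] (A ⧸ N)) := by
    rw [← key, span_le]
    rintro w ⟨χ, hχ, hw⟩
    obtain ⟨y, rfl⟩ := hsurj w
    refine ⟨y, subset_span (Or.inl ⟨hr y.2, χ, hχ, fun z => ?_⟩), rfl⟩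
    have h2 := hw z ⟨z, rfl⟩
    rw [hbr, ← sub_eq_zero, ← map_smul, ← map_sub] at h2
    exact (hN _).1 h2
  obtain ⟨y, hy, hyx⟩ := h1 (Submodule.mem_top (x := mk' N ⟨x, hx⟩))
  have h3 : mk' N (⟨x, hx⟩ - y) = 0 := by
    rw [map_sub, sub_eq_zero]; exact hyx.symm
  have h4 : x - y ∈ center k L := (hN _).1 h3
  have h5 : x = (x - y) + y := by abel
  rw [h5]
  exact add_mem (subset_span (Or.inr h4)) hy

lemma mem_center_of_commute_offLattice (hred : AbelianCentral k L) {x : L} (hx : x ∈ radical k L)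
    (hc : ∀ a ∈ offLattice H, ⁅x, a⁆ = 0) : x ∈ center k L := by
  let P : LieIdeal k L → Prop := fun A =>
    A ≤ radical k L ∧ center k L < A ∧ ∀ B, center k L < B → B ≤ A → B = A
  let C : LieIdeal k L := sInf {J | J = radical k L ∨ ∃ A, P A ∧ J = trans A (radical k L) ⊥}
  have hCr : C ≤ radical k L := sInf_le (Or.inl rfl)
  have hC : ∀ A, P A → C ≤ trans A (radical k L) ⊥ := fun A hA => sInf_le (Or.inr ⟨A, hA, rfl⟩)
  have hZC : center k L ≤ C := by
    refine le_sInf ?_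
    rintro J (rfl | ⟨A, hA, rfl⟩)
    · exact center_le_radical k L
    · exact fun z hz => ⟨center_le_radical k L hz, fun a _ => by
        rw [lie_center hz]; exact zero_mem _⟩
  have hCZ : C ≤ center k L := by
    by_contra hcon
    obtain ⟨A, h1, h2, h3⟩ := exists_minimal (lt_of_le_not_ge hZC hcon)
    refine not_le_of_gt h1 (abelian_le_center hred fun a ha b hb => ?_)
    have := (hC A ⟨h2.trans hCr, h1, h3⟩ (h2 hb)).2 a ha
    simpa using this
  apply hCZ
  rw [← SetLike.mem_coe, LieSubmodule.coe_sInf, Set.mem_iInter₂]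
  rintro J (rfl | ⟨A, hA, rfl⟩)
  · exact hx
  · refine ⟨hx, fun a ha => ?_⟩
    have h1 := minimal_le_span_offLattice H hred hA.1 hA.2.1 hA.2.2 ha
    have h2 : ⁅a, x⁆ = 0 := by
      clear ha
      induction h1 using span_induction with
      | mem a ha =>
        rcases ha with ha | ha
        · rw [← lie_skew, hc a ha, neg_zero]
        · exact center_lie ha x
      | zero => simp
      | add a b _ _ ha hb => rw [add_lie, ha, hb, add_zero]
      | smul c a _ ha => rw [smul_lie, ha, smul_zero]
    rw [h2]; exact zero_mem _

lemma sub_smul_one_apply (y : H) (c : k) (x : L) :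
    (toEnd k H L y - c • (1 : End k L)) x = ⁅(y : L), x⁆ - c • x := rfl

lemma lie_pow_offLattice (hred : AbelianCentral k L) {x a : L} (hx : x ∈ radical k L)
    (ha : a ∈ radical k L) (y : H) (c d : k) (hd : ⁅(y : L), a⁆ - d • a ∈ center k L) (n : ℕ) :
    ⁅((toEnd k H L y - c • (1 : End k L)) ^ n) x, a⁆ = (-(d + c)) ^ n • ⁅x, a⁆ ∧
      ((toEnd k H L y - c • (1 : End k L)) ^ n) x ∈ radical k L := by
  induction n with
  | zero => simpa using hx
  | succ n ih =>
    obtain ⟨h1, h2⟩ := ih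
    rw [pow_succ', End.mul_apply]
    set z := ((toEnd k H L y - c • (1 : End k L)) ^ n) x
    rw [sub_smul_one_apply]
    refine ⟨?_, sub_mem (lie_mem_right k L _ _ _ h2) (smul_mem _ c h2)⟩
    have e1 : ⁅(y : L), ⁅z, a⁆⁆ = 0 := lie_center (lie_radical_mem_center hred h2 ha) _
    have e2 : ⁅z, ⁅(y : L), a⁆ - d • a⁆ = 0 := lie_center hd z
    rw [lie_sub, lie_smul, sub_eq_zero] at e2
    rw [leibniz_lie, e2] at e1
    rw [sub_lie, smul_lie, eq_neg_of_add_eq_zero_left e1, h1, pow_succ', mul_smul]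
    module

lemma pow_smul_lie_eq_zero (hred : AbelianCentral k L) {x a : L} {μ : H → k} (hx : x ∈ radical k L)
    (hμ : x ∈ rootSpace H μ) (ha : a ∈ radical k L) (y : H) (d : k)
    (hd : ⁅(y : L), a⁆ - d • a ∈ center k L) : d + μ y = 0 ∨ ⁅x, a⁆ = 0 := by
  obtain ⟨n, hn⟩ := (mem_genWeightSpace L μ x).1 hμ y
  have := (lie_pow_offLattice H hred hx ha y (μ y) d hd n).1
  rw [hn, zero_lie] at this
  rcases smul_eq_zero.1 this.symm with h | h
  · exact Or.inl (neg_eq_zero.1 (pow_eq_zero_iff_of_pos_or h))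
  · exact Or.inr h
where
  pow_eq_zero_iff_of_pos_or {c : k} {n : ℕ} (h : c ^ n = 0) : c = 0 := by
    rcases Nat.eq_zero_or_pos n with rfl | hn
    · simp at h
    · exact (pow_eq_zero_iff hn.ne').1 h

lemma lie_sub_smul_mem_center (hred : AbelianCentral k L) {x : L} {μ : H → k} (hx : x ∈ radical k L)
    (hμ : x ∈ rootSpace H μ) (y : H) : ⁅(y : L), x⁆ - μ y • x ∈ center k L := by
  have hz : ⁅(y : L), x⁆ - μ y • x ∈ radical k L :=
    sub_mem (lie_mem_right k L _ _ _ hx) (smul_mem _ _ hx)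
  refine mem_center_of_commute_offLattice H hred hz ?_
  rintro a ⟨ha, χ, -, hχ⟩
  have := (lie_pow_offLattice H hred hx ha y (μ y) _ (hχ y) 1).1
  rw [pow_one, pow_one, sub_smul_one_apply] at this
  rw [this]
  rcases pow_smul_lie_eq_zero H hred hx hμ ha y _ (hχ y) with h | h
  · rw [h, neg_zero, zero_smul]
  · rw [h, smul_zero]

lemma toImg_surjective : Function.Surjective (toImg (radQuot k L) H) :=
  LieHom.surjective_rangeRestrict _

lemma mem_center_of_rootLat (hred : AbelianCentral k L) {x : L} {ν : Dual k (img (radQuot k L) H)}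
    (hν : ν ∈ rootLat (img (radQuot k L) H)) (hx : x ∈ radical k L)
    (hμ : x ∈ rootSpace H (fun y => ν (toImg (radQuot k L) H y))) : x ∈ center k L := by
  refine mem_center_of_commute_offLattice H hred hx ?_
  rintro a ⟨ha, χ, hχ, hχ'⟩
  by_contra hne
  apply hχ
  have : χ = -ν := by
    ext y
    obtain ⟨y, rfl⟩ := toImg_surjective H y
    exact eq_neg_of_add_eq_zero_left
      ((pow_smul_lie_eq_zero H hred hx hμ ha y _ (hχ' y)).resolve_right hne)
  rw [this]
  exact neg_mem hν

lemma center_le_rootSpace_zero {x : L} (hx : x ∈ center k L) : x ∈ rootSpace H (0 : H → k) :=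
  (mem_genWeightSpace L _ x).2 fun y => ⟨1, by
    rw [pow_one, Pi.zero_apply, sub_smul_one_apply, lie_center hx]; simp⟩

lemma lie_sub_smul_mem_rootSpace {μ : H → k} {x : L} (hx : x ∈ rootSpace H μ) (y : H) :
    ⁅(y : L), x⁆ - μ y • x ∈ rootSpace H μ :=
  sub_mem (LieSubmodule.lie_mem (rootSpace H μ) (x := y) hx) (smul_mem _ _ hx)

lemma lie_eq_smul_of_sub_mem_center {μ : H → k} (h0 : μ ≠ 0) {x : L} (hx : x ∈ rootSpace H μ)
    (y : H) (hc : ⁅(y : L), x⁆ - μ y • x ∈ center k L) : ⁅(y : L), x⁆ = μ y • x := by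
  rw [← sub_eq_zero]
  have hd : Disjoint (rootSpace H μ) (rootSpace H (0 : H → k)) := disjoint_genWeightSpace k H L h0
  exact (LieSubmodule.mem_bot _).1 (hd.le_bot
    ⟨lie_sub_smul_mem_rootSpace H hx y, center_le_rootSpace_zero H hc⟩)

lemma lie_eq_smul_of_weight (hred : AbelianCentral k L)
    (α : Weight k (img (radQuot k L) H) (L ⧸ radical k L)) (hα : α.IsNonZero) {x : L}
    (hx : x ∈ rootSpace H (fun y => α (toImg (radQuot k L) H y))) (y : H) :
    ⁅(y : L), x⁆ = α (toImg (radQuot k L) H y) • x := by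
  have h0 : (fun y => α (toImg (radQuot k L) H y)) ≠ (0 : H → k) := by
    intro h
    apply hα
    funext z
    obtain ⟨z, rfl⟩ := toImg_surjective H z
    exact congrFun h z
  refine lie_eq_smul_of_sub_mem_center H h0 hx y ?_
  have hmem := lie_sub_smul_mem_rootSpace H hx y
  refine mem_center_of_rootLat H hred (toLinear_mem_rootLat _ α) ?_ hmem
  rw [← radQuot_eq_zero, map_sub, map_smul, LieHom.map_lie, sub_eq_zero]
  have := lie_eq_smul_of_mem_rootSpace (map_mem_rootSpace (radQuot k L) H _ hx)
    (toImg (radQuot k L) H y)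
  exact this

lemma cartan_lie_eq_zero (hred : AbelianCentral k L) {x y : L} (hx : x ∈ H) (hy : y ∈ H) :
    ⁅x, y⁆ = 0 := by
  have hH : ∀ {z : L}, z ∈ rootSpace H (0 : H → k) → z ∈ radical k L → z ∈ center k L :=
    fun hz hz' => mem_center_of_rootLat H hred (zero_mem (rootLat (img (radQuot k L) H))) hz' hz
  have hy0 : y ∈ rootSpace H (0 : H → k) := by rw [rootSpace_zero_eq]; exact hy
  have key : ∀ z : img (radQuot k L) H, ∃ w ∈ rootSpace H (0 : H → k),
      radQuot k L w = z ∧ ⁅x, w⁆ = 0 := by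
    intro z
    have hz : (cartanEquivDual _ z : Dual k (img (radQuot k L) H)) ∈
        span k (Weight.toLinear k _ (L ⧸ radical k L) '' {α | α.IsNonZero}) := by
      rw [span_weight_isNonZero_eq_top]; trivial
    have hz' : ∀ φ ∈ span k (Weight.toLinear k (img (radQuot k L) H)
        (L ⧸ radical k L) '' {α | α.IsNonZero}), ∃ w ∈ rootSpace H (0 : H → k),
      radQuot k L w = ((cartanEquivDual (img (radQuot k L) H)).symm φ : L ⧸ radical k L) ∧
        ⁅x, w⁆ = 0 := by
      intro φ hφ
      induction hφ using span_induction with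
      | zero => exact ⟨0, zero_mem _, by simp, by simp⟩
      | add a b _ _ ha hb =>
        obtain ⟨w, h1, h2, h3⟩ := ha
        obtain ⟨w', h1', h2', h3'⟩ := hb
        exact ⟨w + w', add_mem h1 h1', by rw [map_add, map_add, h2, h2']; rfl,
          by rw [lie_add, h3, h3', add_zero]⟩
      | smul c a _ ha =>
        obtain ⟨w, h1, h2, h3⟩ := ha
        exact ⟨c • w, smul_mem _ c h1, by rw [map_smul, map_smul, h2]; rfl,
          by rw [lie_smul, h3, smul_zero]⟩
      | mem φ hφ =>
        obtain ⟨α, hα, rfl⟩ := hφ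
        have h1 := cartanEquivDual_symm_apply_mem_corootSpace α
        rw [mem_corootSpace] at h1
        generalize (((cartanEquivDual (img (radQuot k L) H)).symm
          (Weight.toLinear k _ (L ⧸ radical k L) α) : _) : L ⧸ radical k L) = t at h1
        induction h1 using span_induction with
        | zero => exact ⟨0, zero_mem _, by simp, by simp⟩
        | add a b _ _ ha hb =>
          obtain ⟨w, h1, h2, h3⟩ := ha
          obtain ⟨w', h1', h2', h3'⟩ := hb
          exact ⟨w + w', add_mem h1 h1', by rw [map_add, h2, h2'],
            by rw [lie_add, h3, h3', add_zero]⟩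
        | smul c a _ ha =>
          obtain ⟨w, h1, h2, h3⟩ := ha
          exact ⟨c • w, smul_mem _ c h1, by rw [map_smul, h2],
            by rw [lie_smul, h3, smul_zero]⟩
        | mem t ht =>
          obtain ⟨e, he, f, hf, rfl⟩ := ht
          obtain ⟨e', he', rfl⟩ := exists_lift_rootSpace (radQuot k L) H radQuot_surjective _ he
          obtain ⟨f', hf', rfl⟩ := exists_lift_rootSpace (radQuot k L) H radQuot_surjective _ hf
          refine ⟨⁅e', f'⁆, ?_, LieHom.map_lie _ _ _, ?_⟩
          · have := lie_mem_genWeightSpace_of_mem_genWeightSpace he' hf'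
            convert this using 2
            funext y
            simp
          · have e1 := lie_eq_smul_of_weight H hred α hα he' ⟨x, hx⟩
            have e2 := lie_eq_smul_of_weight H hred (-α) (by
              intro h; apply hα
              have h' : (-(α : img (radQuot k L) H → k)) = 0 := by
                rw [← Weight.coe_neg]; exact h
              exact neg_eq_zero.1 h') (x := f') (by rw [Weight.coe_neg]; exact hf') ⟨x, hx⟩
            rw [Weight.coe_neg, Pi.neg_apply] at e2
            simp only at e1 e2
            rw [leibniz_lie, e1, e2, smul_lie, lie_smul, neg_smul, add_neg_cancel]
    obtain ⟨w, h1, h2, h3⟩ := hz' _ hz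
    exact ⟨w, h1, by rw [h2, LinearEquiv.symm_apply_apply], h3⟩
  obtain ⟨w, h1, h2, h3⟩ := key (toImg (radQuot k L) H ⟨y, hy⟩)
  have h4 : y - w ∈ center k L := by
    refine hH (sub_mem hy0 h1) ?_
    rw [← radQuot_eq_zero, map_sub, h2, sub_eq_zero]
    rfl
  have h5 := lie_center h4 x
  rwa [lie_sub, h3, sub_zero] at h5

/-- In a reductive Lie algebra, a Cartan subalgebra acts diagonalizably. -/
lemma span_eigenvectors (hred : AbelianCentral k L) :
    span k {x : L | ∃ χ : Dual k H, ∀ y : H, ⁅(y : L), x⁆ = χ y • x} = ⊤ := by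
  have h1 := congrArg LieSubmodule.toSubmodule (iSup_genWeightSpace_eq_top' k H L)
  rw [LieSubmodule.iSup_toSubmodule, LieSubmodule.top_toSubmodule] at h1
  rw [eq_top_iff, ← h1]
  refine iSup_le fun μ x hx => subset_span ⟨μ.toLinear, fun y => ?_⟩
  change _ = μ y • x
  have hx' : x ∈ rootSpace H μ := hx
  by_cases h0 : (μ : H → k) = 0
  · rw [h0, rootSpace_zero_eq] at hx'
    rw [h0, Pi.zero_apply, zero_smul]
    exact cartan_lie_eq_zero H hred y.2 hx'
  · by_cases hr : x ∈ radical k L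
    · exact lie_eq_smul_of_sub_mem_center H h0 hx' y (lie_sub_smul_mem_center H hred hr hx' y)
    · have hr' : radQuot k L x ≠ 0 := fun h => hr (radQuot_eq_zero.1 h)
      obtain ⟨χ, hχ⟩ := exists_factor (radQuot k L) H hx' hr'
      have hw : radQuot k L x ∈ rootSpace (img (radQuot k L) H) χ := by
        refine map_mem_rootSpace (radQuot k L) H χ ?_
        rw [← hχ]; exact hx'
      let α : Weight k (img (radQuot k L) H) (L ⧸ radical k L) :=
        ⟨χ, fun h => hr' ((LieSubmodule.mem_bot _).1 (h.le hw))⟩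
      have hα : α.IsNonZero := by
        intro h
        apply h0
        rw [hχ]
        funext y
        exact congrFun h _
      have := lie_eq_smul_of_weight H hred α hα (x := x) (by
        show x ∈ rootSpace H (fun y => χ (toImg (radQuot k L) H y))
        rw [← hχ]; exact hx') y
      rw [this, hχ]
      rfl

end Structure

section Diagonalizable

variable {k V : Type*} [Field k] [AddCommGroup V] [Module k V]

lemma apply_eq_zero_of_apply_apply (f : End k V) (hf : span k {x | ∃ c : k, f x = c • x} = ⊤)
    {x : V} (hx : f (f x) = 0) : f x = 0 := by
  let W : Submodule k V := ⨆ (c : k) (_ : c ≠ 0), f.eigenspace c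
  have hd : Disjoint (f.eigenspace 0) W := f.eigenspaces_iSupIndep 0
  have hW : ∀ w ∈ W, f w ∈ W := by
    intro w hw
    have : W ≤ W.comap f := iSup₂_le fun c hc w hw => by
      show f w ∈ W
      rw [End.mem_eigenspace_iff.1 hw]
      exact W.smul_mem _ (mem_iSup_of_mem c (mem_iSup_of_mem hc hw))
    exact this hw
  have htop : (⊤ : Submodule k V) ≤ f.eigenspace 0 ⊔ W := by
    rw [← hf, span_le]
    rintro y ⟨c, hc⟩
    rcases eq_or_ne c 0 with rfl | h0
    · exact Submodule.mem_sup_left (End.mem_eigenspace_iff.2 hc)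
    · exact Submodule.mem_sup_right (mem_iSup_of_mem c
        (mem_iSup_of_mem h0 (End.mem_eigenspace_iff.2 hc)))
  obtain ⟨a, ha, w, hw, rfl⟩ := Submodule.mem_sup.1 (htop (Submodule.mem_top (x := x)))
  have h1 : f (a + w) = f w := by
    rw [map_add, End.mem_eigenspace_iff.1 ha, zero_smul, zero_add]
  rw [h1] at hx ⊢
  have h2 : f w ∈ f.eigenspace 0 := End.mem_eigenspace_iff.2 (by rw [hx, zero_smul])
  exact (Submodule.mem_bot k).1 (hd.le_bot ⟨h2, hW w hw⟩)

end Diagonalizable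

section Toral

variable {k L : Type*} [Field k] [IsAlgClosed k] [CharZero k] [LieRing L] [LieAlgebra k L]
  [FiniteDimensional k L]

/-- Commutative subalgebras acting diagonalizably. -/
def Toral (T : LieSubalgebra k L) : Prop :=
  (∀ x ∈ T, ∀ y ∈ T, ⁅x, y⁆ = 0) ∧
    span k {x : L | ∃ χ : Dual k T, ∀ y : T, ⁅(y : L), x⁆ = χ y • x} = ⊤

/-- The elements commuting with a subalgebra. -/
def commutant (T : LieSubalgebra k L) : LieSubalgebra k L where
  carrier := {x | ∀ y ∈ T, ⁅y, x⁆ = 0}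
  add_mem' ha hb y hy := by rw [lie_add, ha y hy, hb y hy, add_zero]
  zero_mem' y _ := lie_zero y
  smul_mem' c x hx y hy := by rw [lie_smul, hx y hy, smul_zero]
  lie_mem' {a b} ha hb y hy := by
    rw [leibniz_lie, show ⁅y, a⁆ = 0 from ha y hy, show ⁅y, b⁆ = 0 from hb y hy]; simp

lemma Toral.lie_eq_zero {T : LieSubalgebra k L} (hT : Toral T) {t x : L} (ht : t ∈ T)
    (h : ⁅t, ⁅t, x⁆⁆ = 0) : ⁅t, x⁆ = 0 := by
  refine apply_eq_zero_of_apply_apply (ad k L t) ?_ h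
  rw [eq_top_iff, ← hT.2]
  refine span_mono ?_
  rintro y ⟨χ, hχ⟩
  exact ⟨χ ⟨t, ht⟩, hχ ⟨t, ht⟩⟩

/-- A maximal toral subalgebra of a reductive Lie algebra is self-centralizing. -/
lemma mem_of_commute (hred : AbelianCentral k L) {T : LieSubalgebra k L} (hT : Toral T)
    (hmax : ∀ T', Toral T' → T ≤ T' → T' = T) {x : L} (hx : ∀ y ∈ T, ⁅y, x⁆ = 0) : x ∈ T := by
  obtain ⟨c, hc⟩ := exists_isCartanSubalgebra_engel k (commutant T)
  set H'' := LieSubalgebra.engel k c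
  let ψ : H'' →ₗ⁅k⁆ L := (commutant T).incl.comp H''.incl
  have hmem : ∀ z : L, z ∈ ψ.range ↔ ∃ h : z ∈ commutant T, (⟨z, h⟩ : commutant T) ∈ H'' := by
    intro z
    constructor
    · rintro ⟨w, rfl⟩; exact ⟨w.1.2, w.2⟩
    · rintro ⟨h, h'⟩; exact ⟨⟨_, h'⟩, rfl⟩
  have hTC : T ≤ commutant T := fun t ht y hy => hT.1 y hy t ht
  have hTH : T ≤ ψ.range := by
    intro t ht
    refine (hmem t).2 ⟨hTC ht, ?_⟩
    rw [← hc.self_normalizing, LieSubalgebra.mem_normalizer_iff]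
    intro y hy
    have : ⁅(⟨t, hTC ht⟩ : commutant T), y⁆ = 0 := Subtype.ext (y.2 t ht)
    rw [this]; exact zero_mem _
  haveI : ψ.range.IsCartanSubalgebra := by
    refine ⟨LieHom.isNilpotent_range ψ, le_antisymm (fun z hz => ?_) ψ.range.le_normalizer⟩
    rw [LieSubalgebra.mem_normalizer_iff'] at hz
    have hzC : z ∈ commutant T := fun t ht =>
      hT.lie_eq_zero ht (((hmem _).1 (hz t (hTH ht))).1 t ht)
    refine (hmem z).2 ⟨hzC, ?_⟩
    rw [← hc.self_normalizing, LieSubalgebra.mem_normalizer_iff']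
    intro y hy
    exact ((hmem _).1 (hz y ((hmem _).2 ⟨y.2, hy⟩))).2
  have hTor : Toral ψ.range := ⟨fun a ha b hb => cartan_lie_eq_zero ψ.range hred ha hb,
    span_eigenvectors ψ.range hred⟩
  have hEq := hmax _ hTor hTH
  rw [← hEq]
  refine (hmem x).2 ⟨hx, ?_⟩
  rw [← hc.self_normalizing, LieSubalgebra.mem_normalizer_iff']
  intro y hy
  have hyT : (y : L) ∈ T := hEq.le ((hmem _).2 ⟨y.2, hy⟩)
  have : ⁅y, (⟨x, hx⟩ : commutant T)⁆ = 0 := Subtype.ext (hx y hyT)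
  rw [this]; exact zero_mem _

end Toral

end Red

section SetupToral

open Module

variable (S : Setup K g)

lemma Setup.mem_h_of_commute (n : ℕ) {x : g} (hx : x ∈ S.F n) (hc : ∀ y ∈ S.h ⊓ S.F n, ⁅y, x⁆ = 0) :
    x ∈ S.h := by
  haveI := S.F_findim n
  obtain ⟨⟨hle, hab, hdiag⟩, hmax⟩ := S.h_maxToral n
  let i := (S.F n).incl
  let T : LieSubalgebra K (S.F n) := (S.h ⊓ S.F n).comap i
  have hmemT : ∀ y : S.F n, y ∈ T ↔ (y : g) ∈ S.h ⊓ S.F n := fun y => Iff.rfl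
  have hT : Red.Toral T := by
    refine ⟨fun a ha b hb => ?_, ?_⟩
    · have := hab.trivial (⟨a, ha⟩ : (S.h ⊓ S.F n : LieSubalgebra K g)) ⟨b, hb⟩
      exact Subtype.ext (show ⁅(a : g), (b : g)⁆ = 0 from congrArg Subtype.val this)
    · rw [eq_top_iff]
      rintro y -
      have h1 : (⨆ α : Dual K (S.h ⊓ S.F n : LieSubalgebra K g),
          (S.F n).toSubmodule ⊓ adWeightSpace K g (S.h ⊓ S.F n) α) ≤
          (span K {x : S.F n | ∃ χ : Dual K T, ∀ y : T,
            ⁅(y : S.F n), x⁆ = χ y • x}).map (i : S.F n →ₗ[K] g) := by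
        refine iSup_le fun α x hx => ⟨⟨x, hx.1⟩, subset_span ?_, rfl⟩
        let j : T →ₗ[K] (S.h ⊓ S.F n : LieSubalgebra K g) :=
          { toFun := fun y => ⟨y.1.1, y.2⟩
            map_add' := fun _ _ => rfl
            map_smul' := fun _ _ => rfl }
        exact ⟨α.comp j, fun y => Subtype.ext (hx.2 (j y))⟩
      obtain ⟨z, hz, hzy⟩ := h1 (hdiag y.2)
      have : z = y := Subtype.ext hzy
      rwa [← this]
  have hmax' : ∀ T', Red.Toral T' → T ≤ T' → T' = T := by
    intro T' hT' hTT'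
    have hmm : ∀ z : g, z ∈ T'.map i ↔ ∃ h : z ∈ S.F n, (⟨z, h⟩ : S.F n) ∈ T' := by
      intro z
      constructor
      · rintro ⟨w, hw, rfl⟩; exact ⟨w.2, hw⟩
      · rintro ⟨h, h'⟩; exact ⟨_, h', rfl⟩
    have h1 : T'.map i = S.h ⊓ S.F n := by
      refine hmax _ ⟨fun z hz => ((hmm z).1 hz).1, ⟨fun a b => ?_⟩, ?_⟩ ?_
      · obtain ⟨ha, ha'⟩ := (hmm a).1 a.2
        obtain ⟨hb, hb'⟩ := (hmm b).1 b.2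
        exact Subtype.ext (show ⁅(a : g), (b : g)⁆ = 0 from
          congrArg Subtype.val (hT'.1 _ ha' _ hb'))
      · intro z hz
        have h2 : (⟨z, hz⟩ : S.F n) ∈ span K {x : S.F n | ∃ χ : Dual K T',
            ∀ y : T', ⁅(y : S.F n), x⁆ = χ y • x} := by rw [hT'.2]; trivial
        have h3 : span K {x : S.F n | ∃ χ : Dual K T', ∀ y : T',
            ⁅(y : S.F n), x⁆ = χ y • x} ≤ (⨆ α : Dual K (T'.map i),
            (S.F n).toSubmodule ⊓ adWeightSpace K g (T'.map i) α).comap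
              (i : S.F n →ₗ[K] g) := by
          rw [span_le]
          rintro w ⟨χ, hχ⟩
          let j : T'.map i →ₗ[K] T' :=
            { toFun := fun y => ⟨⟨y.1, ((hmm y).1 y.2).1⟩, ((hmm y).1 y.2).2⟩
              map_add' := fun _ _ => rfl
              map_smul' := fun _ _ => rfl }
          refine mem_iSup_of_mem (χ.comp j) ⟨w.2, fun y => ?_⟩
          exact congrArg Subtype.val (hχ (j y))
        exact h3 h2
      · intro z hz
        exact (hmm z).2 ⟨hz.2, hTT' hz⟩
    refine le_antisymm (fun z hz => ?_) hTT'
    rw [hmemT, ← h1]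
    exact ⟨z, hz, rfl⟩
  have := Red.mem_of_commute (S.F_reductive n) hT hmax' (x := ⟨x, hx⟩)
    (fun y hy => Subtype.ext (hc y hy))
  exact this.1

end SetupToral

section Sl2

open Module

variable {V : Type*} [AddCommGroup V] [Module K V]

/-- Operators satisfying the relations of an `sl₂`-triple. -/
structure Sl2Ops (E F H : End K V) : Prop where
  ef : ∀ v, E (F v) = F (E v) + H v
  hf : ∀ v, H (F v) = F (H v) - (2 : K) • F v
  he : ∀ v, H (E v) = E (H v) + (2 : K) • E v

namespace Sl2Ops

variable {E F H : End K V}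

lemma h_pow_f (T : Sl2Ops E F H) {μ : K} {v : V} (hv : H v = μ • v) (n : ℕ) :
    H ((F ^ n) v) = (μ - 2 * n) • (F ^ n) v := by
  induction n with
  | zero => simpa using hv
  | succ n ih =>
    rw [pow_succ', End.mul_apply, T.hf, ih, map_smul]
    push_cast
    module

lemma h_e (T : Sl2Ops E F H) {μ : K} {v : V} (hv : H v = μ • v) : H (E v) = (μ + 2) • E v := by
  rw [T.he, hv, map_smul]; module

lemma h_pow_e (T : Sl2Ops E F H) {μ : K} {v : V} (hv : H v = μ • v) (n : ℕ) :
    H ((E ^ n) v) = (μ + 2 * n) • (E ^ n) v := by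
  induction n with
  | zero => simpa using hv
  | succ n ih =>
    rw [pow_succ', End.mul_apply, T.h_e ih]
    push_cast
    module

lemma e_pow_f (T : Sl2Ops E F H) {μ : K} {v : V} (hv : H v = μ • v) (n : ℕ) :
    E ((F ^ (n + 1)) v) = (F ^ (n + 1)) (E v) + ((n + 1 : K) * (μ - n)) • (F ^ n) v := by
  induction n with
  | zero => simp [T.ef, hv]
  | succ n ih =>
    have h1 : ∀ w, F ((F ^ n) w) = (F ^ (n + 1)) w := fun w => by rw [pow_succ', End.mul_apply]
    rw [pow_succ' F (n + 1), End.mul_apply, End.mul_apply, T.ef, ih, map_add, map_smul,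
      T.h_pow_f hv (n + 1), h1]
    push_cast
    module

lemma swap (T : Sl2Ops E F H) : Sl2Ops F E (-H) where
  ef v := by rw [T.ef]; simp
  hf v := by simp only [LinearMap.neg_apply, map_neg, T.he]; module
  he v := by simp only [LinearMap.neg_apply, map_neg, T.hf]; module

/-- On the `E`-nilpotent vectors of weight `m`, the power `F ^ m` is injective. -/
lemma eq_zero_of_pow_f (T : Sl2Ops E F H) {m : ℕ} {v : V} (hv : H v = (m : K) • v) {k : ℕ}
    (hk : (E ^ k) v = 0) (hf : (F ^ m) v = 0) : v = 0 := by
  induction k generalizing m v with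
  | zero => simpa using hk
  | succ k ih =>
    have h1 : E v = 0 := by
      refine ih (m := m + 2) ?_ ?_ ?_
      · rw [T.h_e hv]; push_cast; rfl
      · rwa [pow_succ, End.mul_apply] at hk
      · have := T.e_pow_f hv m
        rw [pow_succ' F m, End.mul_apply, End.mul_apply, hf, map_zero, map_zero, smul_zero,
          add_zero, ← End.mul_apply, ← pow_succ'] at this
        rw [pow_succ', End.mul_apply, ← this, map_zero]
    have h2 : ∀ j ≤ m, (F ^ (m - j)) v = 0 := by
      intro j
      induction j with
      | zero => simpa using hf
      | succ j ihj =>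
        intro hj
        have h3 := T.e_pow_f hv (m - (j + 1))
        rw [show m - (j + 1) + 1 = m - j by omega, ihj (by omega), h1, map_zero, map_zero,
          zero_add] at h3
        refine (smul_eq_zero.1 h3.symm).resolve_left (mul_ne_zero ?_ ?_)
        · exact_mod_cast Nat.succ_ne_zero (m - (j + 1))
        · rw [sub_ne_zero]
          exact_mod_cast (show m ≠ m - (j + 1) by omega)
    simpa using h2 m le_rfl

lemma pow_f_ne_zero (T : Sl2Ops E F H) {m : ℕ} {v : V} (hv : H v = (m : K) • v) (h0 : v ≠ 0) {k : ℕ}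
    (hk : (E ^ k) v = 0) {i : ℕ} (hi : i ≤ m) : (F ^ i) v ≠ 0 := fun h => h0 <| by
  refine T.eq_zero_of_pow_f hv hk ?_
  rw [← Nat.sub_add_cancel hi, pow_add, End.mul_apply, h, map_zero]

/-- Weights of vectors nilpotent for both operators are integral. -/
lemma exists_int (T : Sl2Ops E F H) {μ : K} {v : V} (hv : H v = μ • v) (h0 : v ≠ 0) {k : ℕ}
    (hk : (E ^ k) v = 0) (hF : ∀ w, ∃ j, (F ^ j) w = 0) : ∃ z : ℤ, μ = z := by
  classical
  have hex : ∃ k, (E ^ k) v = 0 := ⟨k, hk⟩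
  set n := Nat.find hex with hn
  have hn1 : (E ^ n) v = 0 := Nat.find_spec hex
  have hnpos : n ≠ 0 := by
    intro h
    rw [h] at hn1
    exact h0 (by simpa using hn1)
  obtain ⟨p, hp⟩ := Nat.exists_eq_succ_of_ne_zero hnpos
  have hw0 : (E ^ p) v ≠ 0 := Nat.find_min hex (by omega)
  set w := (E ^ p) v
  have hEw : E w = 0 := by
    show E ((E ^ p) v) = 0
    rw [← End.mul_apply, ← pow_succ', ← Nat.succ_eq_add_one, ← hp, hn1]
  have hHw := T.h_pow_e hv p
  set q := Nat.find (hF w)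
  have hq1 : (F ^ q) w = 0 := Nat.find_spec (hF w)
  have hqpos : q ≠ 0 := by
    intro h
    rw [h] at hq1
    exact hw0 (by simpa using hq1)
  obtain ⟨r, hr⟩ := Nat.exists_eq_succ_of_ne_zero hqpos
  have hr0 : (F ^ r) w ≠ 0 := Nat.find_min (hF w) (by omega)
  have h3 := T.e_pow_f hHw r
  rw [← Nat.succ_eq_add_one, ← hr, hq1, hEw, map_zero, map_zero, zero_add] at h3
  have h4 := (smul_eq_zero.1 h3.symm).resolve_right hr0
  have h5 : ((r : K) + 1) ≠ 0 := by exact_mod_cast Nat.succ_ne_zero r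
  have h6 := (mul_eq_zero.1 h4).resolve_left h5
  refine ⟨r - 2 * p, ?_⟩
  push_cast
  linear_combination h6

/-- Highest weight vectors of negative weight vanish. -/
lemma eq_zero_of_neg (T : Sl2Ops E F H) {m : ℕ} {v : V} (hv : H v = -((m : K) + 1) • v)
    (hE : E v = 0) {k : ℕ} (hk : (F ^ k) v = 0) : v = 0 := by
  refine T.swap.eq_zero_of_pow_f (m := m + 1) (k := k) ?_ hk ?_
  · rw [LinearMap.neg_apply, hv]; push_cast; module
  · rw [pow_succ, End.mul_apply, hE, map_zero]

/-- A highest weight vector of weight `m` is killed by `F ^ (m + 1)`. -/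
lemma pow_f_eq_zero (T : Sl2Ops E F H) {m : ℕ} {v : V} (hv : H v = (m : K) • v) (hE : E v = 0)
    {k : ℕ} (hk : (F ^ k) v = 0) : (F ^ (m + 1)) v = 0 := by
  refine T.eq_zero_of_neg (m := m + 1) (k := k) ?_ ?_ ?_
  · rw [T.h_pow_f hv]; push_cast; congr 1; ring
  · rw [T.e_pow_f hv m, hE]; simp
  · rw [← End.mul_apply, ← pow_add, add_comm, pow_add, End.mul_apply, hk, map_zero]

lemma weight_of_e_eq_zero (T : Sl2Ops E F H) {μ : K} {v : V} (hv : H v = μ • v) (h0 : v ≠ 0)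
    (hE : E v = 0) (hF : ∀ w, ∃ j, (F ^ j) w = 0) : ∃ m : ℕ, μ = m := by
  obtain ⟨z, hz⟩ := T.exists_int (k := 1) hv h0 (by simpa using hE) hF
  rcases Int.eq_nat_or_neg z with ⟨m, rfl | rfl⟩
  · exact ⟨m, by simpa using hz⟩
  · rcases m with _ | m
    · exact ⟨0, by simpa using hz⟩
    · obtain ⟨k, hk⟩ := hF v
      refine absurd (T.eq_zero_of_neg (m := m) ?_ hE hk) h0
      rw [hv, hz]; push_cast; rfl

lemma e_ne_zero (T : Sl2Ops E F H) {μ : K} {x y : V} (hx : H x = μ • x) (hx0 : x ≠ 0)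
    (hy : H y = (μ + 2) • y) (hy0 : y ≠ 0) {t : K} (hyx : F y = t • x)
    (hE : ∀ w, ∃ j, (E ^ j) w = 0) (hF : ∀ w, ∃ j, (F ^ j) w = 0) : E x ≠ 0 := by
  intro hEx
  obtain ⟨m, rfl⟩ := T.weight_of_e_eq_zero hx hx0 hEx hF
  obtain ⟨j, hj⟩ := hE y
  obtain ⟨k, hk⟩ := hF x
  refine T.pow_f_ne_zero (m := m + 2) (by rw [hy]; push_cast; rfl) hy0 hj le_rfl ?_
  rw [pow_succ, End.mul_apply, hyx, map_smul, T.pow_f_eq_zero hx hEx hk, smul_zero]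

end Sl2Ops

lemma eq_zero_of_commutator [FiniteDimensional K V] {X Y U : End K V}
    (hU : ∀ v, U v = X (Y v) - Y (X v)) (hX : ∀ v, U (X v) = X (U v)) (hY : ∀ v, U (Y v) = Y (U v))
    (hd : span K {x | ∃ c : K, U x = c • x} = ⊤) : U = 0 := by
  have key : ∀ c : K, c ≠ 0 → U.eigenspace c = ⊥ := by
    intro c hc
    have hX' : ∀ v ∈ U.eigenspace c, X v ∈ U.eigenspace c := fun v hv => by
      rw [End.mem_eigenspace_iff] at hv ⊢
      rw [hX, hv, map_smul]
    have hY' : ∀ v ∈ U.eigenspace c, Y v ∈ U.eigenspace c := fun v hv => by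
      rw [End.mem_eigenspace_iff] at hv ⊢
      rw [hY, hv, map_smul]
    have h1 : (X.restrict hX') * (Y.restrict hY') - (Y.restrict hY') * (X.restrict hX') =
        c • (1 : End K (U.eigenspace c)) := by
      ext v
      have h2 := End.mem_eigenspace_iff.1 v.2
      rw [hU] at h2
      exact h2
    have h3 := congrArg (LinearMap.trace K _) h1
    rw [map_sub, LinearMap.trace_mul_comm, sub_self, map_smul, LinearMap.trace_one,
      smul_eq_mul] at h3
    have h4 := (mul_eq_zero.1 h3.symm).resolve_left hc
    exact Submodule.finrank_eq_zero.1 (by exact_mod_cast h4)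
  have h5 : (⊤ : Submodule K V) ≤ LinearMap.ker U := by
    rw [← hd, span_le]
    rintro x ⟨c, hx⟩
    by_cases hc : c = 0
    · rw [hc, zero_smul] at hx; exact hx
    · have h6 : x ∈ U.eigenspace c := End.mem_eigenspace_iff.2 hx
      rw [key c hc, Submodule.mem_bot] at h6
      rw [h6]; exact zero_mem _
  ext v
  exact h5 (Submodule.mem_top (x := v))

end Sl2

namespace Setup

open Module LieAlgebra

variable {S : Setup K g} {α γ : Dual K S.h} {x : g}

variable (S) in
/-- The weight spaces with respect to `h`. -/
abbrev wt (α : Dual K S.h) : Submodule K g := adWeightSpace K g S.h α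

lemma lie_of_mem_wt (hx : x ∈ S.wt α) (H : S.h) : ⁅(H : g), x⁆ = α H • x := hx H

lemma lie_of_mem_wt' (hx : x ∈ S.wt α) (H : S.h) :
    ⁅x, (H : g)⁆ = -(α H • x) := by rw [← lie_skew, hx H]

lemma lie_mem_wt {α β : Dual K S.h} {x y : g} (hx : x ∈ S.wt α) (hy : y ∈ S.wt β) :
    ⁅x, y⁆ ∈ S.wt (α + β) := fun H => by
  rw [leibniz_lie, hx H, hy H, smul_lie, lie_smul, LinearMap.add_apply, add_smul]

lemma wt_disjoint {α β : Dual K S.h} (h : α ≠ β) (hx : x ∈ S.wt α) (hy : x ∈ S.wt β) : x = 0 := by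
  obtain ⟨H, hH⟩ : ∃ H, α H ≠ β H := by
    by_contra! hc
    exact h (LinearMap.ext hc)
  have h1 := hx H
  rw [hy H, ← sub_eq_zero, ← sub_smul] at h1
  exact (smul_eq_zero.1 h1).resolve_left (sub_ne_zero.2 hH.symm)

variable (S) in
lemma exists_mem_F (s : Finset g) (N : ℕ) : ∃ n, N ≤ n ∧ ∀ x ∈ s, x ∈ S.F n := by
  classical
  induction s using Finset.induction_on with
  | empty => exact ⟨N, le_rfl, by simp⟩
  | insert a s _ ih =>
    obtain ⟨n, hn, h⟩ := ih
    obtain ⟨m, hm⟩ := S.F_exhaust a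
    refine ⟨max n m, hn.trans (le_max_left _ _), fun x hx => ?_⟩
    rcases Finset.mem_insert.1 hx with rfl | hx
    · exact S.F_mono (le_max_right _ _) hm
    · exact S.F_mono (le_max_left _ _) (h x hx)

lemma lie_h {x y : g} (hx : x ∈ S.h) (hy : y ∈ S.h) : ⁅x, y⁆ = 0 := by
  classical
  obtain ⟨n, -, hn⟩ := S.exists_mem_F {x, y} 0
  have := (S.h_maxToral n).1.2.1.trivial
    (⟨x, hx, hn x (by simp)⟩ : (S.h ⊓ S.F n : LieSubalgebra K g)) ⟨y, hy, hn y (by simp)⟩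
  exact congrArg Subtype.val this

lemma mem_wt_zero : x ∈ S.wt 0 ↔ x ∈ S.h := by
  constructor
  · intro hx
    obtain ⟨n, hn⟩ := S.F_exhaust x
    refine S.mem_h_of_commute n hn fun y hy => ?_
    have := hx ⟨y, hy.1⟩
    simpa using this
  · intro hx H
    rw [lie_h H.2 hx]; simp

variable (S) in
lemma exists_sum (x : g) : ∃ (s : Finset (Dual K S.h)) (f : Dual K S.h → g),
    (∀ α, f α ∈ S.wt α) ∧ ∑ α ∈ s, f α = x := by
  have hx : x ∈ ⨆ α, S.wt α := by rw [S.h_span]; trivial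
  obtain ⟨f, hf, hs⟩ := (Submodule.mem_iSup_iff_exists_finsupp _ _).1 hx
  exact ⟨f.support, f, hf, hs⟩

/-- A subspace stable under `h` contains the weight components of its elements. -/
lemma component_mem {P : Submodule K g} (hP : ∀ H : S.h, ∀ x ∈ P, ⁅(H : g), x⁆ ∈ P)
    (s : Finset (Dual K S.h)) (f : Dual K S.h → g) (hf : ∀ α, f α ∈ S.wt α) (hs : ∑ α ∈ s, f α ∈ P)
    (hα : α ∈ s) : f α ∈ P := by
  classical
  induction s using Finset.induction_on generalizing f α with
  | empty => simp at hα
  | insert β s hβ ih =>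
    have key : ∀ γ ∈ s, f γ ∈ P := by
      intro γ hγ
      obtain ⟨H, hH⟩ : ∃ H, γ H ≠ β H := by
        by_contra! hc
        have : γ = β := LinearMap.ext hc
        exact hβ (this ▸ hγ)
      have h1 := ih (fun δ => (δ H - β H) • f δ) (fun δ => smul_mem _ _ (hf δ)) (by
        have h2 := P.sub_mem (hP H _ hs) (P.smul_mem (β H) hs)
        rw [Finset.sum_insert hβ, lie_add, hf β H, smul_add, add_sub_add_left_eq_sub,
          lie_sum, smul_sum, ← sum_sub_distrib] at h2
        refine (congrArg (· ∈ P) (sum_congr rfl fun δ _ => ?_)).mp h2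
        rw [hf δ H, sub_smul]) hγ
      exact (P.smul_mem_iff (sub_ne_zero.2 hH)).1 h1
    rcases Finset.mem_insert.1 hα with rfl | h
    · rw [Finset.sum_insert hβ] at hs
      exact (P.add_mem_iff_left (P.sum_mem key)).1 hs
    · exact key α h

lemma ad_h_diag (H : S.h) : span K {x : g | ∃ c : K, ad K g (H : g) x = c • x} = ⊤ := by
  rw [eq_top_iff, ← S.h_span]
  exact iSup_le fun α x hx => subset_span ⟨α H, hx H⟩

lemma ad_h_eq_zero {w : g} (hw : w ∈ S.h) (hx : ⁅w, ⁅w, x⁆⁆ = 0) : ⁅w, x⁆ = 0 :=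
  Red.apply_eq_zero_of_apply_apply (ad K g w) (ad_h_diag ⟨w, hw⟩) hx

lemma mem_h_of_central {z : g} (hz : ∀ x : g, ⁅z, x⁆ = 0) : z ∈ S.h :=
  mem_wt_zero.1 fun H => by rw [← lie_skew, hz]; simp

variable (S) in
/-- The elements lying in the radical of `F n`. -/
def InRad (n : ℕ) (x : g) : Prop := ∃ hx : x ∈ S.F n, (⟨x, hx⟩ : S.F n) ∈ radical K (S.F n)

lemma InRad.mono {m n : ℕ} (h : m ≤ n) (hx : S.InRad n x) (hm : x ∈ S.F m) : S.InRad m x := by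
  haveI := S.F_findim m
  haveI := S.F_findim n
  let i : S.F m →ₗ⁅K⁆ S.F n := LieSubalgebra.inclusion (S.F_mono h)
  obtain ⟨k, hk⟩ := IsSolvable.solvable K (radical K (S.F n))
  rw [LieIdeal.derivedSeries_eq_bot_iff] at hk
  have h1 : derivedSeriesOfIdeal K (S.F m) k ((radical K (S.F n)).comap i) = ⊥ := by
    rw [LieSubmodule.eq_bot_iff]
    intro y hy
    have h2 := Red.derivedSeriesOfIdeal_comap_le i _ k hy
    rw [hk] at h2
    have h3 : i y = 0 := h2
    exact LieSubalgebra.inclusion_injective (S.F_mono h) (h3.trans (map_zero i).symm)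
  rw [← LieIdeal.derivedSeries_eq_bot_iff] at h1
  have h3 := (LieIdeal.solvable_iff_le_radical K _ _).1 (IsSolvable.mk h1)
  exact ⟨hm, h3 (x := ⟨x, hm⟩) hx.2⟩

variable (S) in
/-- The union of the radicals, as a subspace of `g`. -/
def rad : Submodule K g where
  carrier := {x | ∀ n, x ∈ S.F n → S.InRad n x}
  add_mem' := by
    classical
    intro x y hx hy n hn
    obtain ⟨m, hm, h⟩ := S.exists_mem_F {x, y} n
    obtain ⟨hx1, hx2⟩ := hx m (h x (by simp))
    obtain ⟨hy1, hy2⟩ := hy m (h y (by simp))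
    exact InRad.mono hm ⟨add_mem hx1 hy1, add_mem hx2 hy2⟩ hn
  zero_mem' := fun n hn => ⟨hn, zero_mem (radical K (S.F n))⟩
  smul_mem' := by
    intro c x hx n hn
    obtain ⟨m, hm, h⟩ := S.exists_mem_F {x} n
    obtain ⟨hx1, hx2⟩ := hx m (h x (by simp))
    exact InRad.mono hm ⟨(S.F m).smul_mem c hx1, (radical K (S.F m)).smul_mem c hx2⟩ hn

lemma lie_mem_rad (y : g) (hx : x ∈ S.rad) : ⁅y, x⁆ ∈ S.rad := by
  classical
  intro n hn
  obtain ⟨m, hm, h⟩ := S.exists_mem_F {x, y} n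
  have hy := h y (by simp)
  obtain ⟨hx1, hx2⟩ := hx m (h x (by simp))
  exact InRad.mono hm ⟨(S.F m).lie_mem hy hx1,
    LieSubmodule.lie_mem (radical K (S.F m)) (x := (⟨y, hy⟩ : S.F m)) hx2⟩ hn

lemma lie_rad_central {x y : g} (hx : x ∈ S.rad) (hy : y ∈ S.rad) (z : g) : ⁅⁅x, y⁆, z⁆ = 0 := by
  classical
  obtain ⟨m, -, h⟩ := S.exists_mem_F {x, y, z} 0
  haveI := S.F_findim m
  obtain ⟨hx1, hx2⟩ := hx m (h x (by simp))
  obtain ⟨hy1, hy2⟩ := hy m (h y (by simp))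
  have := Red.center_lie (Red.lie_radical_mem_center (S.F_reductive m) hx2 hy2)
    (⟨z, h z (by simp)⟩ : S.F m)
  exact congrArg Subtype.val this

/-- Abelian ideals are central. -/
lemma central_of_abelian (S : Setup K g) {P : Submodule K g} (hP : ∀ y : g, ∀ x ∈ P, ⁅y, x⁆ ∈ P)
    (hab : ∀ x ∈ P, ∀ y ∈ P, ⁅x, y⁆ = 0) (hx : x ∈ P) (z : g) : ⁅x, z⁆ = 0 := by
  classical
  obtain ⟨m, -, h⟩ := S.exists_mem_F {x, z} 0
  haveI := S.F_findim m
  let I : LieIdeal K (S.F m) :=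
    { P.comap (S.F m).toSubmodule.subtype with
      lie_mem := fun {a b} hb => hP a b hb }
  have hI := Red.abelian_le_center (S.F_reductive m) (I := I)
    (fun a ha b hb => Subtype.ext (hab a ha b hb))
  have := Red.center_lie (hI (x := ⟨x, h x (by simp)⟩) hx) (⟨z, h z (by simp)⟩ : S.F m)
  exact congrArg Subtype.val this

lemma rad_h_central {w : g} (hw : w ∈ S.rad) (hh : w ∈ S.h) (x : g) : ⁅w, x⁆ = 0 := by
  have h1 : ⁅w, ⁅w, ⁅w, x⁆⁆⁆ = 0 := by
    have h2 : ⁅w, x⁆ ∈ S.rad := by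
      rw [← lie_skew]; exact neg_mem (lie_mem_rad x hw)
    rw [← lie_skew, lie_rad_central hw h2, neg_zero]
  exact ad_h_eq_zero hh (ad_h_eq_zero hh h1)

lemma zero_notMem_pos : (0 : Dual K S.h) ∉ S.pos := fun h => (S.pos_root 0 h).1 rfl

lemma isRoot_of_mem (h0 : γ ≠ 0) (hx : x ∈ S.wt γ) (hx0 : x ≠ 0) :
    IsRootOf K g S.h γ := ⟨h0, fun h => hx0 ((Submodule.mem_bot K).1 (h ▸ hx))⟩

lemma add_notMem_pos {γ δ : Dual K S.h} (hγ : γ ∉ S.pos) (hδ : δ ∉ S.pos) {x y : g}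
    (hx : x ∈ S.wt γ) (hy : y ∈ S.wt δ) (hx0 : x ≠ 0) (hy0 : y ≠ 0) : γ + δ ∉ S.pos := by
  by_cases h1 : γ = 0
  · rwa [h1, zero_add]
  by_cases h2 : δ = 0
  · rwa [h2, add_zero]
  intro h
  exact S.neg_add γ δ (isRoot_of_mem h1 hx hx0) (isRoot_of_mem h2 hy hy0) hγ hδ (S.pos_root _ h) h

lemma neg_mem_pos (hγ : γ ∉ S.pos) (h0 : γ ≠ 0) (hx : x ∈ S.wt γ) (hx0 : x ≠ 0) : -γ ∈ S.pos := by
  by_contra h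
  exact hγ ((S.pos_polar γ (isRoot_of_mem h0 hx hx0)).2 h)

lemma neg_notMem_pos (hγ : γ ∈ S.pos) : -γ ∉ S.pos :=
  (S.pos_polar γ (S.pos_root γ hγ)).1 hγ

lemma add_notMem_pos_of_simple {β γ : Dual K S.h} (hβ : S.IsSimpleRoot β) (h : -γ ∈ S.pos) :
    β + γ ∉ S.pos := by
  intro h'
  refine hβ.2 ⟨{β + γ, -γ}, by simp, ?_, ?_⟩
  · intro δ hδ
    simp at hδ
    rcases hδ with rfl | rfl <;> assumption
  · simp

/-- Induction principle: a subalgebra containing `h`, the simple root spaces, and the negative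
root spaces is everything. -/
lemma subalgebra_eq_top (hD : S.IsDynkin) (Q : LieSubalgebra K g) (h0 : S.h ≤ Q)
    (hs : ∀ β, S.IsSimpleRoot β → S.wt β ≤ Q.toSubmodule) (hn : ∀ γ ∉ S.pos, S.wt γ ≤ Q.toSubmodule)
    (x : g) : x ∈ Q := by
  have hb : S.b ≤ Q := by
    rw [hD, LieSubalgebra.lieSpan_le]
    refine Set.union_subset h0 (Set.iUnion₂_subset fun β hβ => hs β hβ)
  have hp : ∀ α ∈ S.pos, S.wt α ≤ Q.toSubmodule := fun α hα x hx => hb (by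
    show x ∈ S.b.toSubmodule
    rw [S.b_eq]
    exact Submodule.mem_sup_right (mem_iSup_of_mem α (mem_iSup_of_mem hα hx)))
  have : (⊤ : Submodule K g) ≤ Q.toSubmodule := by
    rw [← S.h_span]
    refine iSup_le fun α => ?_
    by_cases h : α ∈ S.pos
    · exact hp α h
    · exact hn α h
  exact this trivial

lemma rad_nonpos_central (hD : S.IsDynkin) (hγ : γ ∉ S.pos) (hx : x ∈ S.rad) (hxγ : x ∈ S.wt γ)
    (z : g) : ⁅x, z⁆ = 0 := by
  let P : Submodule K g := span K {x | x ∈ S.rad ∧ ∃ γ ∉ S.pos, x ∈ S.wt γ}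
  let Q : LieSubalgebra K g :=
    { carrier := {y | ∀ x ∈ P, ⁅y, x⁆ ∈ P}
      add_mem' := fun ha hb x hx => by rw [add_lie]; exact add_mem (ha x hx) (hb x hx)
      zero_mem' := fun x _ => by rw [zero_lie]; exact zero_mem _
      smul_mem' := fun c a ha x hx => by rw [smul_lie]; exact P.smul_mem c (ha x hx)
      lie_mem' := fun {a b} ha hb x hx => by
        rw [lie_lie]; exact sub_mem (ha _ (hb x hx)) (hb _ (ha x hx)) }
  have hQ : ∀ y, (∀ x ∈ S.rad, ∀ γ ∉ S.pos, x ∈ S.wt γ → ⁅y, x⁆ ∈ P) → y ∈ Q := by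
    intro y hy x hx
    induction hx using span_induction with
    | mem x hx => obtain ⟨h1, γ, h2, h3⟩ := hx; exact hy x h1 γ h2 h3
    | zero => rw [lie_zero]; exact zero_mem _
    | add a b _ _ ha hb => rw [lie_add]; exact add_mem ha hb
    | smul c a _ ha => rw [lie_smul]; exact P.smul_mem c ha
  have hmem : ∀ {x γ}, x ∈ S.rad → γ ∉ S.pos → x ∈ S.wt γ → x ∈ P :=
    fun h1 h2 h3 => subset_span ⟨h1, _, h2, h3⟩
  have hneg : ∀ γ ∉ S.pos, S.wt γ ≤ Q.toSubmodule := fun δ hδ y hy => hQ y fun x hx γ hγ hxγ => by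
    by_cases hx0 : x = 0
    · rw [hx0, lie_zero]; exact zero_mem _
    by_cases hy0 : y = 0
    · rw [hy0, zero_lie]; exact zero_mem _
    exact hmem (lie_mem_rad y hx) (add_notMem_pos hδ hγ hy hxγ hy0 hx0) (lie_mem_wt hy hxγ)
  have htop := subalgebra_eq_top hD Q
    (fun y hy => hneg 0 zero_notMem_pos (mem_wt_zero.2 hy))
    (fun β hβ y hy => hQ y fun x hx γ hγ hxγ => by
      by_cases hx0 : x = 0
      · rw [hx0, lie_zero]; exact zero_mem _
      by_cases h0 : γ = 0
      · rw [h0, mem_wt_zero] at hxγ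
        rw [← lie_skew, rad_h_central hx hxγ, neg_zero]; exact zero_mem _
      exact hmem (lie_mem_rad y hx) (add_notMem_pos_of_simple hβ (neg_mem_pos hγ h0 hxγ hx0))
        (lie_mem_wt hy hxγ))
    hneg
  refine central_of_abelian S (P := P) (fun y => htop y) ?_ (hmem hx hγ hxγ) z
  intro a ha b hb
  induction ha using span_induction with
  | zero => rw [zero_lie]
  | add a b _ _ ha hb => rw [add_lie, ha, hb, add_zero]
  | smul c a _ ha => rw [smul_lie, ha, smul_zero]
  | mem a ha =>
    induction hb using span_induction with
    | zero => rw [lie_zero]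
    | add a b _ _ ha hb => rw [lie_add, ha, hb, add_zero]
    | smul c a _ ha => rw [lie_smul, ha, smul_zero]
    | mem b hb =>
      obtain ⟨ha, γ, hγ, haγ⟩ := ha
      obtain ⟨hb, δ, hδ, hbδ⟩ := hb
      by_contra hne
      have h0 : γ + δ = 0 := by
        by_contra h
        exact hne (wt_disjoint h (lie_mem_wt haγ hbδ)
          (mem_wt_zero.2 (mem_h_of_central (lie_rad_central ha hb))))
      by_cases h1 : γ = 0
      · rw [h1, mem_wt_zero] at haγ
        exact hne (rad_h_central ha haγ b)
      · have ha0 : a ≠ 0 := by rintro rfl; exact hne (zero_lie b)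
        have := neg_mem_pos hγ h1 haγ ha0
        rw [neg_eq_of_add_eq_zero_right h0] at this
        exact hδ this

/-- The union of the radicals is central. -/
lemma rad_central (hD : S.IsDynkin) (hx : x ∈ S.rad) (z : g) : ⁅x, z⁆ = 0 := by
  refine central_of_abelian S (P := S.rad) (fun y x hx => lie_mem_rad y hx) ?_ hx z
  intro a ha b hb
  obtain ⟨s, f, hf, rfl⟩ := S.exists_sum a
  obtain ⟨t, u, hu, rfl⟩ := S.exists_sum b
  have hst : ∀ (H : S.h), ∀ x ∈ S.rad, ⁅(H : g), x⁆ ∈ S.rad := fun H x hx => lie_mem_rad _ hx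
  rw [sum_lie]
  refine sum_eq_zero fun γ hγ => ?_
  rw [lie_sum]
  refine sum_eq_zero fun δ hδ => ?_
  have h1 := component_mem hst s f hf ha hγ
  have h2 := component_mem hst t u hu hb hδ
  by_contra hne
  have h0 : γ + δ = 0 := by
    by_contra h
    exact hne (wt_disjoint h (lie_mem_wt (hf γ) (hu δ))
      (mem_wt_zero.2 (mem_h_of_central (lie_rad_central h1 h2))))
  by_cases hγp : γ ∈ S.pos
  · have hδp : δ ∉ S.pos := by
      rw [← neg_eq_of_add_eq_zero_right h0]; exact neg_notMem_pos hγp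
    apply hne
    rw [← lie_skew, rad_nonpos_central hD hδp h2 (hu δ), neg_zero]
  · exact hne (rad_nonpos_central hD hγp h1 (hf γ) _)

lemma span_F (n : ℕ) : span K {x : S.F n | ∃ χ : Dual K (S.hn n), ∀ y : S.hn n,
    ⁅(y : g), (x : g)⁆ = χ y • (x : g)} = ⊤ := by
  rw [eq_top_iff]
  rintro y -
  have h1 : (⨆ α : Dual K (S.hn n), (S.F n).toSubmodule ⊓ adWeightSpace K g (S.hn n) α) ≤
      (span K {x : S.F n | ∃ χ : Dual K (S.hn n), ∀ y : S.hn n,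
        ⁅(y : g), (x : g)⁆ = χ y • (x : g)}).map ((S.F n).toSubmodule.subtype) :=
    iSup_le fun α x hx => ⟨⟨x, hx.1⟩, subset_span ⟨α, hx.2⟩, rfl⟩
  obtain ⟨z, hz, hzy⟩ := h1 ((S.h_maxToral n).1.2.2 y.2)
  have : z = y := Subtype.ext hzy
  rwa [← this]

lemma exists_pairing (hD : S.IsDynkin) (h0 : α ≠ 0) (hx : x ∈ S.wt α) (hx0 : x ≠ 0) :
    ∃ y : g, ∃ u : S.h, ⁅x, y⁆ = (u : g) ∧ α u ≠ 0 := by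
  classical
  obtain ⟨H, hH⟩ : ∃ H, α H ≠ 0 := by
    by_contra! hc
    exact h0 (LinearMap.ext hc)
  have hnr : x ∉ S.rad := fun h => hx0 (wt_disjoint h0 hx
    (mem_wt_zero.2 (mem_h_of_central (rad_central hD h))))
  obtain ⟨n, hn, hn'⟩ : ∃ n, x ∈ S.F n ∧ ¬ S.InRad n x := by
    by_contra! hc
    exact hnr hc
  obtain ⟨m, hm, hmem⟩ := S.exists_mem_F {x, (H : g)} n
  have hxm := hmem x (by simp)
  have hHm := hmem H (by simp)
  haveI := S.F_findim m
  have hxr : (⟨x, hxm⟩ : S.F m) ∉ radical K (S.F m) := fun h => hn' (InRad.mono hm ⟨hxm, h⟩ hn)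
  have hk : (⟨x, hxm⟩ : S.F m) ∉ LieIdeal.killingCompl K (S.F m) ⊤ := fun h =>
    hxr (killingCompl_top_le_radical K (S.F m) h)
  obtain ⟨y₀, hy₀⟩ : ∃ y, killingForm K (S.F m) ⟨x, hxm⟩ y ≠ 0 := by
    by_contra! hc
    refine hk ?_
    rw [LieIdeal.mem_killingCompl]
    intro y _
    rw [LieModule.traceForm_comm]
    exact hc y
  obtain ⟨y, hy, hBy⟩ : ∃ y : S.F m, (∀ z : S.hn m, ⁅(z : g), (y : g)⁆ =
      -(α ⟨z, z.2.1⟩) • (y : g)) ∧ killingForm K (S.F m) ⟨x, hxm⟩ y ≠ 0 := by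
    by_contra! hc
    apply hy₀
    have h1 : (⊤ : Submodule K (S.F m)) ≤ LinearMap.ker (killingForm K (S.F m) ⟨x, hxm⟩) := by
      rw [← span_F m, span_le]
      rintro y ⟨χ, hχ⟩
      show killingForm K (S.F m) ⟨x, hxm⟩ y = 0
      by_cases hcase : ∀ z : S.hn m, χ z = -(α ⟨z, z.2.1⟩)
      · exact hc y fun z => by rw [hχ, hcase]
      · push Not at hcase
        obtain ⟨z, hz⟩ := hcase
        have h2 := LieModule.traceForm_apply_lie_apply K (S.F m) (S.F m) ⟨x, hxm⟩ ⟨z, z.2.2⟩ y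
        have e1 : ⁅(⟨x, hxm⟩ : S.F m), (⟨z, z.2.2⟩ : S.F m)⁆ =
            -(α ⟨z, z.2.1⟩) • (⟨x, hxm⟩ : S.F m) :=
          Subtype.ext (by
            show ⁅x, (z : g)⁆ = -(α ⟨z, z.2.1⟩) • x
            rw [← lie_skew, neg_smul]
            exact congrArg Neg.neg (hx ⟨z, z.2.1⟩))
        have e2 : ⁅(⟨z, z.2.2⟩ : S.F m), y⁆ = χ z • y := Subtype.ext (hχ z)
        rw [e1, e2, map_smul, map_smul, LinearMap.smul_apply, ← sub_eq_zero, ← sub_smul] at h2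
        exact (smul_eq_zero.1 h2).resolve_left fun h => hz (by linear_combination -h)
    exact h1 (Submodule.mem_top (x := y₀))
  have hu : ⁅x, (y : g)⁆ ∈ S.h := by
    refine S.mem_h_of_commute m ((S.F m).lie_mem hxm y.2) fun z hz => ?_
    rw [leibniz_lie, hy ⟨z, hz⟩, show ⁅z, x⁆ = α ⟨z, hz.1⟩ • x from hx ⟨z, hz.1⟩]
    simp
  refine ⟨y, ⟨_, hu⟩, rfl, fun hαu => ?_⟩
  set u : S.h := ⟨⁅x, (y : g)⁆, hu⟩ with hudef
  let u' : S.F m := ⁅(⟨x, hxm⟩ : S.F m), y⁆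
  have hu'm : (u' : g) ∈ S.hn m := ⟨hu, u'.2⟩
  have hux : ⁅u', (⟨x, hxm⟩ : S.F m)⁆ = 0 := Subtype.ext (by
    have := hx u
    rw [hαu, zero_smul] at this
    exact this)
  have huy : ⁅u', y⁆ = 0 := Subtype.ext (by
    have := hy ⟨u', hu'm⟩
    rw [show α ⟨u', hu'm.1⟩ = 0 from hαu, neg_zero, zero_smul] at this
    exact this)
  have hz : ad K (S.F m) u' = 0 := by
    refine eq_zero_of_commutator (X := ad K (S.F m) ⟨x, hxm⟩) (Y := ad K (S.F m) y)
      (fun v => lie_lie (⟨x, hxm⟩ : S.F m) y v) (fun v => ?_) (fun v => ?_) ?_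
    · show ⁅u', ⁅(⟨x, hxm⟩ : S.F m), v⁆⁆ = _
      rw [leibniz_lie, hux, zero_lie, zero_add]; rfl
    · show ⁅u', ⁅y, v⁆⁆ = _
      rw [leibniz_lie, huy, zero_lie, zero_add]; rfl
    · rw [eq_top_iff, ← span_F m]
      refine span_mono ?_
      rintro v ⟨χ, hχ⟩
      exact ⟨χ ⟨u', hu'm⟩, Subtype.ext (hχ ⟨u', hu'm⟩)⟩
  have h2 := LieModule.traceForm_apply_lie_apply K (S.F m) (S.F m) ⟨H, hHm⟩ ⟨x, hxm⟩ y
  have h3 : LieModule.traceForm K (S.F m) (S.F m) ⟨H, hHm⟩ u' = 0 := by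
    rw [LieModule.traceForm_apply_apply]
    have : LieModule.toEnd K (S.F m) (S.F m) u' = 0 := hz
    rw [this, LinearMap.comp_zero, map_zero]
  have e1 : ⁅(⟨H, hHm⟩ : S.F m), (⟨x, hxm⟩ : S.F m)⁆ = α H • (⟨x, hxm⟩ : S.F m) :=
    Subtype.ext (hx H)
  rw [e1, map_smul, LinearMap.smul_apply] at h2
  exact (smul_ne_zero hH hBy) (h2.trans h3)

lemma exists_coroot (hD : S.IsDynkin) (h0 : α ≠ 0) (hx : x ∈ S.wt α) (hx0 : x ≠ 0) :
    ∃ y ∈ S.wt (-α), ∃ u : S.h, ⁅x, y⁆ = (u : g) ∧ α u = 2 := by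
  classical
  obtain ⟨y, u, hyu, hu⟩ := exists_pairing hD h0 hx hx0
  obtain ⟨s, f, hf, hs⟩ := S.exists_sum y
  let P : Submodule K g := S.h.toSubmodule.comap (ad K g x : g →ₗ[K] g)
  have hP : ∀ H : S.h, ∀ z ∈ P, ⁅(H : g), z⁆ ∈ P := by
    intro H z hz
    have hz' : ⁅x, z⁆ ∈ S.h := hz
    show ⁅x, ⁅(H : g), z⁆⁆ ∈ S.h
    rw [leibniz_lie, lie_of_mem_wt' hx, ← neg_smul, smul_lie, lie_h H.2 hz', add_zero]
    exact S.h.smul_mem _ hz'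
  have hyP : ∑ α ∈ s, f α ∈ P := by
    rw [hs]; show ⁅x, y⁆ ∈ S.h; rw [hyu]; exact u.2
  have h1 : ∀ γ ∈ s, γ ≠ -α → ⁅x, f γ⁆ = 0 := by
    intro γ hγ hne
    have h2 : ⁅x, f γ⁆ ∈ S.h := component_mem hP s f hf hyP hγ
    exact wt_disjoint (fun h => hne (eq_neg_of_add_eq_zero_right h)) (lie_mem_wt hx (hf γ))
      (mem_wt_zero.2 h2)
  have h2 : ⁅x, f (-α)⁆ = (u : g) := by
    rw [← hyu, ← hs, lie_sum]
    symm
    refine Finset.sum_eq_single _ h1 fun hn => ?_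
    exfalso
    apply hu
    have : (u : g) = 0 := by
      rw [← hyu, ← hs, lie_sum]
      exact sum_eq_zero fun γ hγ => h1 γ hγ (fun h => hn (h ▸ hγ))
    have : u = 0 := Subtype.ext this
    rw [this, map_zero]
  refine ⟨(2 / α u) • f (-α), smul_mem _ _ (hf _), (2 / α u) • u, ?_, ?_⟩
  · rw [lie_smul, h2]; rfl
  · rw [map_smul, smul_eq_mul, div_mul_cancel₀ _ hu]

lemma pow_ad_mem {e v : g} (he : e ∈ S.wt α) (hv : v ∈ S.wt γ) (k : ℕ) :
    ((ad K g e) ^ k) v ∈ S.wt (γ + k • α) := by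
  induction k with
  | zero => simpa using hv
  | succ k ih =>
    rw [pow_succ', End.mul_apply, succ_nsmul, add_comm (k • α), add_left_comm]
    exact lie_mem_wt he ih

lemma pow_ad_mem_F {n : ℕ} {e v : g} (he : e ∈ S.F n) (hv : v ∈ S.F n) (k : ℕ) :
    ((ad K g e) ^ k) v ∈ S.F n := by
  induction k with
  | zero => simpa using hv
  | succ k ih =>
    rw [pow_succ', End.mul_apply]
    exact (S.F n).lie_mem he ih

/-- Root vectors act locally nilpotently. -/
lemma exists_pow_ad_eq_zero (h0 : α ≠ 0) {e : g} (he : e ∈ S.wt α) (v : g) :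
    ∃ k, ((ad K g e) ^ k) v = 0 := by
  classical
  have hv : v ∈ ⨆ γ, S.wt γ := by rw [S.h_span]; trivial
  induction hv using Submodule.iSup_induction' with
  | zero => exact ⟨0, by simp⟩
  | add a b _ _ ha hb =>
    obtain ⟨k, hk⟩ := ha
    obtain ⟨l, hl⟩ := hb
    refine ⟨k + l, ?_⟩
    rw [map_add, pow_add, End.mul_apply, End.mul_apply, hl, map_zero, add_zero,
      ← End.mul_apply, ← pow_add, add_comm, pow_add, End.mul_apply, hk, map_zero]
  | mem γ v hv =>
    by_contra! hne
    obtain ⟨n, -, hn⟩ := S.exists_mem_F {e, v} 0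
    haveI := S.F_findim n
    have hinj : Function.Injective fun k : ℕ => γ + k • α := by
      intro k l hkl
      have h1 : ((k : K) - l) • α = 0 := by
        rw [show ((k : K) - l) • α = (k : K) • α - (l : K) • α from
            LinearMap.ext fun x => by simp [sub_mul],
          cast_smul_eq_nsmul, cast_smul_eq_nsmul]
        exact sub_eq_zero.2 (add_left_cancel hkl)
      have h2 := (smul_eq_zero.1 h1).resolve_right h0
      exact_mod_cast sub_eq_zero.1 h2
    have hli : LinearIndependent K fun k : ℕ => ((ad K g e) ^ k) v :=
      (S.h_indep.comp hinj).linearIndependent _ (fun k => pow_ad_mem he hv k) hne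
    have hli' : LinearIndependent K fun k : ℕ => (⟨((ad K g e) ^ k) v,
        pow_ad_mem_F (hn e (by simp)) (hn v (by simp)) k⟩ : (S.F n).toSubmodule) :=
      LinearIndependent.of_comp (S.F n).toSubmodule.subtype hli
    have : FiniteDimensional K (S.F n).toSubmodule := S.F_findim n
    exact (not_finite_iff_infinite.2 inferInstance : ¬ Finite ℕ) hli'.finite

variable (S) in
/-- An `sl₂`-triple for the weight `α`. -/
structure Tri (α : Dual K S.h) (e f : g) (u : S.h) : Prop where
  he : e ∈ S.wt α
  hf : f ∈ S.wt (-α)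
  hef : ⁅e, f⁆ = (u : g)
  two : α u = 2

namespace Tri

variable {α γ : Dual K S.h} {e f x y : g} {u : S.h}

lemma ne_zero (T : S.Tri α e f u) : α ≠ 0 := by
  rintro rfl
  have := T.two
  rw [LinearMap.zero_apply] at this
  exact two_ne_zero this.symm

lemma symm (T : S.Tri α e f u) : S.Tri (-α) f e (-u) where
  he := T.hf
  hf := by rw [neg_neg]; exact T.he
  hef := by rw [← lie_skew, T.hef]; rfl
  two := by simp [T.two]

lemma ops (T : S.Tri α e f u) : Sl2Ops (ad K g e) (ad K g f) (ad K g (u : g)) where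
  ef v := by simp only [ad_apply]; rw [leibniz_lie, T.hef, add_comm]
  hf v := by
    simp only [ad_apply]
    rw [leibniz_lie, lie_of_mem_wt T.hf, LinearMap.neg_apply, T.two, smul_lie]
    module
  he v := by
    simp only [ad_apply]
    rw [leibniz_lie, lie_of_mem_wt T.he, T.two, smul_lie, add_comm]

lemma nil_e (T : S.Tri α e f u) (v : g) : ∃ k, ((ad K g e) ^ k) v = 0 :=
  exists_pow_ad_eq_zero T.ne_zero T.he v

lemma nil_f (T : S.Tri α e f u) (v : g) : ∃ k, ((ad K g f) ^ k) v = 0 :=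
  T.symm.nil_e v

lemma e_ne_zero (T : S.Tri α e f u) : e ≠ 0 := by
  rintro rfl
  have h := T.hef
  rw [zero_lie] at h
  have : u = 0 := Subtype.ext h.symm
  have h2 := T.two
  rw [this, map_zero] at h2
  exact two_ne_zero h2.symm

lemma f_ne_zero (T : S.Tri α e f u) : f ≠ 0 := T.symm.e_ne_zero

lemma eq_zero_of_pow (T : S.Tri α e f u) (hx : x ∈ S.wt γ) {m : ℕ} (hm : γ u = m)
    (h : ((ad K g f) ^ m) x = 0) : x = 0 := by
  obtain ⟨k, hk⟩ := T.nil_e x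
  exact T.ops.eq_zero_of_pow_f (m := m) (by rw [ad_apply, lie_of_mem_wt hx, hm]) hk h

lemma pow_f_ne_zero (T : S.Tri α e f u) (hx : x ∈ S.wt γ) (h0 : x ≠ 0) {m i : ℕ} (hm : γ u = m)
    (hi : i ≤ m) : ((ad K g f) ^ i) x ≠ 0 := by
  obtain ⟨k, hk⟩ := T.nil_e x
  exact T.ops.pow_f_ne_zero (m := m) (by rw [ad_apply, lie_of_mem_wt hx, hm]) h0 hk hi

lemma pow_f_mem (T : S.Tri α e f u) (hx : x ∈ S.wt γ) (k : ℕ) :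
    ((ad K g f) ^ k) x ∈ S.wt (γ - k • α) := by
  have := pow_ad_mem T.hf hx k
  rwa [smul_neg, ← sub_eq_add_neg] at this

lemma int (T : S.Tri α e f u) (hx : x ∈ S.wt γ) (h0 : x ≠ 0) : ∃ z : ℤ, γ u = z := by
  obtain ⟨k, hk⟩ := T.nil_e x
  exact T.ops.exists_int (by rw [ad_apply, lie_of_mem_wt hx]) h0 hk T.nil_f

/-- Root spaces are one-dimensional. -/
lemma eq_smul (T : S.Tri α e f u) (hx : x ∈ S.wt α) : ∃ t : K, x = t • e := by
  have hw : ⁅f, x⁆ ∈ S.h := mem_wt_zero.1 (by simpa using lie_mem_wt T.hf hx)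
  set w : S.h := ⟨⁅f, x⁆, hw⟩ with hwdef
  refine ⟨-(α w / 2), ?_⟩
  have h1 : x + (α w / 2) • e = 0 := by
    refine T.eq_zero_of_pow (γ := α) (m := 2)
      (add_mem hx (smul_mem _ _ T.he)) (by rw [T.two]; norm_num) ?_
    rw [pow_two, End.mul_apply, ad_apply, ad_apply, lie_add, lie_smul, ← lie_skew f e, T.hef,
      show ⁅f, x⁆ = (w : g) from rfl, lie_add, lie_smul, lie_neg, lie_of_mem_wt' T.hf,
      lie_of_mem_wt' T.hf, LinearMap.neg_apply, LinearMap.neg_apply, T.two]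
    module
  rw [neg_smul]
  exact eq_neg_of_add_eq_zero_left h1

lemma lie_e_ne_zero (T : S.Tri α e f u) (hx : x ∈ S.wt γ) (hx0 : x ≠ 0) (hy : y ∈ S.wt (γ + α))
    (hy0 : y ≠ 0) (h : ∀ z ∈ S.wt γ, ∃ t : K, z = t • x) : ⁅e, x⁆ ≠ 0 := by
  obtain ⟨t, ht⟩ := h ⁅f, y⁆ (by simpa [add_comm] using lie_mem_wt T.hf hy)
  refine T.ops.e_ne_zero (μ := γ u) (by rw [ad_apply, lie_of_mem_wt hx]) hx0 ?_ hy0 ht T.nil_e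
    T.nil_f
  rw [ad_apply, lie_of_mem_wt hy, LinearMap.add_apply, T.two]

lemma eq_zero_of_nsmul (T : S.Tri α e f u) (k : ℕ) (hx : x ∈ S.wt ((k + 2) • α)) : x = 0 := by
  induction k generalizing x with
  | zero =>
    have h1 : ⁅f, x⁆ ∈ S.wt α := by
      have := lie_mem_wt T.hf hx
      rwa [show -α + (0 + 2) • α = α by simp [two_smul]] at this
    obtain ⟨t, ht⟩ := T.eq_smul h1
    refine T.eq_zero_of_pow (m := 4) hx (by simp [T.two]; norm_num) ?_
    rw [pow_succ, pow_succ, pow_two]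
    simp only [End.mul_apply, ad_apply]
    rw [ht, lie_smul, lie_smul, lie_smul, ← lie_skew f e, T.hef, lie_neg, lie_of_mem_wt' T.hf]
    simp
  | succ k ih =>
    have h1 : ⁅f, x⁆ = 0 := ih (by
      have := lie_mem_wt T.hf hx
      rwa [show -α + (k + 1 + 2) • α = (k + 2) • α by
        rw [show k + 1 + 2 = (k + 2) + 1 by ring, succ_nsmul]; abel] at this)
    refine T.eq_zero_of_pow (m := 2 * (k + 1 + 2)) hx (by simp [T.two]; ring) ?_
    rw [show 2 * (k + 1 + 2) = (2 * k + 5) + 1 by ring, pow_succ, End.mul_apply, ad_apply, h1,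
      map_zero]

end Tri

variable (S) in
/-- A choice of `sl₂`-triples for all positive roots. -/
structure Chev where
  dynkin : S.IsDynkin
  e : Dual K S.h → g
  f : Dual K S.h → g
  c : Dual K S.h → S.h
  tri : ∀ α ∈ S.pos, S.Tri α (e α) (f α) (c α)

lemma exists_tri (hD : S.IsDynkin) {α : Dual K S.h} (hα : α ∈ S.pos) : ∃ e f u, S.Tri α e f u := by
  obtain ⟨h0, h1⟩ := S.pos_root α hα
  obtain ⟨x, hx, hx0⟩ := exists_mem_ne_zero_of_ne_bot h1
  obtain ⟨y, hy, u, h2, h3⟩ := exists_coroot hD h0 hx hx0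
  exact ⟨x, y, u, hx, hy, h2, h3⟩

theorem nonempty_chev (hD : S.IsDynkin) : Nonempty S.Chev := by
  classical
  choose e f c h using fun α : S.pos => exists_tri hD α.2
  exact ⟨{
    dynkin := hD
    e := fun α => if hα : α ∈ S.pos then e ⟨α, hα⟩ else 0
    f := fun α => if hα : α ∈ S.pos then f ⟨α, hα⟩ else 0
    c := fun α => if hα : α ∈ S.pos then c ⟨α, hα⟩ else 0
    tri := fun α hα => by simpa only [dif_pos hα] using h ⟨α, hα⟩ }⟩

namespace Chev

variable {α β γ : Dual K S.h}

lemma coroot_eq (D : S.Chev) (hα : α ∈ S.pos) {H : S.h} : IsCoroot S α H ↔ H = D.c α := by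
  have T := D.tri α hα
  constructor
  · rintro ⟨h2, x, hx, y, hy, hxy⟩
    obtain ⟨s, rfl⟩ := T.eq_smul hx
    obtain ⟨t, rfl⟩ := T.symm.eq_smul hy
    have h1 : H = (s * t) • D.c α := Subtype.ext (by
      rw [hxy, smul_lie, lie_smul, T.hef, smul_smul]; rfl)
    rw [h1, map_smul, T.two, smul_eq_mul] at h2
    have : s * t = 1 := by
      have h3 : (s * t - 1) * 2 = 0 := by linear_combination h2
      exact sub_eq_zero.1 ((mul_eq_zero.1 h3).resolve_right two_ne_zero)
    rw [h1, this, one_smul]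
  · rintro rfl
    exact ⟨T.two, _, T.he, _, T.hf, T.hef.symm⟩

end Chev

variable (D : S.Chev) {α β γ ρ μ : Dual K S.h} {x : g}

/-- The roots of `h` in `g`. -/
def IsRt (S : Setup K g) (γ : Dual K S.h) : Prop := γ ∈ S.pos ∨ -γ ∈ S.pos

lemma isRt_of_mem (h0 : γ ≠ 0) (hx : x ∈ S.wt γ) (hx0 : x ≠ 0) : S.IsRt γ := by
  by_cases h : γ ∈ S.pos
  · exact Or.inl h
  · exact Or.inr (neg_mem_pos h h0 hx hx0)

lemma IsRt.neg (h : S.IsRt γ) : S.IsRt (-γ) := by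
  rcases h with h | h
  · exact Or.inr (by rwa [neg_neg])
  · exact Or.inl h

lemma ne_zero_of_mem_pos (h : γ ∈ S.pos) : γ ≠ 0 := (S.pos_root γ h).1

lemma IsRt.ne_zero (h : S.IsRt γ) : γ ≠ 0 := by
  rcases h with h | h
  · exact ne_zero_of_mem_pos h
  · exact neg_ne_zero.1 (ne_zero_of_mem_pos h)

namespace Chev

variable {α β γ : Dual K S.h}

lemma exists_tri_of_isRt (D : S.Chev) (h : S.IsRt γ) : ∃ e f u, S.Tri γ e f u := by
  rcases h with h | h
  · exact ⟨_, _, _, D.tri γ h⟩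
  · have := (D.tri _ h).symm
    rw [neg_neg] at this
    exact ⟨_, _, _, this⟩

lemma int (hα : α ∈ S.pos) (hγ : S.IsRt γ) : ∃ z : ℤ, γ (D.c α) = z := by
  obtain ⟨e, f, u, T⟩ := D.exists_tri_of_isRt hγ
  exact (D.tri α hα).int T.he T.e_ne_zero

/-- Roots are stable under reflections. -/
lemma isRt_reflect (hα : α ∈ S.pos) (hγ : S.IsRt γ) : S.IsRt (γ - γ (D.c α) • α) := by
  obtain ⟨e, f, u, T⟩ := D.exists_tri_of_isRt hγ
  have Tα := D.tri α hα
  have h0 : γ - γ (D.c α) • α ≠ 0 := by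
    intro h
    have h1 := congrArg (fun φ : Dual K S.h => φ (D.c α)) h
    simp only [LinearMap.sub_apply, LinearMap.smul_apply, Tα.two, smul_eq_mul,
      LinearMap.zero_apply] at h1
    have h2 : γ (D.c α) = 0 := by linear_combination -h1
    rw [h2, zero_smul, sub_zero] at h
    exact hγ.ne_zero h
  obtain ⟨z, hz⟩ := D.int hα hγ
  rcases Int.eq_nat_or_neg z with ⟨m, rfl | rfl⟩
  · rw [Int.cast_natCast] at hz
    have h1 := Tα.pow_f_mem T.he m
    rw [← cast_smul_eq_nsmul K, ← hz] at h1
    exact isRt_of_mem h0 h1 (Tα.pow_f_ne_zero T.he T.e_ne_zero hz le_rfl)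
  · have hz' : γ (-D.c α) = (m : K) := by rw [map_neg, hz]; simp
    have h1 := Tα.symm.pow_f_mem T.he m
    rw [← cast_smul_eq_nsmul K, ← hz', map_neg, neg_smul_neg] at h1
    exact isRt_of_mem h0 h1 (Tα.symm.pow_f_ne_zero T.he T.e_ne_zero hz' le_rfl)

lemma sub_isRt (hα : α ∈ S.pos) (hγ : S.IsRt γ) (hne : γ ≠ α) {m : ℕ} (hm : γ (D.c α) = (m + 1 : ℕ)) :
    S.IsRt (γ - α) := by
  obtain ⟨e, f, u, T⟩ := D.exists_tri_of_isRt hγ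
  have h1 := (D.tri α hα).pow_f_mem T.he 1
  rw [one_smul] at h1
  exact isRt_of_mem (sub_ne_zero.2 hne) h1
    ((D.tri α hα).pow_f_ne_zero T.he T.e_ne_zero hm (by omega))

lemma add_isRt (hα : α ∈ S.pos) (hγ : S.IsRt γ) (hne : γ ≠ -α) {m : ℕ}
    (hm : γ (D.c α) = -(m + 1 : ℕ)) : S.IsRt (γ + α) := by
  obtain ⟨e, f, u, T⟩ := D.exists_tri_of_isRt hγ
  have h1 := (D.tri α hα).symm.pow_f_mem T.he 1
  rw [one_smul, sub_neg_eq_add] at h1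
  refine isRt_of_mem (fun h => hne (eq_neg_of_add_eq_zero_left h)) h1
    ((D.tri α hα).symm.pow_f_ne_zero T.he T.e_ne_zero (m := m + 1) ?_ (by omega))
  rw [map_neg, hm, neg_neg]

lemma eq_one_of_nsmul_mem (D : S.Chev) (hα : α ∈ S.pos) {k : ℕ} (h : k • α ∈ S.pos) : k = 1 := by
  rcases k with _ | _ | k
  · rw [zero_smul] at h; exact absurd h zero_notMem_pos
  · rfl
  · exact absurd ((D.tri α hα).eq_zero_of_nsmul k (D.tri _ h).he) (D.tri _ h).e_ne_zero

lemma eq_smul_e (hα : α ∈ S.pos) (hx : x ∈ S.wt α) : ∃ t : K, x = t • D.e α :=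
  (D.tri α hα).eq_smul hx

lemma eq_smul_f (hα : α ∈ S.pos) (hx : x ∈ S.wt (-α)) : ∃ t : K, x = t • D.f α :=
  (D.tri α hα).symm.eq_smul hx

lemma lie_e_ne_zero (hα : α ∈ S.pos) (hβ : β ∈ S.pos) (h : α + β ∈ S.pos) : ⁅D.e α, D.e β⁆ ≠ 0 :=
  (D.tri α hα).lie_e_ne_zero (D.tri β hβ).he (D.tri β hβ).e_ne_zero
    (by rw [add_comm]; exact (D.tri _ h).he) (D.tri _ h).e_ne_zero fun _ hz => D.eq_smul_e hβ hz

lemma lie_f_ne_zero (hα : α ∈ S.pos) (hβ : β ∈ S.pos) (h : α + β ∈ S.pos) : ⁅D.f α, D.f β⁆ ≠ 0 :=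
  (D.tri α hα).symm.lie_e_ne_zero (D.tri β hβ).hf (D.tri β hβ).f_ne_zero
    (by rw [add_comm, ← _root_.neg_add]; exact (D.tri _ h).hf) (D.tri _ h).f_ne_zero
    fun _ hz => D.eq_smul_f hβ hz

end Chev

open Classical in
/-- The Killing form of `F n`, extended by zero. -/
def kf (S : Setup K g) (n : ℕ) (x y : g) : K :=
  if h : x ∈ S.F n ∧ y ∈ S.F n then killingForm K (S.F n) ⟨x, h.1⟩ ⟨y, h.2⟩ else 0

section kf

variable {n : ℕ} {x y z : g}

lemma kf_eq (hx : x ∈ S.F n) (hy : y ∈ S.F n) :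
    S.kf n x y = killingForm K (S.F n) ⟨x, hx⟩ ⟨y, hy⟩ := dif_pos ⟨hx, hy⟩

lemma kf_comm (hx : x ∈ S.F n) (hy : y ∈ S.F n) : S.kf n x y = S.kf n y x := by
  rw [kf_eq hx hy, kf_eq hy hx, LieModule.traceForm_comm]

lemma kf_lie (hx : x ∈ S.F n) (hy : y ∈ S.F n) (hz : z ∈ S.F n) :
    S.kf n ⁅x, y⁆ z = S.kf n x ⁅y, z⁆ := by
  rw [kf_eq ((S.F n).lie_mem hx hy) hz, kf_eq hx ((S.F n).lie_mem hy hz)]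
  exact LieModule.traceForm_apply_lie_apply K (S.F n) (S.F n) ⟨x, hx⟩ ⟨y, hy⟩ ⟨z, hz⟩

lemma kf_smul_left (hx : x ∈ S.F n) (hy : y ∈ S.F n) (t : K) :
    S.kf n (t • x) y = t * S.kf n x y := by
  rw [kf_eq ((S.F n).smul_mem t hx) hy, kf_eq hx hy,
    show (⟨t • x, (S.F n).smul_mem t hx⟩ : S.F n) = t • ⟨x, hx⟩ from rfl, map_smul,
    LinearMap.smul_apply, smul_eq_mul]

lemma kf_smul_right (hx : x ∈ S.F n) (hy : y ∈ S.F n) (t : K) :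
    S.kf n x (t • y) = t * S.kf n x y := by
  rw [kf_comm hx ((S.F n).smul_mem t hy), kf_smul_left hy hx, kf_comm hx hy]

end kf

variable (S) in
lemma exists_eigen (n : ℕ) : ∃ (m : ℕ) (v : Basis (Fin m) K (S.F n))
    (χ : Fin m → Dual K (S.hn n)), ∀ i, ∀ y : S.hn n, ⁅(y : g), (v i : g)⁆ = χ i y • (v i : g) := by
  haveI := S.F_findim n
  let v := Basis.ofSpan (span_F (S := S) n).ge
  have : Finite _ := Module.Finite.finite_basis v
  have h1 : ∀ i, ∃ χ : Dual K (S.hn n), ∀ y : S.hn n, ⁅(y : g), (v i : g)⁆ = χ y • (v i : g) :=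
    fun i => Basis.ofSpan_subset (span_F (S := S) n).ge ⟨i, rfl⟩
  choose χ hχ using h1
  refine ⟨_, v.reindex (Finite.equivFin _), fun i => χ ((Finite.equivFin _).symm i),
    fun i y => ?_⟩
  rw [Basis.reindex_apply]
  exact hχ _ y

lemma trace_diag {V : Type*} [AddCommGroup V] [Module K V] {m : ℕ} (v : Basis (Fin m) K V)
    (T : End K V) (c : Fin m → K) (h : ∀ i, T (v i) = c i • v i) :
    LinearMap.trace K V T = ∑ i, c i := by
  rw [LinearMap.trace_eq_matrix_trace K v, Matrix.trace]
  refine sum_congr rfl fun i _ => ?_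
  rw [Matrix.diag_apply, LinearMap.toMatrix_apply, h]
  simp

lemma kf_diag {n m : ℕ} (v : Basis (Fin m) K (S.F n)) (χ : Fin m → Dual K (S.hn n))
    (h : ∀ i, ∀ y : S.hn n, ⁅(y : g), (v i : g)⁆ = χ i y • (v i : g)) (x y : S.hn n) :
    S.kf n x y = ∑ i, χ i x * χ i y := by
  rw [kf_eq x.2.2 y.2.2, killingForm, LieModule.traceForm_apply_apply]
  refine trace_diag v _ _ fun i => ?_
  have h1 : ∀ z : S.hn n, ⁅(⟨z, z.2.2⟩ : S.F n), v i⁆ = χ i z • v i := fun z => Subtype.ext (h i z)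
  rw [LinearMap.comp_apply, LieModule.toEnd_apply_apply, LieModule.toEnd_apply_apply, h1, lie_smul,
    h1, smul_smul, mul_comm]

namespace Chev

variable {D : S.Chev} {n : ℕ} {α β : Dual K S.h}

variable (D n) in
/-- The positive roots whose root vectors lie in `F n`. -/
def lev : Set (Dual K S.h) := {α | α ∈ S.pos ∧ D.e α ∈ S.F n ∧ D.f α ∈ S.F n}

lemma c_mem (h : α ∈ D.lev n) : (D.c α : g) ∈ S.F n := by
  rw [← (D.tri α h.1).hef]
  exact (S.F n).lie_mem h.2.1 h.2.2

lemma exists_eq_smul (hα : α ∈ S.pos) (hβ : β ∈ S.pos) (h : α + β ∈ S.pos) :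
    (∃ t : K, t ≠ 0 ∧ ⁅D.e α, D.e β⁆ = t • D.e (α + β)) ∧
    ∃ t : K, t ≠ 0 ∧ ⁅D.f α, D.f β⁆ = t • D.f (α + β) := by
  constructor
  · obtain ⟨t, ht⟩ := D.eq_smul_e h (lie_mem_wt (D.tri α hα).he (D.tri β hβ).he)
    refine ⟨t, fun h0 => D.lie_e_ne_zero hα hβ h ?_, ht⟩
    rw [ht, h0, zero_smul]
  · obtain ⟨t, ht⟩ := D.eq_smul_f h (by
      rw [_root_.neg_add]; exact lie_mem_wt (D.tri α hα).hf (D.tri β hβ).hf)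
    refine ⟨t, fun h0 => D.lie_f_ne_zero hα hβ h ?_, ht⟩
    rw [ht, h0, zero_smul]

lemma add_mem_lev (hα : α ∈ D.lev n) (hβ : β ∈ D.lev n) (h : α + β ∈ S.pos) : α + β ∈ D.lev n := by
  obtain ⟨⟨s, hs, h1⟩, t, ht, h2⟩ := exists_eq_smul (D := D) hα.1 hβ.1 h
  refine ⟨h, ?_, ?_⟩
  · rw [← inv_smul_smul₀ hs (D.e (α + β)), ← h1]
    exact (S.F n).smul_mem _ ((S.F n).lie_mem hα.2.1 hβ.2.1)
  · rw [← inv_smul_smul₀ ht (D.f (α + β)), ← h2]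
    exact (S.F n).smul_mem _ ((S.F n).lie_mem hα.2.2 hβ.2.2)

variable (D) in
lemma exists_lev (Q : Finset (Dual K S.h)) (hQ : ∀ α ∈ Q, α ∈ S.pos) (s : Finset g) :
    ∃ n, (∀ x ∈ s, x ∈ S.F n) ∧ ∀ α ∈ Q, α ∈ D.lev n := by
  classical
  obtain ⟨n, -, hn⟩ := S.exists_mem_F (s ∪ Q.image D.e ∪ Q.image D.f) 0
  refine ⟨n, fun x hx => hn x (by simp [hx]), fun α hα => ⟨hQ α hα, hn _ ?_, hn _ ?_⟩⟩
  · simp only [Finset.mem_union, Finset.mem_image]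
    exact Or.inl (Or.inr ⟨α, hα, rfl⟩)
  · simp only [Finset.mem_union, Finset.mem_image]
    exact Or.inr ⟨α, hα, rfl⟩

lemma kf_c (hα : α ∈ D.lev n) (H : S.h) (hH : (H : g) ∈ S.F n) :
    S.kf n H (D.c α) = α H * S.kf n (D.e α) (D.f α) := by
  rw [← (D.tri α hα.1).hef, ← kf_lie hH hα.2.1 hα.2.2, lie_of_mem_wt (D.tri α hα.1).he,
    kf_smul_left hα.2.1 hα.2.2]

end Chev

/-- The data of an invariant form on the span of the coroots of `D.lev n`. -/
structure LForm (D : S.Chev) (n : ℕ) where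
  b : Dual K S.h → ℚ
  m : ℕ
  a : Fin m → Dual K S.h → ℚ
  b_pos : ∀ α ∈ D.lev n, 0 < b α
  gram : ∀ α ∈ D.lev n, ∀ β ∈ D.lev n, α (D.c β) = b β * ((∑ i, a i α * a i β : ℚ) : K)
  diag : ∀ H : S.h, (H : g) ∈ S.F n → ∃ χ : Fin m → K, ∀ α ∈ D.lev n, α H = ∑ i, χ i * a i α
  add : ∀ α ∈ D.lev n, ∀ β ∈ D.lev n, α + β ∈ S.pos →
    (b (α + β) : K)⁻¹ • D.c (α + β) = (b α : K)⁻¹ • D.c α + (b β : K)⁻¹ • D.c β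
  a_add : ∀ i, ∀ α ∈ D.lev n, ∀ β ∈ D.lev n, α + β ∈ S.pos → a i (α + β) = a i α + a i β
  adj : ∀ α ∈ D.lev n, ∀ β ∈ D.lev n, α + β ∈ S.pos → ∃ p : K,
    (b β : K)⁻¹ • ⁅D.f α, D.f β⁆ = p • (b (α + β) : K)⁻¹ • D.f (α + β) ∧
    ⁅D.f α, D.e (α + β)⁆ = -p • D.e β

theorem nonempty_lform (n : ℕ) : Nonempty (LForm D n) := by
  classical
  obtain ⟨m, v, χ, hv⟩ := S.exists_eigen n
  have hint : ∀ i, ∀ α : D.lev n, ∃ z : ℤ, χ i ⟨D.c α, (D.c α).2, Chev.c_mem α.2⟩ = z := by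
    intro i α
    have T := D.tri α α.2.1
    obtain ⟨k, hk⟩ := T.nil_e (v i)
    refine T.ops.exists_int (v := (v i : g)) (hv i ⟨D.c α, (D.c α).2, Chev.c_mem α.2⟩) ?_ hk T.nil_f
    intro h0
    exact v.ne_zero i (Subtype.ext h0)
  choose z hz using hint
  let b : D.lev n → ℚ := fun α => (∑ i, (z i α : ℚ) ^ 2) / 2
  have hb : ∀ α : D.lev n, S.kf n (D.e α) (D.f α) = b α := by
    intro α
    have h1 := Chev.kf_c α.2 (D.c α) (Chev.c_mem α.2)
    rw [(D.tri α α.2.1).two] at h1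
    have h2 := kf_diag v χ hv ⟨D.c α, (D.c α).2, Chev.c_mem α.2⟩ ⟨D.c α, (D.c α).2, Chev.c_mem α.2⟩
    have h3 : ((∑ i, (z i α : ℚ) ^ 2 : ℚ) : K) = 2 * S.kf n (D.e α) (D.f α) := by
      rw [← h1]
      refine Eq.trans ?_ h2.symm
      push_cast
      exact sum_congr rfl fun i _ => by rw [hz, pow_two]
    show _ = (((∑ i, (z i α : ℚ) ^ 2) / 2 : ℚ) : K)
    rw [Rat.cast_div, h3, Rat.cast_ofNat, mul_div_cancel_left₀ _ two_ne_zero]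
  have hbpos : ∀ α : D.lev n, 0 < b α := by
    intro α
    refine div_pos (lt_of_le_of_ne (Finset.sum_nonneg fun i _ => sq_nonneg _) fun h0 => ?_) two_pos
    have h1 : ∀ i, z i α = 0 := fun i => by
      have := (Finset.sum_eq_zero_iff_of_nonneg (fun i _ => sq_nonneg _)).1 h0.symm i
        (mem_univ i)
      exact_mod_cast pow_eq_zero_iff two_ne_zero |>.1 this
    have h2 : ad K (S.F n) ⟨D.c α, Chev.c_mem α.2⟩ = 0 := by
      refine v.ext fun i => Subtype.ext ?_
      have := hv i ⟨D.c α, (D.c α).2, Chev.c_mem α.2⟩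
      rw [hz, h1, Int.cast_zero, zero_smul] at this
      exact this
    have h3 : ⁅(D.c α : g), D.e α⁆ = 0 :=
      congrArg Subtype.val (LinearMap.congr_fun h2 ⟨D.e α, α.2.2.1⟩)
    rw [lie_of_mem_wt (D.tri α α.2.1).he, (D.tri α α.2.1).two] at h3
    exact (smul_ne_zero two_ne_zero (D.tri α α.2.1).e_ne_zero) h3
  have hbne : ∀ α : D.lev n, (b α : K) ≠ 0 := fun α => by exact_mod_cast (hbpos α).ne'
  have hc : ∀ α : D.lev n, ∀ H : S.h, ∀ hH : (H : g) ∈ S.F n,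
      α.1 H = ∑ i, χ i ⟨H, H.2, hH⟩ * ((z i α / b α : ℚ) : K) := by
    intro α H hH
    have h1 := Chev.kf_c α.2 H hH
    have h2 := kf_diag v χ hv ⟨H, H.2, hH⟩ ⟨D.c α, (D.c α).2, Chev.c_mem α.2⟩
    rw [hb] at h1
    rw [eq_div_of_mul_eq (hbne α) (h1.symm.trans h2), Finset.sum_div]
    refine sum_congr rfl fun i _ => ?_
    rw [hz]; push_cast; ring
  have key : ∀ α β : D.lev n, ∀ h : α.1 + β.1 ∈ S.pos, ∃ p : K,
      ((b β : K)⁻¹ • ⁅D.f α, D.f β⁆ = p • (b ⟨_, Chev.add_mem_lev α.2 β.2 h⟩ : K)⁻¹ •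
        D.f (α + β) ∧ ⁅D.f α, D.e (α + β)⁆ = -p • D.e β) := by
    intro α β h
    have hαβ := Chev.add_mem_lev α.2 β.2 h
    obtain ⟨-, r, hr, h2⟩ := Chev.exists_eq_smul (D := D) α.2.1 β.2.1 h
    obtain ⟨q, hq⟩ := D.eq_smul_e β.2.1 (x := ⁅D.f α, D.e (α + β)⁆) (by
      have := lie_mem_wt (D.tri α α.2.1).hf (D.tri _ h).he
      rwa [neg_add_cancel_left] at this)
    have h3 : -(r * b ⟨_, hαβ⟩) = q * (b β : K) := by
      rw [← hb, ← hb]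
      have e1 := kf_lie (S := S) (n := n) β.2.2.2 α.2.2.2 hαβ.2.1
      rw [← lie_skew, h2, hq, kf_smul_right β.2.2.2 β.2.2.1, ← neg_smul,
        kf_smul_left hαβ.2.2 hαβ.2.1, kf_comm hαβ.2.2 hαβ.2.1, kf_comm β.2.2.2 β.2.2.1] at e1
      rw [← e1]; ring
    have hb1 := hbne β
    have hb2 := hbne ⟨_, hαβ⟩
    refine ⟨-q, ?_, ?_⟩
    · rw [h2, smul_smul, smul_smul]
      congr 1
      field_simp
      linear_combination -h3
    · rw [hq, neg_neg]
  have hadd : ∀ α β : D.lev n, ∀ h : α.1 + β.1 ∈ S.pos,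
      (b ⟨_, Chev.add_mem_lev α.2 β.2 h⟩ : K)⁻¹ • D.c (α + β) =
        (b α : K)⁻¹ • D.c α + (b β : K)⁻¹ • D.c β := by
    intro α β h
    have hαβ := Chev.add_mem_lev α.2 β.2 h
    obtain ⟨⟨N, hN, h1⟩, -⟩ := Chev.exists_eq_smul (D := D) α.2.1 β.2.1 h
    have Tα := D.tri α α.2.1
    have Tβ := D.tri β β.2.1
    have Tγ := D.tri _ h
    obtain ⟨x, hx⟩ := D.eq_smul_f α.2.1 (x := ⁅D.e β, D.f (α + β)⁆) (by
      have := lie_mem_wt Tβ.he Tγ.hf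
      rwa [show β.1 + -(α.1 + β.1) = -α.1 by abel] at this)
    obtain ⟨y, hy⟩ := D.eq_smul_f β.2.1 (x := ⁅D.e α, D.f (α + β)⁆) (by
      have := lie_mem_wt Tα.he Tγ.hf
      rwa [show α.1 + -(α.1 + β.1) = -β.1 by abel] at this)
    have e1 : x * b α = N * b ⟨_, hαβ⟩ := by
      rw [← hb, ← hb]
      have e := kf_lie (S := S) (n := n) α.2.2.1 β.2.2.1 hαβ.2.2
      rw [h1, hx, kf_smul_right α.2.2.1 α.2.2.2, kf_smul_left hαβ.2.1 hαβ.2.2] at e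
      exact e.symm
    have e2 : y * b β = -(N * b ⟨_, hαβ⟩) := by
      rw [← hb, ← hb]
      have e := kf_lie (S := S) (n := n) β.2.2.1 α.2.2.1 hαβ.2.2
      rw [← lie_skew, h1, hy, kf_smul_right β.2.2.1 β.2.2.2, ← neg_smul,
        kf_smul_left hαβ.2.1 hαβ.2.2, neg_mul] at e
      exact e.symm
    have e3 : N • D.c (α + β) = x • D.c α - y • D.c β := by
      refine Subtype.ext ?_
      show N • (D.c (α + β) : g) = x • (D.c α : g) - y • (D.c β : g)
      rw [← Tγ.hef, ← Tα.hef, ← Tβ.hef, ← smul_lie, ← h1, lie_lie, hx, hy, lie_smul, lie_smul]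
    have hb1 := hbne α
    have hb2 := hbne β
    have hb3 := hbne ⟨_, hαβ⟩
    rw [eq_div_of_mul_eq hb1 e1, eq_div_of_mul_eq hb2 e2] at e3
    rw [← inv_smul_smul₀ hN (D.c (α + β)), e3, smul_sub, smul_sub, smul_smul, smul_smul, smul_smul,
      smul_smul, sub_eq_add_neg, ← neg_smul]
    congr 2 <;> field_simp
  let b' : Dual K S.h → ℚ := fun α => if h : α ∈ D.lev n then b ⟨α, h⟩ else 0
  let a' : Fin m → Dual K S.h → ℚ := fun i α =>
    if h : α ∈ D.lev n then z i ⟨α, h⟩ / b ⟨α, h⟩ else 0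
  have hb' : ∀ α (h : α ∈ D.lev n), b' α = b ⟨α, h⟩ := fun α h => dif_pos h
  have ha' : ∀ i α (h : α ∈ D.lev n), a' i α = z i ⟨α, h⟩ / b ⟨α, h⟩ := fun i α h => dif_pos h
  refine ⟨⟨b', m, a', ?_, ?_, ?_, ?_, ?_, ?_⟩⟩
  · intro α hα; rw [hb' _ hα]; exact hbpos _
  · intro α hα β hβ
    simp only [hb' _ hβ, ha' _ _ hα, ha' _ _ hβ]
    rw [hc ⟨α, hα⟩ (D.c β) (Chev.c_mem hβ)]
    have h0 : (b ⟨β, hβ⟩ : K) ≠ 0 := hbne _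
    push_cast
    rw [mul_sum]
    refine sum_congr rfl fun i _ => ?_
    rw [hz i ⟨β, hβ⟩]
    field_simp
  · intro H hH
    refine ⟨fun i => χ i ⟨H, H.2, hH⟩, fun α hα => ?_⟩
    simp only [ha' _ _ hα]
    exact hc ⟨α, hα⟩ H hH
  · intro α hα β hβ h
    simp only [hb' _ hα, hb' _ hβ, hb' _ (Chev.add_mem_lev hα hβ h)]
    exact hadd ⟨α, hα⟩ ⟨β, hβ⟩ h
  · intro i α hα β hβ h
    have hαβ := Chev.add_mem_lev hα hβ h
    rw [ha' _ _ hα, ha' _ _ hβ, ha' _ _ hαβ]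
    have e : ∀ γ : D.lev n, (((z i γ : ℚ) / b γ : ℚ) : K) =
        χ i ((b γ : K)⁻¹ • (⟨D.c γ, (D.c γ).2, Chev.c_mem γ.2⟩ : S.hn n)) := by
      intro γ
      rw [map_smul, hz, smul_eq_mul]
      push_cast
      rw [div_eq_inv_mul]
    have h1 := e ⟨_, hαβ⟩
    have h2 := hadd ⟨α, hα⟩ ⟨β, hβ⟩ h
    have h3 : (b ⟨_, hαβ⟩ : K)⁻¹ • (⟨D.c (α + β), (D.c (α + β)).2, Chev.c_mem hαβ⟩ : S.hn n) =
        (b ⟨α, hα⟩ : K)⁻¹ • (⟨D.c α, (D.c α).2, Chev.c_mem hα⟩ : S.hn n) +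
        (b ⟨β, hβ⟩ : K)⁻¹ • (⟨D.c β, (D.c β).2, Chev.c_mem hβ⟩ : S.hn n) := by
      refine Subtype.ext ?_
      exact congrArg (fun H : S.h => (H : g)) h2
    have h4 := h1.trans ((congrArg (χ i) h3).trans (map_add _ _ _))
    rw [← e ⟨α, hα⟩, ← e ⟨β, hβ⟩] at h4
    exact_mod_cast h4
  · intro α hα β hβ h
    simp only [hb' _ hβ, hb' _ (Chev.add_mem_lev hα hβ h)]
    exact key ⟨α, hα⟩ ⟨β, hβ⟩ h

/-- A vanishing sum of positive roots is empty. -/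
lemma eq_zero_of_sum_eq_zero (D : S.Chev) (s : Multiset (Dual K S.h)) (hs : ∀ β ∈ s, β ∈ S.pos)
    (h : s.sum = 0) : s = 0 := by
  classical
  induction hn : s.card generalizing s with
  | zero => exact Multiset.card_eq_zero.1 hn
  | succ n ih =>
    exfalso
    obtain ⟨β, hβs⟩ := Multiset.card_pos_iff_exists_mem.1 (by omega : 0 < s.card)
    obtain ⟨t, rfl⟩ := Multiset.exists_cons_of_mem hβs
    have hβ := hs β (Multiset.mem_cons_self β t)
    have ht : ∀ γ ∈ t, γ ∈ S.pos := fun γ hγ => hs γ (Multiset.mem_cons_of_mem hγ)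
    rw [Multiset.sum_cons] at h
    rw [Multiset.card_cons] at hn
    obtain ⟨γ, hγ, m, hm⟩ : ∃ γ ∈ t, ∃ m : ℕ, γ (D.c β) = -(m + 1 : ℕ) := by
      by_contra! hc
      have key : ∀ u : Multiset (Dual K S.h), u ≤ t → ∃ k : ℕ, u.sum (D.c β) = k := by
        intro u hu
        induction u using Multiset.induction_on with
        | empty => exact ⟨0, by simp⟩
        | cons γ u ihu =>
          obtain ⟨k, hk⟩ := ihu ((Multiset.le_cons_self u γ).trans hu)
          have hγ := Multiset.mem_of_le hu (Multiset.mem_cons_self γ u)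
          obtain ⟨z, hz⟩ := D.int hβ (Or.inl (ht γ hγ))
          obtain ⟨m, rfl | rfl⟩ := z.eq_nat_or_neg
          · refine ⟨m + k, ?_⟩
            rw [Multiset.sum_cons, LinearMap.add_apply, hk, hz]; push_cast; ring
          · rcases m with _ | m
            · refine ⟨k, ?_⟩
              rw [Multiset.sum_cons, LinearMap.add_apply, hk, hz]; simp
            · exact absurd (by rw [hz]; push_cast; ring) (hc γ hγ m)
      obtain ⟨k, hk⟩ := key t le_rfl
      have h1 := congrArg (fun φ : Dual K S.h => φ (D.c β)) h
      simp only [LinearMap.add_apply, LinearMap.zero_apply, hk, (D.tri β hβ).two] at h1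
      have h2 : (2 + k : ℕ) = 0 := by exact_mod_cast h1
      omega
    obtain ⟨u, rfl⟩ := Multiset.exists_cons_of_mem hγ
    have hγp := ht γ hγ
    have h1 : γ + β ∈ S.pos := by
      have hr : S.IsRt (γ + β) := D.add_isRt hβ (Or.inl hγp)
        (fun h0 => neg_notMem_pos hβ (h0 ▸ hγp)) hm
      obtain ⟨e, f, c, T⟩ := D.exists_tri_of_isRt hr
      exact S.pos_add γ hγp β hβ (isRoot_of_mem hr.ne_zero T.he T.e_ne_zero)
    have h2 := ih ((γ + β) ::ₘ u) (by
      intro δ hδ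
      rcases Multiset.mem_cons.1 hδ with rfl | hδ
      · exact h1
      · exact ht δ (Multiset.mem_cons_of_mem hδ)) (by
      rw [Multiset.sum_cons] at h ⊢
      rw [← h]; abel) (by
      rw [Multiset.card_cons] at hn ⊢; omega)
    exact Multiset.cons_ne_zero h2

lemma add_ne_zero_of_pos (hα : α ∈ S.pos) (hβ : β ∈ S.pos) : α + β ≠ 0 := by
  intro h
  rw [add_eq_zero_iff_eq_neg] at h
  exact neg_notMem_pos hβ (h ▸ hα)

variable (S) in
/-- The simple roots. -/
abbrev Simp := {β : Dual K S.h // S.IsSimpleRoot β}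

variable (S) in
/-- The weight of a combination of simple roots. -/
def ws : (S.Simp →₀ ℕ) →+ Dual K S.h :=
  Finsupp.liftAddHom fun β => (multiplesHom _ β.1)

lemma ws_single (β : S.Simp) (k : ℕ) : S.ws (single β k) = k • β.1 := by
  simp [ws]

lemma ws_eq_sum (r : S.Simp →₀ ℕ) : S.ws r = r.sum fun β k => k • β.1 := by
  simp [ws, Finsupp.sum]

lemma mem_of_mem_iSup_wt {P : Set (Dual K S.h)} {δ : Dual K S.h} (hx : x ∈ S.wt δ)
    (h : x ∈ ⨆ γ ∈ P, S.wt γ) (hx0 : x ≠ 0) : δ ∈ P := by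
  by_contra hδ
  refine hx0 (Submodule.disjoint_def.1 (S.h_indep δ) x hx ?_)
  refine (iSup₂_le fun γ hγ => ?_ : ⨆ γ ∈ P, S.wt γ ≤ _) h
  exact le_iSup₂_of_le γ (fun h0 : γ = δ => hδ (h0 ▸ hγ)) le_rfl

lemma b_le (hx : x ∈ S.b) : x ∈ ⨆ γ ∈ insert 0 S.pos, S.wt γ := by
  have h1 : x ∈ S.b.toSubmodule := hx
  rw [S.b_eq] at h1
  refine (sup_le (fun y hy => ?_) (iSup₂_mono' fun α hα => ⟨α, Or.inr hα, le_rfl⟩) :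
    S.h.toSubmodule ⊔ ⨆ α ∈ S.pos, adWeightSpace K g S.h α ≤ _) h1
  exact le_iSup₂ (f := fun γ (_ : γ ∈ insert 0 S.pos) => S.wt γ) 0 (Or.inl rfl)
    (mem_wt_zero.2 hy)

lemma wt_le_b (hα : α ∈ S.pos) (hx : x ∈ S.wt α) : x ∈ S.b := by
  show x ∈ S.b.toSubmodule
  rw [S.b_eq]
  exact Submodule.mem_sup_right
    (le_iSup₂ (f := fun γ (_ : γ ∈ S.pos) => S.wt γ) α hα hx)

lemma h_le_b (hx : x ∈ S.h) : x ∈ S.b := by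
  show x ∈ S.b.toSubmodule
  rw [S.b_eq]
  exact Submodule.mem_sup_left hx

/-- The submodule spanned by the weight spaces of an additively closed set of weights. -/
lemma lie_mem_iSup {P : Set (Dual K S.h)}
    (hP : ∀ γ ∈ P, ∀ δ ∈ P, ∀ x : g, x ∈ S.wt (γ + δ) → x ≠ 0 → γ + δ ∈ P) {x y : g}
    (hx : x ∈ ⨆ γ ∈ P, S.wt γ) (hy : y ∈ ⨆ γ ∈ P, S.wt γ) : ⁅x, y⁆ ∈ ⨆ γ ∈ P, S.wt γ := by
  rw [iSup_subtype'] at hx hy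
  induction hx using Submodule.iSup_induction' with
  | zero => rw [zero_lie]; exact zero_mem _
  | add x x' _ _ h h' => rw [add_lie]; exact add_mem h h'
  | mem γ x hx =>
    induction hy using Submodule.iSup_induction' with
    | zero => rw [lie_zero]; exact zero_mem _
    | add y y' _ _ h h' => rw [lie_add]; exact add_mem h h'
    | mem δ y hy =>
      by_cases h0 : ⁅x, y⁆ = 0
      · rw [h0]; exact zero_mem _
      have h1 := lie_mem_wt hx hy
      exact le_iSup₂ (f := fun γ (_ : γ ∈ P) => S.wt γ) _ (hP _ γ.2 _ δ.2 _ h1 h0) h1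

/-- Every positive root is a sum of simple roots. -/
lemma exists_ws (D : S.Chev) (hα : α ∈ S.pos) : ∃ r : S.Simp →₀ ℕ, S.ws r = α := by
  let P : Set (Dual K S.h) := {γ | γ = 0 ∨ (γ ∈ S.pos ∧ ∃ r : S.Simp →₀ ℕ, S.ws r = γ)}
  let Q : LieSubalgebra K g :=
    { (⨆ γ ∈ P, S.wt γ : Submodule K g) with
      lie_mem' := by
        intro x y hx hy
        refine lie_mem_iSup (P := P) ?_ hx hy
        rintro γ (rfl | ⟨hγ, r, rfl⟩) δ hδ x hx hx0
        · rwa [zero_add]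
        rcases hδ with rfl | ⟨hδ, s, rfl⟩
        · rw [add_zero]; exact Or.inr ⟨hγ, r, rfl⟩
        · exact Or.inr ⟨S.pos_add _ hγ _ hδ (isRoot_of_mem (add_ne_zero_of_pos hγ hδ) hx hx0),
            r + s, map_add _ _ _⟩ }
  have hle : ∀ {γ}, γ ∈ P → ∀ x ∈ S.wt γ, x ∈ Q := fun hγ x hx =>
    le_iSup₂ (f := fun γ (_ : γ ∈ P) => S.wt γ) _ hγ hx
  have hb : S.b ≤ Q := by
    rw [D.dynkin, LieSubalgebra.lieSpan_le]
    rintro x (hx | hx)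
    · exact hle (Or.inl rfl) x (mem_wt_zero.2 hx)
    · simp only [Set.mem_iUnion, Set.mem_setOf_eq] at hx
      obtain ⟨β, hβ, hx⟩ := hx
      exact hle (Or.inr ⟨hβ.1, single ⟨β, hβ⟩ 1, by rw [ws_single, one_smul]⟩) x hx
  obtain ⟨h0, h1⟩ := S.pos_root α hα
  obtain ⟨x, hx, hx0⟩ := exists_mem_ne_zero_of_ne_bot h1
  have h2 : x ∈ (⨆ γ ∈ P, S.wt γ : Submodule K g) := hb (wt_le_b hα hx)
  rcases mem_of_mem_iSup_wt hx h2 hx0 with rfl | ⟨-, h⟩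
  · exact absurd rfl h0
  · exact h

lemma eq_zero_of_ws (D : S.Chev) {r : S.Simp →₀ ℕ} (h : S.ws r = 0) : r = 0 := by
  classical
  have h1 := eq_zero_of_sum_eq_zero D ((toMultiset r).map Subtype.val) (by
    intro β hβ
    obtain ⟨γ, -, rfl⟩ := Multiset.mem_map.1 hβ
    exact γ.2.1) (by
    rw [← h, ws_eq_sum, Finsupp.toMultiset_map, Finsupp.sum_toMultiset,
      Finsupp.sum_mapDomain_index (by simp) (by intros; rw [add_smul])])
  rw [Multiset.map_eq_zero] at h1
  exact Multiset.toFinsupp.symm.injective (h1.trans (map_zero toMultiset).symm)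

lemma simple_apply_nonpos (hβ : S.IsSimpleRoot β) (hγ : S.IsSimpleRoot γ) (h : β ≠ γ) :
    ∃ m : ℕ, β (D.c γ) = -(m : K) := by
  obtain ⟨z, hz⟩ := D.int hγ.1 (Or.inl hβ.1)
  obtain ⟨m, rfl | rfl⟩ := z.eq_nat_or_neg
  · rcases m with _ | m
    · exact ⟨0, by simpa using hz⟩
    · exfalso
      rcases D.sub_isRt hγ.1 (Or.inl hβ.1) h (m := m) (by rw [hz]; push_cast; ring) with h1 | h1
      · refine hβ.2 ⟨{β - γ, γ}, by simp, ?_, by simp⟩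
        intro δ hδ
        simp at hδ
        rcases hδ with rfl | rfl
        · exact h1
        · exact hγ.1
      · rw [neg_sub] at h1
        refine hγ.2 ⟨{γ - β, β}, by simp, ?_, by simp⟩
        intro δ hδ
        simp at hδ
        rcases hδ with rfl | rfl
        · exact h1
        · exact hβ.1
  · exact ⟨m, by rw [hz]; push_cast; ring⟩

abbrev Chev.InLev (D : S.Chev) (n : ℕ) (r : S.Simp →₀ ℕ) : Prop :=
  ∀ β ∈ r.support, β.1 ∈ D.lev n

namespace LForm

variable {D : S.Chev} {n : ℕ} (L : LForm D n)

/-- The coordinates of a combination of simple roots. -/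
def A (i : Fin L.m) : (S.Simp →₀ ℕ) →+ ℚ :=
  Finsupp.liftAddHom fun β => (multiplesHom _ (L.a i β.1))

lemma A_eq_sum (i : Fin L.m) (r : S.Simp →₀ ℕ) : L.A i r = r.sum fun β k => k * L.a i β.1 := by
  simp [A, Finsupp.sum]

lemma ws_apply (r : S.Simp →₀ ℕ) (hr : D.InLev n r) (hβ : β ∈ D.lev n) :
    S.ws r (D.c β) = L.b β * ((∑ i, L.A i r * L.a i β : ℚ) : K) := by
  rw [ws_eq_sum]
  simp only [A_eq_sum, Finsupp.sum, LinearMap.sum_apply, Finset.sum_mul]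
  rw [sum_comm, Rat.cast_sum, mul_sum]
  refine sum_congr rfl fun γ hγ => ?_
  rw [LinearMap.smul_apply, L.gram γ (hr γ hγ) β hβ, nsmul_eq_mul]
  simp only [mul_assoc]
  rw [← mul_sum]
  push_cast
  ring

lemma diag_ws (H : S.h) (hH : (H : g) ∈ S.F n) : ∃ χ : Fin L.m → K,
    ∀ r : S.Simp →₀ ℕ, (D.InLev n r) → S.ws r H = ∑ i, χ i * L.A i r := by
  obtain ⟨χ, hχ⟩ := L.diag H hH
  refine ⟨χ, fun r hr => ?_⟩
  rw [ws_eq_sum]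
  simp only [A_eq_sum, Finsupp.sum, LinearMap.sum_apply, Rat.cast_sum, mul_sum]
  rw [sum_comm]
  refine sum_congr rfl fun γ hγ => ?_
  rw [LinearMap.smul_apply, hχ γ (hr γ hγ), nsmul_eq_mul, mul_sum]
  refine sum_congr rfl fun i _ => ?_
  push_cast; ring

lemma A_eq_of_ws_eq {r s : S.Simp →₀ ℕ} (hr : D.InLev n r) (hs : ∀ β ∈ s.support, β.1 ∈ D.lev n)
    (h : S.ws r = S.ws s) (i : Fin L.m) : L.A i r = L.A i s := by
  have h1 : ∀ β ∈ D.lev n, ∑ i, L.A i r * L.a i β = ∑ i, L.A i s * L.a i β := by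
    intro β hβ
    have h2 := L.ws_apply r hr hβ
    rw [h, L.ws_apply s hs hβ] at h2
    have h3 : (L.b β : K) ≠ 0 := by exact_mod_cast (L.b_pos β hβ).ne'
    exact_mod_cast (mul_left_cancel₀ h3 h2).symm
  have h2 : ∀ t : S.Simp →₀ ℕ, (∀ β ∈ t.support, β.1 ∈ D.lev n) →
      ∑ i, (L.A i r - L.A i s) * L.A i t = 0 := by
    intro t ht
    simp only [L.A_eq_sum _ t, Finsupp.sum, mul_sum]
    rw [sum_comm]
    refine sum_eq_zero fun β hβ => ?_
    have := h1 β (ht β hβ)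
    rw [← sub_eq_zero, ← sum_sub_distrib] at this
    rw [← mul_zero (t β : ℚ), ← this, mul_sum]
    exact sum_congr rfl fun i _ => by ring
  have h3 : ∑ i, (L.A i r - L.A i s) ^ 2 = 0 := by
    rw [← sub_self (0 : ℚ)]
    nth_rewrite 1 [← h2 r hr]
    rw [← h2 s hs, ← sum_sub_distrib]
    exact sum_congr rfl fun i _ => by ring
  have h4 := (Finset.sum_eq_zero_iff_of_nonneg (fun i _ => sq_nonneg _)).1 h3 i (mem_univ i)
  exact sub_eq_zero.1 (pow_eq_zero_iff two_ne_zero |>.1 h4)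

end LForm

lemma exists_lev_simp (J : Finset S.Simp) (s : Finset g) :
    ∃ n, (∀ x ∈ s, x ∈ S.F n) ∧ ∀ β ∈ J, β.1 ∈ D.lev n := by
  classical
  obtain ⟨n, h1, h2⟩ := D.exists_lev (J.image Subtype.val) (by
    intro α hα
    obtain ⟨β, -, rfl⟩ := Finset.mem_image.1 hα
    exact β.2.1) s
  exact ⟨n, h1, fun β hβ => h2 _ (Finset.mem_image_of_mem _ hβ)⟩

lemma eq_zero_of_ws_eq (D : S.Chev) {r s : S.Simp →₀ ℕ} (hd : Disjoint r.support s.support)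
    (h : S.ws r = S.ws s) : r = 0 := by
  classical
  refine eq_zero_of_ws D (LinearMap.ext fun H => ?_)
  obtain ⟨n, h1, h2⟩ := exists_lev_simp D (r.support ∪ s.support) {(H : g)}
  obtain ⟨L⟩ := nonempty_lform D n
  have hr : D.InLev n r := fun β hβ => h2 β (Finset.mem_union_left _ hβ)
  have hs : ∀ β ∈ s.support, β.1 ∈ D.lev n := fun β hβ => h2 β (Finset.mem_union_right _ hβ)
  have h3 : ∑ i, L.A i r ^ 2 ≤ 0 := by
    have : ∀ i, L.A i r ^ 2 = L.A i r * L.A i s := fun i => by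
      rw [pow_two, ← L.A_eq_of_ws_eq hr hs h i]
    simp only [this]
    simp only [L.A_eq_sum, Finsupp.sum, Finset.sum_mul_sum]
    rw [sum_comm]
    refine Finset.sum_nonpos fun β hβ => ?_
    rw [sum_comm]
    refine Finset.sum_nonpos fun γ hγ => ?_
    obtain ⟨m, hm⟩ := simple_apply_nonpos D β.2 γ.2 (fun h0 =>
      Finset.disjoint_left.1 hd hβ (by rwa [Subtype.ext h0]))
    rw [L.gram _ (hr β hβ) _ (hs γ hγ)] at hm
    have hm' : L.b γ.1 * ∑ i, L.a i β.1 * L.a i γ.1 = -(m : ℚ) := by exact_mod_cast hm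
    have h5 : ∑ i, L.a i β.1 * L.a i γ.1 ≤ 0 := by
      have h6 := L.b_pos _ (hs γ hγ)
      by_contra! h7
      have := mul_pos h6 h7
      have : (0 : ℚ) ≤ m := Nat.cast_nonneg m
      linarith
    have : ∑ i, (r β : ℚ) * L.a i β.1 * ((s γ : ℚ) * L.a i γ.1) =
        (r β * s γ : ℚ) * ∑ i, L.a i β.1 * L.a i γ.1 := by
      rw [mul_sum]; exact sum_congr rfl fun i _ => by ring
    rw [this]
    exact mul_nonpos_of_nonneg_of_nonpos (by positivity) h5
  have h4 : ∀ i, L.A i r = 0 := fun i => by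
    have h5 := le_antisymm h3 (Finset.sum_nonneg fun i _ => sq_nonneg _)
    exact pow_eq_zero_iff two_ne_zero |>.1
      ((Finset.sum_eq_zero_iff_of_nonneg (fun i _ => sq_nonneg _)).1 h5 i (mem_univ i))
  obtain ⟨χ, hχ⟩ := L.diag_ws H (h1 _ (by simp))
  rw [hχ r hr]
  simp [h4]

lemma ws_injective (D : S.Chev) : Function.Injective S.ws := by
  intro r s h
  have h1 : r - s = 0 ∧ s - r = 0 := by
    have h2 : S.ws (r - s) = S.ws (s - r) := by
      have e1 : r - s + (s + r - r) = s - r + (s + r - s) := by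
        ext i; simp only [Finsupp.add_apply, Finsupp.tsub_apply]; omega
      rw [add_tsub_cancel_right, add_comm s r, add_tsub_cancel_right] at e1
      have e2 := congrArg S.ws e1
      rw [map_add, map_add, h] at e2
      exact add_right_cancel e2
    have hd : Disjoint (r - s).support (s - r).support := by
      rw [Finset.disjoint_left]
      intro i hi hi'
      simp only [Finsupp.mem_support_iff, Finsupp.tsub_apply] at hi hi'
      omega
    exact ⟨eq_zero_of_ws_eq D hd h2, eq_zero_of_ws_eq D hd.symm h2.symm⟩
  ext i
  have e1 := DFunLike.congr_fun h1.1 i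
  have e2 := DFunLike.congr_fun h1.2 i
  simp only [Finsupp.tsub_apply, Finsupp.zero_apply] at e1 e2
  omega

open Classical in
variable (S) in
/-- The coefficients of a weight in terms of simple roots. -/
def cf (α : Dual K S.h) : S.Simp →₀ ℕ := if h : ∃ r, S.ws r = α then h.choose else 0

lemma ws_cf (D : S.Chev) (hα : α ∈ S.pos) : S.ws (S.cf α) = α := by
  have h := exists_ws D hα
  rw [cf, dif_pos h]
  exact h.choose_spec

lemma cf_ws (D : S.Chev) (r : S.Simp →₀ ℕ) : S.cf (S.ws r) = r := by
  have h : ∃ s, S.ws s = S.ws r := ⟨r, rfl⟩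
  rw [cf, dif_pos h]
  exact ws_injective D h.choose_spec

lemma cf_eq (D : S.Chev) {r : S.Simp →₀ ℕ} (h : S.ws r = α) : S.cf α = r := by
  rw [← h, cf_ws D]

lemma cf_simple (D : S.Chev) (β : S.Simp) : S.cf β.1 = single β 1 :=
  cf_eq D (by rw [ws_single, one_smul])

lemma cf_add (D : S.Chev) (hα : α ∈ S.pos) (hβ : β ∈ S.pos) : S.cf (α + β) = S.cf α + S.cf β :=
  cf_eq D (by rw [map_add, ws_cf D hα, ws_cf D hβ])

lemma cf_ne_zero (D : S.Chev) (hα : α ∈ S.pos) : S.cf α ≠ 0 := by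
  intro h
  have := ws_cf D hα
  rw [h, map_zero] at this
  exact zero_notMem_pos (this ▸ hα)

/-- A simple reflection permutes the other positive roots. -/
lemma simple_reflect_mem (β : S.Simp) (hα : α ∈ S.pos) (hne : α ≠ β.1) :
    α - α (D.c β.1) • β.1 ∈ S.pos := by
  obtain ⟨z, hz⟩ := D.int β.2.1 (Or.inl hα)
  rcases D.isRt_reflect β.2.1 (Or.inl hα) with h | h
  · exact h
  exfalso
  have h1 : S.ws (S.cf α + S.cf (-(α - α (D.c β.1) • β.1)) + z.natAbs • single β 1) =
      S.ws ((z.natAbs + z).toNat • single β 1) := by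
    rw [map_add, map_add, ws_cf D hα, ws_cf D h, map_nsmul, map_nsmul, ws_single, one_smul, hz]
    have : (((z.natAbs + z).toNat : ℕ) : K) = z.natAbs + z := by
      have : (((z.natAbs + z).toNat : ℕ) : ℤ) = z.natAbs + z := Int.toNat_of_nonneg (by omega)
      have := congrArg (Int.cast : ℤ → K) this
      rwa [Int.cast_natCast, Int.cast_add, Int.cast_natCast] at this
    rw [← cast_smul_eq_nsmul K, ← cast_smul_eq_nsmul K, this]
    refine LinearMap.ext fun x => ?_
    simp
    ring
  have h2 := ws_injective D h1
  have h3 : ∀ γ ≠ β, S.cf α γ = 0 := by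
    intro γ hγ
    have := DFunLike.congr_fun h2 γ
    simp only [Finsupp.add_apply, Finsupp.smul_apply, single_eq_of_ne hγ] at this
    simp only [smul_zero] at this
    omega
  have h4 : S.cf α = single β (S.cf α β) := by
    ext γ
    by_cases hγ : γ = β
    · rw [hγ, single_eq_same]
    · rw [h3 γ hγ, single_eq_of_ne hγ]
  have h5 := ws_cf D hα
  rw [h4, ws_single] at h5
  have h6 := D.eq_one_of_nsmul_mem β.2.1 (h5 ▸ hα)
  rw [h6, one_smul] at h5
  exact hne h5.symm

lemma exists_apply_pos (hα : α ∈ S.pos) :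
    ∃ β ∈ (S.cf α).support, ∃ m : ℕ, β.1 (D.c α) = (m + 1 : ℕ) := by
  by_contra! hc
  have key : ∀ s ⊆ (S.cf α).support, ∃ k : ℕ, ∑ β ∈ s, (S.cf α β : K) * β.1 (D.c α) = -(k : K) := by
    classical
    intro s
    induction s using Finset.induction_on with
    | empty => exact fun _ => ⟨0, by simp⟩
    | insert β s hβ ih =>
      intro hs
      obtain ⟨k, hk⟩ := ih ((Finset.subset_insert _ _).trans hs)
      obtain ⟨z, hz⟩ := D.int hα (Or.inl β.2.1)
      obtain ⟨m, rfl | rfl⟩ := z.eq_nat_or_neg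
      · rcases m with _ | m
        · exact ⟨k, by rw [Finset.sum_insert hβ, hk, hz]; simp⟩
        · exact absurd (by rw [hz]; push_cast; ring) (hc β (hs (Finset.mem_insert_self _ _)) m)
      · refine ⟨S.cf α β * m + k, ?_⟩
        rw [Finset.sum_insert hβ, hk, hz]; push_cast; ring
  obtain ⟨k, hk⟩ := key _ subset_rfl
  have h1 := (D.tri α hα).two
  nth_rewrite 1 [← ws_cf D hα] at h1
  rw [ws_eq_sum, Finsupp.sum, LinearMap.sum_apply] at h1
  simp only [LinearMap.smul_apply, nsmul_eq_mul] at h1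
  rw [hk] at h1
  have h2 : (2 + k : ℕ) = 0 := by
    have h3 : ((2 + k : ℕ) : K) = 0 := by push_cast; rw [← h1]; ring
    exact_mod_cast h3
  omega

/-- The coroot pairings of two roots have the same sign. -/
lemma apply_pos_symm (hα : α ∈ S.pos) (hβ : β ∈ S.pos) {m : ℕ} (h : β (D.c α) = (m + 1 : ℕ)) :
    ∃ k : ℕ, α (D.c β) = (k + 1 : ℕ) := by
  classical
  obtain ⟨n, -, hn⟩ := D.exists_lev {α, β} (by simp [hα, hβ]) ∅
  obtain ⟨L⟩ := nonempty_lform D n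
  have hαn := hn α (by simp)
  have hβn := hn β (by simp)
  obtain ⟨z, hz⟩ := D.int hβ (Or.inl hα)
  rw [L.gram β hβn α hαn] at h
  have h' := L.gram α hαn β hβn
  rw [hz] at h'
  have e1 : L.b α * ∑ i, L.a i β * L.a i α = ((m + 1 : ℕ) : ℚ) := by exact_mod_cast h
  have e2 : (z : ℚ) = L.b β * ∑ i, L.a i α * L.a i β := by exact_mod_cast h'
  have e3 : ∑ i, L.a i α * L.a i β = ∑ i, L.a i β * L.a i α :=
    sum_congr rfl fun i _ => mul_comm _ _
  have hb := L.b_pos α hαn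
  have hb' := L.b_pos β hβn
  have e4 : 0 < ∑ i, L.a i β * L.a i α := by
    refine pos_of_mul_pos_right ?_ hb.le
    rw [e1]; positivity
  have e5 : (0 : ℚ) < z := by rw [e2, e3]; exact mul_pos hb' e4
  have e6 : 0 < z := by exact_mod_cast e5
  refine ⟨(z - 1).toNat, ?_⟩
  rw [hz]
  have : (((z - 1).toNat + 1 : ℕ) : ℤ) = z := by omega
  exact_mod_cast (congrArg (Int.cast : ℤ → K) this).symm

lemma exists_sub_simple (hα : α ∈ S.pos) (hs : ¬ S.IsSimpleRoot α) :
    ∃ β : S.Simp, α - β.1 ∈ S.pos ∧ ∃ m : ℕ, α (D.c β.1) = (m + 1 : ℕ) := by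
  obtain ⟨β, -, m, hm⟩ := exists_apply_pos D hα
  obtain ⟨k, hk⟩ := apply_pos_symm D hα β.2.1 hm
  refine ⟨β, ?_, k, hk⟩
  rcases D.sub_isRt β.2.1 (Or.inl hα) (fun h => hs (h ▸ β.2)) hk with h | h
  · exact h
  · exfalso
    rw [neg_sub] at h
    refine β.2.2 ⟨{β.1 - α, α}, by simp, ?_, by simp⟩
    intro δ hδ
    simp at hδ
    rcases hδ with rfl | rfl
    · exact h
    · exact hα

/-- Induction on positive roots by adding simple roots. -/
lemma pos_induction (D : S.Chev) {P : Dual K S.h → Prop} (h1 : ∀ β : S.Simp, P β.1)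
    (h2 : ∀ (β : S.Simp) (α : Dual K S.h), α ∈ S.pos → β.1 + α ∈ S.pos → P α → P (β.1 + α))
    (hα : α ∈ S.pos) : P α := by
  induction hn : (S.cf α).degree using Nat.strong_induction_on generalizing α with
  | _ n ih =>
    by_cases hs : S.IsSimpleRoot α
    · exact h1 ⟨α, hs⟩
    obtain ⟨β, hβ, -⟩ := exists_sub_simple D hα hs
    have e : β.1 + (α - β.1) = α := by abel
    have h3 := cf_add D β.2.1 hβ
    rw [e, cf_simple D] at h3
    have h4 := h2 β (α - β.1) hβ (by rwa [e]) (ih _ (by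
      rw [← hn, h3, map_add, Finsupp.degree_single]; omega) hβ rfl)
    rwa [e] at h4

lemma support_cf_add (D : S.Chev) (hα : α ∈ S.pos) (hβ : β ∈ S.pos) {J : Set S.Simp} :
    ↑(S.cf (α + β)).support ⊆ J ↔ ↑(S.cf α).support ⊆ J ∧ ↑(S.cf β).support ⊆ J := by
  classical
  rw [cf_add D hα hβ]
  simp only [Set.subset_def, Finset.mem_coe, Finsupp.mem_support_iff, Finsupp.add_apply]
  constructor
  · intro h
    exact ⟨fun x hx => h x (by omega), fun x hx => h x (by omega)⟩
  · rintro ⟨h1, h2⟩ x hx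
    by_cases h3 : S.cf α x = 0
    · exact h2 x (by omega)
    · exact h1 x h3

lemma mem_lev_of_support {n : ℕ} {J : Set S.Simp} (hJ : ∀ β ∈ J, β.1 ∈ D.lev n) (hα : α ∈ S.pos)
    (h : ↑(S.cf α).support ⊆ J) : α ∈ D.lev n := by
  refine pos_induction D (P := fun α => ↑(S.cf α).support ⊆ J → α ∈ D.lev n)
    (fun β h => hJ β (h (by simp [cf_simple D]))) (fun β α hα hβα ih h => ?_) hα h
  · rw [support_cf_add D β.2.1 hα] at h
    exact D.add_mem_lev (hJ β (h.1 (by simp [cf_simple D]))) (ih h.2) hβα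

lemma lev_finite (n : ℕ) : (D.lev n).Finite := by
  haveI := S.F_findim n
  have h1 : LinearIndependent K (fun α : D.lev n => D.e α.1) :=
    (S.h_indep.comp Subtype.val_injective).linearIndependent _ (fun α => (D.tri α.1 α.2.1).he)
      (fun α => (D.tri α.1 α.2.1).e_ne_zero)
  have h2 : LinearIndependent K (fun α : D.lev n => (⟨D.e α.1, α.2.2.1⟩ : S.F n)) :=
    LinearIndependent.of_comp (S.F n).toSubmodule.subtype h1
  exact Set.finite_coe_iff.1 h2.finite

lemma finite_supported (D : S.Chev) (J : Finset S.Simp) :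
    {α | α ∈ S.pos ∧ (S.cf α).support ⊆ J}.Finite := by
  obtain ⟨n, -, h⟩ := exists_lev_simp D J ∅
  refine (lev_finite D n).subset fun α hα => mem_lev_of_support D (J := ↑J) h hα.1 ?_
  exact_mod_cast hα.2

namespace LForm

variable {D : S.Chev} {n : ℕ} (L : LForm D n)

/-- The bilinear form on combinations of simple roots. -/
def ip (r s : S.Simp →₀ ℕ) : ℚ := ∑ i, L.A i r * L.A i s

lemma ip_comm (r s : S.Simp →₀ ℕ) : L.ip r s = L.ip s r :=
  sum_congr rfl fun _ _ => mul_comm _ _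

lemma ip_add_left (r r' s : S.Simp →₀ ℕ) : L.ip (r + r') s = L.ip r s + L.ip r' s := by
  simp only [ip, map_add, add_mul, Finset.sum_add_distrib]

lemma ip_add_right (r s s' : S.Simp →₀ ℕ) : L.ip r (s + s') = L.ip r s + L.ip r s' := by
  rw [ip_comm, ip_add_left, L.ip_comm s, L.ip_comm s']

/-- The element of `h` dual to a combination of simple roots. -/
def t : (S.Simp →₀ ℕ) →+ S.h :=
  Finsupp.liftAddHom fun β => (multiplesHom _ ((L.b β.1 : K)⁻¹ • D.c β.1))

lemma t_single (β : S.Simp) (k : ℕ) : L.t (single β k) = k • (L.b β.1 : K)⁻¹ • D.c β.1 := by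
  simp [t]

lemma t_eq_sum (r : S.Simp →₀ ℕ) : L.t r = r.sum fun β k => k • (L.b β.1 : K)⁻¹ • D.c β.1 := by
  simp [t, Finsupp.sum]

lemma ws_t {r s : S.Simp →₀ ℕ} (hr : D.InLev n r) (hs : ∀ β ∈ s.support, β.1 ∈ D.lev n) :
    S.ws r (L.t s) = L.ip r s := by
  rw [t_eq_sum, Finsupp.sum, map_sum, ip]
  simp only [L.A_eq_sum _ s, Finsupp.sum, mul_sum]
  rw [sum_comm, Rat.cast_sum]
  refine sum_congr rfl fun β hβ => ?_
  have h0 : (L.b β.1 : K) ≠ 0 := by exact_mod_cast (L.b_pos _ (hs β hβ)).ne'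
  rw [map_nsmul, map_smul, L.ws_apply r hr (hs β hβ), smul_eq_mul, nsmul_eq_mul,
    inv_mul_cancel_left₀ h0, ← Rat.cast_natCast, ← Rat.cast_mul, mul_sum]
  congr 1
  exact sum_congr rfl fun i _ => by ring

lemma a_and_c_eq {J : Set S.Simp} (hJ : ∀ β ∈ J, β.1 ∈ D.lev n) (hα : α ∈ S.pos)
    (h : ↑(S.cf α).support ⊆ J) :
    (∀ i, L.A i (S.cf α) = L.a i α) ∧ L.t (S.cf α) = (L.b α : K)⁻¹ • D.c α := by
  refine pos_induction D (P := fun α => ↑(S.cf α).support ⊆ J →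
    (∀ i, L.A i (S.cf α) = L.a i α) ∧ L.t (S.cf α) = (L.b α : K)⁻¹ • D.c α)
    (fun β h => ?_) (fun β α hα hβα ih h => ?_) hα h
  · rw [cf_simple D]
    exact ⟨fun i => by simp [A_eq_sum], by simp [t_single]⟩
  · rw [support_cf_add D β.2.1 hα] at h
    have hβ : β ∈ J := h.1 (by simp [cf_simple D])
    have hαn := mem_lev_of_support D hJ hα h.2
    obtain ⟨h3, h4⟩ := ih h.2
    rw [cf_add D β.2.1 hα, cf_simple D]
    refine ⟨fun i => ?_, ?_⟩
    · rw [map_add, h3, L.a_add i _ (hJ β hβ) _ hαn hβα]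
      simp [A_eq_sum]
    · rw [map_add, h4, L.add _ (hJ β hβ) _ hαn hβα]
      simp [t_single]

end LForm

/-- A form covering a given finite set of positive roots. -/
lemma exists_lform (J : Finset S.Simp) : ∃ n, ∃ L : LForm D n,
    ∀ β ∈ J, β.1 ∈ D.lev n := by
  obtain ⟨n, -, h⟩ := exists_lev_simp D J ∅
  exact ⟨n, (nonempty_lform D n).some, h⟩

variable (S) in
lemma exists_sum_ne_zero (x : g) : ∃ (s : Finset (Dual K S.h)) (f : Dual K S.h → g),
    (∀ α, f α ∈ S.wt α) ∧ (∀ α ∈ s, f α ≠ 0) ∧ ∑ α ∈ s, f α = x := by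
  classical
  obtain ⟨s, f, hf, rfl⟩ := S.exists_sum x
  refine ⟨s.filter (fun α => f α ≠ 0), f, hf, fun α hα => (mem_filter.1 hα).2, ?_⟩
  exact Finset.sum_filter_ne_zero s

lemma mem_insert_pos_of_mem_b {δ : Dual K S.h} (hx : x ∈ S.wt δ) (hb : x ∈ S.b) (hx0 : x ≠ 0) :
    δ ∈ insert 0 S.pos := mem_of_mem_iSup_wt hx (b_le hb) hx0

variable {n : ℕ} {γ : Dual K (S.hn n)} {e x : g}

lemma mem_h_of_weight_zero (hx : x ∈ S.F n) (h : x ∈ adWeightSpace K g (S.hn n) γ) (h0 : γ = 0) :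
    x ∈ S.h := by
  refine S.mem_h_of_commute n hx fun y hy => ?_
  rw [show y = ((⟨y, hy⟩ : S.hn n) : g) from rfl, h ⟨y, hy⟩, h0, LinearMap.zero_apply, zero_smul]

lemma lie_mem_adWeightSpace (he : e ∈ S.wt α) (hx : x ∈ adWeightSpace K g (S.hn n) γ) :
    ⁅e, x⁆ ∈ adWeightSpace K g (S.hn n) (γ + S.resDual n α) := by
  intro y
  have h1 : ⁅(y : g), e⁆ = S.resDual n α y • e := he ⟨y, y.2.1⟩
  rw [leibniz_lie, h1, hx y, smul_lie, lie_smul, LinearMap.add_apply]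
  module

lemma pow_mem_adWeightSpace (he : e ∈ S.wt α) (hx : x ∈ adWeightSpace K g (S.hn n) γ) (m : ℕ) :
    ((ad K g e) ^ m) x ∈ adWeightSpace K g (S.hn n) (γ + (m : K) • S.resDual n α) := by
  induction m with
  | zero => simpa using hx
  | succ m ih =>
    rw [pow_succ', End.mul_apply, ad_apply]
    have := lie_mem_adWeightSpace he ih
    rwa [add_assoc, show (m : K) • S.resDual n α + S.resDual n α =
      ((m + 1 : ℕ) : K) • S.resDual n α by push_cast; module] at this

lemma adWeightSpace_stable (H : S.h) (x : g) (hx : x ∈ adWeightSpace K g (S.hn n) γ) :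
    ⁅(H : g), x⁆ ∈ adWeightSpace K g (S.hn n) γ := by
  intro y
  rw [leibniz_lie, lie_h y.2.1 H.2, zero_lie, zero_add, hx y, lie_smul]

lemma component_eq {s : Finset (Dual K S.h)} {f : Dual K S.h → g} (hf : ∀ α, f α ∈ S.wt α)
    (h0 : ∀ α ∈ s, f α ≠ 0) (hx : ∑ α ∈ s, f α ∈ adWeightSpace K g (S.hn n) γ) {δ : Dual K S.h}
    (hδ : δ ∈ s) : S.resDual n δ = γ := by
  have h1 := component_mem adWeightSpace_stable s f hf hx hδ
  refine LinearMap.ext fun y => ?_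
  have h2 : ⁅(y : g), f δ⁆ = S.resDual n δ y • f δ := hf δ ⟨y, y.2.1⟩
  rw [h1 y] at h2
  exact (smul_left_injective K (h0 δ hδ) h2).symm

lemma pow_ad_lie_h (he : e ∈ S.wt α) (H : S.h) (m : ℕ) (x : g) :
    ((ad K g e) ^ m) ⁅(H : g), x⁆ =
      ⁅(H : g), ((ad K g e) ^ m) x⁆ - (m * α H) • ((ad K g e) ^ m) x := by
  induction m with
  | zero => simp
  | succ m ih =>
    rw [pow_succ', End.mul_apply, End.mul_apply, ih, map_sub, map_smul, ad_apply,
      ad_apply, leibniz_lie e (H : g), lie_of_mem_wt' he, neg_lie, smul_lie]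
    push_cast
    module

/-- The preimage of `b` under a power of `ad e` is stable under `h`. -/
lemma comap_b_stable (he : e ∈ S.wt α) (m : ℕ) (H : S.h) (x : g)
    (hx : x ∈ S.b.toSubmodule.comap ((ad K g e) ^ m)) :
    ⁅(H : g), x⁆ ∈ S.b.toSubmodule.comap ((ad K g e) ^ m) := by
  rw [Submodule.mem_comap] at hx ⊢
  rw [pow_ad_lie_h he]
  exact sub_mem (S.b.lie_mem (h_le_b H.2) hx) (smul_mem _ _ hx)

lemma comap_h_stable (he : e ∈ S.wt α) (H : S.h) (x : g) (hx : x ∈ S.h.toSubmodule.comap (ad K g e)) :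
    ⁅(H : g), x⁆ ∈ S.h.toSubmodule.comap (ad K g e) := by
  rw [Submodule.mem_comap] at hx ⊢
  have := pow_ad_lie_h he H 1 x
  rw [pow_one] at this
  rw [this]
  exact sub_mem (S.h.lie_mem H.2 hx) (smul_mem _ _ hx)

lemma posRootsN_reflect {e f : g} {u : S.h} (T : S.Tri α e f u) (he : e ∈ S.F n) (hf : f ∈ S.F n)
    (hs : ∀ δ ∈ S.pos, δ ≠ β → δ - δ u • α ∈ S.pos) (hγ : γ ∈ S.posRootsN n)
    (hne : γ ≠ S.resDual n β) (uh : S.hn n) (hu : (uh : g) = u) {m : ℕ} (hm : γ uh = m) :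
    γ - (m : K) • S.resDual n α ∈ S.posRootsN n := by
  obtain ⟨h0, h1, h2⟩ := hγ
  have hα2 : S.resDual n α uh = 2 := by
    rw [← T.two]
    exact congrArg α (Subtype.ext hu)
  have hlow : ∀ x ∈ S.rootSpaceN n γ,
      ((ad K g f) ^ m) x ∈ S.rootSpaceN n (γ - (m : K) • S.resDual n α) := by
    intro x hx
    refine ⟨pow_ad_mem_F hf hx.1 m, ?_⟩
    have := pow_mem_adWeightSpace T.hf hx.2 m
    rwa [show γ + (m : K) • S.resDual n (-α) = γ - (m : K) • S.resDual n α by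
      rw [show S.resDual n (-α) = -S.resDual n α from rfl]; module] at this
  refine ⟨fun h => h0 ?_, ?_, ?_⟩
  · have h3 := congrArg (fun φ : Dual K (S.hn n) => φ uh) h
    simp only [LinearMap.sub_apply, LinearMap.smul_apply, hm, hα2, LinearMap.zero_apply,
      smul_eq_mul] at h3
    have h4 : (m : K) = 0 := by linear_combination -h3
    rw [h4] at h
    rw [← h]; module
  · obtain ⟨x, hx, hx0⟩ := exists_mem_ne_zero_of_ne_bot h1
    intro h
    obtain ⟨k, hk⟩ := T.nil_e x
    refine T.ops.pow_f_ne_zero (m := m) (i := m) ?_ hx0 hk le_rfl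
      ((Submodule.mem_bot K).1 (h ▸ hlow x hx))
    rw [ad_apply, ← hu, hx.2 uh, hm]
  · intro z hz
    obtain ⟨s, c, hc, hc0, rfl⟩ := S.exists_sum_ne_zero z
    refine sum_mem fun δ hδ => ?_
    have h3 : ∑ δ ∈ s, c δ ∈ S.b.toSubmodule.comap ((ad K g e) ^ m) := by
      refine h2 ⟨pow_ad_mem_F he hz.1 m, ?_⟩
      have := pow_mem_adWeightSpace T.he hz.2 m
      rwa [sub_add_cancel] at this
    have h4 := component_mem (comap_b_stable T.he m) s c hc h3 hδ
    have h5 := component_eq hc hc0 hz.2 hδ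
    have h6 : δ u = -(m : K) := by
      have h7 : S.resDual n δ uh = δ u := congrArg δ (Subtype.ext hu)
      rw [← h7, h5, LinearMap.sub_apply, LinearMap.smul_apply, hα2, hm, smul_eq_mul]; ring
    have h8 : ((ad K g e) ^ m) (c δ) ≠ 0 := T.symm.pow_f_ne_zero (hc δ) (hc0 δ hδ) (m := m)
      (by rw [map_neg, h6, neg_neg]) le_rfl
    have h9 : S.resDual n (δ + m • α) = γ := by
      rw [show S.resDual n (δ + m • α) = S.resDual n δ + m • S.resDual n α from rfl, h5,
        ← cast_smul_eq_nsmul K]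
      module
    rcases mem_insert_pos_of_mem_b (pow_ad_mem T.he (hc δ) m) h4 h8 with h10 | h10
    · exact absurd (by rw [← h9, h10]; rfl) h0
    · have h11 := hs _ h10 (fun h => hne (by rw [← h9, h]))
      rw [LinearMap.add_apply, h6, LinearMap.smul_apply, T.two,
        show δ + m • α - (-(m : K) + m • (2 : K)) • α = δ by
          rw [nsmul_eq_mul, ← cast_smul_eq_nsmul K]; module] at h11
      exact wt_le_b h11 (hc δ)

variable (S) in
lemma posRootsN_finite (n : ℕ) : (S.posRootsN n).Finite := by
  obtain ⟨m, v, χ, hv⟩ := S.exists_eigen n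
  refine (Set.finite_range χ).subset ?_
  rintro γ ⟨-, h1, -⟩
  obtain ⟨x, hx, hx0⟩ := exists_mem_ne_zero_of_ne_bot h1
  obtain ⟨i, hi⟩ : ∃ i, v.repr ⟨x, hx.1⟩ i ≠ 0 := by
    by_contra! hc
    refine hx0 (congrArg Subtype.val (v.repr.injective (a₁ := ⟨x, hx.1⟩) (a₂ := 0) ?_))
    rw [map_zero]
    exact Finsupp.ext hc
  refine ⟨i, LinearMap.ext fun y => ?_⟩
  have h2 : ad K (S.F n) ⟨y, y.2.2⟩ ⟨x, hx.1⟩ = γ y • (⟨x, hx.1⟩ : S.F n) :=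
    Subtype.ext (hx.2 y)
  have h3 : v.repr (ad K (S.F n) ⟨y, y.2.2⟩ ⟨x, hx.1⟩) i = χ i y * v.repr ⟨x, hx.1⟩ i := by
    have h4 : (v.coord i ∘ₗ ad K (S.F n) ⟨y, y.2.2⟩) = χ i y • v.coord i := by
      refine v.ext fun j => ?_
      have h5 : ad K (S.F n) ⟨y, y.2.2⟩ (v j) = χ j y • v j := Subtype.ext (hv j y)
      rw [LinearMap.comp_apply, h5, map_smul, LinearMap.smul_apply, Basis.coord_apply,
        Basis.repr_self, smul_eq_mul, smul_eq_mul]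
      by_cases hij : j = i
      · rw [hij]
      · rw [single_eq_of_ne (Ne.symm hij), mul_zero, mul_zero]
    exact LinearMap.congr_fun h4 _
  rw [h2, map_smul, Finsupp.smul_apply, smul_eq_mul] at h3
  exact (mul_right_cancel₀ hi h3).symm

lemma simple_mem_posRootsN {D : S.Chev} (β : S.Simp) (hn : β.1 ∈ D.lev n) :
    S.resDual n β.1 ∈ S.posRootsN n := by
  have T := D.tri β.1 β.2.1
  have h2 : S.resDual n β.1 ⟨D.c β.1, (D.c β.1).2, Chev.c_mem hn⟩ = 2 := T.two
  refine ⟨fun h => ?_, fun h => ?_, fun x hx => ?_⟩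
  · rw [h, LinearMap.zero_apply] at h2
    exact two_ne_zero h2.symm
  · have he : D.e β.1 ∈ S.rootSpaceN n (S.resDual n β.1) :=
      ⟨hn.2.1, fun y => T.he ⟨y, y.2.1⟩⟩
    rw [h] at he
    exact T.e_ne_zero ((Submodule.mem_bot K).1 he)
  · have h3 : x ∈ S.h.toSubmodule.comap (ad K g (D.f β.1)) := by
      refine mem_h_of_weight_zero ((S.F n).lie_mem hn.2.2 hx.1)
        (lie_mem_adWeightSpace T.hf hx.2) ?_
      exact LinearMap.ext fun y => add_neg_cancel (β.1 _)
    obtain ⟨s, c, hc, hc0, rfl⟩ := S.exists_sum_ne_zero x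
    refine sum_mem fun δ hδ => ?_
    by_cases hδβ : δ = β.1
    · exact wt_le_b (hδβ ▸ β.2.1) (hc δ)
    exfalso
    have h4 := component_mem (comap_h_stable T.hf) s c hc h3 hδ
    have h5 : ⁅D.f β.1, c δ⁆ = 0 :=
      wt_disjoint (fun h => hδβ (neg_add_eq_zero.1 h).symm) (lie_mem_wt T.hf (hc δ))
        (mem_wt_zero.2 h4)
    have h6 : δ (D.c β.1) = (2 : ℕ) := by
      rw [Nat.cast_ofNat, ← h2, ← component_eq hc hc0 hx.2 hδ]; rfl
    refine hc0 δ hδ (T.eq_zero_of_pow (hc δ) h6 ?_)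
    rw [pow_two, End.mul_apply, ad_apply, ad_apply, h5, lie_zero]

lemma posRootsN_int {D : S.Chev} (β : S.Simp) (hn : β.1 ∈ D.lev n) (hγ : γ ∈ S.posRootsN n) :
    ∃ z : ℤ, γ ⟨D.c β.1, (D.c β.1).2, Chev.c_mem hn⟩ = z := by
  obtain ⟨x, hx, hx0⟩ := exists_mem_ne_zero_of_ne_bot hγ.2.1
  have T := D.tri β.1 β.2.1
  obtain ⟨k, hk⟩ := T.nil_e x
  exact T.ops.exists_int (hx.2 ⟨D.c β.1, (D.c β.1).2, Chev.c_mem hn⟩) hx0 hk T.nil_f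

lemma posRootsN_simple_reflect {D : S.Chev} (β : S.Simp) (hn : β.1 ∈ D.lev n)
    (hγ : γ ∈ S.posRootsN n) (hne : γ ≠ S.resDual n β.1) :
    γ - γ ⟨D.c β.1, (D.c β.1).2, Chev.c_mem hn⟩ • S.resDual n β.1 ∈ S.posRootsN n ∧
    γ - γ ⟨D.c β.1, (D.c β.1).2, Chev.c_mem hn⟩ • S.resDual n β.1 ≠ S.resDual n β.1 := by
  have T := D.tri β.1 β.2.1
  set uh : S.hn n := ⟨D.c β.1, (D.c β.1).2, Chev.c_mem hn⟩ with huh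
  have h2 : S.resDual n β.1 uh = 2 := T.two
  obtain ⟨z, hz⟩ := posRootsN_int β hn hγ
  rw [← huh] at hz
  constructor
  · obtain ⟨m, rfl | rfl⟩ := z.eq_nat_or_neg
    · rw [hz, Int.cast_natCast]
      exact posRootsN_reflect T hn.2.1 hn.2.2 (fun δ hδ h => simple_reflect_mem D β hδ h) hγ hne
        uh rfl (by rw [hz, Int.cast_natCast])
    · have := posRootsN_reflect T.symm hn.2.2 hn.2.1 (β := β.1) (fun δ hδ h => by
        have := simple_reflect_mem D β hδ h
        rwa [map_neg, smul_neg, neg_smul, neg_neg]) hγ hne (-uh) rfl (m := m) (by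
          rw [map_neg, hz]; push_cast; ring)
      rw [hz]
      rw [show S.resDual n (-β.1) = -S.resDual n β.1 from rfl] at this
      convert this using 1
      push_cast
      module
  · intro h
    have h3 := congrArg (fun φ : Dual K (S.hn n) => φ uh) h
    simp only [LinearMap.sub_apply, LinearMap.smul_apply, h2, smul_eq_mul] at h3
    have h4 : γ uh = -2 := by linear_combination -h3
    have h5 : γ = -S.resDual n β.1 := by
      rw [h4] at h
      rw [sub_eq_iff_eq_add.1 h]
      module
    obtain ⟨x, hx, hx0⟩ := exists_mem_ne_zero_of_ne_bot hγ.2.1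
    have hb : x ∈ S.b.toSubmodule := hγ.2.2 hx
    have h6 : x ∈ S.h.toSubmodule.comap (ad K g (D.e β.1)) := by
      refine mem_h_of_weight_zero ((S.F n).lie_mem hn.2.1 hx.1)
        (lie_mem_adWeightSpace T.he hx.2) ?_
      rw [h5, neg_add_cancel]
    obtain ⟨s, c, hc, hc0, rfl⟩ := S.exists_sum_ne_zero x
    refine hx0 (sum_eq_zero fun δ hδ => ?_)
    have h7 := component_mem (fun H y hy => S.b.lie_mem (h_le_b H.2) hy) s c hc hb hδ
    have h8 := component_eq hc hc0 hx.2 hδ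
    have h9 := component_mem (comap_h_stable T.he) s c hc h6 hδ
    have h10 : δ ∈ S.pos := by
      rcases mem_insert_pos_of_mem_b (hc δ) h7 (hc0 δ hδ) with h | h
      · exact absurd (by rw [← h8, h]; rfl) hγ.1
      · exact h
    have h11 : ⁅D.e β.1, c δ⁆ = 0 :=
      wt_disjoint (add_ne_zero_of_pos β.2.1 h10) (lie_mem_wt T.he (hc δ)) (mem_wt_zero.2 h9)
    have h12 : δ (-D.c β.1) = (2 : ℕ) := by
      rw [map_neg, Nat.cast_ofNat, ← neg_neg (2 : K), ← h4, ← h8]; rfl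
    refine T.symm.eq_zero_of_pow (hc δ) h12 ?_
    rw [pow_two, End.mul_apply, ad_apply, ad_apply, h11, lie_zero]

/-- The half sum of positive roots takes value one on simple coroots. -/
theorem rho_simple (hρ : S.IsGlobalRho ρ) (β : S.Simp) : ρ (D.c β.1) = 1 := by
  classical
  obtain ⟨n, -, hn⟩ := exists_lev_simp D {β} ∅
  replace hn := hn β (by simp)
  set uh : S.hn n := ⟨D.c β.1, (D.c β.1).2, Chev.c_mem hn⟩ with huh
  have h2 : S.resDual n β.1 uh = 2 := (D.tri β.1 β.2.1).two
  have h1 : ρ (D.c β.1) = S.rhoN n uh := by rw [← hρ n]; rfl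
  rw [h1, rhoN, finsum_mem_eq_finite_toFinset_sum _ (S.posRootsN_finite n)]
  set P := (S.posRootsN_finite n).toFinset with hP
  have hmem : ∀ γ, γ ∈ P ↔ γ ∈ S.posRootsN n := fun γ => Set.Finite.mem_toFinset _
  have hβ : S.resDual n β.1 ∈ P := (hmem _).2 (simple_mem_posRootsN β hn)
  rw [← Finset.add_sum_erase P _ hβ]
  have h3 : ∑ γ ∈ P.erase (S.resDual n β.1), γ uh = 0 := by
    let σ : Dual K (S.hn n) → Dual K (S.hn n) := fun γ => γ - γ uh • S.resDual n β.1
    have hσ : ∀ γ ∈ P.erase (S.resDual n β.1), σ γ ∈ P.erase (S.resDual n β.1) := by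
      intro γ hγ
      rw [Finset.mem_erase, hmem] at hγ ⊢
      have := posRootsN_simple_reflect β hn hγ.2 hγ.1
      exact ⟨this.2, this.1⟩
    have hval : ∀ γ, σ γ uh = -γ uh := by
      intro γ
      simp only [σ, LinearMap.sub_apply, LinearMap.smul_apply, h2, smul_eq_mul]; ring
    have hinv : ∀ γ, σ (σ γ) = γ := by
      intro γ
      show σ γ - σ γ uh • S.resDual n β.1 = γ
      rw [hval]
      simp only [σ]; module
    have h4 : ∑ γ ∈ P.erase (S.resDual n β.1), γ uh =
        ∑ γ ∈ P.erase (S.resDual n β.1), -γ uh :=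
      Finset.sum_nbij' σ σ hσ hσ (fun γ _ => hinv γ) (fun γ _ => hinv γ)
        (fun γ _ => by rw [hval, neg_neg])
    rw [Finset.sum_neg_distrib] at h4
    exact self_eq_neg.1 h4
  rw [LinearMap.smul_apply, LinearMap.add_apply, LinearMap.sum_apply, h3, h2, add_zero,
    smul_eq_mul, inv_mul_cancel₀ two_ne_zero]

lemma neg_one_smul_dual (γ : Dual K S.h) : (-1 : K) • γ = -γ := by module

lemma exists_reflect (hα : α ∈ S.pos) (hβ : β ∈ S.pos) :
    ∃ γ ∈ S.pos, ∃ ε : K, (ε = 1 ∨ ε = -1) ∧ β - β (D.c α) • α = ε • γ ∧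
      D.c β - α (D.c β) • D.c α = ε • D.c γ := by
  classical
  obtain ⟨γ, hγ, ε, hε, h1⟩ : ∃ γ ∈ S.pos, ∃ ε : K, (ε = 1 ∨ ε = -1) ∧
      β - β (D.c α) • α = ε • γ := by
    rcases D.isRt_reflect hα (Or.inl hβ) with h | h
    · exact ⟨_, h, 1, Or.inl rfl, (one_smul _ _).symm⟩
    · exact ⟨_, h, -1, Or.inr rfl, by rw [neg_one_smul_dual, neg_neg]⟩
  refine ⟨γ, hγ, ε, hε, h1, ?_⟩
  obtain ⟨m, hm⟩ := D.int hα (Or.inl hβ)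
  obtain ⟨n, L, hJ⟩ := exists_lform D ((S.cf α).support ∪ (S.cf β).support ∪ (S.cf γ).support)
  have hJ' : ∀ δ ∈ (((S.cf α).support ∪ (S.cf β).support ∪ (S.cf γ).support : Finset _) :
      Set S.Simp), δ.1 ∈ D.lev n := fun δ hδ => hJ δ hδ
  have sα : ((S.cf α).support : Set S.Simp) ⊆
      (((S.cf α).support ∪ (S.cf β).support ∪ (S.cf γ).support : Finset _)) := fun δ hδ => by
    simp only [Finset.mem_coe, Finset.mem_union] at hδ ⊢; tauto
  have sβ : ((S.cf β).support : Set S.Simp) ⊆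
      (((S.cf α).support ∪ (S.cf β).support ∪ (S.cf γ).support : Finset _)) := fun δ hδ => by
    simp only [Finset.mem_coe, Finset.mem_union] at hδ ⊢; tauto
  have sγ : ((S.cf γ).support : Set S.Simp) ⊆
      (((S.cf α).support ∪ (S.cf β).support ∪ (S.cf γ).support : Finset _)) := fun δ hδ => by
    simp only [Finset.mem_coe, Finset.mem_union] at hδ ⊢; tauto
  have lα := mem_lev_of_support D hJ' hα sα
  have lβ := mem_lev_of_support D hJ' hβ sβ
  have lγ := mem_lev_of_support D hJ' hγ sγ
  have cα := (L.a_and_c_eq hJ' hα sα).2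
  have cβ := (L.a_and_c_eq hJ' hβ sβ).2
  have cγ := (L.a_and_c_eq hJ' hγ sγ).2
  have hmm : (m : K) = (m.toNat : K) - ((-m).toNat : K) := by
    have : m = (m.toNat : ℤ) - ((-m).toNat : ℤ) := by omega
    calc (m : K) = (((m.toNat : ℤ) - ((-m).toNat : ℤ) : ℤ) : K) := by rw [← this]
      _ = _ := by push_cast; rfl
  have h2 : (L.b β : K)⁻¹ • D.c β - (m : K) • (L.b α : K)⁻¹ • D.c α =
      ε • (L.b γ : K)⁻¹ • D.c γ := by
    rw [← cα, ← cβ, ← cγ, hmm]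
    rw [hm, hmm, sub_eq_iff_eq_add] at h1
    rcases hε with rfl | rfl
    · have h3 : S.cf β + (-m).toNat • S.cf α = S.cf γ + m.toNat • S.cf α := by
        apply ws_injective D
        rw [map_add, map_add, map_nsmul, map_nsmul, ws_cf D hα, ws_cf D hβ, ws_cf D hγ, h1]
        simp only [← cast_smul_eq_nsmul K]; module
      have h4 := congrArg L.t h3
      rw [map_add, map_add, map_nsmul, map_nsmul] at h4
      rw [eq_sub_of_add_eq h4]
      simp only [← cast_smul_eq_nsmul K]; module
    · have h3 : S.cf β + (-m).toNat • S.cf α + S.cf γ = m.toNat • S.cf α := by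
        apply ws_injective D
        rw [map_add, map_add, map_nsmul, map_nsmul, ws_cf D hα, ws_cf D hβ, ws_cf D hγ, h1]
        simp only [← cast_smul_eq_nsmul K]; module
      have h4 := congrArg L.t h3
      rw [map_add, map_add, map_nsmul, map_nsmul, add_assoc] at h4
      rw [eq_sub_of_add_eq h4]
      simp only [← cast_smul_eq_nsmul K]; module
  have bα : (L.b α : K) ≠ 0 := by exact_mod_cast (L.b_pos _ lα).ne'
  have bβ : (L.b β : K) ≠ 0 := by exact_mod_cast (L.b_pos _ lβ).ne'
  have bγ : (L.b γ : K) ≠ 0 := by exact_mod_cast (L.b_pos _ lγ).ne'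
  have g1 := L.gram β lβ α lα
  have g2 := L.gram α lα β lβ
  have h5 : D.c β - α (D.c β) • D.c α = ((L.b β : K) * (L.b γ : K)⁻¹) • ε • D.c γ := by
    have : D.c β - α (D.c β) • D.c α =
        (L.b β : K) • ((L.b β : K)⁻¹ • D.c β - (m : K) • (L.b α : K)⁻¹ • D.c α) := by
      rw [smul_sub, smul_smul, mul_inv_cancel₀ bβ, one_smul, smul_smul, smul_smul]
      congr 2
      rw [hm] at g1
      rw [g1, g2]
      have : ∑ i, L.a i α * L.a i β = ∑ i, L.a i β * L.a i α :=
        sum_congr rfl fun _ _ => mul_comm _ _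
      rw [this]
      field_simp
    rw [this, h2]
    simp only [smul_smul]; congr 1; ring
  have h6 := congrArg (β - β (D.c α) • α) h5
  rw [h1] at h6
  have two : ∀ {δ}, δ ∈ S.pos → δ (D.c δ) = 2 := fun h => (D.tri _ h).two
  have hl : (ε • γ) (D.c β - α (D.c β) • D.c α) = 2 := by
    rw [← h1]
    simp only [map_sub, map_smul, LinearMap.sub_apply, LinearMap.smul_apply, smul_eq_mul, two hα,
      two hβ]
    ring
  rw [hl] at h6
  simp only [map_smul, LinearMap.smul_apply, smul_eq_mul, two hγ] at h6
  have hεε : ε * ε = 1 := by rcases hε with rfl | rfl <;> ring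
  have h7 : (L.b β : K) * (L.b γ : K)⁻¹ = 1 := by
    linear_combination (-1 / 2 : K) * h6 + (-(L.b β : K) * (L.b γ : K)⁻¹) * hεε
  rw [h5, h7, one_smul]

/-- The positive roots on which `μ + ρ` takes a positive integral value. -/
def Chev.badSet (D : S.Chev) (ρ μ : Dual K S.h) : Set (Dual K S.h) :=
  {β | β ∈ S.pos ∧ ∃ k : ℕ, 0 < k ∧ (μ + ρ) (D.c β) = k}

lemma isAlmostAntidominant_iff : S.IsAlmostAntidominant ρ μ ↔ (D.badSet ρ μ).Finite := by
  rw [IsAlmostAntidominant, Chev.badSet]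
  refine iff_of_eq (congrArg _ (Set.ext fun β => and_congr_right fun hβ => ?_))
  simp only [D.coroot_eq hβ, exists_eq_left]

lemma isAntidominant_iff : S.IsAntidominant ρ μ ↔ D.badSet ρ μ = ∅ := by
  rw [Set.eq_empty_iff_forall_notMem]
  refine ⟨fun h β hβ => h β hβ.1 _ ((D.coroot_eq hβ.1).2 rfl) hβ.2, fun h β hβ H hH hk => ?_⟩
  rw [D.coroot_eq hβ] at hH
  exact h β ⟨hβ, hH ▸ hk⟩

lemma dotReflect_reflect_apply {D : S.Chev} (hα : α ∈ S.pos) (μ : Dual K S.h) (H : S.h) :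
    (S.dotReflect ρ α (D.c α) μ + ρ) (H - α H • D.c α) = (μ + ρ) H := by
  have two : α (D.c α) = 2 := (D.tri _ hα).two
  simp only [dotReflect, map_sub, map_smul, LinearMap.sub_apply, LinearMap.add_apply,
    LinearMap.smul_apply, smul_eq_mul, two]
  ring

lemma reflect_reflect {D : S.Chev} (hα : α ∈ S.pos) (β : Dual K S.h) :
    (β - β (D.c α) • α) - (β - β (D.c α) • α) (D.c α) • α = β := by
  have two : α (D.c α) = 2 := (D.tri _ hα).two
  simp only [LinearMap.sub_apply, LinearMap.smul_apply, smul_eq_mul, two]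
  module

/-- A positive root made negative by `s_α` pairs positively with `α` and is supported on the
support of `α`. -/
lemma reflect_neg {γ : Dual K S.h} (hα : α ∈ S.pos) (hβ : β ∈ S.pos) (hγ : γ ∈ S.pos)
    (h : β - β (D.c α) • α = -γ) :
    (∃ m : ℕ, β (D.c α) = (m + 1 : ℕ)) ∧ (S.cf β).support ⊆ (S.cf α).support := by
  obtain ⟨z, hz⟩ := D.int hα (Or.inl hβ)
  have hpos : ∃ m : ℕ, β (D.c α) = (m + 1 : ℕ) := by
    rcases lt_or_ge 0 z with h0 | h0
    · obtain ⟨m, rfl⟩ := Int.eq_succ_of_zero_lt h0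
      exact ⟨m, by rw [hz]; push_cast; rfl⟩
    · exfalso
      obtain ⟨m, rfl⟩ : ∃ m : ℕ, z = -(m : ℤ) := ⟨(-z).toNat, by omega⟩
      have := eq_zero_of_sum_eq_zero D (β ::ₘ γ ::ₘ Multiset.replicate m α) (by
        intro δ hδ
        rw [Multiset.mem_cons, Multiset.mem_cons] at hδ
        rcases hδ with rfl | rfl | hδ
        · exact hβ
        · exact hγ
        · exact Multiset.eq_of_mem_replicate hδ ▸ hα) (by
        rw [Multiset.sum_cons, Multiset.sum_cons, Multiset.sum_replicate, ← neg_eq_iff_eq_neg.2 h,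
          hz, ← cast_smul_eq_nsmul K]
        push_cast
        module)
      simp at this
  refine ⟨hpos, ?_⟩
  obtain ⟨m, hm⟩ := hpos
  have h1 : S.cf β + S.cf γ = (m + 1) • S.cf α := by
    apply ws_injective D
    rw [map_add, map_nsmul, ws_cf D hα, ws_cf D hβ, ws_cf D hγ, ← neg_eq_iff_eq_neg.2 h, hm,
      ← cast_smul_eq_nsmul K]
    module
  intro δ hδ
  rw [Finsupp.mem_support_iff] at hδ ⊢
  intro h0
  have h2 := DFunLike.congr_fun h1 δ
  rw [Finsupp.smul_apply, h0, smul_zero, Finsupp.add_apply] at h2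
  omega

lemma finite_badSet_of_linked {ξ : Dual K S.h} (hξ : D.badSet ρ ξ = ∅) (h : S.StronglyLinked ρ ξ μ) :
    (D.badSet ρ μ).Finite := by
  induction h with
  | refl => rw [hξ]; exact Set.finite_empty
  | @step μ α H hα hH _ _ ih =>
    rw [D.coroot_eq hα] at hH
    subst hH
    refine ((ih.image fun γ => γ - γ (D.c α) • α).union
      (finite_supported D (S.cf α).support)).subset ?_
    rintro β ⟨hβ, k, hk, hk2⟩
    obtain ⟨γ, hγ, ε, hε, h1, h2⟩ := exists_reflect D hα hβ
    rw [← dotReflect_reflect_apply hα, h2] at hk2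
    rcases hε with rfl | rfl
    · left
      rw [one_smul] at h1 hk2
      exact ⟨γ, ⟨hγ, k, hk, hk2⟩, by rw [← h1]; exact reflect_reflect hα β⟩
    · right
      rw [neg_one_smul_dual] at h1
      exact ⟨hβ, (reflect_neg D hα hβ hγ h1).2⟩

lemma exists_linked (N : ℕ) :
    ∀ μ : Dual K S.h, (D.badSet ρ μ).Finite → (D.badSet ρ μ).ncard ≤ N →
      ∃ ξ, D.badSet ρ ξ = ∅ ∧ S.StronglyLinked ρ ξ μ := by
  classical
  induction N with
  | zero =>
    intro μ hf hN
    exact ⟨μ, (Set.ncard_eq_zero hf).1 (Nat.le_zero.1 hN), .refl μ⟩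
  | succ N ih =>
    intro μ hf hN
    rcases Set.eq_empty_or_nonempty (D.badSet ρ μ) with h0 | ⟨α, hα⟩
    · exact ⟨μ, h0, .refl μ⟩
    obtain ⟨hα, k, hk, hk2⟩ := id hα
    set ν := S.dotReflect ρ α (D.c α) μ with hν
    have hμν : S.dotReflect ρ α (D.c α) ν = μ := by
      have two : α (D.c α) = 2 := (D.tri _ hα).two
      simp only [hν, dotReflect, LinearMap.sub_apply, LinearMap.add_apply,
        LinearMap.smul_apply, smul_eq_mul, two]
      module
    let φ : Dual K S.h → Dual K S.h := fun β =>
      if β - β (D.c α) • α ∈ S.pos then β - β (D.c α) • α else β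
    have key : ∀ β ∈ D.badSet ρ ν, φ β ∈ D.badSet ρ μ \ {α} ∧
        (β - β (D.c α) • α ∉ S.pos → -(β - β (D.c α) • α) ∈ S.pos) := by
      rintro β ⟨hβ, l, hl, hl2⟩
      obtain ⟨γ, hγ, ε, hε, h1, h2⟩ := exists_reflect D hα hβ
      have h3 := dotReflect_reflect_apply (D := D) (ρ := ρ) hα ν (D.c β)
      rw [hμν, h2, hl2] at h3
      have hαr : α - α (D.c α) • α = -α := by
        have two : α (D.c α) = 2 := (D.tri _ hα).two
        rw [two]; module
      rcases hε with rfl | rfl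
      · rw [one_smul] at h1 h3
        have hp : β - β (D.c α) • α ∈ S.pos := h1 ▸ hγ
        refine ⟨?_, fun h => (h hp).elim⟩
        simp only [φ, if_pos hp]
        refine ⟨by rw [h1]; exact ⟨hγ, l, hl, h3⟩, fun h => ?_⟩
        have h4 := reflect_reflect (D := D) hα β
        rw [Set.mem_singleton_iff.1 h, hαr] at h4
        exact neg_notMem_pos hα (h4 ▸ hβ)
      · rw [neg_one_smul_dual] at h1
        have hp : β - β (D.c α) • α ∉ S.pos := h1 ▸ neg_notMem_pos hγ
        refine ⟨?_, fun _ => by rw [h1, neg_neg]; exact hγ⟩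
        simp only [φ, if_neg hp]
        obtain ⟨⟨m, hm⟩, -⟩ := reflect_neg D hα hβ hγ h1
        obtain ⟨m', hm'⟩ := apply_pos_symm D hα hβ hm
        have h5 : (μ + ρ) (D.c β) = (l + k * (m' + 1) : ℕ) := by
          have h6 : (ν + ρ) (D.c β) = (μ + ρ) (D.c β) - (μ + ρ) (D.c α) * α (D.c β) := by
            simp only [hν, dotReflect, LinearMap.sub_apply, LinearMap.add_apply,
              LinearMap.smul_apply, smul_eq_mul]
            ring
          rw [hl2, hk2, hm'] at h6
          push_cast at h6 ⊢
          linear_combination -h6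
        refine ⟨⟨hβ, _, by positivity, h5⟩, fun h => ?_⟩
        rw [Set.mem_singleton_iff.1 h] at hl2
        have h6 := dotReflect_reflect_apply (D := D) (ρ := ρ) hα ν (D.c α)
        have two : α (D.c α) = 2 := (D.tri _ hα).two
        rw [hμν, hl2, two] at h6
        have h7 : (k : K) + l = 0 := by
          rw [map_sub, map_smul, hk2, smul_eq_mul] at h6
          linear_combination -h6
        have : k + l = 0 := by exact_mod_cast h7
        omega
    have hinj : Set.InjOn φ (D.badSet ρ ν) := by
      have mixed : ∀ β ∈ D.badSet ρ ν, ∀ β' ∈ D.badSet ρ ν, β - β (D.c α) • α ∈ S.pos →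
          β' - β' (D.c α) • α ∉ S.pos → β - β (D.c α) • α ≠ β' := by
        intro β hβ β' hβ' hp hq h
        have := (key β' hβ').2 hq
        rw [← h, reflect_reflect hα] at this
        exact neg_notMem_pos hβ.1 this
      intro β hβ β' hβ' h
      by_cases hp : β - β (D.c α) • α ∈ S.pos <;> by_cases hq : β' - β' (D.c α) • α ∈ S.pos <;>
        simp only [φ, hp, hq, if_true, if_false] at h
      · rw [← reflect_reflect (D := D) hα β, h, reflect_reflect hα]
      · exact (mixed β hβ β' hβ' hp hq h).elim
      · exact (mixed β' hβ' β hβ hq hp h.symm).elim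
      · exact h
    have hfin : (D.badSet ρ ν).Finite :=
      Set.Finite.of_injOn (fun β hβ => (key β hβ).1) hinj (hf.subset Set.diff_subset)
    have hcard : (D.badSet ρ ν).ncard ≤ (D.badSet ρ μ \ {α}).ncard :=
      Set.ncard_le_ncard_of_injOn φ (fun β hβ => (key β hβ).1) hinj (hf.subset Set.diff_subset)
    have hlt : (D.badSet ρ μ \ {α}).ncard < (D.badSet ρ μ).ncard :=
      Set.ncard_diff_singleton_lt_of_mem ⟨hα, k, hk, hk2⟩ hf
    obtain ⟨ξ, hξ, hl⟩ := ih ν hfin (by omega)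
    refine ⟨ξ, hξ, .step α (D.c α) hα ((D.coroot_eq hα).2 rfl) ⟨Multiset.replicate k α,
      fun β hβ => Multiset.eq_of_mem_replicate hβ ▸ hα, ?_⟩ hl⟩
    rw [Multiset.sum_replicate, dotReflect, hk2, sub_sub_cancel, cast_smul_eq_nsmul]

theorem exists_antidominant_iff (hD : S.IsDynkin) {lam : Dual K S.h} :
    (∃ ξ, S.IsAntidominant ρ ξ ∧ S.StronglyLinked ρ ξ lam) ↔ S.IsAlmostAntidominant ρ lam := by
  obtain ⟨D⟩ := nonempty_chev hD
  simp only [isAntidominant_iff D, isAlmostAntidominant_iff D]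
  exact ⟨fun ⟨_, h1, h2⟩ => finite_badSet_of_linked D h1 h2,
    fun h => exists_linked D _ _ h le_rfl⟩

end Setup

namespace PBW

section Induced

open UniversalEnvelopingAlgebra

variable {k L ι P : Type*} [Field k] [LieRing L] [LieAlgebra k L] [LinearOrder ι]

theorem expo_prod (val : ι → k) (w : List ι) :
    ((expo w).prod fun i n => val i ^ n) = (w.map val).prod := by
  induction w with
  | nil => simp [expo]
  | cons x w ih =>
    have h : expo (x :: w) = single x 1 + expo w := by
      rw [show x :: w = [x] ++ w from rfl, expo_append]; simp [expo]
    rw [h, Finsupp.prod_add_index' (fun _ => pow_zero _) (fun _ _ _ => pow_add _ _ _), ih,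
      Finsupp.prod_single_index (h := fun i n => val i ^ n) (pow_zero _), pow_one, List.map_cons, List.prod_cons]

variable (b : Basis ι k L) (j : P → ι)

/-- The letters outside the range of `j` span a subalgebra on which `val` is a character, and they
come after the letters in the range of `j`. -/
structure IsChar (val : ι → k) : Prop where
  inj : Function.Injective j
  low : ∀ p, ∀ i ∉ range j, j p < i
  one : ∀ p, val (j p) = 1
  lie : ∀ x ∉ range j, ∀ y ∉ range j,
    ⁅b x, b y⁆ ∈ span k (b '' (range j)ᶜ) ∧ b.constr k val ⁅b x, b y⁆ = 0

/-- The word in the letters `j p` with exponents `s`. -/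
def fword (s : P →₀ ℕ) : List ι := word (s.mapDomain j)

/-- The projection of the enveloping algebra to the module induced from a character. -/
def theta (hj : Function.Injective j) (val : ι → k) :
    UniversalEnvelopingAlgebra k L →ₗ[k] ((P →₀ ℕ) →₀ k) :=
  (basis b).constr k fun m =>
    (m.prod fun i n => val i ^ n) • single (m.comapDomain j hj.injOn) 1

theorem mem_fword {s : P →₀ ℕ} {i : ι} (h : i ∈ fword j s) : ∃ p ∈ s.support, j p = i := by
  classical
  rw [fword, mem_word] at h
  have := Finsupp.mapDomain_support h
  simpa using this

variable {b j} {val : ι → k}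

theorem theta_wd (hc : IsChar b j val) (s : P →₀ ℕ) (w : List ι) (hw : ∀ x ∈ w, x ∉ range j) :
    theta b j hc.inj val (wd b (fword j s ++ w)) = (w.map val).prod • single s 1 := by
  classical
  induction w using word_induction with
  | sorted w h =>
    have hs : (fword j s ++ w).Pairwise (· ≤ ·) := by
      rw [List.pairwise_append]
      refine ⟨word_sorted _, h, fun x hx y hy => ?_⟩
      obtain ⟨p, -, rfl⟩ := mem_fword j hx
      exact (hc.low p y (hw y hy)).le
    rw [← word_expo hs, ← basis_apply, theta, Basis.constr_basis, expo_append, fword,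
      expo_word, Finsupp.prod_add_index' (fun _ => pow_zero _) (fun _ _ _ => pow_add _ _ _),
      expo_prod, Finsupp.prod_mapDomain_index (fun _ => pow_zero _) (fun _ _ _ => pow_add _ _ _)]
    simp only [hc.one, one_pow, Finsupp.prod_fun_one, one_mul]
    congr 2
    ext p
    rw [Finsupp.comapDomain_apply, Finsupp.add_apply, Finsupp.mapDomain_apply hc.inj, expo,
      Multiset.toFinsupp_apply, Multiset.coe_count,
      List.count_eq_zero_of_not_mem (fun h => hw _ h ⟨p, rfl⟩), add_zero]
  | descent a x y c hd ih1 ih2 =>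
    have hx : x ∉ range j := hw x (by simp)
    have hy : y ∉ range j := hw y (by simp)
    have key : ∀ z ∈ span k (b '' (range j)ᶜ),
        theta b j hc.inj val (wd b (fword j s ++ a) * UniversalEnvelopingAlgebra.ι k z * wd b c) =
          ((a.map val).prod * b.constr k val z * (c.map val).prod) • single s 1 := by
      intro z hz
      induction hz using span_induction with
      | mem z hz =>
        obtain ⟨i, hi, rfl⟩ := hz
        rw [mul_assoc, ← wd_cons, ← wd_append, append_assoc, ih2 (a ++ i :: c) (by simp)
          (fun t ht => ?_), Basis.constr_basis]
        · simp [mul_assoc]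
        · rw [List.mem_append, List.mem_cons] at ht
          rcases ht with ht | rfl | ht
          · exact hw t (by simp [ht])
          · exact hi
          · exact hw t (by simp [ht])
      | zero => simp
      | add z z' _ _ h h' => rw [map_add, mul_add, add_mul, map_add, h, h', map_add, mul_add,
          add_mul, add_smul]
      | smul r z _ h => rw [map_smul, mul_smul_comm, smul_mul_assoc, map_smul, h, map_smul,
          smul_eq_mul, smul_smul]; congr 1; ring
    rw [← append_assoc, wd_rule, map_add, append_assoc, ih1 (fun t ht => hw t ?_),
      key _ (hc.lie x hx y hy).1, (hc.lie x hx y hy).2]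
    · simp only [List.map_append, List.map_cons, List.prod_append, List.prod_cons, mul_zero,
        zero_mul, zero_smul, add_zero]
      congr 1; ring
    · simp only [List.mem_append, List.mem_cons] at ht ⊢; tauto

theorem exists_split (hlow : ∀ p, ∀ i ∉ range j, j p < i) (hj : Function.Injective j) (m : ι →₀ ℕ) :
    ∃ (s : P →₀ ℕ) (w : List ι), (∀ x ∈ w, x ∉ range j) ∧
      word m = fword j s ++ w := by
  classical
  refine ⟨m.comapDomain j hj.injOn, word (m.filter (· ∉ range j)), fun x hx => ?_, ?_⟩
  · rw [mem_word, Finsupp.support_filter, mem_filter] at hx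
    exact hx.2
  have hs : (fword j (m.comapDomain j hj.injOn) ++ word (m.filter (· ∉ range j))).Pairwise
      (· ≤ ·) := by
    rw [List.pairwise_append]
    refine ⟨word_sorted _, word_sorted _, fun x hx y hy => ?_⟩
    obtain ⟨p, -, rfl⟩ := mem_fword j hx
    rw [mem_word, Finsupp.support_filter, mem_filter] at hy
    exact (hlow p y hy.2).le
  rw [← word_expo hs, expo_append, fword, expo_word, expo_word]
  congr 1
  ext i
  rw [Finsupp.add_apply]
  by_cases hi : i ∈ range j
  · obtain ⟨p, rfl⟩ := hi
    rw [Finsupp.mapDomain_apply hj, Finsupp.comapDomain_apply, Finsupp.filter_apply_neg, add_zero]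
    simp
  · rw [Finsupp.mapDomain_notin_range _ _ hi, Finsupp.filter_apply_pos, zero_add]
    exact hi

theorem theta_ideal (hc : IsChar b j val) (u : UniversalEnvelopingAlgebra k L) {z : L}
    (hz : z ∈ span k (b '' (range j)ᶜ)) :
    theta b j hc.inj val (u * UniversalEnvelopingAlgebra.ι k z) =
      b.constr k val z • theta b j hc.inj val u := by
  suffices H : ∀ i ∉ range j, ∀ m, theta b j hc.inj val (wd b (word m) *
      UniversalEnvelopingAlgebra.ι k (b i)) = val i • theta b j hc.inj val (wd b (word m)) by
    induction hz using span_induction with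
    | mem z hz =>
      obtain ⟨i, hi, rfl⟩ := hz
      rw [Basis.constr_basis]
      have : (theta b j hc.inj val) ∘ₗ LinearMap.mulRight k (UniversalEnvelopingAlgebra.ι k (b i)) =
          val i • theta b j hc.inj val :=
        (basis b).ext fun m => by
          rw [basis_apply]; exact H i hi m
      exact LinearMap.congr_fun this u
    | zero => simp
    | add z z' _ _ h h' => rw [map_add, mul_add, map_add, h, h', map_add, add_smul]
    | smul r z _ h => rw [map_smul, mul_smul_comm, map_smul, h, map_smul, smul_assoc]
  intro i hi m
  obtain ⟨s, w, hw, e⟩ := exists_split hc.low hc.inj m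
  have h1 : UniversalEnvelopingAlgebra.ι k (b i) = wd b [i] := by simp [wd]
  rw [e, h1, ← wd_append, append_assoc, theta_wd hc _ _ hw, theta_wd hc]
  · rw [List.map_append, List.prod_append, smul_smul, List.map_singleton, List.prod_singleton,
      mul_comm]
  · intro x hx
    rw [List.mem_append, List.mem_singleton] at hx
    rcases hx with hx | rfl
    · exact hw x hx
    · exact hi

end Induced

end PBW

open MvPolynomial in
/-- A hypersurface cannot be covered by the sets `ℓ i = Q i = 0`, unless some `ℓ i` divides `Q i`. -/
lemma exists_dvd_of_zero {σ ι : Type*} [Finite σ] {P : MvPolynomial σ K} (C : Finset ι)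
    (l Q : ι → MvPolynomial σ K) (hd : ∀ i ∈ C, (l i).totalDegree ≤ 1) (hl : ∀ i ∈ C, l i ≠ 0)
    (hP : ∀ x, eval x P = 0 →
      ∃ i ∈ C, eval x (l i) = 0 ∧ eval x (Q i) = 0) (h0 : eval 0 P = 0) :
    ∃ i ∈ C, eval 0 (l i) = 0 ∧ l i ∣ Q i := by
  classical
  have hP0 : P ≠ 0 := by
    rintro rfl
    refine Finset.prod_ne_zero_iff.2 hl (MvPolynomial.funext fun x => ?_)
    obtain ⟨i, hi, h, -⟩ := hP x (map_zero _)
    rw [map_prod, map_zero]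
    exact Finset.prod_eq_zero hi h
  obtain ⟨p, hp, hpP, hp0⟩ : ∃ p, Irreducible p ∧ p ∣ P ∧ eval 0 p = 0 := by
    obtain ⟨f, hf, u, rfl⟩ := WfDvdMonoid.exists_factors P hP0
    rw [map_mul, mul_eq_zero, or_iff_left ((u.isUnit.map (eval 0)).ne_zero),
      map_multiset_prod, Multiset.prod_eq_zero_iff, Multiset.mem_map] at h0
    obtain ⟨p, hp, h⟩ := h0
    exact ⟨p, hf p hp, (Multiset.dvd_prod hp).mul_right _, h⟩
  have hprime : Prime p := hp.prime
  haveI : (Ideal.span {p}).IsPrime := (Ideal.span_singleton_prime hp.ne_zero).2 hprime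
  let G : ι → MvPolynomial σ K := fun i => if p ∣ l i then Q i else l i
  have hG : ∏ i ∈ C, G i ∈ Ideal.span {p} := by
    rw [← MvPolynomial.IsPrime.vanishingIdeal_zeroLocus (K := K) (Ideal.span {p}),
      mem_vanishingIdeal_iff]
    intro x hx
    have h1 : eval x p = 0 := hx p (Ideal.mem_span_singleton_self p)
    obtain ⟨i, hi, h2, h3⟩ := hP x (by
      obtain ⟨c, rfl⟩ := hpP
      rw [map_mul, h1, zero_mul])
    change eval x _ = 0
    rw [map_prod]
    refine Finset.prod_eq_zero hi ?_
    simp only [G]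
    split_ifs
    exacts [h3, h2]
  obtain ⟨i, hi, h1⟩ := (hprime.dvd_finset_prod_iff _).1 (Ideal.mem_span_singleton.1 hG)
  obtain ⟨h2, h3⟩ : p ∣ l i ∧ p ∣ Q i := by
    simp only [G] at h1
    split_ifs at h1 with h
    exacts [⟨h, h1⟩, absurd h1 h]
  refine ⟨i, hi, ?_, ?_⟩
  · obtain ⟨c, hc⟩ := h2
    rw [hc, map_mul, hp0, zero_mul]
  obtain ⟨c, hc⟩ := h2
  have hc0 : c ≠ 0 := fun h => hl i hi (by rw [hc, h, mul_zero])
  have h4 := hd i hi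
  rw [hc, totalDegree_mul_of_isDomain hp.ne_zero hc0] at h4
  have h5 : p.totalDegree ≠ 0 := fun h => hp.ne_zero (by
    rw [totalDegree_eq_zero_iff_eq_C] at h
    rw [h, eval_C] at hp0
    rw [h, hp0, map_zero])
  have h6 := totalDegree_eq_zero_iff_eq_C.1 (show c.totalDegree = 0 by omega)
  have h7 : IsUnit c := by
    rw [h6]
    refine (isUnit_iff_ne_zero.2 fun h => hc0 ?_).map MvPolynomial.C
    rw [h6, h, map_zero]
  rw [hc]
  exact (h7.mul_right_dvd).2 h3

namespace Setup

open Module LieAlgebra PBW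
open MvPolynomial (eval)

local notation "ug" => UniversalEnvelopingAlgebra.ι K

variable {S : Setup K g} (D : S.Chev) {α μ : Dual K S.h} {γ r : S.Simp →₀ ℕ}

section Modules

attribute [local instance] LieRing.ofAssociativeRing

variable {V : Type*} [AddCommGroup V] [Module K V] [Module (Env K g) V]
  [IsScalarTower K (Env K g) V]

variable (S V) in
/-- The weight spaces of a module. -/
def WV (μ : Dual K S.h) : Submodule K V where
  carrier := {x | ∀ H : S.h, ug (H : g) • x = μ H • x}
  add_mem' {x y} hx hy H := by rw [smul_add, hx H, hy H, smul_add]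
  zero_mem' H := by rw [smul_zero, smul_zero]
  smul_mem' c x hx H := by rw [smul_comm, hx H, smul_comm]

lemma ug_smul_smul (x y : g) (v : V) : ug x • ug y • v = ug y • ug x • v + ug ⁅x, y⁆ • v := by
  rw [LieHom.map_lie, LieRing.of_associative_ring_bracket, sub_smul, mul_smul, mul_smul]; abel

lemma ug_smul_mem {z : g} {x : V} (hz : z ∈ S.wt α) (hx : x ∈ S.WV V μ) :
    ug z • x ∈ S.WV V (μ + α) := fun H => by
  rw [ug_smul_smul, hx H, hz H, map_smul, smul_comm, smul_assoc, ← add_smul, LinearMap.add_apply]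

lemma WV_component {P : Submodule K V} (hP : ∀ H : S.h, ∀ x ∈ P, ug (H : g) • x ∈ P) {ι : Type*}
    (s : Finset ι) (w : ι → Dual K S.h) (hw : Set.InjOn w s) (f : ι → V)
    (hf : ∀ i ∈ s, f i ∈ S.WV V (w i)) (hs : ∑ i ∈ s, f i ∈ P) {i : ι} (hi : i ∈ s) : f i ∈ P := by
  classical
  induction s using Finset.induction_on generalizing f i with
  | empty => simp at hi
  | insert k s hk ih =>
    have key : ∀ j ∈ s, f j ∈ P := by
      intro j hj
      obtain ⟨H, hH⟩ : ∃ H, w j H ≠ w k H := by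
        by_contra! hc
        exact hk (hw (Finset.mem_insert_of_mem hj) (Finset.mem_insert_self _ _)
          (LinearMap.ext hc) ▸ hj)
      have h1 := ih (hw.mono (Finset.coe_subset.2 (Finset.subset_insert _ _))) (fun l => (w l H - w k H) • f l)
        (fun l hl => smul_mem _ _ (hf l (Finset.mem_insert_of_mem hl))) (by
          have h2 := P.sub_mem (hP H _ hs) (P.smul_mem (w k H) hs)
          rw [Finset.sum_insert hk, smul_add, hf k (Finset.mem_insert_self _ _) H, smul_add,
            add_sub_add_left_eq_sub, smul_sum, smul_sum,
            ← sum_sub_distrib] at h2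
          refine (congrArg (· ∈ P) (sum_congr rfl fun l hl => ?_)).mp h2
          rw [hf l (Finset.mem_insert_of_mem hl) H, sub_smul]) hj
      exact (P.smul_mem_iff (sub_ne_zero.2 hH)).1 h1
    rcases Finset.mem_insert.1 hi with rfl | h
    · rw [Finset.sum_insert hk] at hs
      exact (P.add_mem_iff_left (P.sum_mem key)).1 hs
    · exact key i h

lemma exists_hom {w : V} (hw : w ∈ S.WV V μ) (he : ∀ α ∈ S.pos, ∀ x ∈ S.wt α, ug x • w = 0) :
    ∃ φ : S.Verma μ →ₗ[Env K g] V, φ (Submodule.Quotient.mk 1) = w := by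
  refine ⟨(S.vermaIdeal μ).liftQ (LinearMap.toSpanSingleton (Env K g) V w) ?_,
    one_smul (Env K g) w⟩
  refine span_le.2 ?_
  rintro _ (⟨x, hx, rfl⟩ | ⟨H, rfl⟩)
  · have : x ∈ LinearMap.ker ((LinearMap.toSpanSingleton (Env K g) V w).restrictScalars K ∘ₗ
        (ug : g →ₗ⁅K⁆ Env K g).toLinearMap) := by
      refine (iSup₂_le fun α hα y hy => ?_ : S.nplus ≤ _) hx
      simpa using he α hα y hy
    simpa using this
  · change (ug (H : g) - algebraMap K (Env K g) (μ H)) • w = 0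
    rw [sub_smul, hw H, algebraMap_smul, sub_self]

end Modules

section VermaBasis

variable (S)

/-- The index set of a basis of `g` adapted to the triangular decomposition. -/
inductive Ix
  | f (α : S.pos)
  | h (i : Basis.ofVectorSpaceIndex K S.h)
  | e (α : S.pos)

variable {S}

/-- The positions of the basis elements, in lexicographic order. -/
def Ix.toSum : S.Ix → S.pos ⊕ₗ (Basis.ofVectorSpaceIndex K S.h ⊕ₗ S.pos)
  | .f α => Sum.inlₗ α
  | .h i => Sum.inrₗ (Sum.inlₗ i)
  | .e α => Sum.inrₗ (Sum.inrₗ α)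

instance [LinearOrder S.pos] : LinearOrder S.Ix :=
  letI : LinearOrder (Basis.ofVectorSpaceIndex K S.h) :=
    @linearOrderOfSTO _ WellOrderingRel _ (Classical.decRel _)
  LinearOrder.lift' Ix.toSum fun x y h => by
    cases x <;> cases y <;> simp_all [Ix.toSum, Sum.inlₗ, Sum.inrₗ]

lemma Ix.f_lt [LinearOrder S.pos] (p : S.pos) (i : S.Ix) (hi : i ∉ range Ix.f) : Ix.f p < i := by
  letI : LinearOrder (Basis.ofVectorSpaceIndex K S.h) :=
    @linearOrderOfSTO _ WellOrderingRel _ (Classical.decRel _)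
  cases i with
  | f α => exact absurd ⟨α, rfl⟩ hi
  | h i => exact Sum.Lex.inl_lt_inr _ _
  | e α => exact Sum.Lex.inl_lt_inr _ _

/-- The basis vectors. -/
def Chev.vec : S.Ix → g
  | .f α => D.f α
  | .h i => (Basis.ofVectorSpace K S.h i : g)
  | .e α => D.e α

lemma vec_linearIndependent : LinearIndependent K D.vec := by
  have hf : ∀ α : S.pos, D.f α ∈ S.wt (-α.1) := fun α => (D.tri α.1 α.2).hf
  have he : ∀ α : S.pos, D.e α ∈ S.wt α.1 := fun α => (D.tri α.1 α.2).he
  have h1 : LinearIndependent K fun α : S.pos => D.f α :=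
    iSupIndep.linearIndependent _ (S.h_indep.comp (f := fun α : S.pos => -α.1)
      fun a b h => Subtype.ext (neg_injective h)) hf fun α => (D.tri α.1 α.2).f_ne_zero
  have h2 : LinearIndependent K fun α : S.pos => D.e α :=
    iSupIndep.linearIndependent _ (S.h_indep.comp (f := fun α : S.pos => α.1)
      Subtype.val_injective) he fun α => (D.tri α.1 α.2).e_ne_zero
  have h3 : LinearIndependent K fun i => (Basis.ofVectorSpace K S.h i : g) :=
    (Basis.ofVectorSpace K S.h).linearIndependent.map' S.h.toSubmodule.subtype
      (Submodule.ker_subtype _)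
  have A : span K (range fun α : S.pos => D.f α) ≤
      ⨆ γ ∈ {γ | -γ ∈ S.pos}, S.wt γ := span_le.2 (by
    rintro _ ⟨α, rfl⟩
    exact le_iSup₂ (f := fun γ (_ : γ ∈ {γ | -γ ∈ S.pos}) => S.wt γ) (-α.1)
      (by simp) (hf α))
  have B : span K (range fun α : S.pos => D.e α) ≤ ⨆ γ ∈ S.pos, S.wt γ :=
    span_le.2 (by
    rintro _ ⟨α, rfl⟩
    exact le_iSup₂ (f := fun γ (_ : γ ∈ S.pos) => S.wt γ) α.1 α.2 (he α))
  have C : span K (range fun i => (Basis.ofVectorSpace K S.h i : g)) ≤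
      ⨆ γ ∈ ({0} : Set (Dual K S.h)), S.wt γ := span_le.2 (by
    rintro _ ⟨i, rfl⟩
    exact le_iSup₂ (f := fun γ (_ : γ ∈ ({0} : Set (Dual K S.h))) => S.wt γ) 0 rfl
      (mem_wt_zero.2 (Basis.ofVectorSpace K S.h i).2))
  have h4 := h3.sum_type h2 ((S.h_indep.disjoint_biSup_biSup
    (Set.disjoint_singleton_left.2 zero_notMem_pos)).mono C B)
  have E : span K (range (Sum.elim (fun i => (Basis.ofVectorSpace K S.h i : g))
      fun α : S.pos => D.e α)) ≤ ⨆ γ ∈ ({0} ∪ S.pos : Set (Dual K S.h)), S.wt γ := by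
    rw [Set.Sum.elim_range, Submodule.span_union]
    exact sup_le (C.trans (biSup_mono fun _ => Or.inl)) (B.trans (biSup_mono fun _ => Or.inr))
  have h5 := h1.sum_type h4 ((S.h_indep.disjoint_biSup_biSup (by
    rw [Set.disjoint_left]
    rintro γ h (rfl | h')
    · exact zero_notMem_pos (S := S) (by simpa using h)
    · exact neg_notMem_pos h' h)).mono A E)
  let q : S.Ix → S.pos ⊕ (Basis.ofVectorSpaceIndex K S.h ⊕ S.pos)
    | .f α => Sum.inl α
    | .h i => Sum.inr (Sum.inl i)
    | .e α => Sum.inr (Sum.inr α)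
  have h6 := h5.comp q fun x y h => by cases x <;> cases y <;> simp_all [q]
  have h7 : D.vec = Sum.elim (fun α : S.pos => D.f α) (Sum.elim
      (fun i => (Basis.ofVectorSpace K S.h i : g)) fun α : S.pos => D.e α) ∘ q :=
    funext fun x => by cases x <;> rfl
  rw [h7]
  exact h6

lemma le_span_vec_h : S.h.toSubmodule ≤ span K (D.vec '' range Ix.h) := by
  intro x hx
  have h1 := (Basis.ofVectorSpace K S.h).mem_span ⟨x, hx⟩
  have h2 := Submodule.mem_map_of_mem (f := S.h.toSubmodule.subtype) h1
  rw [Submodule.map_span, ← Set.range_comp, ] at h2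
  rw [← Set.range_comp]
  exact h2

lemma wt_le_span_vec_e (hα : α ∈ S.pos) : S.wt α ≤ span K {D.vec (Ix.e ⟨α, hα⟩)} := fun x hx => by
  obtain ⟨t, rfl⟩ := D.eq_smul_e hα hx
  exact smul_mem _ _ (Submodule.mem_span_singleton_self _)

variable [LinearOrder S.pos]

/-- A basis of `g` adapted to the triangular decomposition. -/
def gb : Basis S.Ix K g := Basis.mk (vec_linearIndependent D) (by
  rw [← S.h_span]
  refine iSup_le fun γ x hx => ?_
  by_cases hx0 : x = 0
  · rw [hx0]; exact zero_mem _
  by_cases h0 : γ = 0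
  · rw [h0] at hx
    exact span_mono (Set.image_subset_range _ _) (le_span_vec_h D (mem_wt_zero.1 hx))
  rcases isRt_of_mem h0 hx hx0 with h | h
  · exact span_mono (by simp) (wt_le_span_vec_e D h hx)
  · rw [← neg_neg γ] at hx
    obtain ⟨t, rfl⟩ := D.eq_smul_f h hx
    exact smul_mem _ _ (subset_span ⟨Ix.f ⟨_, h⟩, rfl⟩))

@[simp] lemma gb_apply (i : S.Ix) : gb D i = D.vec i := by simp [gb]

/-- The character of the Borel subalgebra. -/
def ch (lam : Dual K S.h) : S.Ix → K
  | .f _ => 1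
  | .h i => lam (Basis.ofVectorSpace K S.h i)
  | .e _ => 0

lemma constr_h (lam : Dual K S.h) (H : S.h) : (gb D).constr K (ch lam) (H : g) = lam H := by
  have : ((gb D).constr K (ch lam)) ∘ₗ S.h.toSubmodule.subtype = lam :=
    (Basis.ofVectorSpace K S.h).ext fun i => by
      have h1 := (gb D).constr_basis K (ch lam) (Ix.h i)
      rw [gb_apply] at h1
      exact h1
  exact LinearMap.congr_fun this H

lemma constr_e (lam : Dual K S.h) (hα : α ∈ S.pos) {x : g} (hx : x ∈ S.wt α) :
    (gb D).constr K (ch lam) x = 0 := by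
  obtain ⟨t, rfl⟩ := D.eq_smul_e hα hx
  have h1 := (gb D).constr_basis K (ch lam) (Ix.e ⟨α, hα⟩)
  rw [gb_apply] at h1
  rw [map_smul, show D.e α = D.vec (Ix.e ⟨α, hα⟩) from rfl, h1]
  simp [ch]

lemma h_mem_span (H : S.h) : (H : g) ∈ span K (gb D '' (range Ix.f)ᶜ) := by
  refine span_mono ?_ (le_span_vec_h D H.2)
  rintro _ ⟨_, ⟨i, rfl⟩, rfl⟩
  exact ⟨Ix.h i, by simp, by simp⟩

lemma e_mem_span (hα : α ∈ S.pos) {x : g} (hx : x ∈ S.wt α) : x ∈ span K (gb D '' (range Ix.f)ᶜ) :=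
  span_mono (by
    rintro _ rfl
    exact ⟨Ix.e ⟨α, hα⟩, by simp, by simp⟩) (wt_le_span_vec_e D hα hx)

lemma isChar (lam : Dual K S.h) : PBW.IsChar (gb D) Ix.f (ch lam) where
  inj a b h := by injection h
  low := Ix.f_lt
  one _ := rfl
  lie x hx y hy := by
    have key : ∀ α ∈ S.pos, ∀ z ∈ S.wt α, z ∈ span K (gb D '' (range Ix.f)ᶜ) ∧
        (gb D).constr K (ch lam) z = 0 := fun α hα z hz => ⟨e_mem_span D hα hz, constr_e D lam hα hz⟩
    cases x with
    | f α => exact absurd ⟨α, rfl⟩ hx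
    | h i =>
      cases y with
      | f α => exact absurd ⟨α, rfl⟩ hy
      | h j =>
        simp only [gb_apply, Chev.vec]
        rw [lie_h (Basis.ofVectorSpace K S.h i).2 (Basis.ofVectorSpace K S.h j).2]
        exact ⟨zero_mem _, map_zero _⟩
      | e β =>
        simp only [gb_apply, Chev.vec]
        rw [lie_of_mem_wt (D.tri _ β.2).he]
        exact key β β.2 _ (smul_mem _ _ (D.tri _ β.2).he)
    | e α =>
      cases y with
      | f α => exact absurd ⟨α, rfl⟩ hy
      | h j =>
        simp only [gb_apply, Chev.vec]
        rw [lie_of_mem_wt' (D.tri _ α.2).he]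
        exact key α α.2 _ (Submodule.neg_mem _ (smul_mem _ _ (D.tri _ α.2).he))
      | e β =>
        simp only [gb_apply, Chev.vec]
        have h1 := lie_mem_wt (D.tri _ α.2).he (D.tri _ β.2).he
        by_cases h0 : ⁅D.e α, D.e β⁆ = 0
        · simp [h0]
        · exact key _ (S.pos_add _ α.2 _ β.2 ⟨add_ne_zero_of_pos α.2 β.2, fun h => h0 (by
            rw [wt, h] at h1; exact h1)⟩) _ h1

end VermaBasis

section VermaBasis

attribute [local instance] LieRing.ofAssociativeRing

variable (S) in
/-- The highest weight vector of the Verma module. -/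
abbrev hv (lam : Dual K S.h) : S.Verma lam := Submodule.Quotient.mk 1

lemma mk_eq (lam : Dual K S.h) (u : Env K g) :
    (Submodule.Quotient.mk u : S.Verma lam) = u • S.hv lam := by
  rw [hv, ← Submodule.Quotient.mk_smul, smul_eq_mul, mul_one]

lemma hv_mem (lam : Dual K S.h) : S.hv lam ∈ S.WV (S.Verma lam) lam := fun H => by
  rw [← algebraMap_smul (Env K g) (lam H), ← sub_eq_zero, ← sub_smul, ← mk_eq,
    Submodule.Quotient.mk_eq_zero]
  exact subset_span (Or.inr ⟨H, rfl⟩)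

lemma e_smul_hv (lam : Dual K S.h) (hα : α ∈ S.pos) {z : g} (hz : z ∈ S.wt α) :
    ug z • S.hv lam = 0 := by
  rw [← mk_eq, Submodule.Quotient.mk_eq_zero]
  exact subset_span (Or.inl ⟨z, le_iSup₂ (f := fun γ (_ : γ ∈ S.pos) => S.wt γ) α hα hz,
    rfl⟩)

variable (S) in
/-- The weight of an exponent vector. -/
def wts : (S.pos →₀ ℕ) →+ (S.Simp →₀ ℕ) :=
  (Multiset.sumAddMonoidHom.comp (Multiset.mapAddMonoidHom fun α : S.pos => S.cf α)).comp
    toMultiset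

lemma wts_single (α : S.pos) (n : ℕ) : S.wts (single α n) = n • S.cf α := by
  simp [wts, Finsupp.toMultiset_single, Multiset.map_nsmul, Multiset.sum_nsmul]

variable (S) in
/-- The weight of a list of positive roots. -/
def lw (l : List S.pos) : S.Simp →₀ ℕ := (l.map fun α : S.pos => S.cf α).sum

lemma lie_f_eq_zero {β : Dual K S.h} (hα : α ∈ S.pos) (hβ : β ∈ S.pos) (h : α + β ∉ S.pos) :
    ⁅D.f α, D.f β⁆ = 0 := by
  by_contra h0
  have h1 := lie_mem_wt (D.tri _ hα).hf (D.tri _ hβ).hf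
  refine (isRt_of_mem (fun h => ?_) h1 h0).elim ?_ fun h' => h ?_
  · rw [← _root_.neg_add, neg_eq_zero] at h
    exact add_ne_zero_of_pos hα hβ h
  · exact add_notMem_pos (neg_notMem_pos hα) (neg_notMem_pos hβ) (D.tri _ hα).hf
      (D.tri _ hβ).hf (D.tri _ hα).f_ne_zero (D.tri _ hβ).f_ne_zero
  · rwa [← _root_.neg_add, neg_neg] at h'

variable [LinearOrder S.pos] (D : S.Chev) (lam : Dual K S.h)

lemma lw_word (s : S.pos →₀ ℕ) : S.lw (word s) = S.wts s := by
  change _ = ((toMultiset s).map fun α : S.pos => S.cf α).sum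
  rw [← Multiset.sort_eq (toMultiset s) (· ≤ ·), Multiset.map_coe, Multiset.sum_coe, lw,
    word]

/-- Products of lowering operators. -/
def fw (l : List S.pos) : Env K g := wd (gb D) (l.map Ix.f)

/-- Products of raising operators. -/
def ew (l : List S.pos) : Env K g := wd (gb D) (l.map Ix.e)

lemma fw_cons (α : S.pos) (l : List S.pos) : fw D (α :: l) = ug (D.f α) * fw D l := by
  rw [fw, List.map_cons, wd_cons, gb_apply]; rfl

lemma ew_cons (α : S.pos) (l : List S.pos) : ew D (α :: l) = ug (D.e α) * ew D l := by
  rw [ew, List.map_cons, wd_cons, gb_apply]; rfl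

lemma fw_append (l l' : List S.pos) : fw D (l ++ l') = fw D l * fw D l' := by
  rw [fw, List.map_append, wd_append]; rfl

lemma ew_append (l l' : List S.pos) : ew D (l ++ l') = ew D l * ew D l' := by
  rw [ew, List.map_append, wd_append]; rfl

lemma map_word {P ι : Type*} [LinearOrder P] [LinearOrder ι] {j : P → ι} (hj : StrictMono j)
    (s : P →₀ ℕ) : (word s).map j = fword j s := by
  have h : ((word s).map j).Pairwise (· ≤ ·) :=
    (word_sorted s).map _ fun a b h => hj.monotone h
  rw [← word_expo h, fword]
  congr 1
  rw [expo, ← Multiset.map_coe, word, Multiset.sort_eq, Finsupp.toMultiset_map]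
  exact Finsupp.toMultiset_toFinsupp _

lemma Ix.f_strictMono : StrictMono (Ix.f : S.pos → S.Ix) := fun _ _ h => by
  letI : LinearOrder (Basis.ofVectorSpaceIndex K S.h) :=
    @linearOrderOfSTO _ WellOrderingRel _ (Classical.decRel _)
  exact Sum.Lex.inl_lt_inl_iff.2 h

/-- The coordinates of the image of an element in the Verma module. -/
abbrev th : Env K g →ₗ[K] ((S.pos →₀ ℕ) →₀ K) :=
  theta (gb D) Ix.f (isChar D lam).inj (ch lam)

lemma th_fw (s : S.pos →₀ ℕ) : th D lam (fw D (word s)) = single s 1 := by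
  have h := theta_wd (isChar D lam) s [] (by simp)
  rw [fw, map_word Ix.f_strictMono]
  simpa using h

lemma th_ideal {z : Env K g} (hz : z ∈ S.vermaIdeal lam) : th D lam z = 0 := by
  suffices H : ∀ u, th D lam (u * z) = 0 by simpa using H 1
  induction hz using span_induction with
  | mem z hz =>
    intro u
    rcases hz with ⟨x, hx, rfl⟩ | ⟨H, rfl⟩
    · have : x ∈ LinearMap.ker (th D lam ∘ₗ LinearMap.mulLeft K u ∘ₗ
          (ug : g →ₗ⁅K⁆ Env K g).toLinearMap) := by
        refine (iSup₂_le fun α hα y hy => ?_ : S.nplus ≤ _) hx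
        have := theta_ideal (isChar D lam) u (e_mem_span D hα hy)
        rw [constr_e D lam hα hy, zero_smul] at this
        exact this
      exact this
    · have := theta_ideal (isChar D lam) u (h_mem_span D H)
      rw [constr_h] at this
      rw [mul_sub, map_sub, this, ← Algebra.commutes, ← Algebra.smul_def, map_smul, sub_self]
  | zero => simp
  | add x y _ _ hx hy => intro u; rw [mul_add, map_add, hx, hy, add_zero]
  | smul a x _ hx => intro u; rw [smul_eq_mul, ← mul_assoc, hx]

/-- The coordinate map of the Verma module. -/
def coord : S.Verma lam →ₗ[K] ((S.pos →₀ ℕ) →₀ K) :=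
  ((S.vermaIdeal lam).restrictScalars K).liftQ (th D lam) (fun _ hz => th_ideal D lam hz) ∘ₗ
    (Submodule.Quotient.restrictScalarsEquiv K (S.vermaIdeal lam)).symm.toLinearMap

lemma coord_smul (u : Env K g) : coord D lam (u • S.hv lam) = th D lam u := by
  rw [← mk_eq]; rfl

lemma wd_smul_hv (w : List S.Ix) (hw : ∀ x ∈ w, x ∉ range Ix.f) :
    wd (gb D) w • S.hv lam = (w.map (ch lam)).prod • S.hv lam := by
  induction w with
  | nil => simp [wd]
  | cons x w ih =>
    rw [wd_cons, mul_smul, ih fun y hy => hw y (List.mem_cons_of_mem _ hy), List.map_cons,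
      List.prod_cons, mul_smul, smul_comm, smul_comm (ch lam x), gb_apply]
    congr 1
    cases x with
    | f α => exact absurd ⟨α, rfl⟩ (hw _ List.mem_cons_self)
    | h i => exact hv_mem lam (Basis.ofVectorSpace K S.h i)
    | e α => rw [ch, zero_smul]; exact e_smul_hv lam α.2 (D.tri _ α.2).he

lemma linearCombination_th (u : Env K g) :
    linearCombination K (fun s => fw D (word s) • S.hv lam) (th D lam u) =
      u • S.hv lam := by
  have h : ∀ m, linearCombination K (fun s => fw D (word s) • S.hv lam)
      (th D lam (basis (gb D) m)) = basis (gb D) m • S.hv lam := by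
    intro m
    obtain ⟨s, w, hw, h⟩ := exists_split Ix.f_lt (isChar D lam).inj m
    rw [basis_apply, h, theta_wd (isChar D lam) s w hw, map_smul,
      Finsupp.linearCombination_single, one_smul, wd_append, mul_smul, wd_smul_hv D lam w hw,
      smul_comm, fw, map_word Ix.f_strictMono]
  induction (basis (gb D)).mem_span u using span_induction with
  | mem x hx => obtain ⟨m, rfl⟩ := hx; exact h m
  | zero => rw [map_zero, map_zero, zero_smul]
  | add x y _ _ hx hy => rw [map_add, map_add, hx, hy, add_smul]
  | smul a x _ hx => rw [map_smul, map_smul, hx, smul_assoc]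

lemma linearCombination_coord (x : S.Verma lam) :
    linearCombination K (fun s => fw D (word s) • S.hv lam) (coord D lam x) = x := by
  obtain ⟨u, rfl⟩ := Submodule.Quotient.mk_surjective _ x
  rw [mk_eq, coord_smul, linearCombination_th]

lemma coord_linearCombination (x : (S.pos →₀ ℕ) →₀ K) :
    coord D lam (linearCombination K (fun s => fw D (word s) • S.hv lam) x) = x := by
  induction x using Finsupp.induction_linear with
  | zero => rw [map_zero, map_zero]
  | add x y hx hy => rw [map_add, map_add, hx, hy]
  | single s a =>
    rw [Finsupp.linearCombination_single, map_smul, coord_smul, th_fw, Finsupp.smul_single_one]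

/-- The basis of the Verma module. -/
def vb : Basis (S.pos →₀ ℕ) K (S.Verma lam) := Basis.ofRepr
  { coord D lam with
    invFun := linearCombination K fun s => fw D (word s) • S.hv lam
    left_inv := linearCombination_coord D lam
    right_inv := coord_linearCombination D lam }

lemma vb_apply (s : S.pos →₀ ℕ) : vb D lam s = fw D (word s) • S.hv lam := by

  change linearCombination K (fun s => fw D (word s) • S.hv lam) (single s 1) = _
  rw [Finsupp.linearCombination_single, one_smul]

lemma repr_smul (u : Env K g) : (vb D lam).repr (u • S.hv lam) = th D lam u := coord_smul D lam u

/-- The span of the products of lowering operators. -/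
def um : Submodule K (Env K g) := span K (range fun s => fw D (word s))

lemma lie_f_mem (α β : S.pos) : ⁅gb D (Ix.f α), gb D (Ix.f β)⁆ ∈ span K (gb D '' range Ix.f) := by
  rw [gb_apply, gb_apply]
  change ⁅D.f α, D.f β⁆ ∈ _
  by_cases h3 : α.1 + β.1 ∈ S.pos
  · have h1 := lie_mem_wt (D.tri _ α.2).hf (D.tri _ β.2).hf
    rw [← _root_.neg_add] at h1
    obtain ⟨t, ht⟩ := D.eq_smul_f h3 h1
    rw [ht]
    exact smul_mem _ _ (subset_span ⟨_, ⟨⟨_, h3⟩, rfl⟩, by simp [Chev.vec]⟩)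
  · rw [lie_f_eq_zero D α.2 β.2 h3]
    exact zero_mem _

lemma fw_mem_um (l : List S.pos) : fw D l ∈ um D := by
  have h := wd_mem_span (gb D) (range Ix.f)
    (by rintro _ ⟨α, rfl⟩ _ ⟨β, rfl⟩; exact lie_f_mem D α β) (l.map Ix.f) (by
      intro x hx; obtain ⟨α, -, rfl⟩ := List.mem_map.1 hx; exact ⟨α, rfl⟩)
  refine span_mono ?_ h
  rintro _ ⟨w, ⟨hw, hT, -⟩, rfl⟩
  obtain ⟨l', rfl⟩ : ∃ l' : List S.pos, l'.map Ix.f = w := by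
    clear hw h
    induction w with
    | nil => exact ⟨[], rfl⟩
    | cons x w ih =>
      obtain ⟨α, rfl⟩ := hT x List.mem_cons_self
      obtain ⟨l', rfl⟩ := ih fun y hy => hT y (List.mem_cons_of_mem _ hy)
      exact ⟨α :: l', rfl⟩
  refine ⟨expo l', ?_⟩
  change fw D (word (expo l')) = _
  rw [word_expo]
  · rfl
  exact (List.pairwise_map.1 hw).imp fun h => Ix.f_strictMono.le_iff_le.1 h

lemma um_mul {u u' : Env K g} (hu : u ∈ um D) (hu' : u' ∈ um D) : u * u' ∈ um D := by
  induction hu, hu' using Submodule.span_induction₂ with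
  | mem_mem x y hx hy =>
    obtain ⟨s, rfl⟩ := hx
    obtain ⟨t, rfl⟩ := hy
    simp only [← fw_append]
    exact fw_mem_um D _
  | zero_left => simp
  | zero_right => simp
  | add_left _ _ _ _ _ _ h h' => rw [add_mul]; exact add_mem h h'
  | add_right _ _ _ _ _ _ h h' => rw [mul_add]; exact add_mem h h'
  | smul_left _ _ _ _ _ h => rw [smul_mul_assoc]; exact smul_mem _ _ h
  | smul_right _ _ _ _ _ h => rw [mul_smul_comm]; exact smul_mem _ _ h

lemma exists_um (x : S.Verma lam) : ∃ u ∈ um D, u • S.hv lam = x := by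
  have h := (vb D lam).mem_span x
  induction h using span_induction with
  | mem x hx =>
    obtain ⟨s, rfl⟩ := hx
    exact ⟨_, subset_span ⟨s, rfl⟩, (vb_apply D lam s).symm⟩
  | zero => exact ⟨0, zero_mem _, zero_smul _ _⟩
  | add x y _ _ hx hy =>
    obtain ⟨u, hu, rfl⟩ := hx
    obtain ⟨u', hu', rfl⟩ := hy
    exact ⟨_, add_mem hu hu', add_smul _ _ _⟩
  | smul a x _ hx =>
    obtain ⟨u, hu, rfl⟩ := hx
    exact ⟨_, smul_mem _ a hu, smul_assoc _ _ _⟩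

lemma um_inj {u : Env K g} (hu : u ∈ um D) (h : u • S.hv lam = 0) : u = 0 := by
  revert h
  have key : linearCombination K (fun s => fw D (word s)) (th D lam u) = u := by
    induction hu using span_induction with
    | mem x hx => obtain ⟨s, rfl⟩ := hx; simp [th_fw]
    | zero => simp
    | add x y _ _ hx hy => rw [map_add, map_add, hx, hy]
    | smul a x _ hx => rw [map_smul, map_smul, hx]
  intro h
  rw [← key, ← repr_smul, h, map_zero, map_zero]

variable {lam}

lemma um_smul_eq_zero {u : Env K g} (hu : u ∈ um D) {x : S.Verma lam} (hx : x ≠ 0) (h : u • x = 0) :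
    u = 0 := by
  obtain ⟨y, hy, rfl⟩ := exists_um D lam x
  rw [← mul_smul] at h
  haveI := noZeroDivisors (gb D)
  refine (mul_eq_zero.1 (um_inj D lam (um_mul D hu hy) h)).resolve_right ?_
  rintro rfl
  simp at hx

lemma hom_injective (D : S.Chev) (φ : S.Verma μ →ₗ[Env K g] S.Verma lam) (h : φ (S.hv μ) ≠ 0) :
    Function.Injective φ := by
  rw [injective_iff_map_eq_zero]
  intro x hx
  obtain ⟨u, hu, rfl⟩ := exists_um D μ x
  rw [map_smul] at hx
  rw [um_smul_eq_zero D hu h hx, zero_smul]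

end VermaBasis

section Weights

variable (S) in
/-- The weight spaces of a Verma module. -/
abbrev Mg (lam : Dual K S.h) (γ : S.Simp →₀ ℕ) : Submodule K (S.Verma lam) :=
  S.WV (S.Verma lam) (lam - S.ws γ)

lemma lw_cons (α : S.pos) (L : List S.pos) : S.lw (α :: L) = S.cf α + S.lw L := rfl

lemma lw_append (L L' : List S.pos) : S.lw (L ++ L') = S.lw L + S.lw L' := by simp [lw]

variable [LinearOrder S.pos] (D : S.Chev) {lam : Dual K S.h} {x : S.Verma lam}

lemma fw_smul_mem (L : List S.pos) (hx : x ∈ S.Mg lam γ) : fw D L • x ∈ S.Mg lam (γ + S.lw L) := by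
  induction L with
  | nil => simpa [fw, wd, lw] using hx
  | cons α L ih =>
    rw [fw_cons, mul_smul]
    have h := ug_smul_mem (D.tri _ α.2).hf ih
    rwa [show lam - S.ws (γ + S.lw L) + -α.1 = lam - S.ws (γ + S.lw (α :: L)) by
      rw [lw_cons, map_add, map_add, map_add, ws_cf D α.2]; abel] at h

lemma ew_smul_mem (L : List S.pos) (hx : x ∈ S.Mg lam (γ + S.lw L)) : ew D L • x ∈ S.Mg lam γ := by
  induction L generalizing γ with
  | nil => simpa [ew, wd, lw] using hx
  | cons α L ih =>
    rw [ew_cons, mul_smul]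
    rw [lw_cons, ← add_assoc] at hx
    have h := ug_smul_mem (D.tri _ α.2).he (ih hx)
    rwa [show lam - S.ws (γ + S.cf α) + α.1 = lam - S.ws γ by
      rw [map_add, ws_cf D α.2]; abel] at h

lemma vb_mem (s : S.pos →₀ ℕ) : vb D lam s ∈ S.Mg lam (S.wts s) := by
  rw [vb_apply, ← lw_word, ← zero_add (S.lw _)]
  refine fw_smul_mem D _ ?_
  rw [Mg, map_zero, sub_zero]
  exact hv_mem lam

lemma repr_h (H : S.h) (x : S.Verma lam) (s : S.pos →₀ ℕ) :
    (vb D lam).repr (ug (H : g) • x) s = (lam - S.ws (S.wts s)) H * (vb D lam).repr x s := by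
  induction (vb D lam).mem_span x using span_induction with
  | mem x hx =>
    obtain ⟨t, rfl⟩ := hx
    rw [vb_mem D t H, map_smul, Basis.repr_self, Finsupp.smul_apply, smul_eq_mul]
    by_cases h : t = s
    · rw [h]
    · rw [single_eq_of_ne (Ne.symm h), mul_zero, mul_zero]
  | zero => simp
  | add x y _ _ hx hy => rw [smul_add, map_add, Finsupp.add_apply, hx, hy, map_add,
      Finsupp.add_apply, mul_add]
  | smul a x _ hx =>
    rw [smul_comm, map_smul, Finsupp.smul_apply, hx, map_smul, Finsupp.smul_apply, smul_eq_mul,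
      smul_eq_mul, mul_left_comm]

lemma weight_of_repr (hx : x ∈ S.WV _ μ) {s : S.pos →₀ ℕ} (hs : (vb D lam).repr x s ≠ 0) :
    μ = lam - S.ws (S.wts s) :=
  LinearMap.ext fun H => mul_right_cancel₀ hs (by
    rw [← repr_h, hx H, map_smul, Finsupp.smul_apply, smul_eq_mul])

lemma wts_of_repr (hx : x ∈ S.Mg lam γ) {s : S.pos →₀ ℕ} (hs : (vb D lam).repr x s ≠ 0) :
    S.wts s = γ :=
  (ws_injective D (sub_right_injective (weight_of_repr D hx hs))).symm

lemma exists_repr_ne_zero (hx : x ≠ 0) : ∃ s, (vb D lam).repr x s ≠ 0 := by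
  by_contra! h
  exact hx ((vb D lam).repr.map_eq_zero_iff.1 (Finsupp.ext h))

lemma exists_weight (D : S.Chev) (hx : x ∈ S.WV _ μ) (h0 : x ≠ 0) : ∃ γ, μ = lam - S.ws γ := by
  obtain ⟨s, hs⟩ := exists_repr_ne_zero D h0
  exact ⟨_, weight_of_repr D hx hs⟩

lemma e_smul_mem (D : S.Chev) (hα : α ∈ S.pos) {z : g} (hz : z ∈ S.wt α) (hx : x ∈ S.Mg lam γ)
    (h0 : ug z • x ≠ 0) : ∃ γ₁, γ = γ₁ + S.cf α ∧ ug z • x ∈ S.Mg lam γ₁ := by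
  have h := ug_smul_mem hz hx
  obtain ⟨γ₁, h1⟩ := exists_weight D h h0
  refine ⟨γ₁, ws_injective D ?_, by rwa [h1] at h⟩
  rw [map_add, ws_cf D hα]
  have : S.ws γ = lam + α - (lam - S.ws γ + α) := by abel
  rw [this, h1]; abel

lemma Mg_le {P : Submodule K (S.Verma lam)} (h : ∀ s, S.wts s = γ → vb D lam s ∈ P) :
    S.Mg lam γ ≤ P := fun x hx => by
  rw [← (vb D lam).linearCombination_repr x]
  exact P.sum_mem fun s hs => P.smul_mem _
    (h s (wts_of_repr D hx (Finsupp.mem_support_iff.1 hs)))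

/-- Homogeneous components of an element of a Verma module. -/
lemma mem_of_components (D : S.Chev) {V V' : Submodule (Env K g) (S.Verma lam)}
    (h : ∀ γ, ∀ x ∈ S.Mg lam γ, x ∈ V' → x ∈ V) : V' ≤ V := by
  classical
  intro x hx
  have h1 : x = ∑ γ ∈ ((vb D lam).repr x).support.image S.wts,
      ∑ s ∈ ((vb D lam).repr x).support with S.wts s = γ, (vb D lam).repr x s • vb D lam s := by
    rw [Finset.sum_fiberwise_of_maps_to fun s hs => Finset.mem_image_of_mem _ hs]
    conv_lhs => rw [← (vb D lam).linearCombination_repr x]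
    rfl
  have hm : ∀ γ, ∑ s ∈ ((vb D lam).repr x).support with S.wts s = γ,
      (vb D lam).repr x s • vb D lam s ∈ S.Mg lam γ := fun γ =>
    sum_mem fun s hs => smul_mem _ _
      ((mem_filter.1 hs).2 ▸ vb_mem D s)
  rw [h1]
  refine V.sum_mem fun γ hγ => h γ _ (hm γ) ?_
  exact WV_component (P := V'.restrictScalars K) (fun H x hx => V'.smul_mem _ hx) _
    (fun γ => lam - S.ws γ) (fun a _ b _ h => ws_injective D (sub_right_injective h)) _
    (fun γ _ => hm γ) (by rw [← h1]; exact hx) hγ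

end Weights

section Counting

/-- Exponent vectors of a given weight. -/
def X (S : Setup K g) (γ : S.Simp →₀ ℕ) : Set (S.pos →₀ ℕ) := {s | S.wts s = γ}

/-- The positive roots supported in a finite set of simple roots. -/
def Ph (J : Finset S.Simp) : Finset S.pos :=
  ((finite_supported D J).preimage Subtype.val_injective.injOn).toFinset

@[simp] lemma mem_Ph {J : Finset S.Simp} {α : S.pos} :
    α ∈ Ph D J ↔ (S.cf α).support ⊆ J := by
  simp only [Ph, Set.Finite.mem_toFinset, Set.mem_preimage, Set.mem_setOf_eq]
  exact and_iff_right α.2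

lemma le_wts (s : S.pos →₀ ℕ) (α : S.pos) : s α • S.cf α ≤ S.wts s := by
  rw [← wts_single]
  conv_rhs => rw [← Finsupp.single_add_erase α s, map_add]
  exact le_self_add

lemma support_mono' {s : S.Simp →₀ ℕ} (h : r ≤ s) : r.support ⊆ s.support := fun i hi => by
  rw [Finsupp.mem_support_iff] at hi ⊢
  exact fun h0 => hi (Nat.le_zero.1 (h0 ▸ h i))

lemma cf_le_wts {s : S.pos →₀ ℕ} {α : S.pos} (h : α ∈ s.support) : S.cf α ≤ S.wts s := by
  refine le_trans ?_ (le_wts s α)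
  conv_lhs => rw [← one_smul ℕ (S.cf α)]
  exact nsmul_le_nsmul_left (zero_le) (Nat.one_le_iff_ne_zero.2 (Finsupp.mem_support_iff.1 h))

lemma X_subset {J : Finset S.Simp} (hJ : γ.support ⊆ J) :
    X S γ ⊆ (Ph D J).finsupp fun _ => Finset.range (γ.degree + 1) := by
  rintro s rfl
  rw [Finset.mem_coe, Finset.mem_finsupp_iff]
  refine ⟨fun α hα => (mem_Ph D).2 ((support_mono' (cf_le_wts hα)).trans hJ), fun α _ => ?_⟩
  rw [Finset.mem_range, Nat.lt_succ_iff]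
  have h1 := Finsupp.degree_mono (le_wts s α)
  rw [map_nsmul, smul_eq_mul] at h1
  refine le_trans (Nat.le_mul_of_pos_right _ ?_) h1
  exact Nat.pos_of_ne_zero fun h => cf_ne_zero D α.2 ((Finsupp.degree_eq_zero_iff _).1 h)

lemma X_finite (D : S.Chev) (γ : S.Simp →₀ ℕ) : (X S γ).Finite :=
  (Finset.finite_toSet _).subset (X_subset D (Finset.Subset.refl γ.support))

lemma X_ncard_le {J : Finset S.Simp} (hJ : γ.support ⊆ J) :
    (X S γ).ncard ≤ (γ.degree + 1) ^ (Ph D J).card := by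
  refine (Set.ncard_le_ncard (X_subset D hJ) (Finset.finite_toSet _)).trans ?_
  rw [Set.ncard_coe_finset, Finset.card_finsupp, Finset.prod_const, Finset.card_range]

end Counting

section Casimir

lemma lie_f_e_eq_zero (β : S.Simp) (hα : α ∈ S.pos) (hne : α ≠ β.1) (h : α - β.1 ∉ S.pos) :
    ⁅D.f β.1, D.e α⁆ = 0 := by
  by_contra h0
  have h1 := lie_mem_wt (D.tri _ β.2.1).hf (D.tri _ hα).he
  rw [neg_add_eq_sub] at h1
  refine (isRt_of_mem (sub_ne_zero.2 hne) h1 h0).elim h fun h' => β.2.2 ⟨{α, β.1 - α}, by simp, ?_,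
    by simp⟩
  rw [neg_sub] at h'
  simp [hα, h']

variable {D} {n : ℕ} (L : LForm D n)

/-- The nilpotent part of a Casimir element. -/
def cas (J : Finset S.Simp) : Env K g :=
  ∑ α ∈ Ph D J, (L.b α : K)⁻¹ • (ug (D.f α) * ug (D.e α))

/-- The eigenvalues of `cas`. -/
def kap (ρ lam : Dual K S.h) (γ : S.Simp →₀ ℕ) : K :=
  (lam + ρ) (L.t γ) - 1 / 2 * (L.ip γ γ : ℚ)

variable {J : Finset S.Simp} (hJ : ∀ β ∈ J, β.1 ∈ D.lev n)

attribute [local instance] LieRing.ofAssociativeRing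

lemma lie_cas (hJ : ∀ β ∈ J, β.1 ∈ D.lev n) {β : S.Simp} (hβ : β ∈ J) :
    ug (D.f β.1) * cas L J = cas L J * ug (D.f β.1) -
      (L.b β.1 : K)⁻¹ • (ug (D.f β.1) * ug (D.c β.1 : g)) := by
  classical
  have hsupp : ∀ {γ : Dual K S.h} (hγ : γ ∈ S.pos), β.1 + γ ∈ S.pos →
      ((S.cf (β.1 + γ)).support ⊆ J ↔ (S.cf γ).support ⊆ J) := fun {γ} hγ h => by
    have h1 := support_cf_add D β.2.1 hγ (J := ↑J)
    simp only [Finset.coe_subset] at h1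
    rw [h1, and_iff_right]
    simp [cf_simple D, hβ]
  let A : S.pos → Env K g := fun α => (L.b α : K)⁻¹ • (ug ⁅D.f β.1, D.f α⁆ * ug (D.e α))
  let B : S.pos → Env K g := fun α => (L.b α : K)⁻¹ • (ug (D.f α) * ug ⁅D.f β.1, D.e α⁆)
  let β' : S.pos := ⟨β.1, β.2.1⟩
  have hβ' : β' ∈ Ph D J := by simp [β', cf_simple D, hβ]
  have key : ug (D.f β.1) * cas L J - cas L J * ug (D.f β.1) =
      ∑ α ∈ Ph D J, A α + ∑ α ∈ Ph D J, B α := by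
    rw [cas, mul_sum, Finset.sum_mul, ← sum_sub_distrib, ← Finset.sum_add_distrib]
    refine sum_congr rfl fun α _ => ?_
    simp only [A, B, LieHom.map_lie, LieRing.of_associative_ring_bracket, mul_smul_comm,
      smul_mul_assoc, ← smul_sub, ← smul_add]
    congr 1
    noncomm_ring
  have h2 : ∑ α ∈ Ph D J, A α + ∑ α ∈ (Ph D J).erase β', B α = 0 := by
    have e1 : ∑ α ∈ Ph D J with β.1 + α.1 ∈ S.pos, A α = ∑ α ∈ Ph D J, A α :=
      Finset.sum_filter_of_ne fun α _ h => by
        by_contra h0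
        exact h (by simp only [A]; rw [lie_f_eq_zero D β.2.1 α.2 h0]; simp)
    have e2 : ∑ α ∈ (Ph D J).erase β' with α.1 - β.1 ∈ S.pos, B α =
        ∑ α ∈ (Ph D J).erase β', B α :=
      Finset.sum_filter_of_ne fun α hα h => by
        by_contra h0
        exact h (by
          simp only [B]
          rw [lie_f_e_eq_zero D β α.2 (fun h => (Finset.mem_erase.1 hα).1 (Subtype.ext h)) h0]
          simp)
    rw [← e1, ← e2, ← eq_neg_iff_add_eq_zero, ← Finset.sum_neg_distrib]
    refine Finset.sum_bij' (fun α h => ⟨β.1 + α.1, (mem_filter.1 h).2⟩)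
      (fun α h => ⟨α.1 - β.1, (mem_filter.1 h).2⟩) ?_ ?_ ?_ ?_ ?_
    · intro α h
      obtain ⟨h3, h4⟩ := mem_filter.1 h
      refine mem_filter.2 ⟨Finset.mem_erase.2 ⟨fun h => ?_,
        (mem_Ph D).2 ((hsupp α.2 h4).2 ((mem_Ph D).1 h3))⟩, by simp [α.2]⟩
      have := congrArg Subtype.val h
      have h5 : α.1 = 0 := by simpa [β'] using this
      exact zero_notMem_pos (S := S) (h5 ▸ α.2)
    · intro α h
      obtain ⟨h3, h4⟩ := mem_filter.1 h
      have h5 : β.1 + (α.1 - β.1) = α.1 := by abel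
      refine mem_filter.2 ⟨(mem_Ph D).2 ((hsupp h4 (by rw [h5]; exact α.2)).1 ?_), ?_⟩
      · rw [h5]; exact (mem_Ph D).1 (Finset.mem_of_mem_erase h3)
      · change β.1 + (α.1 - β.1) ∈ S.pos
        rw [h5]; exact α.2
    · intro α h; exact Subtype.ext (by simp)
    · intro α h; exact Subtype.ext (by simp)
    · intro α h
      obtain ⟨h3, h4⟩ := mem_filter.1 h
      obtain ⟨p, h5, h6⟩ := L.adj β.1 (hJ β hβ) α.1 (mem_lev_of_support D (J := ↑J) hJ α.2
        (by exact_mod_cast (mem_Ph D).1 h3)) h4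
      simp only [A, B]
      rw [← smul_mul_assoc, ← map_smul, h5, h6, map_smul, map_smul, map_smul, smul_mul_assoc,
        smul_mul_assoc, mul_smul_comm, neg_smul, smul_neg, neg_neg, smul_comm]
  rw [← Finset.add_sum_erase _ B hβ', add_left_comm, h2, add_zero, sub_eq_iff_eq_add'] at key
  rw [key, sub_eq_add_neg]
  congr 1
  simp only [B, β']
  rw [← lie_skew, (D.tri _ β.2.1).hef, map_neg, mul_neg, smul_neg]

variable {ρ : Dual K S.h}

lemma kap_add (hρ : S.IsGlobalRho ρ) (hJ : ∀ β ∈ J, β.1 ∈ D.lev n) (lam : Dual K S.h)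
    (hγ : γ.support ⊆ J) {β : S.Simp} (hβ : β ∈ J) :
    kap L ρ lam (γ + single β 1) =
      kap L ρ lam γ + (L.b β.1 : K)⁻¹ * (lam - S.ws γ) (D.c β.1) := by
  have h1 : ∀ β' ∈ γ.support, β'.1 ∈ D.lev n := fun i hi => hJ i (hγ hi)
  have h2 : ∀ β' ∈ (single β 1).support, β'.1 ∈ D.lev n := fun i hi => by
    rw [Finset.mem_singleton.1 (support_single_subset hi)]; exact hJ β hβ
  have h3 := L.ws_t h1 h2
  have h4 := L.ws_t h2 h2
  rw [ws_single, one_smul, L.t_single, one_smul, map_smul, (D.tri _ β.2.1).two, smul_eq_mul] at h4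
  rw [L.t_single, one_smul, map_smul, smul_eq_mul] at h3
  rw [kap, kap, map_add, L.ip_add_left, L.ip_add_right, L.ip_add_right,
    L.ip_comm (single β 1) γ,
    L.t_single, one_smul, map_add, map_smul, LinearMap.add_apply _ _ (D.c _), rho_simple D hρ,
    LinearMap.sub_apply, smul_eq_mul]
  push_cast
  rw [← h3, ← h4]
  ring

variable [LinearOrder S.pos] {lam : Dual K S.h} {x : S.Verma lam}

lemma f_smul_mem (D : S.Chev) (hα : α ∈ S.pos) (hx : x ∈ S.Mg lam γ) :
    ug (D.f α) • x ∈ S.Mg lam (γ + S.cf α) := by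
  have h := ug_smul_mem (D.tri _ hα).hf hx
  rwa [show lam - S.ws γ + -α = lam - S.ws (γ + S.cf α) by rw [map_add, ws_cf D hα]; abel] at h

lemma cas_smul_f (hρ : S.IsGlobalRho ρ) (hJ : ∀ β ∈ J, β.1 ∈ D.lev n) (hα : α ∈ S.pos)
    (hαJ : (S.cf α).support ⊆ J) (hγ : γ.support ⊆ J) (hx : x ∈ S.Mg lam γ)
    (h : cas L J • x = kap L ρ lam γ • x) :
    cas L J • ug (D.f α) • x = kap L ρ lam (γ + S.cf α) • ug (D.f α) • x := by
  classical
  have hs : ∀ {γ δ : S.Simp →₀ ℕ}, γ.support ⊆ J → δ.support ⊆ J → (γ + δ).support ⊆ J :=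
    fun h h' => Finsupp.support_add.trans (Finset.union_subset h h')
  have hsimple : ∀ β : S.Simp, (S.cf β.1).support ⊆ J → ∀ (γ : S.Simp →₀ ℕ)
      (x : S.Verma lam), γ.support ⊆ J → x ∈ S.Mg lam γ → cas L J • x = kap L ρ lam γ • x →
        cas L J • ug (D.f β.1) • x = kap L ρ lam (γ + S.cf β.1) • ug (D.f β.1) • x := by
    intro β hβ γ x hγ hx h
    have hβ : β ∈ J := hβ (by simp [cf_simple D])
    have h1 := congrArg (· • x) (lie_cas L hJ hβ)
    simp only [sub_smul, mul_smul, smul_assoc] at h1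
    rw [cf_simple D, kap_add L hρ hJ lam hγ hβ, ← sub_add_cancel (cas L J • ug (D.f β.1) • x)
      ((L.b β.1 : K)⁻¹ • ug (D.f β.1) • ug (D.c β.1 : g) • x), ← h1, h,
      hx (D.c β.1), smul_comm _ (kap L ρ lam γ) x, smul_comm _ ((lam - S.ws γ) _) x, smul_smul,
      ← add_smul]
  refine pos_induction D (P := fun α => (S.cf α).support ⊆ J → ∀ (γ : S.Simp →₀ ℕ)
    (x : S.Verma lam), γ.support ⊆ J → x ∈ S.Mg lam γ → cas L J • x = kap L ρ lam γ • x →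
      cas L J • ug (D.f α) • x = kap L ρ lam (γ + S.cf α) • ug (D.f α) • x) hsimple ?_ hα hαJ γ
      x hγ hx h
  intro β α hα hβα ih hJ' γ x hγ hx h
  have h1 := support_cf_add D β.2.1 hα (J := ↑J)
  simp only [Finset.coe_subset] at h1
  obtain ⟨hβJ, hαJ⟩ := h1.1 hJ'
  obtain ⟨-, t, ht, ht'⟩ := Chev.exists_eq_smul (D := D) β.2.1 hα hβα
  have h2 : ug (D.f (β.1 + α)) • x =
      t⁻¹ • (ug (D.f β.1) • ug (D.f α) • x - ug (D.f α) • ug (D.f β.1) • x) := by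
    rw [ug_smul_smul (D.f β.1), add_sub_cancel_left, ht', map_smul, smul_assoc, smul_smul,
      inv_mul_cancel₀ ht, one_smul]
  rw [h2, smul_comm _ t⁻¹, smul_sub, hsimple β hβJ _ _ (hs hγ hαJ) (f_smul_mem D hα hx)
    (ih hαJ γ x hγ hx h), ih hαJ _ _ (hs hγ hβJ) (f_smul_mem D β.2.1 hx)
    (hsimple β hβJ γ x hγ hx h), smul_comm _ t⁻¹, cf_add D β.2.1 hα, smul_sub,
    smul_sub, smul_sub, add_right_comm γ (S.cf β.1), add_assoc γ, add_comm (S.cf β.1)]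

lemma cas_smul (hρ : S.IsGlobalRho ρ) (hJ : ∀ β ∈ J, β.1 ∈ D.lev n) (hγ : γ.support ⊆ J)
    (hx : x ∈ S.Mg lam γ) : cas L J • x = kap L ρ lam γ • x := by
  let P : Submodule K (S.Verma lam) :=
    { carrier := {x | cas L J • x = kap L ρ lam γ • x}
      add_mem' := fun {x y} hx hy => by
        simp only [Set.mem_setOf_eq] at *; rw [smul_add, hx, hy, smul_add]
      zero_mem' := by simp
      smul_mem' := fun a x hx => by
        simp only [Set.mem_setOf_eq] at *; rw [smul_comm, hx, smul_comm] }
  refine Mg_le D (P := P) (fun s hs => ?_) hx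
  change cas L J • vb D lam s = kap L ρ lam γ • vb D lam s
  rw [vb_apply, ← hs, ← lw_word]
  rw [← hs, ← lw_word] at hγ
  change cas L J • fw D (word s) • S.hv lam =
    kap L ρ lam (S.lw (word s)) • fw D (word s) • S.hv lam
  have h0 : S.hv lam ∈ S.Mg lam 0 := by
    rw [Mg, map_zero, sub_zero]
    exact hv_mem lam
  clear hs
  generalize word s = w at *
  induction w with
  | nil =>
    have h1 : kap L ρ lam 0 = 0 := by simp [kap, LForm.ip]
    rw [show S.lw ([] : List S.pos) = 0 from rfl, h1, show fw D [] = 1 from wd_nil _, one_smul, cas,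
      sum_smul, zero_smul]
    refine sum_eq_zero fun α _ => ?_
    rw [smul_assoc, mul_smul, e_smul_hv lam α.2 (D.tri _ α.2).he, smul_zero, smul_zero]
  | cons α w ih =>
    rw [lw_cons] at hγ ⊢
    have hw := (support_mono' (le_add_self : S.lw w ≤ S.cf α + S.lw w)).trans hγ
    rw [fw_cons, mul_smul, add_comm]
    have h2 := fw_smul_mem D w h0
    rw [zero_add] at h2
    exact cas_smul_f L hρ hJ α.2
      ((support_mono' (le_self_add : S.cf α ≤ S.cf α + S.lw w)).trans hγ) hw h2 (ih hw)

/-- Vectors which are singular modulo a submodule. -/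
lemma kap_smul_mem (hρ : S.IsGlobalRho ρ) (hJ : ∀ β ∈ J, β.1 ∈ D.lev n) (hγ : γ.support ⊆ J)
    (hx : x ∈ S.Mg lam γ) (V : Submodule (Env K g) (S.Verma lam))
    (he : ∀ α ∈ S.pos, ug (D.e α) • x ∈ V) : kap L ρ lam γ • x ∈ V := by
  rw [← cas_smul L hρ hJ hγ hx, cas, sum_smul]
  refine V.sum_mem fun α _ => ?_
  rw [smul_assoc, mul_smul, ← algebraMap_smul (Env K g)]
  exact V.smul_mem _ (V.smul_mem _ (he α α.2))

end Casimir

namespace LForm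

variable {D : S.Chev} {n : ℕ} (L : LForm D n)

lemma gram_nonneg {β : Dual K S.h} (hα : α ∈ D.lev n) (hβ : β ∈ D.lev n) {m : ℕ} (h : α (D.c β) = m) :
    0 ≤ ∑ i, L.a i α * L.a i β := by
  have h1 := L.gram α hα β hβ
  rw [h] at h1
  have h2 : (m : ℚ) = L.b β * ∑ i, L.a i α * L.a i β := by exact_mod_cast h1
  exact nonneg_of_mul_nonneg_right (h2 ▸ m.cast_nonneg) (L.b_pos β hβ)

lemma gram_nonpos {β : Dual K S.h} (hα : α ∈ D.lev n) (hβ : β ∈ D.lev n) {m : ℕ}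
    (h : α (D.c β) = -m) : ∑ i, L.a i α * L.a i β ≤ 0 := by
  have h1 := L.gram α hα β hβ
  rw [h] at h1
  have h2 : -(m : ℚ) = L.b β * ∑ i, L.a i α * L.a i β := by exact_mod_cast h1
  refine nonpos_of_mul_nonpos_right (h2 ▸ ?_) (L.b_pos β hβ)
  simp

lemma sum_A_mul (r : S.Simp →₀ ℕ) (v : Fin L.m → ℚ) :
    ∑ i, L.A i r * v i = r.sum fun j k => k * ∑ i, L.a i j.1 * v i := by
  simp only [A_eq_sum, Finsupp.sum, Finset.sum_mul, mul_sum, mul_assoc]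
  exact sum_comm

lemma ip_nonpos {s : S.Simp →₀ ℕ} (hr : D.InLev n r) (hs : ∀ β ∈ s.support, β.1 ∈ D.lev n)
    (h : Disjoint r.support s.support) : L.ip r s ≤ 0 := by
  rw [ip, sum_A_mul]
  refine Finset.sum_nonpos fun j hj => mul_nonpos_of_nonneg_of_nonpos (Nat.cast_nonneg _) ?_
  simp only [mul_comm (L.a _ _)]
  rw [sum_A_mul]
  refine Finset.sum_nonpos fun k hk => mul_nonpos_of_nonneg_of_nonpos (Nat.cast_nonneg _) ?_
  obtain ⟨m, hm⟩ := simple_apply_nonpos D k.2 j.2 fun h' =>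
    Finset.disjoint_left.1 h hj (Subtype.ext h' ▸ hk)
  exact L.gram_nonpos (hs k hk) (hr j hj) hm

lemma eq_zero_of_A (hr : D.InLev n r) (h : ∀ i, L.A i r = 0) : r = 0 := by
  classical
  by_contra h0
  obtain ⟨j₀, hj₀⟩ := Finsupp.support_nonempty_iff.2 h0
  obtain ⟨α, hα, hmax⟩ := (Ph D r.support).exists_max_image (fun α => (S.cf α).degree)
    ⟨⟨j₀.1, j₀.2.1⟩, by simpa [cf_simple D] using hj₀⟩
  have hαr := (mem_Ph D).1 hα
  have hαl := mem_lev_of_support D (J := ↑r.support) hr α.2 (by exact_mod_cast hαr)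
  have hnn : ∀ j ∈ r.support, ∃ m : ℕ, α.1 (D.c j.1) = m := by
    intro j hj
    obtain ⟨z, hz⟩ := D.int j.2.1 (Or.inl α.2)
    by_cases hz0 : 0 ≤ z
    · lift z to ℕ using hz0
      exact ⟨z, by simpa using hz⟩
    obtain ⟨m, rfl⟩ : ∃ m : ℕ, z = -(m + 1 : ℕ) := ⟨(-z - 1).toNat, by omega⟩
    have hp : α.1 + j.1 ∈ S.pos := by
      refine (D.add_isRt j.2.1 (Or.inl α.2) (fun h => ?_) (m := m) (by simpa using hz)).resolve_right
        fun h => ?_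
      · exact neg_notMem_pos j.2.1 (h ▸ α.2)
      · have := eq_zero_of_sum_eq_zero D {-(α.1 + j.1), α.1, j.1}
          (by intro γ hγ; simp only [Multiset.insert_eq_cons, Multiset.mem_cons,
            Multiset.mem_singleton] at hγ; rcases hγ with rfl | rfl | rfl <;>
            [exact h; exact α.2; exact j.2.1]) (by simp)
        simp at this
    have h1 := cf_add D α.2 j.2.1
    have h2 : (S.cf (α.1 + j.1)).degree ≤ (S.cf α.1).degree := hmax ⟨_, hp⟩ ((mem_Ph D).2 (by
      rw [h1, cf_simple D]
      refine Finsupp.support_add.trans (Finset.union_subset hαr ?_)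
      exact Finsupp.support_single_subset.trans (Finset.singleton_subset_iff.2 hj)))
    rw [h1, map_add, cf_simple D, Finsupp.degree_single] at h2
    omega
  have hsum : (r.sum fun j k => k * ∑ i, L.a i j.1 * L.a i α.1) = 0 := by
    rw [← sum_A_mul]
    simp [h]
  have hz := (Finset.sum_eq_zero_iff_of_nonneg fun j hj => mul_nonneg (Nat.cast_nonneg _) (by
    obtain ⟨m, hm⟩ := hnn j hj
    exact (L.gram_nonneg hαl (hr j hj) hm).trans_eq
      (sum_congr rfl fun i _ => mul_comm _ _))).1 hsum
  obtain ⟨j, hj, m, hm⟩ := exists_apply_pos D α.2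
  have h1 := L.gram _ (hr j (hαr hj)) _ hαl
  rcases mul_eq_zero.1 (hz j (hαr hj)) with h2 | h2
  · exact Finsupp.mem_support_iff.1 (hαr hj) (by exact_mod_cast h2)
  · rw [h2, hm, Rat.cast_zero, mul_zero] at h1
    exact Nat.cast_ne_zero.2 m.succ_ne_zero h1

lemma A_of_ip (h : L.ip r r ≤ 0) (i : Fin L.m) : L.A i r = 0 :=
  mul_self_eq_zero.1 ((Finset.sum_eq_zero_iff_of_nonneg fun i _ => mul_self_nonneg _).1
    (h.antisymm (Finset.sum_nonneg fun i _ => mul_self_nonneg _)) i (mem_univ i))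

lemma eq_zero_of_ip (hr : D.InLev n r) (h : L.ip r r ≤ 0) : r = 0 := L.eq_zero_of_A hr (L.A_of_ip h)

lemma eq_of_A {s : S.Simp →₀ ℕ} (hr : D.InLev n r) (hs : ∀ β ∈ s.support, β.1 ∈ D.lev n)
    (h : ∀ i, L.A i r = L.A i s) : r = s := by
  obtain ⟨u, r', s', rfl, rfl, hd⟩ : ∃ u r' s', r = u + r' ∧ s = u + s' ∧
      Disjoint r'.support s'.support := by
    refine ⟨r ⊓ s, r - r ⊓ s, s - r ⊓ s, (add_tsub_cancel_of_le inf_le_left).symm,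
      (add_tsub_cancel_of_le inf_le_right).symm, Finset.disjoint_left.2 fun j h3 h4 => ?_⟩
    simp only [Finsupp.mem_support_iff, Finsupp.tsub_apply, Finsupp.inf_apply] at h3 h4
    omega
  have hr' : ∀ β ∈ r'.support, β.1 ∈ D.lev n := fun β hβ => hr β (support_mono' le_add_self hβ)
  have hs' : ∀ β ∈ s'.support, β.1 ∈ D.lev n := fun β hβ => hs β (support_mono' le_add_self hβ)
  have h' : ∀ i, L.A i r' = L.A i s' := fun i => by
    have := h i
    rw [map_add, map_add] at this
    exact add_left_cancel this
  have h3 := L.ip_nonpos hr' hs' hd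
  have h4 : L.ip r' r' = L.ip r' s' := by simp only [ip, h']
  have h5 : L.ip s' s' = L.ip r' s' := by simp only [ip, h']
  rw [L.eq_zero_of_ip hr' (h4.trans_le h3), L.eq_zero_of_ip hs' (h5.trans_le h3)]

lemma t_ne_zero (hr : D.InLev n r) (h : r ≠ 0) : L.t r ≠ 0 := fun h0 => h (L.eq_zero_of_ip hr (by
  have h1 := L.ws_t hr hr
  rw [h0, map_zero] at h1
  exact (Rat.cast_eq_zero.1 h1.symm).le))

lemma exists_dual (hγ : ∀ β ∈ γ.support, β.1 ∈ D.lev n) {β : S.Simp} (hβ : β.1 ∈ D.lev n)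
    (h : γ ≠ single β (γ β)) : ∃ ω : Dual K S.h, ω (D.c β.1) = -1 ∧ ω (L.t γ) = 0 := by
  classical
  suffices hc : D.c β.1 ∉ K ∙ L.t γ by
    obtain ⟨f, h1, h2⟩ := Submodule.exists_le_ker_of_notMem hc
    refine ⟨(-(f (D.c β.1))⁻¹) • f, by simp [h1], ?_⟩
    rw [LinearMap.smul_apply, LinearMap.mem_ker.1 (h2 (Submodule.mem_span_singleton_self _)),
      smul_zero]
  intro hc
  obtain ⟨x, hx⟩ := Submodule.mem_span_singleton.1 hc
  have hb : (L.b β.1 : K) ≠ 0 := by exact_mod_cast (L.b_pos _ hβ).ne'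
  have hs : ∀ β' ∈ (single β 1).support, β'.1 ∈ D.lev n := fun i hi => by
    rwa [Finset.mem_singleton.1 (support_single_subset hi)]
  set γ' := γ.erase β with hγ'
  have hγe : γ β • single β 1 + γ' = γ := by
    rw [smul_single, smul_eq_mul, mul_one, hγ', Finsupp.single_add_erase]
  have h0 : γ' ≠ 0 := fun h0 => h (by
    rw [h0, add_zero, smul_single, smul_eq_mul, mul_one] at hγe; exact hγe.symm)
  have hγ's : ∀ β' ∈ γ'.support, β'.1 ∈ D.lev n := fun i hi =>
    hγ i (support_mono' (hγe ▸ le_add_self) hi)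
  have hd : Disjoint (single β 1).support γ'.support := by
    refine Finset.disjoint_left.2 fun j h3 h4 => ?_
    rw [Finset.mem_singleton.1 (support_single_subset h3)] at h4
    simp [hγ'] at h4
  set τ := L.t (single β 1) with hτ
  have hcτ : D.c β.1 = (L.b β.1 : K) • τ := by
    rw [hτ, L.t_single, one_smul, smul_smul, mul_inv_cancel₀ hb, one_smul]
  have hτ0 : τ ≠ 0 := L.t_ne_zero hs (by simp)
  have hx0 : x ≠ 0 := fun h0 => smul_ne_zero hb hτ0 (by rw [← hcτ, ← hx, h0, zero_smul])
  have hy : L.t γ' = (x⁻¹ * L.b β.1 - γ β : K) • τ := by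
    have h1 : L.t γ = x⁻¹ • (L.b β.1 : K) • τ := by
      rw [← hcτ, ← hx, smul_smul, inv_mul_cancel₀ hx0, one_smul]
    rw [← hγe, map_add, map_nsmul, ← hτ] at h1
    rw [sub_smul, mul_smul, ← h1, cast_smul_eq_nsmul]
    abel
  generalize (x⁻¹ * L.b β.1 - γ β : K) = y at hy
  have hpos : 0 < L.ip (single β 1) (single β 1) :=
    not_le.1 fun h => by simpa using L.eq_zero_of_ip hs h
  obtain ⟨q, hq, hq0⟩ : ∃ q : ℚ, y = -q ∧ 0 ≤ q := by
    refine ⟨-(L.ip (single β 1) γ' / L.ip (single β 1) (single β 1)), ?_,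
      neg_nonneg.2 (div_nonpos_of_nonpos_of_nonneg (L.ip_nonpos hs hγ's hd) hpos.le)⟩
    have h1 := L.ws_t hs hγ's
    rw [hy, map_smul, hτ, L.ws_t hs hs, smul_eq_mul] at h1
    push_cast
    rw [← h1, mul_div_cancel_right₀ _ (by exact_mod_cast hpos.ne'), neg_neg]
  lift q to ℚ≥0 using hq0
  have hz : L.t (q.den • γ' + q.num • single β 1) = 0 := by
    rw [map_add, map_nsmul, map_nsmul, ← hτ, hy, hq, ← cast_smul_eq_nsmul K, smul_smul,
      ← cast_smul_eq_nsmul K q.num, ← add_smul]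
    have h1 : (q : ℚ) * q.den = q.num := by exact_mod_cast q.mul_den_eq_num
    have h2 : ((q : ℚ) : K) * q.den = q.num := by exact_mod_cast congrArg (Rat.cast (K := K)) h1
    rw [show (q.den : K) * -((q : ℚ) : K) + q.num = 0 by rw [← h2]; ring, zero_smul]
  by_contra
  refine L.t_ne_zero (fun i hi => ?_) (fun h1 => h0 ?_) hz
  · rcases Finset.mem_union.1 (Finsupp.support_add hi) with h1 | h1
    · exact hγ's i (Finsupp.support_smul h1)
    · exact hs i (Finsupp.support_smul h1)
  · ext i
    have := DFunLike.congr_fun h1 i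
    simp only [Finsupp.add_apply, Finsupp.smul_apply, smul_eq_mul, Finsupp.coe_zero, Pi.zero_apply,
      add_eq_zero, mul_eq_zero, q.den_ne_zero, false_or] at this
    exact this.1

end LForm

variable {D : S.Chev} {n : ℕ} (L : LForm D n)

namespace LForm

lemma linearIndependent_a {J : Finset S.Simp} (hJ : ∀ β ∈ J, β.1 ∈ D.lev n) :
    LinearIndependent ℚ fun (j : J) i => L.a i j.1.1 := by
  classical
  rw [← LinearIndependent.iff_fractionRing ℤ ℚ, Fintype.linearIndependent_iff]
  intro z hz
  let r (w : J → ℕ) : S.Simp →₀ ℕ := ∑ j : J, single j.1 (w j)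
  have hr : ∀ w, ∀ β ∈ (r w).support, β.1 ∈ D.lev n := fun w β hβ => by
    obtain ⟨j, -, hj⟩ := Finset.mem_biUnion.1 (Finsupp.support_finset_sum hβ)
    rw [Finset.mem_singleton.1 (support_single_subset hj)]
    exact hJ _ j.2
  have hA : ∀ w i, L.A i (r w) = ∑ j : J, w j * L.a i j.1.1 := fun w i => by
    simp [r, A]
  have happ : ∀ w (j : J), r w j.1 = w j := fun w j => by
    simp only [r, finset_sum_apply]
    rw [Finset.sum_eq_single j (fun k _ hk => single_eq_of_ne
      (fun h => hk (Subtype.ext h.symm))) (by simp), single_eq_same]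
  have key := L.eq_of_A (hr fun j => (z j).toNat) (hr fun j => (-z j).toNat) fun i => by
    rw [hA, hA, ← sub_eq_zero, ← sum_sub_distrib]
    refine Eq.trans ?_ (congrFun hz i)
    simp only [Finset.sum_apply, Pi.smul_apply]
    simp only [zsmul_eq_mul, ← sub_mul]
    refine sum_congr rfl fun j _ => ?_
    congr 1
    have := Int.toNat_sub_toNat_neg (z j)
    exact_mod_cast congrArg (Int.cast (R := ℚ)) this
  intro j
  have h1 := DFunLike.congr_fun key j.1
  rw [happ, happ] at h1
  have := Int.toNat_sub_toNat_neg (z j)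
  omega

end LForm

lemma finite_kap_eq_zero {J : Finset S.Simp} (hJ : ∀ β ∈ J, β.1 ∈ D.lev n) (ρ lam : Dual K S.h) :
    {δ : S.Simp →₀ ℕ | δ.support ⊆ J ∧ kap L ρ lam δ = 0}.Finite := by
  classical
  obtain ⟨φ, hφ⟩ := LinearMap.exists_leftInverse_of_injective (Algebra.linearMap ℚ K)
    (LinearMap.ker_eq_bot.2 (algebraMap ℚ K).injective)
  have hφ' : ∀ q : ℚ, φ q = q := fun q => by simpa using LinearMap.congr_fun hφ q
  obtain ⟨B, hB⟩ := LinearMap.exists_leftInverse_of_injective _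
    (LinearMap.ker_eq_bot.2 (L.linearIndependent_a hJ))
  let c : J → ℚ := fun j => φ ((lam + ρ) ((L.b j.1.1 : K)⁻¹ • D.c j.1.1))
  let e : Fin L.m → Fin L.m → ℚ := fun i => Pi.single i 1
  let w : Fin L.m → ℚ := fun i => ∑ j, B (e i) j * c j
  let W : ℚ := ∑ i, w i * w i
  let N : J → ℕ := fun j => ⌈∑ i, (|w i| + W + 1) * |B (e i) j|⌉₊
  refine (Set.finite_Iic (∑ j : J, single j.1 (N j))).subset ?_
  rintro δ ⟨hδ, hk⟩
  let x : Fin L.m → ℚ := fun i => L.A i δ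
  have hsum : ∀ {M : Type} [AddCommMonoid M] (F : S.Simp → ℕ → M), (∀ i, F i 0 = 0) →
      δ.sum F = ∑ j : J, F j.1 (δ j.1) := fun F h0 => by
    rw [Finsupp.sum_of_support_subset δ hδ F fun i _ => h0 i]
    exact (Finset.sum_coe_sort J fun i => F i (δ i)).symm
  have hBx : ∀ j : J, (δ j.1 : ℚ) = B x j := fun j => by
    have h1 := LinearMap.congr_fun hB (Finsupp.equivFunOnFinite.symm fun j : J => (δ j.1 : ℚ))
    have h2 : linearCombination ℚ (fun (j : J) i => L.a i j.1.1)
        (Finsupp.equivFunOnFinite.symm fun j : J => (δ j.1 : ℚ)) = x := by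
      funext i
      simp only [x]
      rw [L.A_eq_sum, hsum _ (by simp), Finsupp.linearCombination_apply,
        Finsupp.sum_fintype _ _ (by simp)]
      simp
    rw [LinearMap.comp_apply, h2] at h1
    rw [h1]; simp
  have hx : ∀ j, B x j = ∑ i, x i * B (e i) j := fun j => by
    conv_lhs => rw [pi_eq_sum_univ' x, map_sum]
    simp only [map_smul, finset_sum_apply, Finsupp.smul_apply, smul_eq_mul]
    rfl
  have hl : φ ((lam + ρ) (L.t δ)) = ∑ i, x i * w i := by
    rw [L.t_eq_sum, hsum _ (by simp), map_sum, map_sum]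
    simp only [map_nsmul]
    simp only [nsmul_eq_mul, hBx, hx, w, mul_sum, Finset.sum_mul]
    rw [sum_comm]
    refine sum_congr rfl fun i _ => sum_congr rfl fun j _ => ?_
    simp only [c]; ring
  have hq : ∑ i, (x i - w i) * (x i - w i) = W := by
    have h1 : φ (kap L ρ lam δ) = ∑ i, x i * w i - 1 / 2 * ∑ i, x i * x i := by
      rw [kap, map_sub, hl, show (1 / 2 * (L.ip δ δ : ℚ) : K) = ((1 / 2 * L.ip δ δ : ℚ) : K) by
        push_cast; rfl, hφ']
      rfl
    rw [hk, map_zero] at h1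
    have h2 : ∑ i, (x i - w i) * (x i - w i) =
        ∑ i, x i * x i - 2 * ∑ i, x i * w i + ∑ i, w i * w i := by
      rw [mul_sum, ← sum_sub_distrib, ← Finset.sum_add_distrib]
      exact sum_congr rfl fun i _ => by ring
    rw [h2]
    linarith
  have hW : 0 ≤ W := Finset.sum_nonneg fun i _ => mul_self_nonneg _
  have hxi : ∀ i, |x i| ≤ |w i| + W + 1 := fun i => by
    have h1 : (x i - w i) * (x i - w i) ≤ W := hq ▸ Finset.single_le_sum
      (f := fun i => (x i - w i) * (x i - w i)) (fun i _ => mul_self_nonneg _) (mem_univ i)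
    have h2 : |x i - w i| ≤ W + 1 := by
      refine abs_le_of_sq_le_sq ?_ (by linarith)
      nlinarith
    have := abs_sub_abs_le_abs_sub (x i) (w i)
    linarith
  intro i
  by_cases hi : i ∈ J
  · rw [finset_sum_apply]
    refine le_trans ?_ (Finset.single_le_sum (f := fun j : J => single j.1 (N j) i)
      (fun _ _ => Nat.zero_le _) (mem_univ ⟨i, hi⟩))
    simp only [single_eq_same]
    have h3 : (δ i : ℚ) ≤ N ⟨i, hi⟩ := by
      refine le_trans ?_ (Nat.le_ceil _)
      rw [hBx ⟨i, hi⟩, hx]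
      refine Finset.sum_le_sum fun k _ => (le_abs_self _).trans ?_
      rw [abs_mul]
      exact mul_le_mul_of_nonneg_right (hxi k) (abs_nonneg _)
    exact_mod_cast h3
  · rw [Finsupp.notMem_support_iff.1 fun h => hi (hδ h)]
    exact Nat.zero_le _

section Singular

variable (S) in
/-- Existence of a singular vector of weight `lam - γ` in the Verma module. -/
def Sing (lam : Dual K S.h) (γ : S.Simp →₀ ℕ) : Prop :=
  ∃ x ∈ S.Mg lam γ, x ≠ 0 ∧ ∀ α ∈ S.pos, ∀ z ∈ S.wt α, ug z • x = 0

variable (S) in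
/-- Polynomial functions on `h*`. -/
def Qalg : Subalgebra K (Dual K S.h → K) :=
  Algebra.adjoin K (range fun (H : S.h) (lam : Dual K S.h) => lam H)

lemma eval_mem_Qalg (H : S.h) : (fun lam : Dual K S.h => lam H) ∈ S.Qalg :=
  Algebra.subset_adjoin ⟨H, rfl⟩

/-- Polynomial functions are polynomial on affine families. -/
lemma Qalg_comp {X R : Type*} [CommRing R] [Algebra K R] (ev : X → R →ₐ[K] K) (pt : X → Dual K S.h)
    (h : ∀ H : S.h, ∃ r, ∀ x, ev x r = pt x H) {q : Dual K S.h → K} (hq : q ∈ S.Qalg) :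
    ∃ r, ∀ x, ev x r = q (pt x) := by
  induction hq using Algebra.adjoin_induction with
  | mem q hq =>
    obtain ⟨H, rfl⟩ := hq
    exact h H
  | algebraMap c => exact ⟨algebraMap K R c, fun x => (ev x).commutes c⟩
  | add p q _ _ hp hq =>
    obtain ⟨a, ha⟩ := hp
    obtain ⟨b, hb⟩ := hq
    exact ⟨a + b, fun x => by rw [map_add, ha, hb, Pi.add_apply]⟩
  | mul p q _ _ hp hq =>
    obtain ⟨a, ha⟩ := hp
    obtain ⟨b, hb⟩ := hq
    exact ⟨a * b, fun x => by rw [map_mul, ha, hb, Pi.mul_apply]⟩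

lemma Qalg_line (lam ω : Dual K S.h) {q : Dual K S.h → K} (hq : q ∈ S.Qalg) :
    ∃ p : Polynomial K, ∀ s : K, p.eval s = q (lam + s • ω) :=
  Qalg_comp (fun s : K => Polynomial.aeval s) (fun s => lam + s • ω) (fun H =>
    ⟨Polynomial.C (lam H) + Polynomial.X * Polynomial.C (ω H), fun s => by
      simp; ring⟩) hq

lemma Qalg_family {σ : Type*} [Fintype σ] (lam : Dual K S.h) (ω : σ → Dual K S.h)
    {q : Dual K S.h → K} (hq : q ∈ S.Qalg) :
    ∃ p : MvPolynomial σ K, ∀ x : σ → K, eval x p = q (lam + ∑ i, x i • ω i) :=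
  Qalg_comp (fun x : σ → K => MvPolynomial.aeval x) (fun x => lam + ∑ i, x i • ω i) (fun H =>
    ⟨MvPolynomial.C (lam H) + ∑ i, MvPolynomial.X i * MvPolynomial.C (ω i H), fun x => by
      simp⟩) hq

lemma det_mem_Qalg {X : Type*} [Fintype X] [DecidableEq X] {M : X → X → Dual K S.h → K}
    (h : ∀ s t, M s t ∈ S.Qalg) : (fun lam => (Matrix.of fun s t => M s t lam).det) ∈ S.Qalg := by
  have : (fun lam => (Matrix.of fun s t => M s t lam).det) =
      ∑ σ : Equiv.Perm X, Equiv.Perm.sign σ • ∏ i, M (σ i) i := by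
    funext lam
    simp [Matrix.det_apply, Finset.sum_apply, Finset.prod_apply]
  rw [this]
  refine sum_mem fun σ _ => ?_
  rcases Int.units_eq_one_or (Equiv.Perm.sign σ) with h1 | h1 <;> rw [h1]
  · rw [one_smul]; exact prod_mem fun i _ => h _ _
  · rw [Units.neg_smul, one_smul]; exact neg_mem (prod_mem fun i _ => h _ _)

variable [LinearOrder S.pos] (D : S.Chev)

lemma th_mem_Qalg (u : Env K g) (t : S.pos →₀ ℕ) : (fun lam => th D lam u t) ∈ S.Qalg := by
  induction (basis (gb D)).mem_span u using span_induction with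
  | mem u hu =>
    obtain ⟨m, rfl⟩ := hu
    have h : (fun lam => th D lam (basis (gb D) m) t) =
        (∏ i ∈ m.support, (fun lam => ch lam i) ^ m i) *
          algebraMap K _ (single (m.comapDomain Ix.f (isChar D (0 : Dual K S.h)).inj.injOn) 1 t) := by
      funext lam
      rw [th, theta, Basis.constr_basis, Finsupp.smul_apply, smul_eq_mul, Finsupp.prod]
      simp [Algebra.algebraMap_eq_smul_one]
    rw [h]
    refine mul_mem (prod_mem fun i _ => pow_mem ?_ _) (algebraMap_mem _ _)
    cases i with
    | f => exact one_mem _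
    | h i => exact eval_mem_Qalg _
    | e => exact zero_mem _
  | zero => simp only [map_zero]; exact zero_mem S.Qalg
  | add u v _ _ hu hv => simp only [map_add]; exact add_mem hu hv
  | smul a u _ hu => simp only [map_smul]; exact S.Qalg.smul_mem hu a

lemma repr_smul_vb (lam : Dual K S.h) (u : Env K g) (s t : S.pos →₀ ℕ) :
    (vb D lam).repr (u • vb D lam s) t = th D lam (u * fw D (word s)) t := by
  rw [vb_apply, ← mul_smul, repr_smul]

lemma exists_det_ne_zero {X R : Type*} [Fintype X] [DecidableEq X] (M : R → X → K)
    (h : ∀ c : X → K, (∀ r, ∑ s, c s * M r s = 0) → c = 0) :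
    ∃ f : X → R, (Matrix.of fun s t => M (f s) t).det ≠ 0 := by
  obtain ⟨κ, a, ha, hs, hli⟩ := exists_linearIndependent' K M
  have htop : span K (range M) = ⊤ := by
    by_contra hne
    obtain ⟨φ, hφ, hle⟩ := Submodule.exists_le_ker_of_lt_top _ (lt_top_iff_ne_top.2 hne)
    refine hφ (LinearMap.pi_ext' fun s => LinearMap.ext_ring ?_)
    have h1 := h (fun s => φ (Pi.single s 1)) fun r => by
      have h2 : φ (M r) = 0 := hle (subset_span ⟨r, rfl⟩)
      rw [pi_eq_sum_univ' (M r), map_sum] at h2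
      rw [← h2]
      exact sum_congr rfl fun s _ => by rw [map_smul, smul_eq_mul, mul_comm]
    exact congrFun h1 s
  let B := Basis.mk hli (by rw [hs, htop])
  haveI := FiniteDimensional.fintypeBasisIndex B
  have e : X ≃ κ := (Pi.basisFun K X).indexEquiv B
  refine ⟨a ∘ e, fun h0 => ?_⟩
  have h1 : LinearIndependent K (Matrix.of fun s t => M ((a ∘ e) s) t).row := hli.comp e e.injective
  exact (Matrix.isUnit_iff_isUnit_det _).1 (Matrix.linearIndependent_rows_iff_isUnit.1 h1) |>.ne_zero
    h0

lemma eq_sum_repr {lam : Dual K S.h} [Fintype (X S γ)] {x : S.Verma lam} (hx : x ∈ S.Mg lam γ) :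
    x = ∑ s : X S γ, (vb D lam).repr x s.1 • vb D lam s.1 := by
  conv_lhs => rw [← (vb D lam).linearCombination_repr x, Finsupp.linearCombination_apply,
    Finsupp.sum_of_support_subset _ (s := (X S γ).toFinset) (fun s hs =>
      Set.mem_toFinset.2 (wts_of_repr D hx (Finsupp.mem_support_iff.1 hs))) _ (by simp)]
  exact Finset.sum_subtype _ (fun s => Set.mem_toFinset) _

lemma exists_repr_eq (lam : Dual K S.h) [Fintype (X S γ)] (c : X S γ → K) :
    ∃ x ∈ S.Mg lam γ, ∀ s : X S γ, (vb D lam).repr x s.1 = c s := by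
  classical
  refine ⟨∑ s, c s • vb D lam s.1, sum_mem fun s _ => smul_mem _ _
    (by convert vb_mem D s.1; exact s.2.symm), fun s => ?_⟩
  simp [finset_sum_apply, Finsupp.single_apply, Subtype.val_inj]

lemma sum_repr_th {lam : Dual K S.h} [Fintype (X S γ)] {x : S.Verma lam} (hx : x ∈ S.Mg lam γ)
    (u : Env K g) (t : S.pos →₀ ℕ) :
    ∑ s : X S γ, (vb D lam).repr x s.1 * th D lam (u * fw D (word s.1)) t =
      (vb D lam).repr (u • x) t := by
  conv_rhs => rw [eq_sum_repr D hx, smul_sum, map_sum, finset_sum_apply]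
  refine sum_congr rfl fun s _ => ?_
  rw [smul_comm, map_smul, Finsupp.smul_apply, repr_smul_vb, smul_eq_mul]

lemma exists_Qalg_of_not_sing (D : S.Chev) {lam₁ : Dual K S.h} (h : ¬ S.Sing lam₁ γ) :
    ∃ q ∈ S.Qalg, q lam₁ ≠ 0 ∧ ∀ lam, q lam ≠ 0 → ¬ S.Sing lam γ := by
  classical
  haveI : Fintype (X S γ) := (X_finite D γ).fintype
  let M (lam : Dual K S.h) (r : S.pos × (S.pos →₀ ℕ)) (s : X S γ) : K :=
    th D lam (ug (D.e r.1) * fw D (word s.1)) r.2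
  obtain ⟨f, hf⟩ := exists_det_ne_zero (M lam₁) fun c hc => by
    obtain ⟨x, hx, hxc⟩ := exists_repr_eq D lam₁ c
    have hx0 : x = 0 := by
      by_contra hx0
      refine h ⟨x, hx, hx0, fun α hα z hz => ?_⟩
      obtain ⟨a, rfl⟩ := D.eq_smul_e hα hz
      have h3 : ug (D.e α) • x = 0 := (vb D lam₁).repr.map_eq_zero_iff.1 (Finsupp.ext fun t => by
        rw [← sum_repr_th D hx]
        refine Eq.trans ?_ (hc (⟨α, hα⟩, t))
        exact sum_congr rfl fun s _ => by rw [hxc])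
      rw [map_smul, smul_assoc, h3, smul_zero]
    funext s
    rw [← hxc, hx0]; simp
  refine ⟨fun lam => (Matrix.of fun s t => M lam (f s) t).det,
    det_mem_Qalg (M := fun s t lam => M lam (f s) t) fun s t => th_mem_Qalg D _ _, hf, ?_⟩
  rintro lam hq ⟨x, hx, hx0, hs⟩
  have h1 := Matrix.eq_zero_of_mulVec_eq_zero hq (v := fun s => (vb D lam).repr x s.1) (by
    funext s
    have h2 := sum_repr_th D hx (ug (D.e (f s).1)) (f s).2
    rw [hs _ (f s).1.2 _ (D.tri _ (f s).1.2).he, map_zero] at h2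
    exact (sum_congr rfl fun t _ => mul_comm _ _).trans h2)
  refine hx0 ((eq_sum_repr D hx).trans (sum_eq_zero fun s _ => ?_))
  rw [show (vb D lam).repr x s.1 = 0 from congrFun h1 s, zero_smul]

lemma sing_line (D : S.Chev) (lam ω : Dual K S.h) (h : {s : K | S.Sing (lam + s • ω) γ}.Infinite)
    (s : K) : S.Sing (lam + s • ω) γ := by
  by_contra hs
  obtain ⟨q, hq, h1, h2⟩ := exists_Qalg_of_not_sing D hs
  obtain ⟨p, hp⟩ := Qalg_line lam ω hq
  have h0 : p = 0 := Polynomial.eq_zero_of_infinite_isRoot p (h.mono fun s' hs' => by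
    by_contra h3
    exact h2 _ (by rw [← hp]; exact h3) hs')
  exact h1 (by rw [← hp, h0, Polynomial.eval_zero])

end Singular

section Reflection

attribute [local instance] LieRing.ofAssociativeRing

variable {V : Type*} [AddCommGroup V] [Module K V] [Module (Env K g) V]
  [IsScalarTower K (Env K g) V]

lemma Tri.moduleOps {e f : g} {u : S.h} (T : S.Tri α e f u) :
    Sl2Ops (Algebra.lsmul K K V (ug e)) (Algebra.lsmul K K V (ug f))
      (Algebra.lsmul K K V (ug (u : g))) where
  ef v := by simp only [Algebra.lsmul_coe]; rw [ug_smul_smul, T.hef]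
  hf v := by
    simp only [Algebra.lsmul_coe]
    rw [ug_smul_smul, T.hf, LinearMap.neg_apply, T.two, map_smul, smul_assoc, neg_smul,
      sub_eq_add_neg]
  he v := by
    simp only [Algebra.lsmul_coe]
    rw [ug_smul_smul, T.he, T.two, map_smul, smul_assoc]

lemma exists_pow_mul (f : g) {z : g} (hn : (ad K g f ^ n) z = 0) (p : ℕ) :
    ∃ u : Env K g, ug f ^ (p + n) * ug z = u * ug f ^ p := by
  induction n generalizing z p with
  | zero => exact ⟨0, by rw [show z = 0 from hn, map_zero, mul_zero, zero_mul]⟩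
  | succ n ih =>
    induction p with
    | zero => exact ⟨_, by rw [pow_zero, mul_one]⟩
    | succ p ihp =>
      obtain ⟨a, ha⟩ := ihp
      obtain ⟨b, hb⟩ := ih (z := ⁅f, z⁆) (by rwa [pow_succ, End.mul_apply] at hn) (p + 1)
      refine ⟨a + b, ?_⟩
      have h1 : ug f * ug z = ug z * ug f + ug ⁅f, z⁆ := by
        rw [LieHom.map_lie, LieRing.of_associative_ring_bracket]; abel
      rw [← add_assoc, pow_succ, mul_assoc, h1, mul_add, hb, ← mul_assoc,
        show p + 1 + n = p + (n + 1) by ring, ha, add_mul, mul_assoc, ← pow_succ]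

lemma e_smul_eq_zero_of_simple (D : S.Chev) {x : V} (h : ∀ β : S.Simp, ug (D.e β.1) • x = 0)
    (hα : α ∈ S.pos) {z : g} (hz : z ∈ S.wt α) : ug z • x = 0 := by
  obtain ⟨t, rfl⟩ := D.eq_smul_e hα hz
  rw [map_smul, smul_assoc]
  refine smul_eq_zero_of_right _ (pos_induction D (P := fun α => ug (D.e α) • x = 0) h ?_ hα)
  intro β α hα hs ih
  obtain ⟨t, ht, h1⟩ := (Chev.exists_eq_smul (D := D) β.2.1 hα hs).1
  have h2 := ug_smul_smul (K := K) (D.e β.1) (D.e α) x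
  rw [ih, h β, smul_zero, smul_zero, zero_add, h1, map_smul, smul_assoc] at h2
  exact (smul_eq_zero.1 h2.symm).resolve_left ht

variable [LinearOrder S.pos] {ρ lam : Dual K S.h} {x : S.Verma lam} (D : S.Chev)

lemma exists_pow_f_smul_mem {β : Dual K S.h} (hβ : β ∈ S.pos)
    (N : Submodule (Env K g) (S.Verma lam)) {p : ℕ} (hp : ug (D.f β) ^ p • S.hv lam ∈ N)
    (x : S.Verma lam) : ∃ k, ug (D.f β) ^ k • x ∈ N := by
  have mono : ∀ {x k} l, ug (D.f β) ^ k • x ∈ N → ug (D.f β) ^ (l + k) • x ∈ N :=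
    fun l h => by rw [pow_add, mul_smul]; exact N.smul_mem _ h
  obtain ⟨u, hu, rfl⟩ := exists_um D lam x
  induction hu using span_induction with
  | mem u hu =>
    obtain ⟨s, rfl⟩ := hu
    change ∃ k, ug (D.f β) ^ k • fw D (word s) • S.hv lam ∈ N
    generalize word s = L
    induction L with
    | nil => exact ⟨p, by rwa [show fw D [] = 1 from wd_nil _, one_smul]⟩
    | cons α L ih =>
      obtain ⟨k, hk⟩ := ih
      obtain ⟨n, hn⟩ := exists_pow_ad_eq_zero
        (neg_ne_zero.2 fun h => zero_notMem_pos (h ▸ hβ)) (D.tri _ hβ).hf (D.f α)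
      obtain ⟨u, hu⟩ := exists_pow_mul (D.f β) hn k
      refine ⟨k + n, ?_⟩
      rw [fw_cons, mul_smul, ← mul_smul, hu, mul_smul]
      exact N.smul_mem _ hk
  | zero => exact ⟨0, by simp⟩
  | add u v _ _ hu hv =>
    obtain ⟨k, hk⟩ := hu
    obtain ⟨l, hl⟩ := hv
    refine ⟨l + k, ?_⟩
    rw [add_smul, smul_add]
    exact N.add_mem (mono _ hk) (by rw [add_comm]; exact mono _ hl)
  | smul a u _ hu =>
    obtain ⟨k, hk⟩ := hu
    refine ⟨k, ?_⟩
    rw [smul_assoc, smul_comm]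
    exact (N.restrictScalars K).smul_mem a hk

lemma pow_f_smul_mem (β : S.Simp) (k : ℕ) (hx : x ∈ S.Mg lam γ) :
    ug (D.f β.1) ^ k • x ∈ S.Mg lam (γ + single β k) := by
  induction k with
  | zero => simpa using hx
  | succ k ih =>
    rw [pow_succ', mul_smul, Finsupp.single_add, ← add_assoc]
    have := f_smul_mem D β.2.1 ih
    rwa [cf_simple D] at this

lemma pow_f_smul_ne_zero {β : Dual K S.h} (hβ : β ∈ S.pos) (k : ℕ) (hx : x ≠ 0) :
    ug (D.f β) ^ k • x ≠ 0 := by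
  induction k with
  | zero => simpa using hx
  | succ k ih =>
    rw [pow_succ', mul_smul]
    intro h
    have h1 : ug (D.f β) ∈ um D := by
      have := fw_mem_um D [⟨β, hβ⟩]
      rwa [fw_cons, show fw D [] = 1 from wd_nil _, mul_one] at this
    haveI := noZeroDivisors (gb D)
    have h2 := um_smul_eq_zero D h1 ih h
    refine (vb D 0).ne_zero (expo [⟨β, hβ⟩]) ?_
    rw [vb_apply, word_expo (List.pairwise_singleton _ _), fw_cons, h2, zero_mul, zero_smul]

/-- A power of a simple root vector sends a singular vector to a singular vector. -/
lemma sing_pow_f (β : S.Simp) {q : ℕ} (hx : x ∈ S.Mg lam γ)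
    (hs : ∀ α ∈ S.pos, ∀ z ∈ S.wt α, ug z • x = 0) (hq : (lam - S.ws γ) (D.c β.1) = (q : K) - 1)
    (hα : α ∈ S.pos) {z : g} (hz : z ∈ S.wt α) : ug z • ug (D.f β.1) ^ q • x = 0 := by
  refine e_smul_eq_zero_of_simple D (fun δ => ?_) hα hz
  by_cases hδ : δ = β
  · subst hδ
    rcases q with _ | q
    · rw [pow_zero, one_smul]; exact hs _ δ.2.1 _ (D.tri _ δ.2.1).he
    have h1 := ((D.tri _ δ.2.1).moduleOps (V := S.Verma lam)).e_pow_f (v := x) (hx _) q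
    rw [← map_pow (Algebra.lsmul K K (S.Verma lam)), hq] at h1
    simp only [Algebra.lsmul_coe] at h1
    rw [h1, hs _ δ.2.1 _ (D.tri _ δ.2.1).he]
    simp
  · have hc : Commute (ug (D.e δ.1)) (ug (D.f β.1)) := by
      have h0 : ⁅D.f β.1, D.e δ.1⁆ = 0 := lie_f_e_eq_zero D β δ.2.1
        (fun h => hδ (Subtype.ext h)) fun h => δ.2.2 ⟨{β.1, δ.1 - β.1}, by simp, by
          simp [h, β.2.1], by simp⟩
      have h2 := congrArg ug h0
      rw [LieHom.map_lie, LieRing.of_associative_ring_bracket, map_zero, sub_eq_zero] at h2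
      exact h2.symm
    rw [← mul_smul, (hc.pow_right q).eq, mul_smul, hs _ δ.2.1 _ (D.tri _ δ.2.1).he, smul_zero]

lemma hv_ne_zero (D : S.Chev) : S.hv lam ≠ 0 := by
  have h1 := (vb D lam).ne_zero (expo [])
  rwa [vb_apply, word_expo List.Pairwise.nil, show fw D [] = 1 from wd_nil _, one_smul] at h1

lemma sing_reflect (hρ : S.IsGlobalRho ρ) (β : S.Simp) {a b p q : ℕ}
    (hγ : S.ws γ (D.c β.1) = (a : K) - b) (hq : 0 < q) (hpq : p + b = q + a)
    (hp : (lam + ρ) (D.c β.1) = p) (h : S.Sing lam γ) :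
    ∃ γ₁, γ₁ + single β a = γ + single β b ∧ S.Sing (lam - p • β.1) γ₁ := by
  have hlam : lam (D.c β.1) = (p : K) - 1 := by
    rw [← hp, LinearMap.add_apply, rho_simple D hρ]; ring
  have hv0 : S.hv lam ∈ S.Mg lam 0 := by rw [Mg, map_zero, sub_zero]; exact hv_mem lam
  have hv1 := pow_f_smul_mem D β p hv0
  obtain ⟨φ, hφ⟩ := exists_hom (μ := lam - p • β.1) (w := ug (D.f β.1) ^ p • S.hv lam)
    (by rwa [Mg, zero_add, ws_single] at hv1) fun α hα z hz => sing_pow_f D β hv0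
      (fun α hα z hz => e_smul_hv lam hα hz) (by rw [map_zero, sub_zero, hlam]) hα hz
  have hinj := hom_injective D φ (hφ ▸ pow_f_smul_ne_zero D β.2.1 p (hv_ne_zero D))
  obtain ⟨x, hx, hx0, hs⟩ := h
  have hpK : (p : K) + b = q + a := by exact_mod_cast hpq
  have hxq : (lam - S.ws γ) (D.c β.1) = (q : K) - 1 := by
    rw [LinearMap.sub_apply, hlam, hγ]; linear_combination hpK
  obtain ⟨k, hk⟩ := exists_pow_f_smul_mem D β.2.1 (LinearMap.range φ) ⟨_, hφ⟩ x
  obtain ⟨y, hy⟩ : ug (D.f β.1) ^ q • x ∈ LinearMap.range φ := by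
    obtain ⟨m, rfl⟩ : ∃ m, q = m + 1 := ⟨q - 1, by omega⟩
    have h1 := ((D.tri _ β.2.1).moduleOps (V := S.Verma lam ⧸ LinearMap.range φ)).pow_f_eq_zero
      (m := m) (k := k) (v := Submodule.Quotient.mk x) ?_ ?_ ?_
    · rw [← map_pow] at h1
      exact (Submodule.Quotient.mk_eq_zero _).1 h1
    · refine (congrArg Submodule.Quotient.mk (hx _)).trans ?_
      rw [hxq, Nat.cast_succ, add_sub_cancel_right]; rfl
    · exact congrArg Submodule.Quotient.mk (hs _ β.2.1 _ (D.tri _ β.2.1).he)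
    · rw [← map_pow]
      exact (Submodule.Quotient.mk_eq_zero _).2 hk
  have hy0 : y ≠ 0 := by
    rintro rfl
    exact pow_f_smul_ne_zero D β.2.1 q hx0 (by rw [← hy, map_zero])
  have hyw : y ∈ S.WV _ (lam - S.ws (γ + single β q)) := fun H => hinj (by
    rw [map_smul, hy, pow_f_smul_mem D β q hx H, ← algebraMap_smul (Env K g), ← hy, ← map_smul,
      algebraMap_smul])
  obtain ⟨γ₁, h1⟩ := exists_weight D hyw hy0
  refine ⟨γ₁, ws_injective D ?_, y, by rwa [h1] at hyw, hy0, fun α hα z hz => hinj (by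
    rw [map_smul, hy, map_zero, sing_pow_f D β hx hs hxq hα hz])⟩
  have h2 : S.ws γ₁ = S.ws γ + q • β.1 - p • β.1 := by
    rw [map_add, ws_single] at h1
    calc S.ws γ₁ = lam - p • β.1 - (lam - p • β.1 - S.ws γ₁) := by abel
      _ = _ := by rw [← h1]; abel
  rw [map_add, map_add, ws_single, ws_single, h2, add_sub_right_comm, add_assoc, sub_add,
    ← add_nsmul, ← hpq, add_nsmul]
  abel

end Reflection

section Embedding

variable {D : S.Chev} {n : ℕ} {ρ lam : Dual K S.h} {x : S.Verma lam}

variable (L : LForm D n)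

lemma kap_reflect (lam : Dual K S.h) {β : S.Simp} (hβ : β.1 ∈ D.lev n) {γ₁ : S.Simp →₀ ℕ}
    (hγ : D.InLev n γ) (hγ₁ : D.InLev n γ₁) {a b : ℕ} (p : ℕ) (hm : S.ws γ (D.c β.1) = (a : K) - b)
    (h : γ₁ + single β a = γ + single β b) (hp : (lam + ρ) (D.c β.1) = -(p : K)) :
    kap L ρ (lam + p • β.1) γ = kap L ρ lam γ₁ := by
  have hs : D.InLev n (single β 1) := fun i hi => by
    rwa [Finset.mem_singleton.1 (support_single_subset hi)]
  have hB := L.ws_t hs hγ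
  rw [L.ip_comm, ← L.ws_t hγ hs, L.t_single, ws_single, one_smul, one_smul, map_smul, hm,
    smul_eq_mul] at hB
  have h2 : β.1 (D.c β.1) = 2 := (D.tri _ β.2.1).two
  have ht : L.t γ₁ = L.t γ + (((b : K) - a) * (L.b β.1 : K)⁻¹) • D.c β.1 := by
    have := congrArg L.t h
    rw [map_add, map_add, L.t_single, L.t_single] at this
    rw [eq_sub_of_add_eq this, ← cast_smul_eq_nsmul K, ← cast_smul_eq_nsmul K]
    module
  have hw : S.ws γ₁ = S.ws γ + ((b : K) - a) • β.1 := by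
    have := congrArg S.ws h
    rw [map_add, map_add, ws_single, ws_single] at this
    rw [eq_sub_of_add_eq this, ← cast_smul_eq_nsmul K, ← cast_smul_eq_nsmul K]
    module
  rw [kap, kap, ← L.ws_t hγ hγ, ← L.ws_t hγ₁ hγ₁, ht, hw, map_add, map_add, map_smul, map_smul,
    hp, add_right_comm, LinearMap.add_apply _ (p • β.1), LinearMap.smul_apply]
  simp only [LinearMap.add_apply, LinearMap.smul_apply, smul_eq_mul, nsmul_eq_mul, hB, hm, h2]
  ring

lemma kap_nsmul_cf (lam : Dual K S.h) (hα : α ∈ S.pos) (h : D.InLev n (S.cf α)) (r : ℕ) :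
    kap L ρ lam (r • S.cf α) = r * (L.b α : K)⁻¹ * ((lam + ρ) (D.c α) - r) := by
  have hr : D.InLev n (r • S.cf α) := fun i hi => h i (Finsupp.support_smul hi)
  rw [kap, ← L.ws_t hr hr, map_nsmul, map_nsmul S.ws, ws_cf D hα,
    (L.a_and_c_eq (J := {i | i.1 ∈ D.lev n}) (fun _ hi => hi) hα h).2]
  simp only [map_nsmul, map_smul, LinearMap.smul_apply, (D.tri α hα).two, smul_eq_mul, nsmul_eq_mul]
  ring

lemma exists_ws_int (D : S.Chev) (γ : S.Simp →₀ ℕ) (β : S.Simp) :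
    ∃ z : ℤ, S.ws γ (D.c β.1) = z := by
  induction γ using Finsupp.induction_linear with
  | zero => exact ⟨0, by simp⟩
  | add r s hr hs =>
    obtain ⟨y, hy⟩ := hr
    obtain ⟨z, hz⟩ := hs
    exact ⟨y + z, by rw [map_add, LinearMap.add_apply, hy, hz]; push_cast; rfl⟩
  | single δ k =>
    obtain ⟨z, hz⟩ := D.int β.2.1 (Or.inl δ.2.1)
    exact ⟨k * z, by rw [ws_single, LinearMap.smul_apply, hz]; simp⟩

/-- A singular vector of weight `lam - γ` exists whenever the Casimir condition allows it. -/
def ESing (ρ : Dual K S.h) (γ : S.Simp →₀ ℕ) : Prop :=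
  ∀ lam, kap L ρ lam γ = 0 → S.Sing lam γ

variable {L} [LinearOrder S.pos]

lemma ESing.reflect (hρ : S.IsGlobalRho ρ) (hE : ESing L ρ γ) {β : S.Simp} (hβ : β.1 ∈ D.lev n)
    (hγ : D.InLev n γ) (hne : γ ≠ single β (γ β)) {a b : ℕ} (hm : S.ws γ (D.c β.1) = (a : K) - b) :
    ∃ γ₁, γ₁ + single β a = γ + single β b ∧ ESing L ρ γ₁ := by
  have h2 : β.1 (D.c β.1) = 2 := (D.tri _ β.2.1).two
  have key : ∀ (lam : Dual K S.h) (k : ℕ), (lam + ρ) (D.c β.1) = -((k + (a + 1) : ℕ) : K) →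
      kap L ρ (lam + (k + (a + 1)) • β.1) γ = 0 →
      ∃ γ₁, γ₁ + single β a = γ + single β b ∧ S.Sing lam γ₁ := by
    intro lam k h1 h0
    have h3 := sing_reflect D hρ β (p := k + (a + 1)) (q := k + 1 + b) hm (by omega) (by omega)
      (by
        rw [add_right_comm, LinearMap.add_apply, h1, LinearMap.smul_apply, h2]
        simp only [nsmul_eq_mul]; ring) (hE _ h0)
    rwa [add_sub_cancel_right] at h3
  obtain ⟨γ₁, h1, -⟩ : ∃ γ₁, γ₁ + single β a = γ + single β b ∧ True := by
    obtain ⟨ω, h3, h4⟩ := L.exists_dual hγ hβ hne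
    obtain ⟨ν, hν⟩ : ∃ ν : Dual K S.h, ν (L.t γ) ≠ 0 := by
      by_contra! hc
      exact L.t_ne_zero hγ (fun h => hne (by simp [h])) ((forall_dual_apply_eq_zero_iff K _).1 hc)
    let x : K := (1 / 2 * (L.ip γ γ : ℚ)) / ν (L.t γ)
    obtain ⟨γ₁, h5, -⟩ := key (x • ν + (x * ν (D.c β.1) - (a + 1)) • ω - (0 + (a + 1)) • β.1 - ρ) 0
      (by
        simp only [LinearMap.add_apply, LinearMap.sub_apply, LinearMap.smul_apply, h3, h2,
          smul_eq_mul, nsmul_eq_mul]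
        push_cast; ring) (by
        have hx : x * ν (L.t γ) = 1 / 2 * (L.ip γ γ : ℚ) := div_mul_cancel₀ _ hν
        simp only [kap, LinearMap.add_apply, LinearMap.sub_apply, LinearMap.smul_apply, h4,
          smul_eq_mul]
        linear_combination hx)
    exact ⟨γ₁, h5, trivial⟩
  have hj : ∀ j, j ≠ β → γ₁ j = γ j := fun j hj => by
    have := DFunLike.congr_fun h1 j
    rwa [Finsupp.add_apply, Finsupp.add_apply, single_eq_of_ne hj,
      single_eq_of_ne hj] at this
  have hγ₁ : D.InLev n γ₁ := fun j hj' => by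
    by_cases h : j = β
    · rwa [h]
    · exact hγ j (by rw [Finsupp.mem_support_iff, ← hj j h]; exact Finsupp.mem_support_iff.1 hj')
  refine ⟨γ₁, h1, fun lam₁ h0 => ?_⟩
  obtain ⟨ω, h3, h4⟩ := L.exists_dual hγ₁ hβ fun h => hne (Finsupp.ext fun j => by
    by_cases hjb : j = β
    · rw [hjb, single_eq_same]
    · rw [← hj j hjb, h, single_eq_of_ne hjb, single_eq_of_ne hjb])
  have h5 := sing_line D lam₁ ω (γ := γ₁) (Set.infinite_of_injective_forall_mem
    (f := fun k : ℕ => (lam₁ + ρ) (D.c β.1) + ((k + (a + 1) : ℕ) : K)) (fun k l hkl => by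
      simpa using hkl) fun k => ?_) 0
  · rwa [zero_smul, add_zero] at h5
  · have h6 : (lam₁ + ((lam₁ + ρ) (D.c β.1) + ((k + (a + 1) : ℕ) : K)) • ω + ρ) (D.c β.1) =
        -((k + (a + 1) : ℕ) : K) := by
      simp only [LinearMap.add_apply, LinearMap.smul_apply, h3, smul_eq_mul]; ring
    obtain ⟨γ', h7, h8⟩ := key _ k h6 (by
      rw [kap_reflect L _ hβ hγ hγ₁ _ hm h1 h6, ← h0, kap, kap]
      simp only [LinearMap.add_apply, LinearMap.smul_apply, h4, smul_zero, add_zero])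
    rwa [add_right_cancel (h7.trans h1.symm)] at h8

lemma sing_zero (D : S.Chev) (lam : Dual K S.h) : S.Sing lam 0 :=
  ⟨S.hv lam, by rw [Mg, map_zero, sub_zero]; exact hv_mem lam, hv_ne_zero D,
    fun α hα z hz => e_smul_hv lam hα hz⟩

lemma eSing_nsmul_cf (hρ : S.IsGlobalRho ρ) (L : LForm D n) (r : ℕ) (hα : α ∈ S.pos)
    (h : D.InLev n (S.cf α)) : ESing L ρ (r • S.cf α) := by
  rcases Nat.eq_zero_or_pos r with rfl | hr
  · exact fun lam _ => by rw [zero_smul]; exact sing_zero D lam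
  induction hd : (S.cf α).degree using Nat.strong_induction_on generalizing α with
  | _ d ih =>
  subst hd
  by_cases hs : S.IsSimpleRoot α
  · obtain ⟨β, rfl⟩ : ∃ β : S.Simp, α = β.1 := ⟨⟨α, hs⟩, rfl⟩
    intro lam h0
    have hβ : β.1 ∈ D.lev n := h β (by rw [cf_simple D]; simp)
    rw [kap_nsmul_cf L lam hα h, mul_assoc, mul_eq_zero, or_iff_right (by exact_mod_cast hr.ne'),
      mul_eq_zero, or_iff_right (inv_ne_zero (by exact_mod_cast (L.b_pos _ hβ).ne')), sub_eq_zero]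
      at h0
    have hv0 : S.hv lam ∈ S.Mg lam 0 := by rw [Mg, map_zero, sub_zero]; exact hv_mem lam
    have h1 := pow_f_smul_mem D β r hv0
    rw [zero_add] at h1
    rw [cf_simple D, smul_single, smul_eq_mul, mul_one]
    obtain ⟨x, -, hx0, -⟩ := sing_zero D lam
    refine ⟨_, h1, pow_f_smul_ne_zero D β.2.1 r fun h => hx0 ?_, fun α hα z hz =>
      sing_pow_f D β hv0 (fun α hα z hz => e_smul_hv lam hα hz) ?_ hα hz⟩
    · obtain ⟨u, -, rfl⟩ := exists_um D lam x
      rw [h, smul_zero]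
    · rw [map_zero, sub_zero, ← h0, LinearMap.add_apply, rho_simple D hρ, add_sub_cancel_right]
  · obtain ⟨β, hβ, m, hm⟩ := exists_apply_pos D hα
    obtain ⟨k, hk⟩ := apply_pos_symm D hα β.2.1 hm
    have hne : α ≠ β.1 := fun h => hs (h ▸ β.2)
    have h1 := simple_reflect_mem D β hα hne
    rw [hk, cast_smul_eq_nsmul] at h1
    have h2 : S.cf (α - (k + 1) • β.1) + single β (k + 1) = S.cf α :=
      ws_injective D (by rw [map_add, ws_cf D h1, ws_cf D hα, ws_single, sub_add_cancel])
    have h3 : D.InLev n (S.cf (α - (k + 1) • β.1)) := fun i hi =>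
      h i (support_mono' (h2 ▸ le_self_add) hi)
    have h5 : β.1 (D.c β.1) = 2 := (D.tri _ β.2.1).two
    obtain ⟨γ₁, h4, h6⟩ := (ih _ (by rw [← h2, map_add]; simp) h1 h3 rfl).reflect hρ
      (h β hβ) (fun i hi => h3 i (Finsupp.support_smul hi)) (a := 0) (b := r * (k + 1)) (fun he => by
        have h7 : S.cf (α - (k + 1) • β.1) = single β (S.cf (α - (k + 1) • β.1) β) := by
          ext j
          have := DFunLike.congr_fun he j
          by_cases hj : j = β
          · rw [hj, single_eq_same]
          · rw [single_eq_of_ne hj] at this ⊢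
            exact (Nat.mul_eq_zero.1 this).resolve_left hr.ne'
        generalize S.cf (α - (k + 1) • β.1) β = l at h7
        rw [h7, ← Finsupp.single_add] at h2
        have h8 := ws_cf D hα
        rw [← h2, ws_single] at h8
        have h9 := D.eq_one_of_nsmul_mem β.2.1 (h8 ▸ hα)
        rw [h9, one_smul] at h8
        exact hne h8.symm) (by
        rw [map_nsmul, ws_cf D h1, LinearMap.smul_apply, LinearMap.sub_apply, hk,
          LinearMap.smul_apply, h5]
        simp only [nsmul_eq_mul]; push_cast; ring)
    rw [Finsupp.single_zero, add_zero] at h4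
    rw [h4] at h6
    rwa [← h2, smul_add, smul_single, smul_eq_mul]

/-- Verma embeddings. -/
lemma sing_nsmul_cf (D : S.Chev) (hρ : S.IsGlobalRho ρ) (hα : α ∈ S.pos) {r : ℕ}
    (h : (lam + ρ) (D.c α) = r) : S.Sing lam (r • S.cf α) := by
  obtain ⟨n, L, hL⟩ := exists_lform D (S.cf α).support
  exact eSing_nsmul_cf hρ L r hα hL lam (by
    rw [kap_nsmul_cf L lam hα hL, h, sub_self, mul_zero])

/-- The only weights allowed by the Casimir condition are multiples of positive roots. -/
lemma ESing.exists_eq (hρ : S.IsGlobalRho ρ) (hE : ESing L ρ γ) (hγ : D.InLev n γ) (h0 : γ ≠ 0) :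
    ∃ α ∈ S.pos, ∃ r : ℕ, 0 < r ∧ γ = r • S.cf α := by
  induction hd : γ.degree using Nat.strong_induction_on generalizing γ with
  | _ d ih =>
  subst hd
  obtain ⟨β, hβ, a, ha0, ha⟩ : ∃ β ∈ γ.support, ∃ a : ℕ, 0 < a ∧ S.ws γ (D.c β.1) = a := by
    by_contra! hc
    refine h0 (L.eq_zero_of_ip hγ ?_)
    choose z hz using exists_ws_int D γ
    have h1 : (L.ip γ γ : K) = ((∑ j ∈ γ.support, γ j * (L.b j.1)⁻¹ * z j : ℚ) : K) := by
      rw [← L.ws_t hγ hγ, L.t_eq_sum, Finsupp.sum, map_sum]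
      push_cast
      exact sum_congr rfl fun j _ => by
        rw [map_nsmul, map_smul, hz, smul_eq_mul, nsmul_eq_mul, mul_assoc]
    rw [Rat.cast_inj.1 h1]
    refine Finset.sum_nonpos fun j hj => mul_nonpos_of_nonneg_of_nonpos
      (mul_nonneg (Nat.cast_nonneg _) (inv_nonneg.2 (L.b_pos _ (hγ j hj)).le)) ?_
    by_contra! h2
    have h3 : 0 < z j := by exact_mod_cast h2
    refine hc j hj (z j).toNat (by omega) ?_
    rw [hz, ← Int.cast_natCast, Int.toNat_of_nonneg h3.le]
  by_cases hne : γ = single β (γ β)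
  · exact ⟨β.1, β.2.1, γ β, Nat.pos_of_ne_zero (Finsupp.mem_support_iff.1 hβ), by
      rw [cf_simple D, smul_single, smul_eq_mul, mul_one]; exact hne⟩
  obtain ⟨γ₁, h1, h2⟩ := hE.reflect hρ (hγ β hβ) hγ hne (a := a) (b := 0) (by rw [ha]; simp)
  rw [Finsupp.single_zero, add_zero] at h1
  have hns : ∀ k, γ ≠ single β k := fun k hk => hne (by
    conv_rhs => rw [hk, single_eq_same]
    exact hk)
  obtain ⟨α, hα, r, hr, h3⟩ := ih _ (by rw [← h1, map_add]; simpa using ha0) h2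
    (fun i hi => hγ i (support_mono' (h1 ▸ le_self_add) hi))
    (fun h => hns a (by rw [← h1, h, zero_add])) rfl
  have hαβ : α ≠ β.1 := fun h => hns (r + a) (by
    rw [← h1, h3, h, cf_simple D, smul_single, smul_eq_mul, mul_one, Finsupp.single_add])
  have h4 := simple_reflect_mem D β hα hαβ
  refine ⟨_, h4, r, hr, ws_injective D ?_⟩
  have h5 : (r : K) * α (D.c β.1) = -a := by
    have := congrArg (fun x => S.ws x (D.c β.1)) h1
    simp only [map_add, h3, map_nsmul, ws_cf D hα, ws_single, LinearMap.add_apply,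
      LinearMap.smul_apply, (D.tri _ β.2.1).two, ha, nsmul_eq_mul] at this
    linear_combination this
  rw [map_nsmul, ws_cf D h4, ← h1, map_add, h3, map_nsmul, ws_cf D hα, ws_single,
    ← cast_smul_eq_nsmul K, ← cast_smul_eq_nsmul K, ← cast_smul_eq_nsmul K, smul_sub,
    smul_smul, h5]
  module

end Embedding

section SimpleSubmodule

variable [LinearOrder S.pos] {ρ lam : Dual K S.h} {x : S.Verma lam} (D : S.Chev)

lemma two_mul_ncard_X_le (D : S.Chev) {η : S.Simp →₀ ℕ} {w y : S.Verma lam} (hw : w ∈ S.Mg lam η)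
    (hy : y ∈ S.Mg lam η) (hw0 : w ≠ 0) (hy0 : y ≠ 0)
    (h : ∀ a b : Env K g, a • w + b • y = 0 → a • w = 0) (γ : S.Simp →₀ ℕ) :
    2 * (X S γ).ncard ≤ (X S (η + γ)).ncard := by
  classical
  haveI : Fintype (X S γ) := (X_finite D γ).fintype
  haveI : Fintype (X S (η + γ)) := (X_finite D _).fintype
  let v : X S γ ⊕ X S γ → S.Verma lam :=
    Sum.elim (fun s => fw D (word s.1) • w) (fun s => fw D (word s.1) • y)
  have hv : ∀ i, v i ∈ S.Mg lam (η + γ) := by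
    have h (s : X S γ) {z : S.Verma lam} (hz : z ∈ S.Mg lam η) :
        fw D (word s.1) • z ∈ S.Mg lam (η + γ) := by
      have := fw_smul_mem D (word s.1) hz
      rwa [lw_word, show S.wts s.1 = γ from s.2] at this
    rintro (s | s)
    exacts [h s hw, h s hy]
  let M : X S γ ⊕ X S γ → X S (η + γ) → K := fun i t => (vb D lam).repr (v i) t.1
  have hM : LinearIndependent K M := by
    refine Fintype.linearIndependent_iff.2 fun c hc => ?_
    have h0 : ∑ i, c i • v i = 0 := by
      rw [eq_sum_repr D (sum_mem fun i _ => smul_mem _ (c i) (hv i))]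
      refine sum_eq_zero fun t _ => smul_eq_zero_of_left ?_ _
      simpa [Finset.sum_apply, finset_sum_apply] using congrFun hc t
    have hz : ∀ (c : X S γ → K) {z : S.Verma lam}, z ≠ 0 →
        (∑ s, c s • fw D (word s.1)) • z = 0 → ∀ s, c s = 0 := fun c z hz hcz => by
      have h1 := um_smul_eq_zero D (sum_mem fun s _ =>
        smul_mem _ _ (fw_mem_um D _)) hz hcz
      refine Fintype.linearIndependent_iff.1 ((vb D lam).linearIndependent.comp _
        Subtype.val_injective) c ?_
      rw [← zero_smul (Env K g) (S.hv lam), ← h1, sum_smul]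
      exact sum_congr rfl fun s _ => by rw [smul_assoc, ← vb_apply]; rfl
    have hs : ∀ (c : X S γ → K) (z : S.Verma lam),
        ∑ s, c s • fw D (word s.1) • z = (∑ s, c s • fw D (word s.1)) • z := fun c z => by
      rw [sum_smul]
      exact sum_congr rfl fun s _ => (smul_assoc _ _ _).symm
    rw [Fintype.sum_sum_type] at h0
    change ∑ s : X S γ, c (Sum.inl s) • fw D (word s.1) • w +
      ∑ s : X S γ, c (Sum.inr s) • fw D (word s.1) • y = 0 at h0
    rw [hs (fun s => c (Sum.inl s)), hs (fun s => c (Sum.inr s))] at h0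
    have h1 := h _ _ h0
    rw [h1, zero_add] at h0
    rintro (s | s)
    exacts [hz (fun s => c (Sum.inl s)) hw0 h1 s, hz (fun s => c (Sum.inr s)) hy0 h0 s]
  have h1 := hM.fintype_card_le_finrank
  rw [finrank_fintype_fun_eq_card, Fintype.card_sum, ← Nat.card_eq_fintype_card,
    ← Nat.card_eq_fintype_card, Nat.card_coe_set_eq, Nat.card_coe_set_eq] at h1
  omega

/-- Any two nonzero submodules generated by weight vectors intersect. -/
lemma exists_smul_eq (D : S.Chev) {μ ν : S.Simp →₀ ℕ} {w y : S.Verma lam} (hw : w ∈ S.Mg lam μ)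
    (hy : y ∈ S.Mg lam ν) (hw0 : w ≠ 0) (hy0 : y ≠ 0) :
    ∃ a b : Env K g, a • w = b • y ∧ a • w ≠ 0 := by
  by_contra! hc
  obtain ⟨s, hs⟩ := exists_repr_ne_zero D hy0
  obtain ⟨t, ht⟩ := exists_repr_ne_zero D hw0
  have hw' := fw_smul_mem D (word s) hw
  have hy' := fw_smul_mem D (word t) hy
  rw [lw_word, wts_of_repr D hy hs] at hw'
  rw [lw_word, wts_of_repr D hw ht, add_comm] at hy'
  have hne : ∀ (s : S.pos →₀ ℕ) {z : S.Verma lam}, z ≠ 0 → fw D (word s) • z ≠ 0 :=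
    fun s z hz h => (vb D lam).ne_zero s (by
      rw [vb_apply, um_smul_eq_zero D (fw_mem_um D _) hz h, zero_smul])
  have key := two_mul_ncard_X_le D hw' hy' (hne s hw0) (hne t hy0) fun a b h => by
    rw [← mul_smul] at h ⊢
    refine hc _ (-b * fw D (word t)) ?_
    rw [mul_smul (-b), neg_smul, eq_neg_of_add_eq_zero_left h]
  have hpow : ∀ j : ℕ, 2 ^ j ≤ (X S (j • (μ + ν))).ncard := fun j => by
    induction j with
    | zero =>
      rw [zero_smul, pow_zero]
      exact (Set.ncard_pos (X_finite D 0)).2 ⟨0, map_zero _⟩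
    | succ j ih =>
      rw [succ_nsmul', pow_succ']
      exact (Nat.mul_le_mul_left 2 ih).trans (key _)
  set d := (μ + ν).degree
  set c := (Ph D (μ + ν).support).card
  have hle : ∀ j : ℕ, 2 ^ j ≤ (j * d + 1) ^ c := fun j => (hpow j).trans (by
    have := X_ncard_le D (γ := j • (μ + ν)) (J := (μ + ν).support) Finsupp.support_smul
    rwa [map_nsmul, smul_eq_mul] at this)
  have hlim := ((tendsto_pow_const_div_const_pow_of_one_lt c (r := (2 : ℝ)) (by norm_num)).const_mul
    ((d + 1 : ℝ) ^ c)).eventually (Iio_mem_nhds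
      (show (d + 1 : ℝ) ^ c * 0 < 1 by rw [mul_zero]; exact one_pos))
  obtain ⟨j, hj1, hj2⟩ := (hlim.and (Filter.eventually_ge_atTop 1)).exists
  rw [← mul_div_assoc, div_lt_one (by positivity), ← mul_pow] at hj1
  have h1 : (2 : ℝ) ^ j ≤ (j * d + 1 : ℝ) ^ c := by exact_mod_cast hle j
  refine absurd (hj1.trans_le (h1.trans (pow_le_pow_left₀ (by positivity) ?_ c))) (lt_irrefl _)
  have : (1 : ℝ) ≤ j := by exact_mod_cast hj2
  nlinarith

lemma finite_badSet_of_simple (hρ : S.IsGlobalRho ρ) (N : Submodule (Env K g) (S.Verma lam))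
    (hN : IsSimpleModule (Env K g) N) : (D.badSet ρ lam).Finite := by
  have hat : IsAtom N := isSimpleModule_iff_isAtom.1 hN
  obtain ⟨ν, y, hy, hyN, hy0⟩ : ∃ ν, ∃ y ∈ S.Mg lam ν, y ∈ N ∧ y ≠ 0 := by
    by_contra! hc
    exact hat.1 (le_bot_iff.1 (mem_of_components D fun γ x hx hxN => hc γ x hx hxN))
  refine (finite_supported D ν.support).subset ?_
  rintro α ⟨hα, k, hk, h1⟩
  obtain ⟨w, hw, hw0, hs⟩ := sing_nsmul_cf D hρ hα h1
  obtain ⟨a, b, hab, h0⟩ := exists_smul_eq D hw hy hw0 hy0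
  have hle : N ≤ span (Env K g) {w} := by
    refine (hat.le_iff_eq ?_).1 inf_le_left ▸ inf_le_right
    refine (Submodule.ne_bot_iff _).2 ⟨a • w, ⟨hab ▸ N.smul_mem b hyN, ?_⟩, h0⟩
    exact smul_mem _ a (Submodule.mem_span_singleton_self w)
  obtain ⟨φ, hφ⟩ := exists_hom hw hs
  obtain ⟨u, hu⟩ := Submodule.mem_span_singleton.1 (hle hyN)
  rw [← hφ, ← map_smul] at hu
  replace hu : φ (u • S.hv _) = y := hu
  have hinj := hom_injective D φ (hφ ▸ hw0)
  obtain ⟨γ, hγ⟩ := exists_weight D (μ := lam - S.ws ν) (lam := lam - S.ws (k • S.cf α))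
    (x := u • S.hv _) (fun H => hinj (by
      rw [map_smul, hu, ← algebraMap_smul (Env K g) ((lam - S.ws ν) H) (u • S.hv _), map_smul, hu,
        algebraMap_smul, hy H])) (fun h => hy0 (by rw [← hu]; exact (congrArg φ h).trans (map_zero φ)))
  rw [sub_sub, sub_right_inj, ← map_add] at hγ
  rw [ws_injective D hγ]
  refine ⟨hα, subset_trans ?_ (support_mono' le_self_add)⟩
  rw [Finsupp.support_smul_eq hk.ne']

end SimpleSubmodule

section Parabolic

variable [LinearOrder S.pos] {lam : Dual K S.h} {I : Finset S.Simp} {x : S.Verma lam} (D : S.Chev)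

variable (S) in
/-- Exponents of roots not supported in `I` whose weight differs from `γ` by a weight supported
in `I`. -/
def Aset (I : Finset S.Simp) (γ : S.Simp →₀ ℕ) : Set (S.pos →₀ ℕ) :=
  {σ | (∀ α ∈ σ.support, ¬ (S.cf α).support ⊆ I) ∧ ∃ r, r.support ⊆ I ∧ γ = r + S.wts σ}

lemma Aset_finite (D : S.Chev) (I : Finset S.Simp) (γ : S.Simp →₀ ℕ) : (S.Aset I γ).Finite := by
  classical
  refine ((Set.finite_Iic γ).biUnion fun γ' _ => X_finite D γ').subset ?_
  rintro σ ⟨-, r, -, rfl⟩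
  exact Set.mem_biUnion (Set.mem_Iic.2 le_add_self) rfl

variable (S I) in
/-- The roots supported in `I` come last. -/
def LeviLast : Prop :=
  ∀ α β : S.pos, ¬ (S.cf α).support ⊆ I → (S.cf β).support ⊆ I → α < β

lemma repr_fw_smul (hord : S.LeviLast I) (hr : r.support ⊆ I) {y : S.Verma lam}
    (hy : y ∈ S.Mg lam r) {σ τ t : S.pos →₀ ℕ} (hσ : ∀ α ∈ σ.support, ¬ (S.cf α).support ⊆ I)
    (hτ : ∀ α ∈ τ.support, ¬ (S.cf α).support ⊆ I) (ht : ∀ α ∈ t.support, (S.cf α).support ⊆ I) :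
    (vb D lam).repr (fw D (word σ) • y) (τ + t) =
      if σ = τ then (vb D lam).repr y t else 0 := by
  have hs : ∀ s ∈ ((vb D lam).repr y).support, ∀ α ∈ s.support, (S.cf α).support ⊆ I :=
    fun s hs α hα => (support_mono' (cf_le_wts hα)).trans
      (wts_of_repr D hy (Finsupp.mem_support_iff.1 hs) ▸ hr)
  have h1 : ∀ s ∈ ((vb D lam).repr y).support,
      fw D (word σ) • vb D lam s = vb D lam (σ + s) := fun s h => by
    have h2 : (word σ ++ word s).Pairwise (· ≤ ·) := List.pairwise_append.2
      ⟨word_sorted _, word_sorted _, fun α hα β hβ =>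
        (hord α β (hσ α (mem_word.1 hα)) (hs s h β (mem_word.1 hβ))).le⟩
    rw [vb_apply, vb_apply, ← mul_smul, ← fw_append, ← word_expo h2, expo_append, expo_word,
      expo_word]
  have hz : ∀ {p q : S.pos →₀ ℕ}, (∀ α ∈ p.support, ¬ (S.cf α).support ⊆ I) →
      (∀ α ∈ q.support, (S.cf α).support ⊆ I) → ∀ α, p α = 0 ∨ q α = 0 := fun hp hq α => by
    by_contra! hc
    exact hp α (Finsupp.mem_support_iff.2 hc.1) (hq α (Finsupp.mem_support_iff.2 hc.2))
  have h2 : ∀ s ∈ ((vb D lam).repr y).support, σ + s = τ + t → σ = τ ∧ s = t := fun s h e => by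
    have h3 : ∀ α, σ α = τ α ∧ s α = t α := fun α => by
      have e1 : σ α + s α = τ α + t α := DFunLike.congr_fun e α
      have := hz hσ (hs s h) α
      have := hz hτ (hs s h) α
      have := hz hσ ht α
      have := hz hτ ht α
      omega
    exact ⟨Finsupp.ext fun α => (h3 α).1, Finsupp.ext fun α => (h3 α).2⟩
  conv_lhs => rw [← (vb D lam).linearCombination_repr y, Finsupp.linearCombination_apply,
    Finsupp.sum, smul_sum, map_sum, finset_sum_apply]
  have h3 : ∀ s ∈ ((vb D lam).repr y).support,
      (vb D lam).repr (fw D (word σ) • (vb D lam).repr y s • vb D lam s) (τ + t) =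
      if s = t then (if σ = τ then (vb D lam).repr y t else 0) else 0 := fun s h => by
    rw [smul_comm, h1 s h, map_smul, Basis.repr_self, Finsupp.smul_apply, Finsupp.single_apply]
    by_cases hst : s = t
    · subst hst
      simp only [add_left_inj, if_true, smul_eq_mul, mul_ite, mul_one, mul_zero]
    · rw [if_neg hst, if_neg fun e => hst (h2 s h e).2, smul_zero]
  rw [sum_congr rfl h3, Finset.sum_ite_eq']
  split_ifs with h4 h5 h5
  exacts [rfl, rfl, (Finsupp.notMem_support_iff.1 h4).symm, rfl]

lemma eq_zero_of_sum_fw_smul (hord : S.LeviLast I) {T : Finset (S.pos →₀ ℕ)}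
    (hT : ∀ σ ∈ T, ∀ α ∈ σ.support, ¬ (S.cf α).support ⊆ I) {y : (S.pos →₀ ℕ) → S.Verma lam}
    (hy : ∀ σ ∈ T, ∃ r : S.Simp →₀ ℕ, r.support ⊆ I ∧ y σ ∈ S.Mg lam r)
    (h0 : ∑ σ ∈ T, fw D (word σ) • y σ = 0) {τ : S.pos →₀ ℕ} (hτ : τ ∈ T) : y τ = 0 := by
  by_contra hne
  obtain ⟨t, ht⟩ := exists_repr_ne_zero D hne
  have hl : ∀ α ∈ t.support, (S.cf α).support ⊆ I := fun α hα => by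
    obtain ⟨r, hr, hm⟩ := hy τ hτ
    exact (support_mono' (cf_le_wts hα)).trans (wts_of_repr D hm ht ▸ hr)
  have h1 := DFunLike.congr_fun (congrArg (vb D lam).repr h0) (τ + t)
  rw [map_sum, finset_sum_apply, map_zero] at h1
  rw [sum_congr rfl fun σ hσ => by
    obtain ⟨r, hr, hm⟩ := hy σ hσ
    exact repr_fw_smul D hord hr hm (hT σ hσ) (hT τ hτ) hl, Finset.sum_ite_eq', if_pos hτ] at h1
  exact ht h1

lemma ew_swap (a c : List S.pos) (α β : S.pos) (h1 : ew D (a ++ β :: α :: c) • x = 0)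
    (h2 : ∀ δ : S.pos, S.cf δ = S.cf α + S.cf β → ew D (a ++ δ :: c) • x = 0) :
    ew D (a ++ α :: β :: c) • x = 0 := by
  rw [ew_append, ew_cons, ew_cons, mul_smul, mul_smul, mul_smul] at h1 ⊢
  rw [ug_smul_smul, smul_add, h1, zero_add]
  by_cases h : α.1 + β.1 ∈ S.pos
  · obtain ⟨⟨t, -, ht⟩, -⟩ := Chev.exists_eq_smul (D := D) α.2 β.2 h
    have h3 := h2 ⟨_, h⟩ (cf_add D α.2 β.2)
    rw [ew_append, ew_cons, mul_smul, mul_smul] at h3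
    rw [ht, map_smul, smul_assoc, smul_comm _ t, h3, smul_zero]
  · rw [show ⁅D.e α.1, D.e β.1⁆ = 0 from by_contra fun h0 => h (S.pos_add _ α.2 _ β.2
      (isRoot_of_mem (add_ne_zero_of_pos α.2 β.2)
        (lie_mem_wt (D.tri _ α.2).he (D.tri _ β.2).he) h0)), map_zero, zero_smul, smul_zero]

/-- All products of raising operators to weights supported in `I` kill `x`. -/
def Killed (D : S.Chev) (I : Finset S.Simp) (γ : S.Simp →₀ ℕ) (x : S.Verma lam) : Prop :=
  ∀ (L : List S.pos) (r : S.Simp →₀ ℕ), r.support ⊆ I → γ = r + S.lw L → ew D L • x = 0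

lemma lw_reverse (L : List S.pos) : S.lw L.reverse = S.lw L := by
  rw [lw, lw, List.map_reverse]
  exact (List.reverse_perm _).sum_eq

lemma killed_of_Aset (hord : S.LeviLast I) (h : ∀ σ ∈ S.Aset I γ, ew D (word σ).reverse • x = 0) :
    Killed D I γ x := by
  classical
  intro L
  refine word_induction (ι := S.posᵒᵈ) (P := fun L : List S.pos => ∀ r : S.Simp →₀ ℕ,
    r.support ⊆ I → γ = r + S.lw L → ew D L • x = 0) ?_ ?_ L
  · intro (L : List S.pos) (hL : L.Pairwise (fun α β => β ≤ α)) r hr hγ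
    induction L generalizing r with
    | nil =>
      have h1 : word (expo ([] : List S.pos)) = [] := word_expo List.Pairwise.nil
      have h2 := h (expo []) ⟨fun α hα => by
        rw [← mem_word, h1] at hα; exact absurd hα List.not_mem_nil, r, hr, by
        rw [← lw_word, h1, hγ]⟩
      rwa [h1] at h2
    | cons α L ih =>
      by_cases hα : (S.cf α).support ⊆ I
      · rw [ew_cons, mul_smul, ih hL.of_cons (r + S.cf α)
          (Finsupp.support_add.trans (Finset.union_subset hr hα)) (by rw [hγ, lw_cons, add_assoc]),
          smul_zero]
      · have h1 : word (expo (α :: L).reverse) = (α :: L).reverse :=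
          word_expo (List.pairwise_reverse.2 hL)
        have h2 := h (expo (α :: L).reverse) ⟨fun β hβ hI => ?_, r, hr, ?_⟩
        · rwa [h1, List.reverse_reverse] at h2
        · rw [← mem_word, h1, List.mem_reverse, List.mem_cons] at hβ
          obtain rfl | hβ := hβ
          · exact hα hI
          · exact absurd (hord α β hα hI) (not_lt.2 ((List.pairwise_cons.1 hL).1 β hβ))
        · rw [← lw_word, h1, lw_reverse, hγ]
  · intro (a : List S.pos) (α : S.pos) (β : S.pos) (c : List S.pos) _ h1 h2 r hr hγ
    replace hγ := hγ.trans (congrArg (r + ·) (lw_append a (α :: β :: c)))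
    refine ew_swap D a c α β (h1 r hr (hγ.trans ?_)) fun δ hδ =>
      h2 (a ++ δ :: c) (show (a ++ δ :: c : List S.pos).length <
        (a ++ α :: β :: c : List S.pos).length by simp) r hr (hγ.trans ?_)
    · change _ = r + S.lw (a ++ β :: α :: c : List S.pos)
      rw [lw_append, lw_cons, lw_cons, lw_cons, lw_cons]; abel
    · change _ = r + S.lw (a ++ δ :: c : List S.pos)
      rw [lw_append, lw_cons, lw_cons, lw_cons, hδ, add_assoc (S.cf α)]

lemma Killed.exists_sing (D : S.Chev) {γ : S.Simp →₀ ℕ} {x : S.Verma lam} (hx : x ∈ S.Mg lam γ)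
    (h0 : x ≠ 0) (h : Killed D I γ x) : ∃ γ' ≤ γ, ¬ γ'.support ⊆ I ∧ S.Sing lam γ' := by
  by_cases hs : ∀ α ∈ S.pos, ∀ z ∈ S.wt α, ug z • x = 0
  · refine ⟨γ, le_rfl, fun hI => h0 ?_, x, hx, h0, hs⟩
    have := h [] γ hI (add_zero _).symm
    rwa [show ew D [] = 1 from wd_nil _, one_smul] at this
  push Not at hs
  obtain ⟨α, hα, z, hz, hne⟩ := hs
  obtain ⟨γ₁, rfl, hx₁⟩ := e_smul_mem D hα hz hx hne
  obtain ⟨t, rfl⟩ := D.eq_smul_e hα hz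
  have hlt : γ₁.degree < (γ₁ + S.cf α).degree := by
    rw [map_add, Nat.lt_add_right_iff_pos, Nat.pos_iff_ne_zero, Ne, Finsupp.degree_eq_zero_iff]
    exact cf_ne_zero D hα
  obtain ⟨γ', h1, h2⟩ := Killed.exists_sing D hx₁ hne fun L r hr hγ => by
    have := h (L ++ [⟨α, hα⟩]) r hr (by
      rw [hγ, lw_append, ← add_assoc]; exact congrArg (r + S.lw L + ·) (add_zero (S.cf α)).symm)
    rw [ew_append, ew_cons, show ew D [] = 1 from wd_nil _, mul_one, mul_smul] at this
    rw [map_smul, smul_assoc, smul_comm _ t, this, smul_zero]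
  exact ⟨γ', h1.trans le_self_add, h2⟩
termination_by γ.degree

/-- The operator detecting the weights supported in `I`. -/
def uop (D : S.Chev) (I : Finset S.Simp) (γ : S.Simp →₀ ℕ) : Env K g :=
  ∑ σ ∈ (Aset_finite D I γ).toFinset, fw D (word σ) * ew D (word σ).reverse

lemma ew_smul_mem_of_Aset (hx : x ∈ S.Mg lam γ) {σ : S.pos →₀ ℕ} (hσ : σ ∈ S.Aset I γ) :
    ∃ r : S.Simp →₀ ℕ, r.support ⊆ I ∧ γ = r + S.wts σ ∧ ew D (word σ).reverse • x ∈ S.Mg lam r := by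
  obtain ⟨-, r, hr, rfl⟩ := hσ
  exact ⟨r, hr, rfl, ew_smul_mem D _ (by rwa [lw_reverse, lw_word])⟩

lemma uop_smul_mem (hx : x ∈ S.Mg lam γ) : uop D I γ • x ∈ S.Mg lam γ := by
  rw [uop, sum_smul]
  refine sum_mem fun σ hσ => ?_
  obtain ⟨r, -, h1, h2⟩ := ew_smul_mem_of_Aset D hx ((Set.Finite.mem_toFinset _).1 hσ)
  rw [mul_smul, h1, ← lw_word]
  exact fw_smul_mem D _ h2

lemma exists_sing_of_uop (D : S.Chev) (hord : S.LeviLast I) {x : S.Verma lam} (hx : x ∈ S.Mg lam γ)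
    (h0 : x ≠ 0) (hu : uop D I γ • x = 0) : ∃ γ' ≤ γ, ¬ γ'.support ⊆ I ∧ S.Sing lam γ' := by
  refine Killed.exists_sing D hx h0 (killed_of_Aset D hord fun τ hτ => ?_)
  rw [uop, sum_smul] at hu
  simp only [mul_smul] at hu
  refine eq_zero_of_sum_fw_smul D hord (y := fun σ => ew D (word σ).reverse • x)
    (fun σ hσ => ((Set.Finite.mem_toFinset _).1 hσ).1) (fun σ hσ => ?_) hu
    ((Set.Finite.mem_toFinset _).2 hτ)
  obtain ⟨r, h1, -, h2⟩ := ew_smul_mem_of_Aset D hx ((Set.Finite.mem_toFinset _).1 hσ)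
  exact ⟨r, h1, h2⟩

lemma finite_Mg (D : S.Chev) (lam : Dual K S.h) (γ : S.Simp →₀ ℕ) :
    FiniteDimensional K (S.Mg lam γ) := by
  haveI : FiniteDimensional K (span K (vb D lam '' X S γ)) :=
    FiniteDimensional.span_of_finite K ((X_finite D γ).image (vb D lam))
  exact Submodule.finiteDimensional_of_le (S₂ := span K (vb D lam '' X S γ))
    (Mg_le D fun s hs => subset_span (Set.mem_image_of_mem _ hs))

/-- If no singular weight lies outside `I`, then submodules are determined by their weight spaces
supported in `I`. -/
lemma le_of_forall_supported (hord : S.LeviLast I)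
    (hs : ∀ γ, ∀ x ∈ S.Mg lam γ, uop D I γ • x = 0 → x = 0)
    {V V' : Submodule (Env K g) (S.Verma lam)} (hle : V ≤ V')
    (h : ∀ r : S.Simp →₀ ℕ, r.support ⊆ I → ∀ x ∈ S.Mg lam r, x ∈ V' → x ∈ V) : V' ≤ V := by
  refine mem_of_components D fun γ x hx hxV => ?_
  haveI := finite_Mg D lam γ
  let W := V.restrictScalars K ⊓ S.Mg lam γ
  let W' := V'.restrictScalars K ⊓ S.Mg lam γ
  have hW : W ≤ W' := inf_le_inf_right _ hle
  have hV : ∀ y : W', uop D I γ • y.1 ∈ V := fun y => by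
    rw [uop, sum_smul]
    refine V.sum_mem fun σ hσ => ?_
    obtain ⟨r, h1, -, h2⟩ := ew_smul_mem_of_Aset D y.2.2 ((Set.Finite.mem_toFinset _).1 hσ)
    rw [mul_smul]
    exact V.smul_mem _ (h r h1 _ h2 (V'.smul_mem _ y.2.1))
  let T : W' →ₗ[K] W := ((Algebra.lsmul K K (S.Verma lam) (uop D I γ)).comp W'.subtype).codRestrict
    W fun y => ⟨hV y, uop_smul_mem D y.2.2⟩
  have hT : Function.Injective T := by
    rw [injective_iff_map_eq_zero]
    exact fun y hy => Subtype.ext (hs γ _ y.2.2 (congrArg Subtype.val hy))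
  haveI : FiniteDimensional K W' := Submodule.finiteDimensional_of_le (inf_le_right (b := S.Mg lam γ))
  have h1 := Submodule.eq_of_le_of_finrank_le hW (LinearMap.finrank_le_finrank_of_injective hT)
  have : x ∈ W := h1 ▸ ⟨hxV, hx⟩
  exact this.1

end Parabolic

section FiniteLength

variable [LinearOrder S.pos] {ρ lam : Dual K S.h} {I : Finset S.Simp} {x : S.Verma lam}

lemma Sing.kap_eq_zero (L : LForm D n) (hρ : S.IsGlobalRho ρ) (hγ : D.InLev n γ) (h : S.Sing lam γ) :
    kap L ρ lam γ = 0 := by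
  obtain ⟨x, hx, hx0, hs⟩ := h
  have := kap_smul_mem L hρ hγ subset_rfl hx ⊥ fun α hα =>
    (Submodule.mem_bot _).2 (hs α hα _ (D.tri α hα).he)
  exact (smul_eq_zero.1 ((Submodule.mem_bot _).1 this)).resolve_right hx0

/-- The determinant of `uop` on a weight space. -/
lemma exists_Qalg_uop (D : S.Chev) (I : Finset S.Simp) (γ : S.Simp →₀ ℕ) :
    ∃ q ∈ S.Qalg, ∀ lam : Dual K S.h, q lam = 0 ↔
      ∃ x ∈ S.Mg lam γ, x ≠ 0 ∧ uop D I γ • x = 0 := by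
  classical
  haveI : Fintype (X S γ) := (X_finite D γ).fintype
  refine ⟨_, det_mem_Qalg (M := fun (s t : X S γ) lam =>
    th D lam (uop D I γ * fw D (word s.1)) t.1) fun s t => th_mem_Qalg D _ _, fun lam => ?_⟩
  rw [← Matrix.exists_vecMul_eq_zero_iff]
  constructor
  · rintro ⟨v, hv, h⟩
    obtain ⟨x, hx, h1⟩ := exists_repr_eq D lam v
    refine ⟨x, hx, fun h0 => hv (funext fun s => ?_), ?_⟩
    · rw [← h1, h0, map_zero]; rfl
    · rw [eq_sum_repr D (uop_smul_mem D hx)]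
      refine sum_eq_zero fun t _ => smul_eq_zero_of_left ?_ _
      rw [← sum_repr_th D hx]
      exact (sum_congr rfl fun s _ => by rw [h1]; rfl).trans (congrFun h t)
  · rintro ⟨x, hx, hx0, h⟩
    refine ⟨fun s => (vb D lam).repr x s.1, fun h1 => hx0 ?_, funext fun t => ?_⟩
    · rw [eq_sum_repr D hx]
      exact sum_eq_zero fun s _ => smul_eq_zero_of_left (congrFun h1 s) _
    · refine (sum_repr_th D hx _ _).trans ?_
      rw [h, map_zero]; rfl

/-- At `lam`, the Casimir condition for a weight outside the supports of the bad roots is not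
implied by the existence of singular vectors. -/
lemma not_eSing_of_badSet (L : LForm D n) (hρ : S.IsGlobalRho ρ)
    (hI : ∀ α ∈ D.badSet ρ lam, (S.cf α).support ⊆ I) (hγ : D.InLev n γ) (hne : ¬ γ.support ⊆ I)
    (hk : kap L ρ lam γ = 0) : ¬ ESing L ρ γ := fun hE => by
  obtain ⟨α, hα, r, hr, rfl⟩ := hE.exists_eq hρ hγ (by rintro rfl; simp at hne)
  rw [Chev.InLev, Finsupp.support_smul_eq hr.ne'] at hγ
  rw [Finsupp.support_smul_eq hr.ne'] at hne
  have hb : (L.b α : K) ≠ 0 := fun h => L.t_ne_zero hγ (cf_ne_zero D hα) (by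
    rw [(L.a_and_c_eq (J := {i | i.1 ∈ D.lev n}) (fun _ hi => hi) hα hγ).2, h, inv_zero,
      zero_smul])
  rw [kap_nsmul_cf L lam hα hγ, mul_eq_zero,
    or_iff_right (mul_ne_zero (Nat.cast_ne_zero.2 hr.ne') (inv_ne_zero hb)), sub_eq_zero] at hk
  exact hne (hI α ⟨hα, r, hr, hk⟩)

lemma uop_injective (D : S.Chev) (hρ : S.IsGlobalRho ρ) (hord : S.LeviLast I)
    (hI : ∀ α ∈ D.badSet ρ lam, (S.cf α).support ⊆ I) (hx : x ∈ S.Mg lam γ) (hu : uop D I γ • x = 0) :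
    x = 0 := by
  classical
  by_contra hx0
  obtain ⟨n, L, hJ⟩ := exists_lform D γ.support
  let C := {γ' | γ' ≤ γ ∧ ¬ γ'.support ⊆ I}
  haveI : Fintype C := ((Set.finite_Iic γ).subset fun γ' h => h.1).fintype
  have hlev : ∀ i : C, D.InLev n i.1 := fun i β hβ => hJ β (support_mono' i.2.1 hβ)
  have key : ∀ i : C, ∃ (μ ω : Dual K S.h), ∃ q ∈ S.Qalg, ω (L.t i.1) ≠ 0 ∧
      (∀ lam, S.Sing lam i.1 → q lam = 0) ∧
      (kap L ρ lam i.1 = 0 → kap L ρ μ i.1 = 0 ∧ q μ ≠ 0) := fun i => by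
    obtain ⟨ω, hω⟩ : ∃ ω : Dual K S.h, ω (L.t i.1) ≠ 0 := by
      by_contra! hc
      refine L.t_ne_zero (hlev i) (fun h => i.2.2 ?_) ((forall_dual_apply_eq_zero_iff K _).1 hc)
      rw [h]; exact Finset.empty_subset _
    by_cases hk : kap L ρ lam i.1 = 0
    · have hE := not_eSing_of_badSet L hρ hI (hlev i) i.2.2 hk
      rw [ESing] at hE
      push Not at hE
      obtain ⟨μ, h1, h2⟩ := hE
      obtain ⟨q, hq, h3, h4⟩ := exists_Qalg_of_not_sing D h2
      exact ⟨μ, ω, q, hq, hω, fun lam h => by_contra fun h5 => h4 lam h5 h, fun _ => ⟨h1, h3⟩⟩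
    · exact ⟨0, ω, 0, zero_mem _, hω, fun _ _ => rfl, fun h => absurd h hk⟩
  choose μ ω q hq hω hq1 hq2 using key
  obtain ⟨d, hd, hd0⟩ := exists_Qalg_uop D I γ
  let v : C × Bool → Dual K S.h := fun j => bif j.2 then μ j.1 - lam else ω j.1
  obtain ⟨P, hP⟩ := Qalg_family lam v hd
  choose Q hQ using fun i => Qalg_family lam v (hq i)
  let l : C → MvPolynomial (C × Bool) K := fun i =>
    MvPolynomial.C (kap L ρ lam i.1) + ∑ j, MvPolynomial.C (v j (L.t i.1)) * MvPolynomial.X j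
  have hl : ∀ i x, eval x (l i) = kap L ρ (lam + ∑ j, x j • v j) i.1 := fun i x => by
    simp only [l, map_add, map_sum, map_mul, MvPolynomial.eval_C, MvPolynomial.eval_X, kap,
      LinearMap.add_apply, LinearMap.sum_apply, LinearMap.smul_apply, smul_eq_mul, mul_comm (x _)]
    ring
  have hs : ∀ j : C × Bool, ∑ j', (Pi.single j 1 : C × Bool → K) j' • v j' = v j := fun j => by
    simp [Pi.single_apply]
  have h0 : ∑ j, (0 : C × Bool → K) j • v j = 0 := by simp
  obtain ⟨i, -, h1, h2⟩ : ∃ i ∈ Finset.univ, eval 0 (l i) = 0 ∧ l i ∣ Q i := by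
    refine exists_dvd_of_zero (P := P) _ l Q (fun i _ => ?_) (fun i _ h => ?_) (fun x hPx => ?_) ?_
    · refine (MvPolynomial.totalDegree_add _ _).trans (max_le ?_ ?_)
      · rw [MvPolynomial.totalDegree_C]; exact zero_le_one
      · refine MvPolynomial.totalDegree_finsetSum_le fun j _ =>
          (MvPolynomial.totalDegree_mul _ _).trans ?_
        rw [MvPolynomial.totalDegree_C, MvPolynomial.totalDegree_X]
    · have e := hl i (Pi.single (i, false) 1)
      have e0 := hl i 0
      rw [h, map_zero, hs] at e
      rw [h, map_zero, h0, add_zero] at e0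
      refine hω i ?_
      rw [kap] at e e0
      change 0 = (lam + ω i + ρ) _ - _ at e
      simp only [LinearMap.add_apply] at e e0
      linear_combination e0 - e
    · rw [hP] at hPx
      obtain ⟨x, hx, hx0, hu⟩ := (hd0 _).1 hPx
      obtain ⟨γ', h1, h2, h3⟩ := exists_sing_of_uop D hord hx hx0 hu
      refine ⟨⟨γ', h1, h2⟩, mem_univ _, ?_, ?_⟩
      · rw [hl]; exact h3.kap_eq_zero L hρ (hlev ⟨γ', h1, h2⟩)
      · rw [hQ]; exact hq1 ⟨γ', h1, h2⟩ _ h3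
    · rw [hP, h0, add_zero]
      exact (hd0 lam).2 ⟨x, hx, hx0, hu⟩
  rw [hl, h0, add_zero] at h1
  obtain ⟨h3, h4⟩ := hq2 i h1
  have e : lam + ∑ j', (Pi.single (i, true) 1 : C × Bool → K) j' • v j' = μ i := by
    rw [hs]; exact add_sub_cancel lam (μ i)
  refine h4 ?_
  obtain ⟨c, hc⟩ := h2
  rw [← e, ← hQ, hc, map_mul, hl, e, h3, zero_mul]

lemma isFiniteLength_aux (D : S.Chev) (hρ : S.IsGlobalRho ρ) (hord : S.LeviLast I)
    (hI : ∀ α ∈ D.badSet ρ lam, (S.cf α).support ⊆ I) : IsFiniteLength (Env K g) (S.Verma lam) := by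
  obtain ⟨n, L, hJ⟩ := exists_lform D I
  let Δ := (finite_kap_eq_zero L hJ ρ lam).toFinset
  have hmem : ∀ {δ}, δ ∈ Δ ↔ δ.support ⊆ I ∧ kap L ρ lam δ = 0 := Set.Finite.mem_toFinset _
  let W : Submodule (Env K g) (S.Verma lam) → (S.Simp →₀ ℕ) → Submodule K (S.Verma lam) :=
    fun V δ => V.restrictScalars K ⊓ S.Mg lam δ
  haveI := finite_Mg D lam
  haveI : ∀ V δ, FiniteDimensional K (W V δ) := fun V δ =>
    Submodule.finiteDimensional_of_le (inf_le_right (b := S.Mg lam δ))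
  have hW : ∀ {V V'} (δ), V ≤ V' → W V δ ≤ W V' δ := fun δ h => inf_le_inf_right _ h
  have key : ∀ V V' : Submodule (Env K g) (S.Verma lam), V ≤ V' →
      (∀ δ ∈ Δ, W V' δ ≤ W V δ) → V' ≤ V := fun V V' hle h => by
    refine le_of_forall_supported D hord (fun γ x => uop_injective D hρ hord hI) hle
      fun r hr => ?_
    induction hd : r.degree using Nat.strong_induction_on generalizing r with
    | _ d ih =>
    subst hd
    intro x hx hxV
    by_cases hk : kap L ρ lam r = 0
    · exact (h r (hmem.2 ⟨hr, hk⟩) ⟨hxV, hx⟩).1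
    · rw [← inv_smul_smul₀ hk x]
      refine (V.restrictScalars K).smul_mem _ (kap_smul_mem L hρ hJ hr hx V fun α hα => ?_)
      by_cases hne : ug (D.e α) • x = 0
      · rw [hne]; exact V.zero_mem
      obtain ⟨γ₁, rfl, h1⟩ := e_smul_mem D hα (D.tri α hα).he hx hne
      refine ih _ ?_ γ₁ ((support_mono' le_self_add).trans hr) rfl _ h1 (V'.smul_mem _ hxV)
      rw [map_add, Nat.lt_add_right_iff_pos, Nat.pos_iff_ne_zero, Ne, Finsupp.degree_eq_zero_iff]
      exact cf_ne_zero D hα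
  let d : Submodule (Env K g) (S.Verma lam) → ℕ := fun V => ∑ δ ∈ Δ, finrank K (W V δ)
  have hd : StrictMono d := fun V V' hlt => by
    refine Finset.sum_lt_sum (fun δ _ => Submodule.finrank_mono (hW δ hlt.le)) ?_
    by_contra! hc
    exact hlt.not_ge (key V V' hlt.le fun δ hδ =>
      (Submodule.eq_of_le_of_finrank_le (hW δ hlt.le) (hc δ hδ)).ge)
  rw [isFiniteLength_iff_isNoetherian_isArtinian, isNoetherian_iff', isArtinian_iff]
  refine ⟨StrictAnti.wellFoundedGT (f := fun V => d ⊤ - d V) fun V V' h => ?_,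
    hd.wellFoundedLT.wf⟩
  have h1 := hd h
  have h2 := hd.monotone (le_top (a := V'))
  change d ⊤ - d V' < d ⊤ - d V
  omega

end FiniteLength

lemma exists_linearOrder {X : Type*} (p : X → Prop) :
    ∃ _ : LinearOrder X, ∀ a b, ¬ p a → p b → a < b := by
  classical
  obtain ⟨_, -⟩ := exists_wellFoundedLT X
  refine ⟨LinearOrder.lift' (fun a => toLex (decide (p a), a)) fun a b h =>
    congrArg Prod.snd (toLex.injective h), fun a b ha hb => ?_⟩
  change toLex (decide (p a), a) < toLex (decide (p b), b)
  rw [Prod.Lex.toLex_lt_toLex, decide_eq_false ha, decide_eq_true hb]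
  exact Or.inl Bool.false_lt_true

lemma isFiniteLength_of_badSet {ρ lam : Dual K S.h} (D : S.Chev) (hρ : S.IsGlobalRho ρ)
    (h : (D.badSet ρ lam).Finite) : IsFiniteLength (Env K g) (S.Verma lam) := by
  classical
  obtain ⟨_, hord⟩ := exists_linearOrder fun α : S.pos =>
    (S.cf α).support ⊆ h.toFinset.biUnion fun α => (S.cf α).support
  exact isFiniteLength_aux D hρ hord fun α hα =>
    Finset.subset_biUnion_of_mem (fun α => (S.cf α).support) (h.mem_toFinset.2 hα)

variable {ρ lam : Dual K S.h}

lemma exists_simple_of_isFiniteLength (D : S.Chev) [LinearOrder S.pos]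
    (h : IsFiniteLength (Env K g) (S.Verma lam)) :
    ∃ N : Submodule (Env K g) (S.Verma lam), IsSimpleModule (Env K g) N := by
  haveI := (isFiniteLength_iff_isNoetherian_isArtinian.1 h).2
  haveI : Nontrivial (S.Verma lam) := ⟨⟨_, 0, hv_ne_zero D⟩⟩
  obtain ⟨N, hN⟩ := IsAtomic.exists_atom (Submodule (Env K g) (S.Verma lam))
  exact ⟨N, isSimpleModule_iff_isAtom.2 hN⟩

end Setup

/-- For `lam ∈ h^*` the following are equivalent:
(a) `M(lam)` has finite length; (b) `M(lam)` has a simple submodule; (c) there is an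
antidominant weight `ξ` strongly linked to `lam`; (d) `lam` is almost antidominant. -/
theorem verma_finite_length_tfae
    (K : Type) [Field K] [IsAlgClosed K] [CharZero K]
    (g : Type) [LieRing g] [LieAlgebra K g] (S : Setup K g) (hDynkin : S.IsDynkin)
    (ρ : Module.Dual K S.h) (hρ : S.IsGlobalRho ρ) (lam : Module.Dual K S.h) :
    (IsFiniteLength (Env K g) (S.Verma lam) ↔
      ∃ N : Submodule (Env K g) (S.Verma lam), IsSimpleModule (Env K g) N) ∧
    ((∃ N : Submodule (Env K g) (S.Verma lam), IsSimpleModule (Env K g) N) ↔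
      ∃ ξ : Module.Dual K S.h, S.IsAntidominant ρ ξ ∧ S.StronglyLinked ρ ξ lam) ∧
    ((∃ ξ : Module.Dual K S.h, S.IsAntidominant ρ ξ ∧ S.StronglyLinked ρ ξ lam) ↔
      S.IsAlmostAntidominant ρ lam) := by
  obtain ⟨D⟩ := Setup.nonempty_chev hDynkin
  obtain ⟨_, -⟩ := exists_wellFoundedLT S.pos
  have hab := Setup.exists_simple_of_isFiniteLength (lam := lam) D
  have hbd : (∃ N : Submodule (Env K g) (S.Verma lam), IsSimpleModule (Env K g) N) →
      S.IsAlmostAntidominant ρ lam := fun ⟨N, hN⟩ =>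
    (Setup.isAlmostAntidominant_iff D).2 (Setup.finite_badSet_of_simple D hρ N hN)
  have hda := fun h => Setup.isFiniteLength_of_badSet D hρ
    ((Setup.isAlmostAntidominant_iff (ρ := ρ) (μ := lam) D).1 h)
  have hcd := Setup.exists_antidominant_iff (ρ := ρ) (lam := lam) hDynkin
  exact ⟨⟨hab, hda ∘ hbd⟩, ⟨hcd.2 ∘ hbd, hab ∘ hda ∘ hcd.1⟩, hcd⟩

end Paper
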